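/- Let u = (u_j)_{j≥0} and v = (v_j)_{j≥0} be strictly increasing real sequences such that the sequence (v_j) is Littlewood–Paley and the collection { −(u_0,u_j] − [v_j,v_{j+1}) : j ≥ 1 } can be split into a finite number of subcollections which are pairwise disjoint and Littlewood–Paley. Then for every triple of exponents with 1 < p₁, p₂, p₃ < ∞ and 1/p₁ + 1/p₂ + 1/p₃ = 1, there exists a finite constant C = C(p₁,p₂,u,v) such that ‖B_{m̃_{u,v}}(f,g)‖_{L^{p₃'}(ℝ)} ≤ C ‖f‖_{L^{p₁}(ℝ)} ‖g‖_{L^{p₂}(ℝ)} for all Schwartz functions f, g on ℝ. -/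

import Mathlib

open MeasureTheory Set
open scoped ENNReal NNReal

noncomputable section

/-- The character `e^{2π i t x}`. -/
def eChar (t x : ℝ) : ℂ := Complex.exp (2 * Real.pi * Complex.I * t * x)

/-- The Fourier transform `f̂(ξ) = ∫ f(x) e^{-2π i ξ x} dx`. -/
def fourierT (f : ℝ → ℂ) (ξ : ℝ) : ℂ := ∫ x : ℝ, f x * eChar (-ξ) x

/-- The bilinear multiplier operator `B_m` with symbol `m`. -/
def Bm (m : ℝ → ℝ → ℂ) (f g : ℝ → ℂ) (x : ℝ) : ℂ :=
  ∫ ξ : ℝ, ∫ η : ℝ, m ξ η * fourierT f ξ * fourierT g η * eChar (ξ + η) x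

/-- Complex-valued indicator function of a set of reals. -/
def indC (s : Set ℝ) (x : ℝ) : ℂ := s.indicator 1 x

/-- The set `-A - B = {-x-y : x ∈ A, y ∈ B}`. -/
def mink2 (A B : Set ℝ) : Set ℝ := Set.image2 (fun x y => -x - y) A B

/-- The paraproduct symbol `m_{a,b}(ξ,η) = Σ_{j≥1} 1_{[a_{j+1},a_j)}(ξ) 1_{[b_j,b_0)}(η)`. -/
def mab (a b : ℕ → ℝ) (ξ η : ℝ) : ℂ :=
  ∑' j : ℕ, indC (Ico (a (j + 2)) (a (j + 1))) ξ * indC (Ico (b (j + 1)) (b 0)) η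

/-- The interval `-[a_{j+1},a_j) - [b_j, b_0)` from the collection `I_{a,b}`. -/
def Iab (a b : ℕ → ℝ) (j : ℕ) : Set ℝ := mink2 (Ico (a (j + 1)) (a j)) (Ico (b j) (b 0))

/-- The interval `-[a_{j+1},a_j) - (b_∞, b_j)` from the collection `J_{a,b}`. -/
def Jab (a b : ℕ → ℝ) (binf : ℝ) (j : ℕ) : Set ℝ :=
  mink2 (Ico (a (j + 1)) (a j)) (Ioo binf (b j))

/-- The symbol `m̃_{u,v}(ξ,η) = Σ_{j≥1} 1_{(u_0,u_j]}(ξ) 1_{[v_j,v_{j+1})}(η)`. -/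
def muv (u v : ℕ → ℝ) (ξ η : ℝ) : ℂ :=
  ∑' j : ℕ, indC (Ioc (u 0) (u (j + 1))) ξ * indC (Ico (v (j + 1)) (v (j + 2))) η

/-- The interval `-(u_0,u_j] - [v_j, v_{j+1})`. -/
def Iuv (u v : ℕ → ℝ) (j : ℕ) : Set ℝ :=
  mink2 (Ioc (u 0) (u j)) (Ico (v j) (v (j + 1)))

/-- The frequency projection `(1_S f̂)^∨`. -/
def fproj (S : Set ℝ) (f : ℝ → ℂ) (x : ℝ) : ℂ := ∫ ξ in S, fourierT f ξ * eChar ξ x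

/-- The `L^p(ℓ²)` norm of the family of frequency projections onto the sets `T i`. -/
def sqNormLp {ι : Type*} (T : ι → Set ℝ) (f : ℝ → ℂ) (p : ℝ) : ℝ≥0∞ :=
  (∫⁻ x : ℝ, (∑' i, ((‖fproj (T i) f x‖₊ : ℝ≥0∞)) ^ 2) ^ (p / 2)) ^ (1 / p)

/-- The collection of connected components of a set `U ⊆ ℝ`. -/
def componentsOf (U : Set ℝ) : Set (Set ℝ) := {S | ∃ x ∈ U, S = connectedComponentIn U x}

/-- A closed Lebesgue-null set `E ⊆ ℝ` is Littlewood–Paley if for every `1 < p < ∞` the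
square function associated with the connected components of `ℝ \ E` is comparable with the
`L^p` norm (stated on the dense class of Schwartz functions). -/
def IsLPSet (E : Set ℝ) : Prop :=
  IsClosed E ∧ volume E = 0 ∧
    ∀ p : ℝ, 1 < p → ∃ c : ℝ, 0 < c ∧ ∃ C : ℝ, 0 < C ∧
      ∀ f : SchwartzMap ℝ ℂ,
        ENNReal.ofReal c * eLpNorm (⇑f) (ENNReal.ofReal p) volume ≤
            sqNormLp (fun ω : componentsOf Eᶜ => (ω : Set ℝ)) (⇑f) p ∧
          sqNormLp (fun ω : componentsOf Eᶜ => (ω : Set ℝ)) (⇑f) p ≤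
            ENNReal.ofReal C * eLpNorm (⇑f) (ENNReal.ofReal p) volume

/-- A strictly monotone real sequence is Littlewood–Paley if the closure of its range is a
Littlewood–Paley set. -/
def IsLPSeq (a : ℕ → ℝ) : Prop := IsLPSet (closure (Set.range a))

/-- A family of (pairwise disjoint) intervals is Littlewood–Paley if for every `1 < p < ∞`
the associated square function is bounded by the `L^p` norm. -/
def IsLPFamily {ι : Type*} (T : ι → Set ℝ) : Prop :=
  ∀ p : ℝ, 1 < p → ∃ C : ℝ, 0 < C ∧ ∀ f : SchwartzMap ℝ ℂ,
    sqNormLp T (⇑f) p ≤ ENNReal.ofReal C * eLpNorm (⇑f) (ENNReal.ofReal p) volume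

/-- Slope of the `j`-th segment of the piecewise linear curve with vertices `(a_j, b_j)`. -/
def pslope (a b : ℕ → ℝ) (j : ℕ) : ℝ := (b j - b (j + 1)) / (a j - a (j + 1))

/-- The epigraph of the piecewise linear curve with vertices `(a_j, b_j)`. -/
def polyEpi (a b : ℕ → ℝ) : Set (ℝ × ℝ) :=
  ⋃ j : ℕ, {p : ℝ × ℝ | a (j + 1) ≤ p.1 ∧ p.1 ≤ a j ∧
    b (j + 1) + pslope a b j * (p.1 - a (j + 1)) ≤ p.2}

end

/-- Complex-valued indicator function of a set in the plane, as a bilinear symbol. -/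
noncomputable def indC2 (S : Set (ℝ × ℝ)) (ξ η : ℝ) : ℂ := S.indicator 1 (ξ, η)

namespace CarlesonHunt

open Filter
open ENNReal (ofReal)
open scoped ComplexConjugate Real

noncomputable section

/-- The dyadic interval `[n 2^k, (n+1) 2^k)`. -/
def dy (k n : ℤ) : Set ℝ := Ico (n * (2 : ℝ) ^ k) ((n + 1) * (2 : ℝ) ^ k)

lemma two_zpow_pos (k : ℤ) : (0 : ℝ) < 2 ^ k := zpow_pos (by norm_num) k

lemma two_zpow_add (a b : ℤ) : (2 : ℝ) ^ (a + b) = 2 ^ a * 2 ^ b := zpow_add₀ (by norm_num) a b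

lemma two_zpow_mono {a b : ℤ} (h : a ≤ b) : (2 : ℝ) ^ a ≤ 2 ^ b :=
  zpow_le_zpow_right₀ (by norm_num) h

lemma two_zpow_succ (k : ℤ) : (2 : ℝ) ^ (k + 1) = 2 * 2 ^ k := by
  rw [two_zpow_add]; norm_num; ring

lemma two_zpow_pred (k : ℤ) : (2 : ℝ) ^ (k - 1) = 2 ^ k / 2 := by
  rw [sub_eq_add_neg, two_zpow_add]; norm_num; ring

lemma two_zpow_neg_mul (k : ℤ) : (2 : ℝ) ^ (-k) * 2 ^ k = 1 := by
  rw [← two_zpow_add]; simp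

lemma two_zpow_mul_neg (k : ℤ) : (2 : ℝ) ^ k * 2 ^ (-k) = 1 := by
  rw [← two_zpow_add]; simp

lemma two_zpow_eq_natPow_mul {k k' : ℤ} (h : k ≤ k') :
    (2 : ℝ) ^ k' = ((2 ^ (k' - k).toNat : ℤ) : ℝ) * 2 ^ k := by
  have h1 : k' = ((k' - k).toNat : ℤ) + k := by rw [Int.toNat_of_nonneg (by omega)]; ring
  conv_lhs => rw [h1]
  rw [two_zpow_add, zpow_natCast]; norm_cast

lemma mem_dy {k n : ℤ} {x : ℝ} : x ∈ dy k n ↔ n * (2 : ℝ) ^ k ≤ x ∧ x < (n + 1) * (2 : ℝ) ^ k :=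
  Iff.rfl

lemma mem_dy_iff {k n : ℤ} {x : ℝ} : x ∈ dy k n ↔ ⌊x * 2 ^ (-k)⌋ = n := by
  rw [mem_dy, Int.floor_eq_iff]
  have h := two_zpow_pos k
  have h1 : x * 2 ^ (-k) = x / 2 ^ k := by rw [zpow_neg]; rfl
  rw [h1, le_div_iff₀ h, div_lt_iff₀ h]

lemma mem_dy_floor (k : ℤ) (x : ℝ) : x ∈ dy k ⌊x * 2 ^ (-k)⌋ := mem_dy_iff.2 rfl

lemma dy_left_mem (k n : ℤ) : (n : ℝ) * 2 ^ k ∈ dy k n := by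
  have := two_zpow_pos k
  constructor <;> nlinarith

lemma dy_nonempty (k n : ℤ) : (dy k n).Nonempty := ⟨_, dy_left_mem k n⟩

lemma dy_inj {k n n' : ℤ} {x : ℝ} (h : x ∈ dy k n) (h' : x ∈ dy k n') : n = n' := by
  rw [mem_dy_iff] at h h'; omega

lemma measurableSet_dy (k n : ℤ) : MeasurableSet (dy k n) := measurableSet_Ico

lemma volume_dy (k n : ℤ) : volume (dy k n) = ofReal (2 ^ k) := by
  rw [dy, Real.volume_Ico]; congr 1; ring

lemma dy_subset {k k' n n' : ℤ} {x : ℝ} (hk : k ≤ k') (h : x ∈ dy k n) (h' : x ∈ dy k' n') :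
    dy k n ⊆ dy k' n' := by
  rw [mem_dy] at h h'
  have h2 := two_zpow_pos k
  rw [two_zpow_eq_natPow_mul hk] at h'
  set j : ℤ := 2 ^ (k' - k).toNat
  have h3 : n' * j < n + 1 := by
    have : ((n' * j : ℤ) : ℝ) < ((n + 1 : ℤ) : ℝ) := by
      push_cast
      apply lt_of_mul_lt_mul_right _ h2.le
      linarith [h'.1, h.2]
    exact_mod_cast this
  have h4 : n < (n' + 1) * j := by
    have : ((n : ℤ) : ℝ) < (((n' + 1) * j : ℤ) : ℝ) := by
      push_cast
      apply lt_of_mul_lt_mul_right _ h2.le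
      linarith [h'.2, h.1]
    exact_mod_cast this
  have h3' : ((n' * j : ℤ) : ℝ) ≤ ((n : ℤ) : ℝ) := by exact_mod_cast (by omega)
  have h4' : ((n + 1 : ℤ) : ℝ) ≤ (((n' + 1) * j : ℤ) : ℝ) := by exact_mod_cast (by omega)
  push_cast at h3' h4'
  intro y hy
  rw [mem_dy] at hy ⊢
  rw [two_zpow_eq_natPow_mul hk]
  constructor
  · nlinarith [hy.1]
  · nlinarith [hy.2]

lemma dy_subset_or_disjoint {k k' : ℤ} (n n' : ℤ) (hk : k ≤ k') :
    dy k n ⊆ dy k' n' ∨ Disjoint (dy k n) (dy k' n') := by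
  by_cases h : Disjoint (dy k n) (dy k' n')
  · exact Or.inr h
  · obtain ⟨x, hx, hx'⟩ := Set.not_disjoint_iff.1 h
    exact Or.inl (dy_subset hk hx hx')

lemma le_of_dy_subset {k k' n n' : ℤ} (h : dy k n ⊆ dy k' n') : k ≤ k' := by
  have h1 := measure_mono (μ := volume) h
  rw [volume_dy, volume_dy, ENNReal.ofReal_le_ofReal_iff (two_zpow_pos _).le] at h1
  exact (zpow_le_zpow_iff_right₀ (by norm_num)).1 h1

lemma dy_lower_subset (k m : ℤ) : dy (k - 1) (2 * m) ⊆ dy k m := by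
  intro x hx
  rw [mem_dy] at hx ⊢
  have := two_zpow_pos k
  rw [two_zpow_pred] at hx
  push_cast at hx
  constructor <;> nlinarith [hx.1, hx.2]

lemma dy_upper_subset (k m : ℤ) : dy (k - 1) (2 * m + 1) ⊆ dy k m := by
  intro x hx
  rw [mem_dy] at hx ⊢
  have := two_zpow_pos k
  rw [two_zpow_pred] at hx
  push_cast at hx
  constructor <;> nlinarith [hx.1, hx.2]

lemma mem_lower_or_upper {k m : ℤ} {x : ℝ} (h : x ∈ dy k m) :
    x ∈ dy (k - 1) (2 * m) ∨ x ∈ dy (k - 1) (2 * m + 1) := by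
  rw [mem_dy] at *
  rw [mem_dy, two_zpow_pred]
  push_cast
  rcases lt_or_ge x ((2 * m + 1) * (2 ^ k / 2)) with h1 | h1
  · left; constructor <;> nlinarith [h.1, h.2]
  · right; constructor <;> nlinarith [h.1, h.2]

lemma disjoint_lower_upper (k m : ℤ) : Disjoint (dy (k - 1) (2 * m)) (dy (k - 1) (2 * m + 1)) := by
  rw [Set.disjoint_left]
  intro x h h'
  have := dy_inj h h'
  omega

/-- A tile `(k, n, m)`: time interval `[n 2^k, (n+1) 2^k)`, frequency interval
`[m 2^{-k}, (m+1) 2^{-k})`. -/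
abbrev Tile := ℤ × ℤ × ℤ

/-- The time interval of a tile. -/
def tI (p : Tile) : Set ℝ := dy p.1 p.2.1
/-- The frequency interval of a tile. -/
def Om (p : Tile) : Set ℝ := dy (-p.1) p.2.2
/-- The lower half of the frequency interval of a tile. -/
def Om1 (p : Tile) : Set ℝ := dy (-p.1 - 1) (2 * p.2.2)
/-- The upper half of the frequency interval of a tile. -/
def Om2 (p : Tile) : Set ℝ := dy (-p.1 - 1) (2 * p.2.2 + 1)
/-- The length of the time interval of a tile. -/
def sc (p : Tile) : ℝ := 2 ^ p.1

lemma sc_pos (p : Tile) : 0 < sc p := two_zpow_pos _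

lemma Om1_subset (p : Tile) : Om1 p ⊆ Om p := dy_lower_subset _ _
lemma Om2_subset (p : Tile) : Om2 p ⊆ Om p := dy_upper_subset _ _
lemma disjoint_Om1_Om2 (p : Tile) : Disjoint (Om1 p) (Om2 p) := disjoint_lower_upper _ _
lemma mem_Om1_or_Om2 {p : Tile} {x : ℝ} (h : x ∈ Om p) : x ∈ Om1 p ∨ x ∈ Om2 p :=
  mem_lower_or_upper h

lemma measurableSet_tI (p : Tile) : MeasurableSet (tI p) := measurableSet_dy _ _
lemma measurableSet_Om (p : Tile) : MeasurableSet (Om p) := measurableSet_dy _ _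
lemma measurableSet_Om2 (p : Tile) : MeasurableSet (Om2 p) := measurableSet_dy _ _

/-- If two tiles have a common frequency and `q` has strictly longer frequency interval, then
the frequency interval of `p` lies in one half of that of `q`. -/
lemma Om_subset_Om2 {p q : Tile} {ξ : ℝ} (hk : q.1 < p.1) (hp : ξ ∈ Om p) (hq : ξ ∈ Om2 q) :
    Om p ⊆ Om2 q := dy_subset (by omega) hp hq

lemma Om_subset_Om1 {p q : Tile} {ξ : ℝ} (hk : q.1 < p.1) (hp : ξ ∈ Om p) (hq : ξ ∈ Om1 q) :
    Om p ⊆ Om1 q := dy_subset (by omega) hp hq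

lemma Om_subset_Om {p q : Tile} {ξ : ℝ} (hk : q.1 ≤ p.1) (hp : ξ ∈ Om p) (hq : ξ ∈ Om q) :
    Om p ⊆ Om q := dy_subset (by omega) hp hq

/-- The order on tiles. -/
def tle (p q : Tile) : Prop := tI p ⊆ tI q ∧ Om q ⊆ Om p

lemma tle_refl (p : Tile) : tle p p := ⟨subset_rfl, subset_rfl⟩
lemma tle_trans {p q r : Tile} (h : tle p q) (h' : tle q r) : tle p r :=
  ⟨h.1.trans h'.1, h'.2.trans h.2⟩

lemma tle.le {p q : Tile} (h : tle p q) : p.1 ≤ q.1 := le_of_dy_subset h.1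

lemma tle_of_mem {p q : Tile} {x ξ : ℝ} (hk : p.1 ≤ q.1) (hp : x ∈ tI p) (hq : x ∈ tI q)
    (hp' : ξ ∈ Om p) (hq' : ξ ∈ Om q) : tle p q :=
  ⟨dy_subset hk hp hq, dy_subset (by omega) hq' hp'⟩

lemma tle_antisymm {p q : Tile} (h : tle p q) (h' : tle q p) : p = q := by
  have hk : p.1 = q.1 := le_antisymm h.le h'.le
  obtain ⟨x, hx⟩ := dy_nonempty p.1 p.2.1
  obtain ⟨y, hy⟩ := dy_nonempty (-p.1) p.2.2
  have h1 := h.1 hx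
  have h2 := h'.2 hy
  unfold tI at h1
  unfold Om at h2
  rw [← hk] at h1 h2
  exact Prod.ext hk (Prod.ext (dy_inj hx h1) (dy_inj hy h2))

/-- The basic decaying weight. -/
def W (t : ℝ) : ℝ := (1 + t ^ 2)⁻¹

lemma W_pos (t : ℝ) : 0 < W t := by unfold W; positivity
lemma W_nonneg (t : ℝ) : 0 ≤ W t := (W_pos t).le
lemma W_le_one (t : ℝ) : W t ≤ 1 := inv_le_one_of_one_le₀ (by nlinarith [sq_nonneg t])

lemma W_neg (t : ℝ) : W (-t) = W t := by simp [W]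

lemma W_anti {s t : ℝ} (h : |s| ≤ |t|) : W t ≤ W s := by
  unfold W
  have := sq_le_sq.2 h
  gcongr

lemma W_mul_le (a b : ℝ) : W a * W b ≤ 2 * W (a + b) := by
  unfold W
  rw [← mul_inv, ← div_eq_mul_inv, inv_eq_one_div, div_le_div_iff₀ (by positivity) (by positivity)]
  nlinarith [sq_nonneg (a - b), sq_nonneg (a * b)]

lemma W_mul_le' (a b : ℝ) : W a * W b ≤ 2 * W (a - b) := by
  have := W_mul_le a (-b)
  rwa [W_neg, ← sub_eq_add_neg] at this

/-- Shifting the argument by a bounded amount changes the weight by a bounded factor. -/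
lemma W_shift {a b c : ℝ} (h : |a - b| ≤ c) : W a ≤ 2 * (1 + c ^ 2) * W b := by
  have h1 := W_mul_le a (b - a)
  rw [add_sub_cancel] at h1
  have h3 : (1 + c ^ 2)⁻¹ ≤ W (b - a) := by
    unfold W
    have : (b - a) ^ 2 ≤ c ^ 2 := by
      rw [abs_sub_comm] at h
      exact sq_le_sq' (by linarith [abs_le.1 h]) (abs_le.1 h).2
    gcongr
  have h4 : (0 : ℝ) < 1 + c ^ 2 := by positivity
  calc W a = (1 + c ^ 2) * (W a * (1 + c ^ 2)⁻¹) := by field_simp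
    _ ≤ (1 + c ^ 2) * (W a * W (b - a)) := by
        have := W_nonneg a
        gcongr
    _ ≤ _ := by nlinarith

lemma continuous_W : Continuous W := by
  unfold W
  exact Continuous.inv₀ (by fun_prop) (fun x => by positivity)

lemma integrable_W : Integrable W := integrable_inv_one_add_sq

lemma integral_W : ∫ x, W x = π := integral_univ_inv_one_add_sq

lemma integrable_W_affine {r : ℝ} (hr : r ≠ 0) (c : ℝ) : Integrable (fun x => W (r * x - c)) :=
  ((integrable_W.comp_sub_right c).comp_mul_left' hr)

lemma integral_W_affine {r : ℝ} (hr : 0 < r) (c : ℝ) : ∫ x, W (r * x - c) = π / r := by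
  have h := Measure.integral_comp_mul_left (fun x => W (x - c)) r
  rw [h, integral_sub_right_eq_self, integral_W, abs_of_pos (by positivity)]
  simp; ring

lemma sum_W_le (s : Finset ℤ) (a : ℝ) : ∑ n ∈ s, W (n - a) ≤ 4 * π := by
  have hd : Set.PairwiseDisjoint (s : Set ℤ) (fun n : ℤ => Ioc (n : ℝ) (n + 1)) := by
    intro i _ j _ hij
    exact pairwise_disjoint_Ioc_intCast ℝ hij
  have key : ∀ n : ℤ, W (n - a) ≤ ∫ x in Ioc (n : ℝ) (n + 1), 4 * W (1 * x - a) := by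
    intro n
    have h1 : ∫ x in Ioc (n : ℝ) (n + 1), W (n - a) = W (n - a) := by simp
    rw [← h1]
    apply setIntegral_mono_on (by simp) (((integrable_W_affine one_ne_zero a).const_mul 4).integrableOn)
      measurableSet_Ioc
    intro x hx
    have : |((n : ℝ) - a) - (1 * x - a)| ≤ 1 := by
      rw [abs_le]; constructor <;> linarith [hx.1, hx.2]
    have := W_shift this
    linarith
  calc ∑ n ∈ s, W (n - a) ≤ ∑ n ∈ s, ∫ x in Ioc (n : ℝ) (n + 1), 4 * W (1 * x - a) :=
        Finset.sum_le_sum fun n _ => key n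
    _ = ∫ x in ⋃ n ∈ s, Ioc (n : ℝ) (n + 1), 4 * W (1 * x - a) := by
        rw [integral_biUnion_finset _ (fun _ _ => measurableSet_Ioc) hd]
        intro i _
        exact ((integrable_W_affine one_ne_zero a).const_mul 4).integrableOn
    _ ≤ ∫ x, 4 * W (1 * x - a) := by
        apply setIntegral_le_integral ((integrable_W_affine one_ne_zero a).const_mul 4)
        exact Eventually.of_forall fun x => by have := W_nonneg (1 * x - a); simp only [Pi.zero_apply]; linarith
    _ = 4 * π := by
        rw [integral_const_mul, integral_W_affine one_pos]; simp

/-- The weight adapted to a tile. -/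
def wt (p : Tile) (x : ℝ) : ℝ := W ((2 : ℝ) ^ (-p.1) * x - p.2.1)

lemma wt_nonneg (p : Tile) (x : ℝ) : 0 ≤ wt p x := W_nonneg _
lemma wt_le_one (p : Tile) (x : ℝ) : wt p x ≤ 1 := W_le_one _
lemma continuous_wt (p : Tile) : Continuous (wt p) := by
  unfold wt
  exact continuous_W.comp (by fun_prop)
lemma integrable_wt (p : Tile) : Integrable (wt p) := integrable_W_affine (two_zpow_pos _).ne' _
lemma integral_wt (p : Tile) : ∫ x, wt p x = π * sc p := by
  unfold wt sc
  rw [integral_W_affine (two_zpow_pos _), zpow_neg, div_inv_eq_mul]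

lemma wt_pow_le (p : Tile) (x : ℝ) {j : ℕ} (hj : j ≠ 0) : wt p x ^ j ≤ wt p x :=
  pow_le_of_le_one (wt_nonneg p x) (wt_le_one p x) hj

lemma wt_pow_anti (p : Tile) (x : ℝ) {i j : ℕ} (hj : i ≤ j) : wt p x ^ j ≤ wt p x ^ i :=
  pow_le_pow_of_le_one (wt_nonneg p x) (wt_le_one p x) hj

lemma integrable_wt_pow (p : Tile) {j : ℕ} (hj : j ≠ 0) : Integrable (fun x => wt p x ^ j) := by
  apply (integrable_wt p).mono' ((continuous_wt p).pow j).aestronglyMeasurable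
  refine Eventually.of_forall fun x => ?_
  rw [Pi.pow_apply, Real.norm_of_nonneg (pow_nonneg (wt_nonneg p x) j)]
  exact wt_pow_le p x hj

lemma integral_wt_pow_le (p : Tile) {j : ℕ} (hj : j ≠ 0) :
    ∫ x, wt p x ^ j ≤ π * sc p := by
  rw [← integral_wt]
  exact integral_mono (integrable_wt_pow p hj) (integrable_wt p) fun x => wt_pow_le p x hj

lemma mem_tI_bounds {p : Tile} {x : ℝ} (h : x ∈ tI p) :
    0 ≤ (2 : ℝ) ^ (-p.1) * x - p.2.1 ∧ (2 : ℝ) ^ (-p.1) * x - p.2.1 < 1 := by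
  unfold tI at h
  rw [mem_dy] at h
  have h1 := two_zpow_pos (-p.1)
  have h2 := two_zpow_mul_neg p.1
  have h3 : (p.2.1 : ℝ) * 2 ^ p.1 * 2 ^ (-p.1) = p.2.1 := by rw [mul_assoc, h2, mul_one]
  have h4 : ((p.2.1 : ℝ) + 1) * 2 ^ p.1 * 2 ^ (-p.1) = p.2.1 + 1 := by rw [mul_assoc, h2, mul_one]
  constructor
  · nlinarith [h.1]
  · nlinarith [h.2]

lemma sum_two_zpow_le {K : ℤ} (s : Finset ℤ) (hs : ∀ k ∈ s, k ≤ K) :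
    ∑ k ∈ s, (2 : ℝ) ^ k ≤ 2 * 2 ^ K := by
  have h1 : ∀ k ∈ s, (2 : ℝ) ^ k = 2 ^ K * (1 / 2) ^ (K - k).toNat := by
    intro k hk
    have h2 : K = ((K - k).toNat : ℤ) + k := by
      rw [Int.toNat_of_nonneg (by have := hs k hk; omega)]; ring
    conv_rhs => rw [h2]
    rw [two_zpow_add, zpow_natCast, add_sub_cancel_right, Int.toNat_natCast, mul_right_comm,
      ← mul_pow]
    norm_num
  rw [Finset.sum_congr rfl h1, ← Finset.mul_sum]
  have h3 : ∑ k ∈ s, ((1 : ℝ) / 2) ^ (K - k).toNat ≤ 2 := by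
    rw [← Finset.sum_image (f := fun j : ℕ => ((1 : ℝ) / 2) ^ j) (g := fun k => (K - k).toNat)]
    · exact (summable_geometric_two.sum_le_tsum _ fun i _ => by positivity).trans_eq
        tsum_geometric_two
    · intro a ha b hb hab
      have := hs a ha
      have := hs b hb
      simp only at hab
      omega
  have := two_zpow_pos K
  nlinarith

lemma wt_le_of_mem {q : Tile} {x y : ℝ} (hy : y ∈ tI q) :
    wt q x ≤ 4 * W ((2 : ℝ) ^ (-q.1) * (x - y)) := by
  have h := mem_tI_bounds hy
  have h1 : |((2 : ℝ) ^ (-q.1) * x - q.2.1) - (2 : ℝ) ^ (-q.1) * (x - y)| ≤ 1 := by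
    rw [abs_le]; constructor <;> linarith
  have := W_shift h1
  unfold wt
  linarith

lemma le_wt_of_mem {q : Tile} {x y : ℝ} (hy : y ∈ tI q) :
    W ((2 : ℝ) ^ (-q.1) * (x - y)) ≤ 4 * wt q x := by
  have h := mem_tI_bounds hy
  have h1 : |(2 : ℝ) ^ (-q.1) * (x - y) - ((2 : ℝ) ^ (-q.1) * x - q.2.1)| ≤ 1 := by
    rw [abs_le]; constructor <;> linarith
  have := W_shift h1
  unfold wt
  linarith

lemma W_scale_mono {k K : ℤ} (h : k ≤ K) (t : ℝ) :
    W ((2 : ℝ) ^ (-k) * t) ≤ W ((2 : ℝ) ^ (-K) * t) := by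
  apply W_anti
  rw [abs_mul, abs_mul, abs_of_pos (two_zpow_pos _), abs_of_pos (two_zpow_pos _)]
  have := two_zpow_mono (neg_le_neg h)
  gcongr

lemma wt_mul_le {p q : Tile} (h : q.1 ≤ p.1) {x y : ℝ} (hy : y ∈ tI q) :
    wt p x * wt q x ≤ 8 * wt p y := by
  have h1 := (wt_le_of_mem (x := x) hy).trans
    (mul_le_mul_of_nonneg_left (W_scale_mono h (x - y)) (by norm_num))
  have h2 := W_mul_le' ((2 : ℝ) ^ (-p.1) * x - p.2.1) ((2 : ℝ) ^ (-p.1) * (x - y))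
  have h3 : (2 : ℝ) ^ (-p.1) * x - p.2.1 - (2 : ℝ) ^ (-p.1) * (x - y)
    = (2 : ℝ) ^ (-p.1) * y - p.2.1 := by ring
  rw [h3] at h2
  have := wt_nonneg p x
  calc wt p x * wt q x ≤ wt p x * (4 * W ((2 : ℝ) ^ (-p.1) * (x - y))) := by gcongr
    _ ≤ 8 * wt p y := by unfold wt; linarith

lemma wt_le_of_subset {p q : Tile} (h : tI p ⊆ tI q) (x : ℝ) : wt p x ≤ 16 * wt q x := by
  obtain ⟨y, hy⟩ := dy_nonempty p.1 p.2.1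
  have h1 := wt_le_of_mem (x := x) (q := p) hy
  have h2 := W_scale_mono (le_of_dy_subset h) (x - y)
  have h3 := le_wt_of_mem (x := x) (h hy)
  linarith

lemma freq_index {p : Tile} {ξ : ℝ} (h : ξ ∈ Om p) : p.2.2 = ⌊ξ * 2 ^ p.1⌋ := by
  have := mem_dy_iff.1 h
  rw [neg_neg] at this
  exact this.symm

/-- A sum over tiles of one scale and one frequency is a sum over positions. -/
lemma sum_slice_le (T : Finset Tile) (k m : ℤ) (h : ∀ p ∈ T, p.1 = k ∧ p.2.2 = m) (a : ℝ) :
    ∑ p ∈ T, W (p.2.1 - a) ≤ 4 * π := by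
  have : ∑ p ∈ T, W ((p.2.1 : ℝ) - a) = ∑ n ∈ T.image (fun p : Tile => (p.2.1 : ℤ)), W ((n : ℝ) - a) := by
    rw [Finset.sum_image]
    intro p hp q hq hpq
    exact Prod.ext ((h p hp).1.trans (h q hq).1.symm)
      (Prod.ext hpq ((h p hp).2.trans (h q hq).2.symm))
  rw [this]
  exact sum_W_le _ _

lemma sum_slice_wt_le (T : Finset Tile) (k m : ℤ) (h : ∀ p ∈ T, p.1 = k ∧ p.2.2 = m) (x : ℝ) :
    ∑ p ∈ T, wt p x ≤ 4 * π := by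
  have h1 : ∀ p ∈ T, wt p x = W (p.2.1 - 2 ^ (-k) * x) := by
    intro p hp
    unfold wt
    rw [(h p hp).1, ← W_neg]
    congr 1; ring
  rw [Finset.sum_congr rfl h1]
  exact sum_slice_le T k m h _

lemma tree_slice {T : Finset Tile} {ξ : ℝ} (hξ : ∀ p ∈ T, ξ ∈ Om p) (k : ℤ) :
    ∀ p ∈ T.filter (fun p => p.1 = k), p.1 = k ∧ p.2.2 = ⌊ξ * 2 ^ k⌋ := by
  intro p hp
  rw [Finset.mem_filter] at hp
  refine ⟨hp.2, ?_⟩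
  rw [← hp.2]
  exact freq_index (hξ p hp.1)

/-- Summation over the scales of a collection of tiles. -/
lemma sum_by_scale (T : Finset Tile) (g : Tile → ℝ) {c : ℤ → ℝ}
    (h : ∀ k, ∑ p ∈ T.filter (fun p => p.1 = k), g p ≤ c k) :
    ∑ p ∈ T, g p ≤ ∑ k ∈ T.image (fun p => p.1), c k := by
  rw [← Finset.sum_fiberwise_of_maps_to (g := fun p : Tile => p.1) (t := T.image (fun p => p.1))
    (fun p hp => Finset.mem_image_of_mem _ hp)]
  exact Finset.sum_le_sum fun k _ => h k

lemma tile_off_le {p : Tile} {K n : ℤ} (h : tI p ⊆ dy K n) :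
    ∫ x in (dy K n)ᶜ, wt p x ^ 2 ≤ π * sc p *
      (W (p.2.1 - 2 ^ (-p.1) * (n * 2 ^ K)) + W (p.2.1 - 2 ^ (-p.1) * ((n + 1) * 2 ^ K))) := by
  set A := W (p.2.1 - 2 ^ (-p.1) * (n * 2 ^ K))
  set B := W (p.2.1 - 2 ^ (-p.1) * ((n + 1) * 2 ^ K))
  have hA : 0 ≤ A := W_nonneg _
  have hB : 0 ≤ B := W_nonneg _
  have hk := two_zpow_pos (-p.1)
  have hk1 := two_zpow_mul_neg p.1
  have hk2 := two_zpow_pos p.1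
  have hl : (n : ℝ) * 2 ^ K ≤ p.2.1 * 2 ^ p.1 := (mem_dy.1 (h (dy_left_mem _ _))).1
  have hr : ((p.2.1 : ℝ)) * 2 ^ p.1 ≤ (n + 1) * 2 ^ K := (mem_dy.1 (h (dy_left_mem _ _))).2.le
  have hl' : 2 ^ (-p.1) * ((n : ℝ) * 2 ^ K) ≤ p.2.1 := by
    calc 2 ^ (-p.1) * ((n : ℝ) * 2 ^ K) ≤ 2 ^ (-p.1) * (p.2.1 * 2 ^ p.1) := by gcongr
      _ = p.2.1 := by rw [mul_comm, mul_assoc, hk1, mul_one]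
  have hr' : (p.2.1 : ℝ) ≤ 2 ^ (-p.1) * ((n + 1) * 2 ^ K) := by
    calc (p.2.1 : ℝ) = 2 ^ (-p.1) * (p.2.1 * 2 ^ p.1) := by
          rw [mul_comm, mul_assoc, hk1, mul_one]
      _ ≤ _ := by gcongr
  have key : ∀ x ∈ (dy K n)ᶜ, wt p x ^ 2 ≤ (A + B) * wt p x := by
    intro x hx
    rw [sq]
    refine mul_le_mul_of_nonneg_right ?_ (wt_nonneg _ _)
    rw [mem_compl_iff, mem_dy, not_and_or, not_le, not_lt] at hx
    rcases hx with hx | hx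
    · have : 2 ^ (-p.1) * x ≤ 2 ^ (-p.1) * (n * 2 ^ K) := by gcongr
      have h1 : wt p x ≤ A := by
        apply W_anti
        rw [abs_of_nonneg (by linarith), abs_of_nonpos (by linarith)]
        linarith
      linarith
    · have : 2 ^ (-p.1) * ((n + 1) * 2 ^ K) ≤ 2 ^ (-p.1) * x := by gcongr
      have h1 : wt p x ≤ B := by
        apply W_anti
        rw [abs_of_nonpos (by linarith), abs_of_nonneg (by linarith)]
        linarith
      linarith
  calc ∫ x in (dy K n)ᶜ, wt p x ^ 2 ≤ ∫ x in (dy K n)ᶜ, (A + B) * wt p x :=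
        setIntegral_mono_on (integrable_wt_pow p two_ne_zero).integrableOn
          ((integrable_wt p).const_mul _).integrableOn (measurableSet_dy _ _).compl key
    _ ≤ ∫ x, (A + B) * wt p x :=
        setIntegral_le_integral ((integrable_wt p).const_mul _)
          (Eventually.of_forall fun x => mul_nonneg (by linarith) (wt_nonneg _ _))
    _ = _ := by rw [integral_const_mul, integral_wt]; ring

/-- The tails of the tiles of a tree off the top interval sum to at most the top length. -/
lemma tree_off_sum {T : Finset Tile} {K n : ℤ} {ξ : ℝ} (hI : ∀ p ∈ T, tI p ⊆ dy K n)
    (hξ : ∀ p ∈ T, ξ ∈ Om p) :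
    ∑ p ∈ T, ∫ x in (dy K n)ᶜ, wt p x ^ 2 ≤ 16 * π ^ 2 * 2 ^ K := by
  have h1 := sum_by_scale T (fun p => ∫ x in (dy K n)ᶜ, wt p x ^ 2)
    (c := fun k => 8 * π ^ 2 * 2 ^ k) (by
      intro k
      have hs := tree_slice hξ k
      calc _ ≤ ∑ p ∈ T.filter (fun p => p.1 = k), π * 2 ^ k *
            (W (p.2.1 - 2 ^ (-k) * (n * 2 ^ K)) + W (p.2.1 - 2 ^ (-k) * ((n + 1) * 2 ^ K))) := by
            apply Finset.sum_le_sum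
            intro p hp
            have := tile_off_le (hI p (Finset.mem_filter.1 hp).1)
            rwa [sc, (Finset.mem_filter.1 hp).2] at this
        _ ≤ π * 2 ^ k * (4 * π + 4 * π) := by
            rw [← Finset.mul_sum, Finset.sum_add_distrib]
            have := two_zpow_pos k
            have := Real.pi_pos
            gcongr
            · exact sum_slice_le _ k _ hs _
            · exact sum_slice_le _ k _ hs _
        _ = _ := by ring)
  refine h1.trans ?_
  rw [← Finset.mul_sum]
  have h2 := sum_two_zpow_le (K := K) (T.image (fun p => p.1)) (by
    intro k hk
    obtain ⟨p, hp, rfl⟩ := Finset.mem_image.1 hk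
    exact le_of_dy_subset (hI p hp))
  have := Real.pi_pos
  calc _ ≤ 8 * π ^ 2 * (2 * 2 ^ K) := by gcongr
    _ = _ := by ring

/-- A family of wave packets adapted to tiles. -/
structure IsPacket (C : ℝ) (ψ : Tile → ℝ → ℂ) : Prop where
  one_le : 1 ≤ C
  cont : ∀ p, Continuous (ψ p)
  decay : ∀ p x, ‖ψ p x‖ ≤ C * wt p x ^ 8
  orth : ∀ p q, Disjoint (Om1 p) (Om1 q) → ∫ x, ψ p x * conj (ψ q x) = 0
  lip : ∀ p ξ, ξ ∈ Om p → ∀ x y, |x - y| ≤ sc p →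
    ‖ψ p x * eChar (-ξ) x - ψ p y * eChar (-ξ) y‖ ≤ C * (|x - y| / sc p) * wt p x ^ 4
  trunc : ∀ (ξ : ℝ) (k₀ : ℤ), ∃ κ : ℝ → ℂ, Continuous κ ∧
    (∀ y, ‖κ y‖ ≤ C * 2 ^ (-k₀) * W (2 ^ (-k₀) * y)) ∧
    ∀ p, ξ ∈ Om2 p → ∀ x, ∫ y, ψ p (x - y) * κ y = if k₀ ≤ p.1 then ψ p x else 0

/-- The coefficient of `f` with respect to the packet of the tile `p`. -/
def cf (ψ : Tile → ℝ → ℂ) (f : ℝ → ℂ) (p : Tile) : ℂ :=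
  ((sc p)⁻¹ : ℝ) * ∫ x, f x * conj (ψ p x)

namespace IsPacket
variable {C : ℝ} {ψ : Tile → ℝ → ℂ}

lemma pos (hψ : IsPacket C ψ) : 0 < C := zero_lt_one.trans_le hψ.one_le

lemma decay' (hψ : IsPacket C ψ) {j : ℕ} (hj : j ≤ 8) (p : Tile) (x : ℝ) :
    ‖ψ p x‖ ≤ C * wt p x ^ j :=
  (hψ.decay p x).trans (mul_le_mul_of_nonneg_left (wt_pow_anti p x hj) hψ.pos.le)

lemma norm_le (hψ : IsPacket C ψ) (p : Tile) (x : ℝ) : ‖ψ p x‖ ≤ C := by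
  simpa using hψ.decay' (Nat.zero_le 8) p x

lemma integrable (hψ : IsPacket C ψ) (p : Tile) : Integrable (ψ p) :=
  ((integrable_wt_pow p (by norm_num : (8 : ℕ) ≠ 0)).const_mul C).mono'
    (hψ.cont p).aestronglyMeasurable (Eventually.of_forall (hψ.decay p))

lemma integrable_mul_conj (hψ : IsPacket C ψ) (p q : Tile) :
    Integrable (fun x => ψ p x * conj (ψ q x)) :=
  (hψ.integrable p).mul_bdd (c := C)
    (Complex.continuous_conj.comp (hψ.cont q)).aestronglyMeasurable
    (Eventually.of_forall fun x => by simpa using hψ.norm_le q x)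

lemma inner_le (hψ : IsPacket C ψ) {p q : Tile} (h : q.1 ≤ p.1) :
    ‖∫ x, ψ p x * conj (ψ q x)‖ ≤
      64 * π * C ^ 2 * ∫ y in tI q, wt p y ^ 2 := by
  have hC := hψ.pos
  have key : ∀ x y, y ∈ tI q → ‖ψ p x * conj (ψ q x)‖ ≤
      64 * C ^ 2 * wt p y ^ 2 * wt q x := by
    intro x y hy
    have h1 := wt_mul_le h (x := x) hy
    have h2 := wt_nonneg p x
    have h3 := wt_nonneg q x
    have h4 := wt_nonneg p y
    rw [norm_mul, RCLike.norm_conj]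
    calc ‖ψ p x‖ * ‖ψ q x‖ ≤ (C * wt p x ^ 2) * (C * wt q x ^ 3) := by
          gcongr
          · exact hψ.decay' (by norm_num) p x
          · exact hψ.decay' (by norm_num) q x
      _ = C ^ 2 * (wt p x * wt q x) ^ 2 * wt q x := by ring
      _ ≤ C ^ 2 * (8 * wt p y) ^ 2 * wt q x := by gcongr
      _ = _ := by ring
  have hq := sc_pos q
  have h1 : ∀ y ∈ tI q, ‖∫ x, ψ p x * conj (ψ q x)‖ ≤
      64 * π * C ^ 2 * sc q * wt p y ^ 2 := by
    intro y hy
    calc _ ≤ ∫ x, 64 * C ^ 2 * wt p y ^ 2 * wt q x :=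
          norm_integral_le_of_norm_le ((integrable_wt q).const_mul _)
            (Eventually.of_forall fun x => key x y hy)
      _ = _ := by rw [integral_const_mul, integral_wt]; ring
  have hv : volume.real (tI q) = sc q := by
    rw [measureReal_def, tI, volume_dy, ENNReal.toReal_ofReal (two_zpow_pos _).le]; rfl
  have h2 : ∫ y in tI q, ‖∫ x, ψ p x * conj (ψ q x)‖ ≤
      ∫ y in tI q, 64 * π * C ^ 2 * sc q * wt p y ^ 2 := by
    apply setIntegral_mono_on _ _ (measurableSet_tI q) h1
    · exact integrableOn_const (by rw [tI, volume_dy]; simp) (by simp)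
    · exact ((integrable_wt_pow p two_ne_zero).const_mul _).integrableOn
  rw [setIntegral_const, hv, integral_const_mul, smul_eq_mul] at h2
  have h3 : sc q * ‖∫ x, ψ p x * conj (ψ q x)‖ ≤
      sc q * (64 * π * C ^ 2 * ∫ y in tI q, wt p y ^ 2) := by
    refine h2.trans (le_of_eq ?_); ring
  exact le_of_mul_le_mul_left h3 hq

lemma inner_same_le (hψ : IsPacket C ψ) {p q : Tile} (h : p.1 = q.1) :
    ‖∫ x, ψ p x * conj (ψ q x)‖ ≤
      2 * π * C ^ 2 * sc p * W (q.2.1 - p.2.1) := by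
  have hC := hψ.pos
  have key : ∀ x, ‖ψ p x * conj (ψ q x)‖ ≤
      2 * C ^ 2 * W (q.2.1 - p.2.1) * wt p x := by
    intro x
    have h2 := wt_nonneg p x
    have h3 := wt_nonneg q x
    have h1 : wt p x * wt q x ≤ 2 * W (q.2.1 - p.2.1) := by
      have := W_mul_le' ((2 : ℝ) ^ (-p.1) * x - p.2.1) ((2 : ℝ) ^ (-q.1) * x - q.2.1)
      rw [h] at this
      unfold wt
      rw [h]
      refine this.trans (le_of_eq ?_)
      congr 2; ring
    rw [norm_mul, RCLike.norm_conj]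
    calc ‖ψ p x‖ * ‖ψ q x‖ ≤ (C * wt p x ^ 2) * (C * wt q x ^ 1) := by
          gcongr
          · exact hψ.decay' (by norm_num) p x
          · exact hψ.decay' (by norm_num) q x
      _ = C ^ 2 * (wt p x * wt q x) * wt p x := by ring
      _ ≤ C ^ 2 * (2 * W (q.2.1 - p.2.1)) * wt p x := by gcongr
      _ = _ := by ring
  calc _ ≤ ∫ x, 2 * C ^ 2 * W (q.2.1 - p.2.1) * wt p x :=
        norm_integral_le_of_norm_le ((integrable_wt p).const_mul _)
          (Eventually.of_forall key)
    _ = _ := by rw [integral_const_mul, integral_wt]; ring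

lemma inner_symm (p q : Tile) : ‖∫ x, ψ p x * conj (ψ q x)‖ =
    ‖∫ x, ψ q x * conj (ψ p x)‖ := by
  rw [← RCLike.norm_conj (∫ x, ψ p x * conj (ψ q x)), ← integral_conj]
  congr 2
  ext x
  simp [mul_comm]

lemma inner_eq_zero (hψ : IsPacket C ψ) {p q : Tile} (hk : q.1 ≤ p.1)
    (h : ¬ (q.1 = p.1 ∧ q.2.2 = p.2.2)) (h' : ¬ Om p ⊆ Om1 q) :
    ∫ x, ψ p x * conj (ψ q x) = 0 := by
  apply hψ.orth
  rw [Set.disjoint_left]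
  intro x hx hx'
  rcases hk.lt_or_eq with hk | hk
  · exact h' (dy_subset (by omega) (Om1_subset p hx) hx')
  · apply h
    refine ⟨hk, ?_⟩
    unfold Om1 at hx hx'
    rw [hk] at hx'
    have := dy_inj hx hx'
    omega

lemma bessel (hψ : IsPacket C ψ) (U : Finset Tile) (b : Tile → ℂ) {X : ℝ}
    (hX : ∑ p ∈ U, ∑ q ∈ U, (open Classical in if Om p ⊆ Om1 q then
      ‖b p‖ * ‖b q‖ * ‖∫ x, ψ p x * conj (ψ q x)‖ else 0) ≤ X) :
    ∫ x, ‖∑ p ∈ U, b p * ψ p x‖ ^ 2 ≤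
      8 * π ^ 2 * C ^ 2 * ∑ p ∈ U, sc p * ‖b p‖ ^ 2 + 2 * X := by
  classical
  have hC := hψ.pos
  have hpi := Real.pi_pos
  set J : Tile → Tile → ℝ := fun p q => ‖∫ x, ψ p x * conj (ψ q x)‖
  have hJ : ∀ p q, J p q = J q p := fun p q => inner_symm p q
  have h0 : ∫ x, ‖∑ p ∈ U, b p * ψ p x‖ ^ 2 ≤ ∑ p ∈ U, ∑ q ∈ U, ‖b p‖ * ‖b q‖ * J p q := by
    have h1 : ∀ x, ((‖∑ p ∈ U, b p * ψ p x‖ ^ 2 : ℝ) : ℂ) =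
        ∑ p ∈ U, ∑ q ∈ U, (b p * conj (b q)) * (ψ p x * conj (ψ q x)) := by
      intro x
      push_cast
      rw [← Complex.mul_conj', map_sum, Finset.sum_mul_sum]
      refine Finset.sum_congr rfl fun p _ => Finset.sum_congr rfl fun q _ => ?_
      rw [map_mul]; ring
    have h2 : ((∫ x, ‖∑ p ∈ U, b p * ψ p x‖ ^ 2 : ℝ) : ℂ) =
        ∑ p ∈ U, ∑ q ∈ U, (b p * conj (b q)) *
          ∫ x, ψ p x * conj (ψ q x) := by
      rw [← integral_complex_ofReal]
      simp_rw [h1]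
      rw [integral_finsetSum _ fun p _ => integrable_finsetSum _ fun q _ =>
        (hψ.integrable_mul_conj p q).const_mul _]
      refine Finset.sum_congr rfl fun p _ => ?_
      rw [integral_finsetSum _ fun q _ => (hψ.integrable_mul_conj p q).const_mul _]
      exact Finset.sum_congr rfl fun q _ => integral_const_mul _ _
    calc ∫ x, ‖∑ p ∈ U, b p * ψ p x‖ ^ 2
        ≤ ‖((∫ x, ‖∑ p ∈ U, b p * ψ p x‖ ^ 2 : ℝ) : ℂ)‖ := by
          rw [Complex.norm_real]; exact Real.le_norm_self _
      _ ≤ _ := by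
          rw [h2]
          refine (norm_sum_le _ _).trans (Finset.sum_le_sum fun p _ => ?_)
          refine (norm_sum_le _ _).trans (Finset.sum_le_sum fun q _ => ?_)
          rw [norm_mul, norm_mul, RCLike.norm_conj]
  set s : Tile → Tile → ℝ := fun p q => if q.1 = p.1 ∧ q.2.2 = p.2.2 then
    ‖b p‖ ^ 2 * (π * C ^ 2 * sc p) * W (q.2.1 - p.2.1) else 0
  set c : Tile → Tile → ℝ := fun p q => if Om p ⊆ Om1 q then ‖b p‖ * ‖b q‖ * J p q else 0
  have hs : ∀ p q, 0 ≤ s p q := by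
    intro p q
    have := sc_pos p
    have := W_nonneg ((q.2.1 : ℝ) - p.2.1)
    simp only [s]; split_ifs <;> positivity
  have hc : ∀ p q, 0 ≤ c p q := by
    intro p q
    simp only [c, J]; split_ifs <;> positivity
  have main : ∀ p q, q.1 ≤ p.1 → ‖b p‖ * ‖b q‖ * J p q ≤ s p q + s q p + c p q := by
    intro p q hk
    by_cases h1 : q.1 = p.1 ∧ q.2.2 = p.2.2
    · have e1 : s p q = ‖b p‖ ^ 2 * (π * C ^ 2 * sc p) * W (q.2.1 - p.2.1) := by
        simp only [s]; rw [if_pos h1]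
      have e2 : s q p = ‖b q‖ ^ 2 * (π * C ^ 2 * sc p) * W (q.2.1 - p.2.1) := by
        simp only [s]; rw [if_pos ⟨h1.1.symm, h1.2.symm⟩, ← W_neg, neg_sub, sc, h1.1]; rfl
      have h3 := hψ.inner_same_le h1.1.symm
      have h4 := hc p q
      have h5 : 0 ≤ π * C ^ 2 * sc p * W (q.2.1 - p.2.1) := by
        have := sc_pos p
        have := W_nonneg ((q.2.1 : ℝ) - p.2.1)
        positivity
      have h6 : ‖b p‖ * ‖b q‖ * J p q ≤ ‖b p‖ * ‖b q‖ *
          (2 * π * C ^ 2 * sc p * W (q.2.1 - p.2.1)) := by gcongr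
      rw [e1, e2]
      nlinarith [mul_nonneg (sq_nonneg (‖b p‖ - ‖b q‖)) h5]
    · by_cases h2 : Om p ⊆ Om1 q
      · have : c p q = ‖b p‖ * ‖b q‖ * J p q := if_pos h2
        linarith [hs p q, hs q p]
      · have : J p q = 0 := by simp only [J]; rw [hψ.inner_eq_zero hk h1 h2, norm_zero]
        rw [this, mul_zero]
        linarith [hs p q, hs q p, hc p q]
  have main' : ∀ p q, ‖b p‖ * ‖b q‖ * J p q ≤ s p q + s q p + (c p q + c q p) := by
    intro p q
    rcases le_total q.1 p.1 with h | h
    · linarith [main p q h, hc q p]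
    · have := main q p h
      rw [hJ q p] at this
      linarith [hc p q, mul_comm ‖b p‖ ‖b q‖]
  have hS : ∑ p ∈ U, ∑ q ∈ U, s p q ≤ 4 * π ^ 2 * C ^ 2 * ∑ p ∈ U, sc p * ‖b p‖ ^ 2 := by
    rw [Finset.mul_sum]
    refine Finset.sum_le_sum fun p _ => ?_
    simp only [s]
    rw [← Finset.sum_filter, ← Finset.mul_sum]
    have := sum_slice_le (U.filter fun q => q.1 = p.1 ∧ q.2.2 = p.2.2) p.1 p.2.2
      (fun q hq => (Finset.mem_filter.1 hq).2) p.2.1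
    have h2 := sc_pos p
    calc _ ≤ ‖b p‖ ^ 2 * (π * C ^ 2 * sc p) * (4 * π) := by gcongr
      _ = _ := by ring
  have hS' : ∑ p ∈ U, ∑ q ∈ U, s q p = ∑ p ∈ U, ∑ q ∈ U, s p q := Finset.sum_comm
  have hc' : ∑ p ∈ U, ∑ q ∈ U, c q p = ∑ p ∈ U, ∑ q ∈ U, c p q := Finset.sum_comm
  calc _ ≤ _ := h0
    _ ≤ ∑ p ∈ U, ∑ q ∈ U, (s p q + s q p + (c p q + c q p)) :=
        Finset.sum_le_sum fun p _ => Finset.sum_le_sum fun q _ => main' p q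
    _ = 2 * ∑ p ∈ U, ∑ q ∈ U, s p q + 2 * ∑ p ∈ U, ∑ q ∈ U, c p q := by
        simp_rw [Finset.sum_add_distrib]
        rw [hS', hc']; ring
    _ ≤ _ := by linarith

lemma integrable_mul (hψ : IsPacket C ψ) {f : ℝ → ℂ}
    (hf : Integrable f) (p : Tile) : Integrable (fun x => f x * conj (ψ p x)) :=
  hf.mul_bdd (c := C)
    (Complex.continuous_conj.comp (hψ.cont p)).aestronglyMeasurable
    (Eventually.of_forall fun x => by simpa using hψ.norm_le p x)

lemma sc_mul_cf (f : ℝ → ℂ) (p : Tile) :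
    (sc p : ℂ) * cf ψ f p = ∫ x, f x * conj (ψ p x) := by
  have : (sc p : ℂ) ≠ 0 := by exact_mod_cast (sc_pos p).ne'
  unfold cf
  push_cast
  rw [← mul_assoc, mul_inv_cancel₀ this, one_mul]

lemma integrable_sq_sum (hψ : IsPacket C ψ) (U : Finset Tile) (b : Tile → ℂ) :
    Integrable (fun x => ‖∑ p ∈ U, b p * ψ p x‖ ^ 2) := by
  have h1 : Integrable (fun x => ∑ p ∈ U, b p * ψ p x) :=
    integrable_finsetSum _ fun p _ => (hψ.integrable p).const_mul _
  have := h1.norm.mul_bdd (c := ∑ p ∈ U, ‖b p‖ * C) h1.norm.aestronglyMeasurable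
    (Eventually.of_forall fun x => by
      rw [norm_norm]
      refine (norm_sum_le _ _).trans (Finset.sum_le_sum fun p _ => ?_)
      rw [norm_mul]
      exact mul_le_mul_of_nonneg_left (hψ.norm_le p x) (norm_nonneg _))
  simpa [sq] using this

/-- The dual form of Bessel's inequality. -/
lemma coef_sum_le (hψ : IsPacket C ψ) {f : ℝ → ℂ} (hf : Integrable f)
    (hf2 : Integrable (fun x => ‖f x‖ ^ 2)) (U : Finset Tile) {D : ℝ} (hD : 0 < D)
    (hG : ∫ x, ‖∑ p ∈ U, cf ψ f p * ψ p x‖ ^ 2 ≤ D * ∑ p ∈ U, sc p * ‖cf ψ f p‖ ^ 2) :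
    ∑ p ∈ U, sc p * ‖cf ψ f p‖ ^ 2 ≤ D * ∫ x, ‖f x‖ ^ 2 := by
  set S := ∑ p ∈ U, sc p * ‖cf ψ f p‖ ^ 2
  set G : ℝ → ℂ := fun x => ∑ p ∈ U, cf ψ f p * ψ p x
  have hfG : (fun x => f x * conj (G x)) =
      fun x => ∑ p ∈ U, conj (cf ψ f p) * (f x * conj (ψ p x)) := by
    ext x
    simp only [G, map_sum, map_mul, Finset.mul_sum]
    exact Finset.sum_congr rfl fun p _ => by ring
  have hi : Integrable (fun x => f x * conj (G x)) := by
    rw [hfG]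
    exact integrable_finsetSum _ fun p _ => (hψ.integrable_mul hf p).const_mul _
  have h1 : ∫ x, f x * conj (G x) = (S : ℂ) := by
    rw [hfG, integral_finsetSum _ fun p _ => (hψ.integrable_mul hf p).const_mul _]
    push_cast [S]
    refine Finset.sum_congr rfl fun p _ => ?_
    rw [integral_const_mul, ← sc_mul_cf, mul_left_comm, mul_comm (conj _),
      Complex.mul_conj']
  have h2 : ∫ x, (f x * conj (G x)).re = S := by
    have := integral_re hi
    simp only [RCLike.re_to_complex] at this
    rw [this, h1, Complex.ofReal_re]
  have h3 : ∀ x, ‖f x - (D⁻¹ : ℝ) * G x‖ ^ 2 =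
      ‖f x‖ ^ 2 - 2 * D⁻¹ * (f x * conj (G x)).re + D⁻¹ ^ 2 * ‖G x‖ ^ 2 := by
    intro x
    simp only [← Complex.normSq_eq_norm_sq]
    rw [Complex.normSq_sub]
    simp only [map_mul, Complex.conj_ofReal, Complex.normSq_ofReal]
    rw [mul_left_comm, Complex.re_ofReal_mul]
    ring
  have hiG := hψ.integrable_sq_sum U (cf ψ f)
  have h4 : ∫ x, ‖f x - (D⁻¹ : ℝ) * G x‖ ^ 2 =
      (∫ x, ‖f x‖ ^ 2) - 2 * D⁻¹ * S + D⁻¹ ^ 2 * ∫ x, ‖G x‖ ^ 2 := by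
    simp_rw [h3]
    have hr : Integrable (fun x => (f x * conj (G x)).re) := hi.re
    have ha : Integrable (fun x => ‖f x‖ ^ 2 - 2 * D⁻¹ * (f x * conj (G x)).re) :=
      hf2.sub (hr.const_mul _)
    have hb : Integrable (fun x => D⁻¹ ^ 2 * ‖G x‖ ^ 2) := hiG.const_mul _
    rw [integral_add ha hb, integral_sub hf2 (hr.const_mul _), integral_const_mul, integral_const_mul, h2]
  have h5 : 0 ≤ ∫ x, ‖f x - (D⁻¹ : ℝ) * G x‖ ^ 2 := integral_nonneg fun x => by positivity
  rw [h4] at h5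
  have h6 : D⁻¹ ^ 2 * ∫ x, ‖G x‖ ^ 2 ≤ D⁻¹ ^ 2 * (D * S) := by gcongr
  have h7 : D⁻¹ ^ 2 * (D * S) = D⁻¹ * S := by field_simp
  have h8 : D⁻¹ * S ≤ ∫ x, ‖f x‖ ^ 2 := by linarith
  rwa [inv_mul_le_iff₀ hD] at h8

end IsPacket

/-- The data of a tree top: a dyadic interval `dy K n` and a frequency. -/
abbrev Top := ℤ × ℤ × ℝ

/-- The interval of a tree top. -/
def topI (θ : Top) : Set ℝ := dy θ.1 θ.2.1

/-- A collection of tiles is a tree with top `θ`. -/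
def IsTree (T : Finset Tile) (θ : Top) : Prop := ∀ p ∈ T, tI p ⊆ topI θ ∧ θ.2.2 ∈ Om p

open Classical in
/-- The part of a collection forming an upper tree with the given top. -/
def tree2 (P : Finset Tile) (θ : Top) : Finset Tile :=
  P.filter fun p => tI p ⊆ topI θ ∧ θ.2.2 ∈ Om2 p

/-- The collection `P` has energy at most `ε` with respect to the coefficients `a`. -/
def HasEnergy (a : Tile → ℂ) (P : Finset Tile) (ε : ℝ) : Prop :=
  ∀ θ : Top, ∑ p ∈ tree2 P θ, sc p * ‖a p‖ ^ 2 ≤ ε ^ 2 * 2 ^ θ.1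

lemma mem_tree2 {P : Finset Tile} {θ : Top} {p : Tile} :
    p ∈ tree2 P θ ↔ p ∈ P ∧ tI p ⊆ topI θ ∧ θ.2.2 ∈ Om2 p := by
  classical
  simp [tree2]

lemma sc_sq_nonneg (a : Tile → ℂ) (p : Tile) : 0 ≤ sc p * ‖a p‖ ^ 2 := by
  have := sc_pos p
  positivity

lemma HasEnergy.mono {a : Tile → ℂ} {P Q : Finset Tile} {ε δ : ℝ} (h : HasEnergy a P ε)
    (hQ : Q ⊆ P) (hε : 0 ≤ ε) (hδ : ε ≤ δ) : HasEnergy a Q δ := by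
  intro θ
  refine le_trans (Finset.sum_le_sum_of_subset_of_nonneg ?_ fun p _ _ => sc_sq_nonneg a p)
    ((h θ).trans ?_)
  · intro p hp
    rw [mem_tree2] at *
    exact ⟨hQ hp.1, hp.2⟩
  · have := two_zpow_pos θ.1
    gcongr

lemma HasEnergy.norm_le {a : Tile → ℂ} {P : Finset Tile} {ε : ℝ} (h : HasEnergy a P ε)
    (hε : 0 ≤ ε) {p : Tile} (hp : p ∈ P) : ‖a p‖ ≤ ε := by
  obtain ⟨ξ, hξ⟩ : (Om2 p).Nonempty := dy_nonempty _ _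
  have h1 := h (p.1, p.2.1, ξ)
  have h2 : sc p * ‖a p‖ ^ 2 ≤ ∑ p ∈ tree2 P (p.1, p.2.1, ξ), sc p * ‖a p‖ ^ 2 :=
    Finset.single_le_sum (f := fun p => sc p * ‖a p‖ ^ 2) (fun p _ => sc_sq_nonneg a p)
      (mem_tree2.2 ⟨hp, subset_rfl, hξ⟩)
  have h3 := sc_pos p
  have h4 : sc p * ‖a p‖ ^ 2 ≤ sc p * ε ^ 2 := by
    refine h2.trans (h1.trans (le_of_eq ?_))
    simp only [sc]; ring
  have h5 := le_of_mul_le_mul_left h4 h3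
  exact (pow_le_pow_iff_left₀ (norm_nonneg _) hε two_ne_zero).1 h5

/-- The lower endpoint of the upper half of the frequency interval. -/
def lft (p : Tile) : ℝ := ((2 * p.2.2 + 1 : ℤ) : ℝ) * 2 ^ (-p.1 - 1)

lemma lft_mem (p : Tile) : lft p ∈ Om2 p := dy_left_mem _ _

lemma lft_le {p : Tile} {ξ : ℝ} (h : ξ ∈ Om2 p) : lft p ≤ ξ := h.1

lemma exists_min_violating {a : Tile → ℂ} {P : Finset Tile} {ε : ℝ} (h : ¬ HasEnergy a P ε) :
    ∃ θ : Top, ε ^ 2 * 2 ^ θ.1 < ∑ p ∈ tree2 P θ, sc p * ‖a p‖ ^ 2 ∧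
      ∀ η : Top, ε ^ 2 * 2 ^ η.1 < ∑ p ∈ tree2 P η, sc p * ‖a p‖ ^ 2 → θ.2.2 ≤ η.2.2 := by
  classical
  set V : Top → Prop := fun η => ε ^ 2 * 2 ^ η.1 < ∑ p ∈ tree2 P η, sc p * ‖a p‖ ^ 2
  have key : ∀ η, V η → ∃ p ∈ P, V (η.1, η.2.1, lft p) ∧ lft p ≤ η.2.2 := by
    intro η hη
    have hne : (tree2 P η).Nonempty := by
      by_contra hne
      rw [Finset.not_nonempty_iff_eq_empty] at hne
      have : (0 : ℝ) ≤ ε ^ 2 * 2 ^ η.1 := by have := two_zpow_pos η.1; positivity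
      simp only [V, hne, Finset.sum_empty] at hη
      linarith
    obtain ⟨p, hp, hmax⟩ := Finset.exists_max_image (tree2 P η) (fun p => p.1) hne
    rw [mem_tree2] at hp
    refine ⟨p, hp.1, ?_, lft_le hp.2.2⟩
    refine lt_of_lt_of_le hη (Finset.sum_le_sum_of_subset_of_nonneg ?_
      fun p _ _ => sc_sq_nonneg a p)
    intro q hq
    have hk := hmax q hq
    rw [mem_tree2] at hq ⊢
    refine ⟨hq.1, hq.2.1, ?_⟩
    exact dy_subset (by omega) hp.2.2 hq.2.2 (lft_mem p)
  have hV : ∃ η, V η := by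
    by_contra hV
    push Not at hV
    exact h fun θ => not_lt.1 (hV θ)
  obtain ⟨η, hη⟩ := hV
  obtain ⟨p, hp, hpV, -⟩ := key η hη
  set Q := P.filter fun p => ∃ K n, V (K, n, lft p)
  have hQ : Q.Nonempty := ⟨p, Finset.mem_filter.2 ⟨hp, _, _, hpV⟩⟩
  obtain ⟨q, hq, hmin⟩ := Finset.exists_min_image Q lft hQ
  obtain ⟨-, K, n, hVq⟩ := Finset.mem_filter.1 hq
  refine ⟨(K, n, lft q), hVq, fun ζ hζ => ?_⟩
  obtain ⟨r, hr, hrV, hle⟩ := key ζ hζ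
  exact (hmin r (Finset.mem_filter.2 ⟨hr, _, _, hrV⟩)).trans hle

lemma energy_select (a : Tile → ℂ) (ε : ℝ) (P : Finset Tile) :
    ∃ (P' : Finset Tile) (Θ : Finset Top) (top : Tile → Top), P' ⊆ P ∧ HasEnergy a P' ε ∧
      (∀ p ∈ P \ P', top p ∈ Θ ∧ tI p ⊆ topI (top p) ∧ (top p).2.2 ∈ Om p) ∧
      (∀ θ ∈ Θ, ε ^ 2 * 2 ^ θ.1 <
        ∑ p ∈ tree2 ((P \ P').filter fun p => top p = θ) θ, sc p * ‖a p‖ ^ 2) ∧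
      ∀ p ∈ P \ P', ∀ q ∈ P \ P', (top p).2.2 ∈ Om2 p → (top q).2.2 ∈ Om2 q → Om p ⊆ Om1 q →
        Disjoint (tI q) (topI (top p)) := by
  classical
  induction P using Finset.strongInduction with
  | H P ih =>
  by_cases hE : HasEnergy a P ε
  · exact ⟨P, ∅, fun _ => (0, 0, 0), subset_rfl, hE, by simp, by simp, by simp⟩
  obtain ⟨θ, hθ, hmin⟩ := exists_min_violating hE
  set R := P.filter fun p => tI p ⊆ topI θ ∧ θ.2.2 ∈ Om p with hR
  have hmemR : ∀ p, p ∈ R ↔ p ∈ P ∧ tI p ⊆ topI θ ∧ θ.2.2 ∈ Om p := fun p => by simp [R]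
  have htR : tree2 P θ ⊆ R := by
    intro p hp
    rw [mem_tree2] at hp
    exact (hmemR p).2 ⟨hp.1, hp.2.1, Om2_subset p hp.2.2⟩
  have hne : (tree2 P θ).Nonempty := by
    by_contra hne
    rw [Finset.not_nonempty_iff_eq_empty] at hne
    have : (0 : ℝ) ≤ ε ^ 2 * 2 ^ θ.1 := by have := two_zpow_pos θ.1; positivity
    simp only [hne, Finset.sum_empty] at hθ
    linarith
  have hss : P \ R ⊂ P := by
    obtain ⟨p, hp⟩ := hne
    exact Finset.sdiff_ssubset (Finset.filter_subset _ _) ⟨p, htR hp⟩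
  obtain ⟨P', Θ, top, h1, h2, h3, h4, h5⟩ := ih _ hss
  have hP'R : ∀ p ∈ P', p ∉ R := fun p hp => (Finset.mem_sdiff.1 (h1 hp)).2
  set top' : Tile → Top := fun p => if p ∈ R then θ else top p
  have ht1 : ∀ p ∈ R, top' p = θ := fun p hp => if_pos hp
  have ht2 : ∀ p, p ∉ R → top' p = top p := fun p hp => if_neg hp
  have hmem : ∀ p ∈ P \ P', p ∉ R → p ∈ (P \ R) \ P' := by
    intro p hp hpR
    rw [Finset.mem_sdiff] at hp
    simp [hp.1, hp.2, hpR]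
  have hmem' : ∀ p ∈ (P \ R) \ P', p ∈ P \ P' ∧ p ∉ R := by
    intro p hp
    simp only [Finset.mem_sdiff] at hp
    simp [hp.1.1, hp.2, hp.1.2]
  have hθΘ : θ ∉ Θ := by
    intro hΘ
    have h6 := h4 θ hΘ
    have h7 : (tree2 (((P \ R) \ P').filter fun p => top p = θ) θ).Nonempty := by
      by_contra hne
      rw [Finset.not_nonempty_iff_eq_empty] at hne
      have : (0 : ℝ) ≤ ε ^ 2 * 2 ^ θ.1 := by have := two_zpow_pos θ.1; positivity
      simp only [hne, Finset.sum_empty] at h6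
      linarith
    obtain ⟨p, hp⟩ := h7
    rw [mem_tree2, Finset.mem_filter] at hp
    obtain ⟨h8, h9⟩ := hmem' p hp.1.1
    exact h9 ((hmemR p).2 ⟨(Finset.mem_sdiff.1 h8).1, hp.2.1, Om2_subset p hp.2.2⟩)
  have hlater : ∀ η ∈ Θ, θ.2.2 ≤ η.2.2 := by
    intro η hη
    apply hmin
    refine (h4 η hη).trans_le (Finset.sum_le_sum_of_subset_of_nonneg ?_
      fun p _ _ => sc_sq_nonneg a p)
    intro p hp
    rw [mem_tree2, Finset.mem_filter] at hp
    rw [mem_tree2]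
    exact ⟨(Finset.mem_sdiff.1 (hmem' p hp.1.1).1).1, hp.2⟩
  refine ⟨P', insert θ Θ, top', h1.trans Finset.sdiff_subset, h2, ?_, ?_, ?_⟩
  · intro p hp
    by_cases hpR : p ∈ R
    · rw [ht1 p hpR]
      exact ⟨Finset.mem_insert_self _ _, ((hmemR p).1 hpR).2⟩
    · rw [ht2 p hpR]
      have := h3 p (hmem p hp hpR)
      exact ⟨Finset.mem_insert_of_mem this.1, this.2⟩
  · intro η hη
    rcases Finset.mem_insert.1 hη with rfl | hη
    · refine hθ.trans_le (Finset.sum_le_sum_of_subset_of_nonneg ?_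
        fun p _ _ => sc_sq_nonneg a p)
      intro p hp
      have hpR := htR hp
      rw [mem_tree2] at hp ⊢
      refine ⟨Finset.mem_filter.2 ⟨?_, ht1 p hpR⟩, hp.2⟩
      exact Finset.mem_sdiff.2 ⟨hp.1, fun h => hP'R p h hpR⟩
    · refine (h4 η hη).trans_le (Finset.sum_le_sum_of_subset_of_nonneg ?_
        fun p _ _ => sc_sq_nonneg a p)
      intro p hp
      rw [mem_tree2, Finset.mem_filter] at hp ⊢
      obtain ⟨h8, h9⟩ := hmem' p hp.1.1
      exact ⟨⟨h8, (ht2 p h9).trans hp.1.2⟩, hp.2⟩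
  · intro p hp q hq hp2 hq2 hpq
    by_cases hpR : p ∈ R
    · rw [ht1 p hpR] at hp2 ⊢
      by_cases hqR : q ∈ R
      · rw [ht1 q hqR] at hq2
        exact absurd hq2 (Set.disjoint_left.1 (disjoint_Om1_Om2 q) (hpq (Om2_subset p hp2)))
      · have hpt := ((hmemR p).1 hpR).2.1
        have hk : q.1 ≤ θ.1 := by
          have h6 := le_of_dy_subset hpq
          have h7 := le_of_dy_subset hpt
          omega
        rcases dy_subset_or_disjoint q.2.1 θ.2.1 hk with h | h
        · exact absurd ((hmemR q).2 ⟨(Finset.mem_sdiff.1 hq).1, h,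
            Om1_subset q (hpq (Om2_subset p hp2))⟩) hqR
        · exact h
    · rw [ht2 p hpR] at hp2 ⊢
      by_cases hqR : q ∈ R
      · rw [ht1 q hqR] at hq2
        have h6 := hlater _ (h3 p (hmem p hp hpR)).1
        have h7 : (top p).2.2 ∈ Om1 q := hpq (Om2_subset p hp2)
        have h8 := h7.2
        have h9 := hq2.1
        push_cast at h8 h9
        linarith
      · rw [ht2 q hqR] at hq2
        exact h5 p (hmem p hp hpR) q (hmem q hq hqR) hp2 hq2 hpq

lemma off_le (p : Tile) (S : Set ℝ) : ∫ x in S, wt p x ^ 2 ≤ π * sc p :=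
  (setIntegral_le_integral (integrable_wt_pow p two_ne_zero)
    (Eventually.of_forall fun _ => sq_nonneg _)).trans (integral_wt_pow_le p two_ne_zero)

lemma off_nonneg (p : Tile) (S : Set ℝ) : 0 ≤ ∫ x in S, wt p x ^ 2 :=
  integral_nonneg fun _ => sq_nonneg _

/-- The energy lemma: the energy can be halved by removing trees whose tops have controlled
total length. -/
theorem energy_lemma {C : ℝ} {ψ : Tile → ℝ → ℂ} (hψ : IsPacket C ψ) {f : ℝ → ℂ}
    (hf : Integrable f) (hf2 : Integrable (fun x => ‖f x‖ ^ 2)) {P : Finset Tile} {ε : ℝ}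
    (hε : 0 < ε) (hP : HasEnergy (cf ψ f) P ε) :
    ∃ (P' : Finset Tile) (Θ : Finset Top) (top : Tile → Top), P' ⊆ P ∧
      HasEnergy (cf ψ f) P' (ε / 2) ∧
      (∀ p ∈ P \ P', top p ∈ Θ ∧ tI p ⊆ topI (top p) ∧ (top p).2.2 ∈ Om p) ∧
      ε ^ 2 * ∑ θ ∈ Θ, (2 : ℝ) ^ θ.1 ≤ 100000 * π ^ 3 * C ^ 2 * ∫ x, ‖f x‖ ^ 2 := by
  classical
  have hC := hψ.pos
  have hpi := Real.pi_pos
  obtain ⟨P', Θ, top, h1, h2, h3, h4, h5⟩ := energy_select (cf ψ f) (ε / 2) P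
  refine ⟨P', Θ, top, h1, h2, h3, ?_⟩
  set a := cf ψ f
  set U := (P \ P').filter fun p => (top p).2.2 ∈ Om2 p
  have hU : ∀ p, p ∈ U ↔ p ∈ P \ P' ∧ (top p).2.2 ∈ Om2 p := fun p => by simp [U]
  set S := ∑ p ∈ U, sc p * ‖a p‖ ^ 2
  have hfib : ∀ g : Tile → ℝ, ∑ θ ∈ Θ, ∑ p ∈ U.filter (fun p => top p = θ), g p =
      ∑ p ∈ U, g p := fun g =>
    Finset.sum_fiberwise_of_maps_to (fun p hp => (h3 p ((hU p).1 hp).1).1) g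
  have hS : ε ^ 2 * ∑ θ ∈ Θ, (2 : ℝ) ^ θ.1 ≤ 4 * S := by
    have : ∑ θ ∈ Θ, (ε / 2) ^ 2 * (2 : ℝ) ^ θ.1 ≤ S := by
      simp only [S]
      rw [← hfib]
      refine Finset.sum_le_sum fun θ hθ => (h4 θ hθ).le.trans ?_
      refine Finset.sum_le_sum_of_subset_of_nonneg ?_ fun p _ _ => sc_sq_nonneg a p
      intro p hp
      rw [mem_tree2, Finset.mem_filter] at hp
      rw [Finset.mem_filter, hU]
      refine ⟨⟨hp.1.1, ?_⟩, hp.1.2⟩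
      rw [hp.1.2]; exact hp.2.2
    rw [← Finset.mul_sum] at this
    linarith
  set t : Tile → ℝ := fun p => ∫ x in (topI (top p))ᶜ, wt p x ^ 2
  have ht0 : ∀ p, 0 ≤ t p := fun p => off_nonneg p _
  have ht1 : ∀ p, t p ≤ π * sc p := fun p => off_le p _
  have htsum : ∑ p ∈ U, t p ≤ 16 * π ^ 2 * ∑ θ ∈ Θ, (2 : ℝ) ^ θ.1 := by
    rw [← hfib, Finset.mul_sum]
    refine Finset.sum_le_sum fun θ hθ => ?_
    have := tree_off_sum (T := U.filter (fun p => top p = θ)) (K := θ.1) (n := θ.2.1)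
      (ξ := θ.2.2) (by
        intro p hp
        rw [Finset.mem_filter, hU] at hp
        rw [← hp.2]; exact (h3 p hp.1.1).2.1) (by
        intro p hp
        rw [Finset.mem_filter, hU] at hp
        rw [← hp.2]; exact (h3 p hp.1.1).2.2)
    refine le_trans (le_of_eq (Finset.sum_congr rfl fun p hp => ?_)) this
    simp only [t, topI]
    rw [(Finset.mem_filter.1 hp).2]
  have hdisj : ∀ p ∈ U, ∑ q ∈ U.filter (fun q => Om p ⊆ Om1 q), ∫ y in tI q, wt p y ^ 2
      ≤ t p := by
    intro p hp
    have hmem : ∀ q ∈ U.filter (fun q => Om p ⊆ Om1 q), q ∈ U ∧ Om p ⊆ Om1 q := fun q hq => by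
      simpa using hq
    have hpd : Set.PairwiseDisjoint (↑(U.filter (fun q => Om p ⊆ Om1 q)) : Set Tile) tI := by
      have key : ∀ q ∈ U.filter (fun q => Om p ⊆ Om1 q),
          ∀ r ∈ U.filter (fun q => Om p ⊆ Om1 q), q ≠ r → q.1 ≤ r.1 → Disjoint (tI q) (tI r) := by
        intro q hq r hr hqr hk
        obtain ⟨hqU, hq1⟩ := hmem q hq
        obtain ⟨hrU, hr1⟩ := hmem r hr
        obtain ⟨z, hz⟩ : (Om p).Nonempty := dy_nonempty _ _
        rcases hk.lt_or_eq with hk | hk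
        · have h6 : Om r ⊆ Om1 q := Om_subset_Om1 hk (Om1_subset r (hr1 hz)) (hq1 hz)
          have h7 := h5 r ((hU r).1 hrU).1 q ((hU q).1 hqU).1 ((hU r).1 hrU).2
            ((hU q).1 hqU).2 h6
          exact h7.mono_right (h3 r ((hU r).1 hrU).1).2.1
        · rw [Set.disjoint_left]
          intro y hy hy'
          apply hqr
          have e1 := hq1 hz
          have e2 := hr1 hz
          unfold Om1 at e1 e2
          unfold tI at hy hy'
          rw [hk] at e1 hy
          have e3 := dy_inj e1 e2
          exact Prod.ext hk (Prod.ext (dy_inj hy hy') (by omega))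
      intro q hq r hr hqr
      rcases le_total q.1 r.1 with h | h
      · exact key q hq r hr hqr h
      · exact (key r hr q hq hqr.symm h).symm
    rw [← integral_biUnion_finset _ (fun q _ => measurableSet_tI q) hpd
      (fun q _ => (integrable_wt_pow p two_ne_zero).integrableOn)]
    apply setIntegral_mono_set (integrable_wt_pow p two_ne_zero).integrableOn
      (Eventually.of_forall fun x => sq_nonneg _)
    apply LE.le.eventuallyLE
    intro y hy
    simp only [mem_iUnion] at hy
    obtain ⟨q, hq, hy⟩ := hy
    obtain ⟨hqU, hq1⟩ := hmem q hq
    exact Set.disjoint_left.1 (h5 p ((hU p).1 hp).1 q ((hU q).1 hqU).1 ((hU p).1 hp).2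
            ((hU q).1 hqU).2 hq1) hy
  have hcross : ∑ p ∈ U, ∑ q ∈ U, (if Om p ⊆ Om1 q then
      ‖a p‖ * ‖a q‖ * ‖∫ x, ψ p x * conj (ψ q x)‖ else 0) ≤
      64 * π * C ^ 2 * ((32 * π ^ 2 + π / 2) * S) := by
    calc _ ≤ ∑ p ∈ U, 64 * π * C ^ 2 * (ε ^ 2 * t p / 2 + π / 2 * (sc p * ‖a p‖ ^ 2)) := by
          refine Finset.sum_le_sum fun p hp => ?_
          rw [← Finset.sum_filter]
          calc _ ≤ ∑ q ∈ U.filter (fun q => Om p ⊆ Om1 q),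
                ‖a p‖ * ε * (64 * π * C ^ 2) * ∫ y in tI q, wt p y ^ 2 := by
                refine Finset.sum_le_sum fun q hq => ?_
                obtain ⟨hqU, hq1⟩ := Finset.mem_filter.1 hq
                have hk : q.1 ≤ p.1 := by
                  have := le_of_dy_subset hq1
                  omega
                have h6 := hψ.inner_le hk
                have h7 : ‖a q‖ ≤ ε := hP.norm_le hε.le
                  (Finset.mem_sdiff.1 ((hU q).1 hqU).1).1
                calc _ ≤ ‖a p‖ * ε * (64 * π * C ^ 2 * ∫ y in tI q, wt p y ^ 2) := by
                      gcongr
                  _ = _ := by ring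
            _ ≤ ‖a p‖ * ε * (64 * π * C ^ 2) * t p := by
                rw [← Finset.mul_sum]
                have := hdisj p hp
                gcongr
            _ = 64 * π * C ^ 2 * (ε * ‖a p‖ * t p) := by ring
            _ ≤ _ := by
                have h6 : ε * ‖a p‖ * t p ≤ ε ^ 2 * t p / 2 + π / 2 * (sc p * ‖a p‖ ^ 2) := by
                  have := mul_le_mul_of_nonneg_left (ht1 p) (sq_nonneg ‖a p‖)
                  nlinarith [mul_nonneg (sq_nonneg (ε - ‖a p‖)) (ht0 p)]
                gcongr
      _ = 64 * π * C ^ 2 * (ε ^ 2 / 2 * ∑ p ∈ U, t p + π / 2 * S) := by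
          rw [← Finset.mul_sum, Finset.sum_add_distrib, ← Finset.mul_sum]
          congr 2
          rw [Finset.mul_sum]
          exact Finset.sum_congr rfl fun p _ => by ring
      _ ≤ _ := by
          have h6 : ε ^ 2 / 2 * ∑ p ∈ U, t p ≤
              ε ^ 2 / 2 * (16 * π ^ 2 * ∑ θ ∈ Θ, (2 : ℝ) ^ θ.1) := by gcongr
          have h7 : 8 * π ^ 2 * (ε ^ 2 * ∑ θ ∈ Θ, (2 : ℝ) ^ θ.1) ≤
              8 * π ^ 2 * (4 * S) := by gcongr
          have h8 : ε ^ 2 / 2 * ∑ p ∈ U, t p + π / 2 * S ≤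
            (32 * π ^ 2 + π / 2) * S := by nlinarith
          gcongr
  have hB := hψ.bessel U a hcross
  have hS0 : 0 ≤ S := Finset.sum_nonneg fun p _ => sc_sq_nonneg a p
  have hpi3 : π ≤ π ^ 2 ∧ π ^ 2 ≤ π ^ 3 := by
    have := Real.pi_gt_three
    constructor <;> nlinarith [mul_pos hpi hpi]
  have hfin := hψ.coef_sum_le hf hf2 U (D := 10000 * π ^ 3 * C ^ 2) (by positivity) (by
    refine hB.trans ?_
    have h6 : 8 * π ^ 2 * C ^ 2 * S ≤ 8 * π ^ 3 * C ^ 2 * S := by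
      have := hpi3.2
      gcongr
    have h7 : 64 * π * C ^ 2 * ((32 * π ^ 2 + π / 2) * S) ≤
        (64 * 33) * π ^ 3 * C ^ 2 * S := by
      have h8 : 0 ≤ C ^ 2 * S := by positivity
      have h9 : 64 * π * (32 * π ^ 2 + π / 2) ≤ (64 * 33) * π ^ 3 := by
        nlinarith [hpi3.2]
      calc _ = (64 * π * (32 * π ^ 2 + π / 2)) * (C ^ 2 * S) := by ring
        _ ≤ ((64 * 33) * π ^ 3) * (C ^ 2 * S) := by gcongr
        _ = _ := by ring
    have h8 : 0 ≤ π ^ 3 * C ^ 2 * S := by positivity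
    linarith)
  have h9 : 0 ≤ π ^ 3 * C ^ 2 * ∫ x, ‖f x‖ ^ 2 :=
    mul_nonneg (by positivity) (integral_nonneg fun x => by positivity)
  linarith [show S ≤ 10000 * π ^ 3 * C ^ 2 * ∫ x, ‖f x‖ ^ 2 from hfin]

/-- A Vitali type estimate for a union of balls on which `u` has large average. -/
lemma measure_iUnion_closedBall_le {u : ℝ → ℝ≥0∞} {l : ℝ} (hl : 0 < l) (S : Set (ℝ × ℝ))
    (hS : ∀ a ∈ S, 0 < a.2 ∧
      ofReal (l * a.2) ≤ ∫⁻ y in Metric.closedBall a.1 a.2, u y) :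
    volume (⋃ a ∈ S, Metric.closedBall a.1 a.2) ≤ ofReal (10 / l) * ∫⁻ y, u y := by
  by_cases hu : ∫⁻ y, u y = ∞
  · rw [hu, ENNReal.mul_top (by simp; positivity)]; exact le_top
  obtain ⟨v, hvS, hv, hcov⟩ := Vitali.exists_disjoint_subfamily_covering_enlargement_closedBall
    S Prod.fst Prod.snd ((∫⁻ y, u y).toReal / l) (by
      intro a ha
      rw [le_div_iff₀ hl, mul_comm]
      have := (hS a ha).2.trans (setLIntegral_le_lintegral _ _)
      rwa [← ENNReal.ofReal_toReal hu, ENNReal.ofReal_le_ofReal_iff ENNReal.toReal_nonneg] at this)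
    5 (by norm_num)
  have hcount : v.Countable := hv.countable_of_nonempty_interior fun a ha => by
    have := (hS a (hvS ha)).1
    rw [interior_closedBall _ this.ne']
    exact Metric.nonempty_ball.2 this
  calc _ ≤ volume (⋃ a ∈ v, Metric.closedBall a.1 (5 * a.2)) := by
        apply measure_mono
        intro x hx
        simp only [mem_iUnion] at hx ⊢
        obtain ⟨a, ha, hx⟩ := hx
        obtain ⟨b, hb, hab⟩ := hcov a ha
        exact ⟨b, hb, hab hx⟩
    _ ≤ ∑' a : v, volume (Metric.closedBall a.1.1 (5 * a.1.2)) := measure_biUnion_le _ hcount _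
    _ ≤ ∑' a : v, ofReal (10 / l) * ∫⁻ y in Metric.closedBall a.1.1 a.1.2, u y := by
        refine ENNReal.tsum_le_tsum fun a => ?_
        obtain ⟨h1, h2⟩ := hS a.1 (hvS a.2)
        rw [Real.volume_closedBall]
        calc _ = ofReal (10 / l) * ofReal (l * a.1.2) := by
              rw [← ENNReal.ofReal_mul (by positivity)]
              congr 1; field_simp; ring
          _ ≤ _ := by gcongr
    _ = ofReal (10 / l) * ∫⁻ y in ⋃ a ∈ v, Metric.closedBall a.1 a.2, u y := by
        rw [ENNReal.tsum_mul_left, lintegral_biUnion hcount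
          (fun a _ => Metric.isClosed_closedBall.measurableSet) hv]
    _ ≤ _ := by gcongr; exact Measure.restrict_le_self

/-- The average of `u` at scale `2 ^ k` with a Cauchy weight. -/
def Av (k : ℤ) (u : ℝ → ℝ≥0∞) (x : ℝ) : ℝ≥0∞ :=
  ofReal (2 ^ (-k)) * ∫⁻ y, u y * ofReal (W (2 ^ (-k) * (x - y)))

/-- The maximal function associated with the averages `Av`. -/
def MW (u : ℝ → ℝ≥0∞) (x : ℝ) : ℝ≥0∞ := ⨆ k, Av k u x

lemma le_MW (k : ℤ) (u : ℝ → ℝ≥0∞) (x : ℝ) : Av k u x ≤ MW u x := le_iSup (Av · u x) k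

lemma measurable_Av (k : ℤ) {u : ℝ → ℝ≥0∞} (hu : Measurable u) : Measurable (Av k u) := by
  unfold Av
  refine Measurable.const_mul (Measurable.lintegral_prod_right' (f := fun z : ℝ × ℝ =>
    u z.2 * ofReal (W (2 ^ (-k) * (z.1 - z.2)))) ?_) _
  have : Measurable W := continuous_W.measurable
  fun_prop

lemma measurable_MW {u : ℝ → ℝ≥0∞} (hu : Measurable u) : Measurable (MW u) :=
  Measurable.iSup fun k => measurable_Av k hu

lemma Av_shift {k : ℤ} (u : ℝ → ℝ≥0∞) {x x' c : ℝ} (h : |x - x'| ≤ c * 2 ^ k) :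
    Av k u x ≤ ofReal (2 * (1 + c ^ 2)) * Av k u x' := by
  unfold Av
  rw [mul_left_comm]
  gcongr
  rw [← lintegral_const_mul' _ _ ENNReal.ofReal_ne_top]
  refine lintegral_mono fun y => ?_
  rw [mul_left_comm]
  gcongr
  rw [← ENNReal.ofReal_mul (by positivity)]
  apply ENNReal.ofReal_le_ofReal
  apply W_shift
  rw [← mul_sub, sub_sub_sub_cancel_right, abs_mul, abs_of_pos (two_zpow_pos _)]
  have := two_zpow_pos (-k)
  calc (2 : ℝ) ^ (-k) * |x - x'| ≤ 2 ^ (-k) * (c * 2 ^ k) := by gcongr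
    _ = c := by rw [mul_left_comm, two_zpow_neg_mul, mul_one]

lemma Av_const (k : ℤ) (c : ℝ≥0∞) (x : ℝ) : Av k (fun _ => c) x = c * ofReal π := by
  unfold Av
  have h0 := two_zpow_pos (-k)
  have h : ∫⁻ y, ofReal (W (2 ^ (-k) * (x - y))) = ofReal (π / 2 ^ (-k)) := by
    rw [← integral_W_affine h0 (2 ^ (-k) * x), ofReal_integral_eq_lintegral_ofReal
      (integrable_W_affine h0.ne' _) (Eventually.of_forall fun _ => W_nonneg _)]
    congr 1; ext y
    rw [← W_neg]; congr 2; ring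
  rw [lintegral_const_mul _ (by have := continuous_W.measurable; fun_prop), h, mul_left_comm,
    ← ENNReal.ofReal_mul h0.le]
  congr 2; field_simp

lemma Av_mono (k : ℤ) {u v : ℝ → ℝ≥0∞} (h : ∀ y, u y ≤ v y) (x : ℝ) : Av k u x ≤ Av k v x := by
  unfold Av
  gcongr
  exact h _

lemma Av_add (k : ℤ) {u v : ℝ → ℝ≥0∞} (hu : Measurable u) (x : ℝ) :
    Av k (fun y => u y + v y) x = Av k u x + Av k v x := by
  unfold Av
  have : Measurable W := continuous_W.measurable
  rw [← mul_add, ← lintegral_add_left (by fun_prop)]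
  simp only [add_mul]

lemma exists_W_le (t : ℝ) : ∃ j : ℕ, |t| ≤ 2 ^ j ∧ W t ≤ 4 * 4⁻¹ ^ j := by
  classical
  have hex : ∃ j : ℕ, |t| ≤ 2 ^ j := by
    obtain ⟨j, hj⟩ := pow_unbounded_of_one_lt |t| (one_lt_two (α := ℝ))
    exact ⟨j, hj.le⟩
  refine ⟨Nat.find hex, Nat.find_spec hex, ?_⟩
  rcases hn : Nat.find hex with _ | j
  · have := W_le_one t
    simp; linarith
  · have h2 := Nat.find_min hex (m := j) (by omega)
    push Not at h2
    have h3 : W t ≤ W (2 ^ j) := W_anti (by rw [abs_of_pos (by positivity)]; exact h2.le)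
    refine h3.trans ?_
    unfold W
    rw [pow_succ' (4⁻¹ : ℝ), mul_inv_cancel_left₀ (by norm_num), inv_pow,
      show (4 : ℝ) = 2 ^ 2 by norm_num, ← pow_mul, ← pow_mul, mul_comm 2 j]
    gcongr
    linarith

lemma W_le_tsum (t : ℝ) : ofReal (W t) ≤
    ∑' j : ℕ, 4 * ofReal (4⁻¹ ^ j) * (Metric.closedBall (0 : ℝ) (2 ^ j)).indicator 1 t := by
  obtain ⟨j, h1, h2⟩ := exists_W_le t
  refine le_trans ?_ (ENNReal.le_tsum j)
  rw [indicator_of_mem (by simpa using h1), Pi.one_apply, mul_one,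
    show (4 : ℝ≥0∞) = ofReal 4 by simp, ← ENNReal.ofReal_mul (by norm_num)]
  exact ENNReal.ofReal_le_ofReal h2

/-- If all ball averages of `u` around `x` are small, then so are the weighted averages. -/
lemma Av_le_of_closedBall {u : ℝ → ℝ≥0∞} (hu : Measurable u) {x : ℝ} {l : ℝ} (hl : 0 < l)
    (k : ℤ) (h : ∀ r, 2 ^ k ≤ r →
      ∫⁻ y in Metric.closedBall x r, u y ≤ ofReal (l / 8 * r)) :
    Av k u x ≤ ofReal l := by
  unfold Av
  have h0 := two_zpow_pos k
  calc _ ≤ ofReal (2 ^ (-k)) * ∫⁻ y, ∑' j : ℕ, 4 * ofReal (4⁻¹ ^ j) *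
        (Metric.closedBall x (2 ^ k * 2 ^ j)).indicator u y := by
        gcongr with y
        calc _ ≤ u y * ∑' j : ℕ, 4 * ofReal (4⁻¹ ^ j) *
              (Metric.closedBall (0 : ℝ) (2 ^ j)).indicator 1 (2 ^ (-k) * (x - y)) := by
              gcongr; exact W_le_tsum _
          _ = _ := by
              rw [← ENNReal.tsum_mul_left]
              congr 1; ext j
              have : (2 : ℝ) ^ (-k) * (x - y) ∈ Metric.closedBall (0 : ℝ) (2 ^ j) ↔
                  y ∈ Metric.closedBall x (2 ^ k * 2 ^ j) := by
                rw [mem_closedBall_zero_iff, Metric.mem_closedBall, Real.norm_eq_abs, abs_mul,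
                  abs_of_pos (two_zpow_pos _), Real.dist_eq, abs_sub_comm y x, zpow_neg,
                  inv_mul_le_iff₀ h0]
              rw [mul_left_comm]
              congr 1
              by_cases hy : y ∈ Metric.closedBall x (2 ^ k * 2 ^ j)
              · rw [indicator_of_mem hy, indicator_of_mem (this.2 hy)]; simp
              · rw [indicator_of_notMem hy, indicator_of_notMem (mt this.1 hy)]; simp
    _ = ofReal (2 ^ (-k)) * ∑' j : ℕ, 4 * ofReal (4⁻¹ ^ j) *
        ∫⁻ y in Metric.closedBall x (2 ^ k * 2 ^ j), u y := by
        rw [lintegral_tsum]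
        · congr 2; ext j
          rw [lintegral_const_mul _ (hu.indicator Metric.isClosed_closedBall.measurableSet),
            lintegral_indicator Metric.isClosed_closedBall.measurableSet]
        · intro j
          exact ((hu.indicator Metric.isClosed_closedBall.measurableSet).const_mul _).aemeasurable
    _ ≤ ofReal (2 ^ (-k)) * ∑' j : ℕ, 4 * ofReal (4⁻¹ ^ j) *
        ofReal (l / 8 * (2 ^ k * 2 ^ j)) := by
        gcongr with j
        exact h _ (le_mul_of_one_le_right h0.le (one_le_pow₀ one_le_two))
    _ = ∑' j : ℕ, ofReal (l / 2 * 2⁻¹ ^ j) := by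
        rw [← ENNReal.tsum_mul_left]
        congr 1; ext j
        rw [show (4 : ℝ≥0∞) = ofReal 4 by simp, ← ENNReal.ofReal_mul (by norm_num),
          ← ENNReal.ofReal_mul (by positivity), ← ENNReal.ofReal_mul (by positivity)]
        congr 1
        rw [zpow_neg, show (4 : ℝ)⁻¹ ^ j = 2⁻¹ ^ j * 2⁻¹ ^ j by rw [← mul_pow]; norm_num]
        have : (2 : ℝ)⁻¹ ^ j * 2 ^ j = 1 := by rw [← mul_pow]; norm_num
        have h1 : ((2 : ℝ) ^ k)⁻¹ * 2 ^ k = 1 := inv_mul_cancel₀ h0.ne'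
        linear_combination (l / 2 * 2⁻¹ ^ j * 2⁻¹ ^ j * 2 ^ j) * h1 + (l / 2 * 2⁻¹ ^ j) * this
    _ = ofReal (∑' j : ℕ, l / 2 * 2⁻¹ ^ j) := by
        rw [ENNReal.ofReal_tsum_of_nonneg (fun j => by positivity)]
        exact (summable_geometric_of_lt_one (by norm_num) (by norm_num)).mul_left _
    _ = _ := by
        rw [tsum_mul_left, tsum_geometric_of_lt_one (by norm_num) (by norm_num)]
        norm_num

lemma weak_type_MW {u : ℝ → ℝ≥0∞} (hu : Measurable u) {l : ℝ} (hl : 0 < l) :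
    volume {x | ofReal l < MW u x} ≤ ofReal (80 / l) * ∫⁻ y, u y := by
  let S : Set (ℝ × ℝ) := {a | 0 < a.2 ∧
      ofReal (l / 8 * a.2) ≤ ∫⁻ y in Metric.closedBall a.1 a.2, u y}
  have h := measure_iUnion_closedBall_le (u := u) (l := l / 8) (by positivity) S fun a ha => ha
  refine le_trans (measure_mono ?_) (h.trans (le_of_eq ?_))
  · intro x hx
    obtain ⟨k, hk⟩ := lt_iSup_iff.1 (show ofReal l < ⨆ k, Av k u x from hx)
    have : ∃ r, 2 ^ k ≤ r ∧
        ofReal (l / 8 * r) < ∫⁻ y in Metric.closedBall x r, u y := by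
      by_contra! hcon
      exact absurd (Av_le_of_closedBall hu hl k hcon) (not_le.2 hk)
    obtain ⟨r, hr0, hr⟩ := this
    have hr1 := (two_zpow_pos k).trans_le hr0
    simp only [mem_iUnion]
    exact ⟨(x, r), ⟨hr1, hr.le⟩, Metric.mem_closedBall_self hr1.le⟩
  · congr 2; field_simp; norm_num

lemma MW_le_of_le {u : ℝ → ℝ≥0∞} {c : ℝ≥0∞} (h : ∀ y, u y ≤ c) (x : ℝ) :
    MW u x ≤ c * ofReal π :=
  iSup_le fun k => (Av_mono k h x).trans (Av_const k c x).le

/-- The `L²` bound for the maximal function. -/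
lemma lintegral_MW_sq_le {u : ℝ → ℝ} (hu : Measurable u) {B : ℝ}
    (hB : ∀ y, u y ≤ B) :
    ∫⁻ x, MW (fun y => ofReal (u y)) x ^ 2 ≤
      ofReal 2560 * ∫⁻ y, ofReal (u y) ^ 2 := by
  set v : ℝ → ℝ≥0∞ := fun y => ofReal (u y)
  have hv : Measurable v := hu.ennreal_ofReal
  have htop : ∀ x, MW v x ≠ ∞ := fun x => ne_top_of_le_ne_top
    (ENNReal.mul_ne_top ENNReal.ofReal_ne_top ENNReal.ofReal_ne_top)
    (MW_le_of_le (c := ofReal B) (fun y => ENNReal.ofReal_le_ofReal (hB y)) x)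
  have hpi := Real.pi_pos
  have key : ∀ t : ℝ, 0 < t → volume {x | t < (MW v x).toReal} ≤
      ofReal (160 / t) * ∫⁻ y, {y | t < 8 * u y}.indicator v y := by
    intro t ht
    have hm : MeasurableSet {y | t < 8 * u y} := measurableSet_lt measurable_const (by fun_prop)
    have h := weak_type_MW (hv.indicator hm) (l := t / 2) (by positivity)
    refine le_trans (measure_mono ?_) (h.trans (le_of_eq ?_))
    · intro x hx
      have hx' : ofReal t < MW v x := by
        rw [← ENNReal.ofReal_toReal (htop x)]
        exact (ENNReal.ofReal_lt_ofReal_iff (ht.trans hx)).2 hx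
      by_contra hcon
      have hcon : MW ({y | t < 8 * u y}.indicator v) x ≤ ofReal (t / 2) := not_lt.1 hcon
      refine absurd hx' (not_lt.2 (iSup_le fun k => ?_))
      calc Av k v x ≤ Av k (fun y => {y | t < 8 * u y}.indicator v y + ofReal (t / 8)) x := by
            apply Av_mono
            intro y
            by_cases hy : t < 8 * u y
            · rw [indicator_of_mem (by exact hy)]; exact le_self_add
            · rw [indicator_of_notMem (by exact hy), zero_add]
              exact ENNReal.ofReal_le_ofReal (by linarith)
        _ = Av k ({y | t < 8 * u y}.indicator v) x + ofReal (t / 8) *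
              ofReal π := by
            rw [Av_add k (hv.indicator hm), Av_const]
        _ ≤ ofReal (t / 2) + ofReal (t / 2) := by
            gcongr
            · exact (le_MW _ _ _).trans hcon
            · rw [← ENNReal.ofReal_mul (by positivity)]
              apply ENNReal.ofReal_le_ofReal
              have := Real.pi_le_four
              nlinarith
        _ = ofReal t := by
            rw [← ENNReal.ofReal_add (by positivity) (by positivity)]; congr 1; ring
    · congr 2; field_simp; norm_num
  have hlc := lintegral_rpow_eq_lintegral_meas_lt_mul volume (f := fun x => (MW v x).toReal)
    (Eventually.of_forall fun x => ENNReal.toReal_nonneg)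
    (measurable_MW hv).ennreal_toReal.aemeasurable (p := 2) (by norm_num)
  calc _ = ∫⁻ x, ofReal ((MW v x).toReal ^ (2 : ℝ)) := by
        congr 1; ext x
        rw [Real.rpow_two, ENNReal.ofReal_pow ENNReal.toReal_nonneg, ENNReal.ofReal_toReal (htop x)]
    _ = _ := hlc
    _ ≤ ofReal 2 * ∫⁻ t in Ioi (0 : ℝ), ofReal 160 *
          ∫⁻ y, {y | t < 8 * u y}.indicator v y := by
        refine mul_le_mul_right (setLIntegral_mono' measurableSet_Ioi fun t ht => ?_) _
        have ht : 0 < t := ht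
        calc _ ≤ (ofReal (160 / t) * ∫⁻ y, {y | t < 8 * u y}.indicator v y) *
              ofReal (t ^ ((2 : ℝ) - 1)) := by gcongr; exact key t ht
          _ = _ := by
              rw [mul_right_comm, ← ENNReal.ofReal_mul (by positivity)]
              norm_num
              rw [div_mul_cancel₀ _ ht.ne']; norm_num
    _ = ofReal 320 * ∫⁻ t in Ioi (0 : ℝ), ∫⁻ y, {y | t < 8 * u y}.indicator v y := by
        rw [lintegral_const_mul' _ _ ENNReal.ofReal_ne_top, ← mul_assoc,
          ← ENNReal.ofReal_mul (by norm_num)]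
        norm_num
    _ = ofReal 320 * ∫⁻ y, ∫⁻ t in Ioi (0 : ℝ), {y | t < 8 * u y}.indicator v y := by
        congr 1
        apply lintegral_lintegral_swap
        apply Measurable.aemeasurable
        have : (Function.uncurry fun t y => {y | t < 8 * u y}.indicator v y) =
            {z : ℝ × ℝ | z.1 < 8 * u z.2}.indicator (fun z => v z.2) := by
          ext ⟨t, y⟩
          simp [Set.indicator, Function.uncurry]
        rw [this]
        exact (hv.comp measurable_snd).indicator (measurableSet_lt measurable_fst (by fun_prop))
    _ = ofReal 320 * ∫⁻ y, ofReal 8 * v y ^ 2 := by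
        congr 1
        refine lintegral_congr fun y => ?_
        have : ∀ t, {y | t < 8 * u y}.indicator v y = (Iio (8 * u y)).indicator (fun _ => v y) t := by
          intro t; simp [Set.indicator]
        simp only [this]
        rw [lintegral_indicator measurableSet_Iio, setLIntegral_const,
          Measure.restrict_apply measurableSet_Iio, inter_comm, Ioi_inter_Iio, Real.volume_Ioo, sub_zero,
          ENNReal.ofReal_mul (by norm_num)]
        ring
    _ = _ := by
        rw [lintegral_const_mul' _ _ ENNReal.ofReal_ne_top, ← mul_assoc,
          ← ENNReal.ofReal_mul (by norm_num)]
        norm_num [v]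

/-- The collection `P` has mass at most `μ`. -/
def HasMass (N : ℝ → ℝ) (E : Set ℝ) (P : Finset Tile) (μ : ℝ) : Prop :=
  ∀ p ∈ P, ∀ p', tle p p' → ∫ x in E ∩ N ⁻¹' (Om p'), wt p' x ^ 2 ≤ μ * sc p'

/-- The dilate of the time interval of a tile by a factor comparable to `2 ^ j`. -/
def tD (j : ℕ) (p : Tile) : Set ℝ := {x | |(2 : ℝ) ^ (-p.1) * x - p.2.1| ≤ 2 ^ j}

lemma mem_tD {j : ℕ} {p : Tile} {x : ℝ} :
    x ∈ tD j p ↔ |x - p.2.1 * 2 ^ p.1| ≤ 2 ^ j * 2 ^ p.1 := by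
  have h := two_zpow_pos p.1
  have h1 : (2 : ℝ) ^ (-p.1) * x - p.2.1 = 2 ^ (-p.1) * (x - p.2.1 * 2 ^ p.1) := by
    rw [mul_sub, mul_left_comm, two_zpow_neg_mul, mul_one]
  rw [tD, Set.mem_ofPred_eq, h1, abs_mul, abs_of_pos (two_zpow_pos _), zpow_neg, inv_mul_le_iff₀ h,
    mul_comm (2 ^ p.1) (2 ^ j)]

lemma measurableSet_tD (j : ℕ) (p : Tile) : MeasurableSet (tD j p) :=
  measurableSet_le (by fun_prop) measurable_const

lemma mem_tI_abs {p : Tile} {x : ℝ} (h : x ∈ tI p) :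
    |x - p.2.1 * 2 ^ p.1| ≤ 2 ^ p.1 := by
  have h1 := mem_dy.1 h
  have := two_zpow_pos p.1
  rw [abs_le]
  constructor <;> nlinarith [h1.1, h1.2]

lemma tD_finite (j : ℕ) (p : Tile) : volume (tD j p) ≠ ∞ := by
  have : tD j p ⊆ Metric.closedBall (p.2.1 * 2 ^ p.1) (2 ^ j * 2 ^ p.1) := fun x hx => by
    rw [Metric.mem_closedBall, Real.dist_eq]; exact mem_tD.1 hx
  exact ne_top_of_le_ne_top (by rw [Real.volume_closedBall]; exact ENNReal.ofReal_ne_top) (measure_mono this)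

lemma exists_large_tD {p : Tile} {A : Set ℝ} {μ : ℝ} (hμ : 0 < μ)
    (h : μ * sc p < ∫ x in A, wt p x ^ 2) :
    ∃ j : ℕ, μ * 4 ^ j * sc p ≤ 32 * volume.real (A ∩ tD j p) := by
  by_contra! hcon
  refine absurd h (not_lt.2 ?_)
  have hsc := sc_pos p
  rw [← ENNReal.ofReal_le_ofReal_iff (by positivity), ofReal_integral_eq_lintegral_ofReal
    (integrable_wt_pow p two_ne_zero).integrableOn (Eventually.of_forall fun _ => sq_nonneg _)]
  calc _ ≤ ∫⁻ x in A, ∑' j : ℕ, ofReal (16 * 16⁻¹ ^ j) * (tD j p).indicator 1 x := by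
        refine lintegral_mono fun x => ?_
        obtain ⟨j, h1, h2⟩ := exists_W_le ((2 : ℝ) ^ (-p.1) * x - p.2.1)
        refine le_trans ?_ (ENNReal.le_tsum j)
        rw [indicator_of_mem (by exact h1), Pi.one_apply, mul_one]
        apply ENNReal.ofReal_le_ofReal
        have h3 : wt p x ^ 2 ≤ (4 * 4⁻¹ ^ j) ^ 2 := pow_le_pow_left₀ (wt_nonneg _ _) h2 2
        refine h3.trans (le_of_eq ?_)
        rw [mul_pow, ← pow_mul, mul_comm j 2, pow_mul]
        norm_num
    _ = ∑' j : ℕ, ofReal (16 * 16⁻¹ ^ j) * volume (A ∩ tD j p) := by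
        rw [lintegral_tsum fun j => ((measurable_one.indicator
          (measurableSet_tD j p)).const_mul _).aemeasurable]
        congr 1; ext j
        rw [lintegral_const_mul _ (measurable_one.indicator (measurableSet_tD j p)),
          lintegral_indicator_one (measurableSet_tD j p), Measure.restrict_apply
          (measurableSet_tD j p), inter_comm]
    _ ≤ ∑' j : ℕ, ofReal (μ * sc p / 2 * 4⁻¹ ^ j) := by
        refine ENNReal.tsum_le_tsum fun j => ?_
        rw [← ENNReal.ofReal_toReal (ne_top_of_le_ne_top (tD_finite j p)
          (measure_mono inter_subset_right)), ← ENNReal.ofReal_mul (by positivity)]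
        apply ENNReal.ofReal_le_ofReal
        have h1 := (hcon j).le
        calc _ ≤ 16 * 16⁻¹ ^ j * (μ * 4 ^ j * sc p / 32) := by
              gcongr
              have : (volume (A ∩ tD j p)).toReal = volume.real (A ∩ tD j p) := rfl
              linarith
          _ = μ * sc p / 2 * (16⁻¹ * 4) ^ j := by rw [mul_pow]; ring
          _ = _ := by norm_num
    _ = ofReal (∑' j : ℕ, μ * sc p / 2 * 4⁻¹ ^ j) := by
        rw [ENNReal.ofReal_tsum_of_nonneg (fun j => by positivity)]
        exact (summable_geometric_of_lt_one (by norm_num) (by norm_num)).mul_left _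
    _ ≤ _ := by
        apply ENNReal.ofReal_le_ofReal
        rw [tsum_mul_left, tsum_geometric_of_lt_one (by norm_num) (by norm_num)]
        have : 0 ≤ μ * sc p := by positivity
        norm_num
        linarith

lemma antichain_sum_le {N : ℝ → ℝ} (hN : Measurable N) {E : Set ℝ} (hE : MeasurableSet E)
    (hE' : volume E ≠ ∞) {R : Finset Tile} (hR : ∀ p ∈ R, ∀ q ∈ R, tle p q → p = q) {j : ℕ}
    {μ : ℝ} (hμ : 0 < μ)
    (h : ∀ p ∈ R, μ * 4 ^ j * sc p ≤ 32 * volume.real (E ∩ N ⁻¹' (Om p) ∩ tD j p)) :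
    μ * ∑ p ∈ R, sc p ≤ 256 * 2⁻¹ ^ j * volume.real E := by
  classical
  obtain ⟨u, huR, hu, hcov⟩ := Vitali.exists_disjoint_subfamily_covering_enlargement
    (fun p => tD j p ×ˢ Om p) (↑R : Set Tile) sc (3 / 2) (by norm_num) (fun p _ => (sc_pos p).le)
    (∑ p ∈ R, sc p) (fun p hp => Finset.single_le_sum (fun p _ => (sc_pos p).le) hp)
    (fun p _ => by
      obtain ⟨z, hz⟩ : (Om p).Nonempty := dy_nonempty _ _
      exact ⟨(p.2.1 * 2 ^ p.1, z), mem_tD.2 (by rw [sub_self, abs_zero]; positivity), hz⟩)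
  choose! b hb hb' hb'' using hcov
  have hk : ∀ p ∈ R, p.1 ≤ (b p).1 := by
    intro p hp
    by_contra! hcon
    have h1 := hb'' p hp
    have h2 := two_zpow_mono (show (b p).1 + 1 ≤ p.1 by omega)
    rw [two_zpow_succ] at h2
    have h3 := sc_pos (b p)
    unfold sc at h1 h3
    linarith
  have hfin : u.Finite := R.finite_toSet.subset huR
  set U := hfin.toFinset
  have hU : ∀ p, p ∈ U ↔ p ∈ u := fun p => by simp [U]
  have hfib : ∀ q ∈ U, ∑ p ∈ R.filter (fun p => b p = q), sc p ≤ 8 * 2 ^ j * sc q := by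
    intro q hq
    have hpd : Set.PairwiseDisjoint (↑(R.filter fun p => b p = q) : Set Tile) tI := by
      have key : ∀ p ∈ R.filter (fun p => b p = q), ∀ r ∈ R.filter (fun p => b p = q),
          p ≠ r → p.1 ≤ r.1 → Disjoint (tI p) (tI r) := by
        intro p hp r hr hpr hk'
        rw [Finset.mem_filter] at hp hr
        rw [Set.disjoint_left]
        intro x hx hx'
        apply hpr
        obtain ⟨z1, hz1, hz1'⟩ := hb' p hp.1
        obtain ⟨z2, hz2, hz2'⟩ := hb' r hr.1
        have h1 := hk p hp.1
        have h2 := hk r hr.1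
        rw [hp.2] at hz1' h1
        rw [hr.2] at hz2' h2
        obtain ⟨z, hz⟩ : (Om q).Nonempty := dy_nonempty _ _
        exact hR p hp.1 r hr.1 (tle_of_mem hk' hx hx' (Om_subset_Om h1 hz1'.2 hz1.2 hz)
          (Om_subset_Om h2 hz2'.2 hz2.2 hz))
      intro p hp r hr hpr
      rcases le_total p.1 r.1 with h' | h'
      · exact key p hp r hr hpr h'
      · exact (key r hr p hp hpr.symm h').symm
    have hsub : (⋃ p ∈ R.filter (fun p => b p = q), tI p) ⊆
        Metric.closedBall (q.2.1 * 2 ^ q.1) (4 * 2 ^ j * sc q) := by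
      intro x hx
      simp only [mem_iUnion] at hx
      obtain ⟨p, hp, hx⟩ := hx
      rw [Finset.mem_filter] at hp
      obtain ⟨z, hz, hz'⟩ := hb' p hp.1
      have h1 := hk p hp.1
      rw [hp.2] at hz' h1
      have h2 := mem_tI_abs hx
      have h3 := mem_tD.1 hz.1
      have h4 := mem_tD.1 hz'.1
      have h5 := two_zpow_mono h1
      have h6 : (1 : ℝ) ≤ 2 ^ j := one_le_pow₀ one_le_two
      rw [Metric.mem_closedBall, Real.dist_eq]
      have h7 : (2 : ℝ) ^ j * 2 ^ p.1 ≤ 2 ^ j * 2 ^ q.1 := by gcongr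
      have h8 : (2 : ℝ) ^ q.1 ≤ 2 ^ j * 2 ^ q.1 := le_mul_of_one_le_left (two_zpow_pos _).le h6
      have h9 : 0 ≤ (2 : ℝ) ^ j * 2 ^ q.1 := by positivity
      unfold sc
      rw [abs_le] at *
      constructor <;> linarith [h2.1, h2.2, h3.1, h3.2, h4.1, h4.2]
    have h1 := measure_mono (μ := volume) hsub
    rw [measure_biUnion_finset hpd (fun p _ => measurableSet_tI p), Real.volume_closedBall] at h1
    have h2 : ∀ p : Tile, volume (tI p) = ofReal (sc p) := fun p => volume_dy _ _
    simp only [h2] at h1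
    rw [← ENNReal.ofReal_sum_of_nonneg (fun p _ => (sc_pos p).le),
      ENNReal.ofReal_le_ofReal_iff (by have := sc_pos q; positivity)] at h1
    linarith
  have hdis : ∑ q ∈ U, volume.real (E ∩ N ⁻¹' (Om q) ∩ tD j q) ≤ volume.real E := by
    rw [← measureReal_biUnion_finset]
    · exact measureReal_mono (by
        intro x hx
        simp only [mem_iUnion] at hx
        obtain ⟨p, _, hx⟩ := hx
        exact hx.1.1) hE'
    · intro p hp q hq hpq
      have := hu ((hU p).1 hp) ((hU q).1 hq) hpq
      rw [Function.onFun, Set.disjoint_left]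
      intro x hx hx'
      exact Set.disjoint_left.1 this (show (x, N x) ∈ tD j p ×ˢ Om p from ⟨hx.2, hx.1.2⟩)
        ⟨hx'.2, hx'.1.2⟩
    · exact fun p _ => (hE.inter (hN (measurableSet_Om p))).inter (measurableSet_tD j p)
  have h2j : (4 : ℝ)⁻¹ ^ j * 4 ^ j = 1 := by rw [← mul_pow]; norm_num
  calc _ = μ * ∑ q ∈ U, ∑ p ∈ R.filter (fun p => b p = q), sc p := by
        rw [Finset.sum_fiberwise_of_maps_to]
        exact fun p hp => (hU _).2 (hb p hp)
    _ ≤ μ * ∑ q ∈ U, 8 * 2 ^ j * sc q := by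
        gcongr with q hq; exact hfib q hq
    _ = 8 * 2 ^ j * 4⁻¹ ^ j * ∑ q ∈ U, μ * 4 ^ j * sc q := by
        rw [Finset.mul_sum, Finset.mul_sum]
        refine Finset.sum_congr rfl fun q _ => ?_
        linear_combination (-(8 * 2 ^ j * μ * sc q)) * h2j
    _ ≤ 8 * 2 ^ j * 4⁻¹ ^ j * ∑ q ∈ U, 32 * volume.real (E ∩ N ⁻¹' (Om q) ∩ tD j q) := by
        refine mul_le_mul_of_nonneg_left (Finset.sum_le_sum fun q hq => ?_) (by positivity)
        exact h q (huR ((hU q).1 hq))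
    _ = 256 * (2 * 4⁻¹) ^ j * ∑ q ∈ U, volume.real (E ∩ N ⁻¹' (Om q) ∩ tD j q) := by
        rw [← Finset.mul_sum, mul_pow]; ring
    _ ≤ 256 * (2 * 4⁻¹) ^ j * volume.real E := by gcongr
    _ = _ := by norm_num

/-- The mass lemma: the mass can be made at most `μ` by removing trees whose tops have
controlled total length. -/
theorem mass_lemma {N : ℝ → ℝ} (hN : Measurable N) {E : Set ℝ} (hE : MeasurableSet E)
    (hE' : volume E ≠ ∞) (P : Finset Tile) {μ : ℝ} (hμ : 0 < μ) :
    ∃ (P' : Finset Tile) (Θ : Finset Top) (top : Tile → Top), P' ⊆ P ∧ HasMass N E P' μ ∧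
      (∀ p ∈ P \ P', top p ∈ Θ ∧ tI p ⊆ topI (top p) ∧ (top p).2.2 ∈ Om p) ∧
      μ * ∑ θ ∈ Θ, (2 : ℝ) ^ θ.1 ≤ 512 * volume.real E := by
  classical
  let heavy : Tile → Tile → Prop := fun p p' =>
    tle p p' ∧ μ * sc p' < ∫ x in E ∩ N ⁻¹' (Om p'), wt p' x ^ 2
  have hA : ∀ p : Tile, MeasurableSet (E ∩ N ⁻¹' (Om p)) := fun p =>
    hE.inter (hN (measurableSet_Om p))
  have hAf : ∀ p : Tile, volume (E ∩ N ⁻¹' (Om p)) ≠ ∞ := fun p =>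
    ne_top_of_le_ne_top hE' (measure_mono inter_subset_left)
  obtain ⟨K, hK⟩ : ∃ K : ℤ, ∀ p p', heavy p p' → p'.1 ≤ K := by
    obtain ⟨n, hn⟩ := pow_unbounded_of_one_lt (volume.real E / μ) (one_lt_two (α := ℝ))
    refine ⟨n, fun p p' h => ?_⟩
    by_contra! hcon
    have h1 : ∫ x in E ∩ N ⁻¹' (Om p'), wt p' x ^ 2 ≤ volume.real E := by
      calc _ ≤ ∫ x in E ∩ N ⁻¹' (Om p'), (1 : ℝ) := by
            apply setIntegral_mono_on (integrable_wt_pow p' two_ne_zero).integrableOn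
              (integrableOn_const (hAf p') (by simp)) (hA p')
            exact fun x _ => pow_le_one₀ (wt_nonneg _ _) (wt_le_one _ _)
        _ = volume.real (E ∩ N ⁻¹' (Om p')) := by simp
        _ ≤ _ := measureReal_mono inter_subset_left hE'
    have h2 := h.2
    have h3 := two_zpow_mono hcon.le
    rw [zpow_natCast] at h3
    rw [div_lt_iff₀ hμ] at hn
    unfold sc at h2
    nlinarith
  have hmax : ∀ p, (∃ p', heavy p p') → ∃ p', heavy p p' ∧ ∀ q, heavy p q → q.1 ≤ p'.1 := by
    intro p hp
    obtain ⟨k, ⟨⟨p', hp', rfl⟩, hk⟩⟩ := Int.exists_greatest_of_bdd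
      (P := fun k => ∃ p', heavy p p' ∧ p'.1 = k) ⟨K, by rintro z ⟨p', h, rfl⟩; exact hK p p' h⟩
      (by obtain ⟨p', hp'⟩ := hp; exact ⟨_, p', hp', rfl⟩)
    exact ⟨p', hp', fun q hq => hk _ ⟨q, hq, rfl⟩⟩
  choose! r hr hr' using hmax
  set H := P.filter fun p => ∃ p', heavy p p'
  set R := H.image r
  have hRm : ∀ q ∈ R, ∃ p, (∃ p', heavy p p') ∧ r p = q := by
    intro q hq
    obtain ⟨p, hp, rfl⟩ := Finset.mem_image.1 hq
    exact ⟨p, (Finset.mem_filter.1 hp).2, rfl⟩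
  have hRanti : ∀ p ∈ R, ∀ q ∈ R, tle p q → p = q := by
    intro p hp q hq hpq
    obtain ⟨p0, hp0, rfl⟩ := hRm p hp
    obtain ⟨q0, hq0, rfl⟩ := hRm q hq
    have h1 : heavy p0 (r q0) := ⟨tle_trans (hr p0 hp0).1 hpq, (hr q0 hq0).2⟩
    have h2 := hr' p0 hp0 _ h1
    have h3 : (r p0).1 = (r q0).1 := le_antisymm hpq.le h2
    obtain ⟨x, hx⟩ := dy_nonempty (r p0).1 (r p0).2.1
    obtain ⟨y, hy⟩ := dy_nonempty (-(r q0).1) (r q0).2.2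
    exact tle_antisymm hpq (tle_of_mem h2 (hpq.1 hx) hx hy (hpq.2 hy))
  have hRj : ∀ q ∈ R, ∃ j : ℕ,
      μ * 4 ^ j * sc q ≤ 32 * volume.real (E ∩ N ⁻¹' (Om q) ∩ tD j q) := by
    intro q hq
    obtain ⟨p0, hp0, rfl⟩ := hRm q hq
    exact exists_large_tD hμ (hr p0 hp0).2
  choose! j hj using hRj
  have hsum : μ * ∑ q ∈ R, sc q ≤ 512 * volume.real E := by
    calc _ = ∑ i ∈ R.image j, μ * ∑ q ∈ R.filter (fun q => j q = i), sc q := by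
          rw [← Finset.mul_sum, Finset.sum_fiberwise_of_maps_to]
          exact fun q hq => Finset.mem_image_of_mem _ hq
      _ ≤ ∑ i ∈ R.image j, 256 * 2⁻¹ ^ i * volume.real E := by
          refine Finset.sum_le_sum fun i _ => antichain_sum_le hN hE hE' ?_ hμ ?_
          · intro p hp q hq
            exact hRanti p (Finset.mem_filter.1 hp).1 q (Finset.mem_filter.1 hq).1
          · intro p hp
            obtain ⟨h1, h2⟩ := Finset.mem_filter.1 hp
            rw [← h2]; exact hj p h1
      _ = 256 * (∑ i ∈ R.image j, 2⁻¹ ^ i) * volume.real E := by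
          rw [Finset.mul_sum, Finset.sum_mul]
      _ ≤ 256 * 2 * volume.real E := by
          gcongr
          have h1 := (summable_geometric_of_lt_one (r := (2 : ℝ)⁻¹) (by norm_num)
            (by norm_num)).sum_le_tsum (R.image j) (fun i _ => by positivity)
          rw [tsum_geometric_of_lt_one (by norm_num) (by norm_num)] at h1
          norm_num at h1 ⊢
          exact h1
      _ = _ := by norm_num
  let tp : Tile → Top := fun q => (q.1, q.2.1, q.2.2 * 2 ^ (-q.1))
  refine ⟨P \ H, R.image tp, fun p => tp (r p), Finset.sdiff_subset, ?_, ?_, ?_⟩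
  · intro p hp p' hpp
    by_contra! hcon
    rw [Finset.mem_sdiff] at hp
    exact hp.2 (Finset.mem_filter.2 ⟨hp.1, p', hpp, hcon⟩)
  · intro p hp
    have hpH : p ∈ H := by
      by_contra hcon
      rw [Finset.mem_sdiff, Finset.mem_sdiff] at hp
      exact hp.2 ⟨hp.1, hcon⟩
    have h1 := (hr p (Finset.mem_filter.1 hpH).2).1
    exact ⟨Finset.mem_image_of_mem _ (Finset.mem_image_of_mem _ hpH), h1.1,
      h1.2 (dy_left_mem _ _)⟩
  · refine le_trans ?_ hsum
    gcongr
    refine (Finset.sum_image_le_of_nonneg (g := tp) (s := R) (f := fun θ : Top => (2 : ℝ) ^ θ.1)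
      fun θ _ => ?_).trans (le_of_eq rfl)
    positivity

/-- The dyadic interval with index `J`. -/
def dI (J : ℤ × ℤ) : Set ℝ := dy J.1 J.2

/-- The dyadic parent. -/
def par (J : ℤ × ℤ) : ℤ × ℤ := (J.1 + 1, J.2 / 2)

/-- The concentric triple of a dyadic interval. -/
def tri (J : ℤ × ℤ) : Set ℝ := Ico ((J.2 - 1) * (2 : ℝ) ^ J.1) ((J.2 + 2) * (2 : ℝ) ^ J.1)

/-- The maximal dyadic intervals satisfying the predicate `good`. -/
def stp (good : ℤ × ℤ → Prop) : Set (ℤ × ℤ) := {J | good J ∧ ¬ good (par J)}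

lemma dI_subset_par (J : ℤ × ℤ) : dI J ⊆ dI (par J) := by
  rcases Int.even_or_odd' J.2 with ⟨m, h | h⟩
  · have := dy_lower_subset (J.1 + 1) m
    rw [add_sub_cancel_right, ← h] at this
    have h2 : J.2 / 2 = m := by omega
    simpa only [dI, par, h2] using this
  · have := dy_upper_subset (J.1 + 1) m
    rw [add_sub_cancel_right, ← h] at this
    have h2 : J.2 / 2 = m := by omega
    simpa only [dI, par, h2] using this

lemma measurableSet_dI (J : ℤ × ℤ) : MeasurableSet (dI J) := measurableSet_dy _ _

lemma dI_subset_tri (J : ℤ × ℤ) : dI J ⊆ tri J := by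
  have := two_zpow_pos J.1
  apply Ico_subset_Ico <;> nlinarith

lemma dI_endpoints {J J' : ℤ × ℤ} (h : dI J ⊆ dI J') :
    (J'.2 : ℝ) * 2 ^ J'.1 ≤ J.2 * 2 ^ J.1 ∧ (J.2 + 1 : ℝ) * 2 ^ J.1 ≤ (J'.2 + 1) * 2 ^ J'.1 := by
  refine (Ico_subset_Ico_iff ?_).1 h
  have := two_zpow_pos J.1
  linarith

lemma tri_mono {J J' : ℤ × ℤ} (h : dI J ⊆ dI J') : tri J ⊆ tri J' := by
  obtain ⟨h1, h2⟩ := dI_endpoints h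
  have h3 := two_zpow_mono (le_of_dy_subset h)
  apply Ico_subset_Ico <;> linarith

lemma stp_pairwiseDisjoint {good : ℤ × ℤ → Prop}
    (hd : ∀ J J', dI J ⊆ dI J' → good J' → good J) : (stp good).PairwiseDisjoint dI := by
  have key : ∀ J ∈ stp good, ∀ J' ∈ stp good, J ≠ J' → J.1 ≤ J'.1 → Disjoint (dI J) (dI J') := by
    intro J hJ J' hJ' hne hk
    rw [Set.disjoint_left]
    intro x hx hx'
    rcases hk.lt_or_eq with hk | hk
    · exact hJ.2 (hd _ _ (dy_subset (x := x) (show J.1 + 1 ≤ J'.1 by omega)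
        (dI_subset_par J hx) hx') hJ'.1)
    · unfold dI at hx hx'
      rw [hk] at hx
      exact hne (Prod.ext hk (dy_inj hx hx'))
  intro J hJ J' hJ' hne
  rcases le_total J.1 J'.1 with h | h
  · exact key J hJ J' hJ' hne h
  · exact (key J' hJ' J hJ hne.symm h).symm

lemma exists_mem_stp {good : ℤ × ℤ → Prop}
    (hd : ∀ J J', dI J ⊆ dI J' → good J' → good J) {x : ℝ} (h : ∃ J, good J ∧ x ∈ dI J)
    (h' : ∃ J, ¬ good J ∧ x ∈ dI J) : ∃ J ∈ stp good, x ∈ dI J := by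
  obtain ⟨J, hJ, hxJ⟩ := h
  obtain ⟨J', hJ', hxJ'⟩ := h'
  obtain ⟨k, hk, hk'⟩ := Int.exists_greatest_of_bdd
    (P := fun k => good (k, ⌊x * 2 ^ (-k)⌋)) ⟨J'.1, fun k hk => by
      by_contra! hcon
      exact hJ' (hd _ _ (dy_subset hcon.le hxJ' (mem_dy_floor k x)) hk)⟩
    ⟨J.1, by
      have : J = (J.1, ⌊x * 2 ^ (-J.1)⌋) := Prod.ext rfl (dy_inj hxJ (mem_dy_floor _ x))
      rwa [← this]⟩
  refine ⟨(k, ⌊x * 2 ^ (-k)⌋), ⟨hk, fun hcon => ?_⟩, mem_dy_floor k x⟩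
  have h1 := dI_subset_par (k, ⌊x * 2 ^ (-k)⌋) (mem_dy_floor k x)
  have h2 : par (k, ⌊x * 2 ^ (-k)⌋) = (k + 1, ⌊x * 2 ^ (-(k + 1))⌋) :=
    Prod.ext rfl (dy_inj h1 (mem_dy_floor _ x))
  rw [h2] at hcon
  have := hk' _ hcon
  omega

lemma lintegral_eq_tsum_stp {good : ℤ × ℤ → Prop}
    (hd : ∀ J J', dI J ⊆ dI J' → good J' → good J) (f : ℝ → ℝ≥0∞) :
    ∑' J : stp good, ∫⁻ x in dI J, f x = ∫⁻ x in ⋃ J ∈ stp good, dI J, f x := by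
  rw [lintegral_biUnion (Set.to_countable _) (fun J _ => measurableSet_dI J)
    (stp_pairwiseDisjoint hd)]

/-- A dyadic interval is small relative to `T` if its triple contains no interval of `T`. -/
def IsSmall (T : Finset Tile) (J : ℤ × ℤ) : Prop := ∀ p ∈ T, ¬ tI p ⊆ tri J

lemma IsSmall.mono {T : Finset Tile} (J J' : ℤ × ℤ) (h : dI J ⊆ dI J') (h' : IsSmall T J') :
    IsSmall T J := fun p hp hcon => h' p hp (hcon.trans (tri_mono h))

lemma exists_isSmall (T : Finset Tile) (x : ℝ) : ∃ J, IsSmall T J ∧ x ∈ dI J := by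
  obtain ⟨k, hk⟩ : ∃ k : ℤ, ∀ p ∈ T, k + 2 ≤ p.1 := by
    obtain ⟨k, hk⟩ := (T.image fun p => -p.1).exists_le
    exact ⟨-k - 2, fun p hp => by have := hk _ (Finset.mem_image_of_mem _ hp); omega⟩
  refine ⟨(k, ⌊x * 2 ^ (-k)⌋), fun p hp hcon => ?_, mem_dy_floor k x⟩
  have h1 := measure_mono (μ := volume) hcon
  rw [tI, volume_dy, tri, Real.volume_Ico, ENNReal.ofReal_le_ofReal_iff (by
    have := two_zpow_pos k; simp only; nlinarith)] at h1
  have h2 := two_zpow_mono (hk p hp)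
  rw [two_zpow_add] at h2
  have h3 := two_zpow_pos k
  simp only at h1
  norm_num at h2
  linarith

lemma exists_not_isSmall {T : Finset Tile} (hT : T.Nonempty) (x : ℝ) :
    ∃ J, ¬ IsSmall T J ∧ x ∈ dI J := by
  obtain ⟨p, hp⟩ := hT
  obtain ⟨k, hk⟩ : ∃ k : ℕ, |x| + |(p.2.1 : ℝ) * 2 ^ p.1| + (2 : ℝ) ^ p.1 < 2 ^ k :=
    pow_unbounded_of_one_lt _ one_lt_two
  refine ⟨((k : ℤ), ⌊x * 2 ^ (-(k : ℤ))⌋), fun h => h p hp ?_, mem_dy_floor _ x⟩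
  intro y hy
  obtain ⟨h1, h2⟩ := mem_dy.1 (mem_dy_floor (k : ℤ) x)
  obtain ⟨h3, h4⟩ := mem_dy.1 hy
  have h5 := abs_le.1 (le_refl |x|)
  have h6 := abs_le.1 (le_refl |(p.2.1 : ℝ) * 2 ^ p.1|)
  have h7 := two_zpow_pos p.1
  rw [zpow_natCast] at h1 h2
  simp only [tri, zpow_natCast]
  constructor
  · linarith
  · linarith

lemma iUnion_stp_isSmall {T : Finset Tile} (hT : T.Nonempty) :
    ⋃ J ∈ stp (IsSmall T), dI J = univ := by
  rw [eq_univ_iff_forall]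
  intro x
  obtain ⟨J, hJ, hx⟩ := exists_mem_stp IsSmall.mono (exists_isSmall T x) (exists_not_isSmall hT x)
  exact mem_biUnion hJ hx

/-- The weight of a tile of small scale is essentially constant on a small interval. -/
lemma IsSmall.wt_le {T : Finset Tile} {J : ℤ × ℤ} (hJ : IsSmall T J) {p : Tile} (hp : p ∈ T)
    {x y : ℝ} (hx : x ∈ dI J) (hy : y ∈ dI J) : wt p x ≤ 4 * wt p y := by
  have hxy : |x - y| ≤ 2 ^ J.1 := by
    have h1 := mem_dy.1 hx
    have h2 := mem_dy.1 hy
    rw [abs_le]; constructor <;> nlinarith [h1.1, h1.2, h2.1, h2.2]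
  have hk0 := two_zpow_pos (-p.1)
  set s := (2 : ℝ) ^ (-p.1) * x - p.2.1 with hs
  set t := (2 : ℝ) ^ (-p.1) * y - p.2.1 with ht
  have hst : |s - t| = 2 ^ (-p.1) * |x - y| := by
    rw [hs, ht, sub_sub_sub_cancel_right, ← mul_sub, abs_mul, abs_of_pos hk0]
  show W s ≤ 4 * W t
  rcases le_or_gt p.1 J.1 with hk | hk
  · have hfar : 2 ^ J.1 ≤ |x - p.2.1 * 2 ^ p.1| := by
      by_contra! hcon
      apply hJ p hp
      have hc := dy_left_mem p.1 p.2.1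
      set c := (p.2.1 : ℝ) * 2 ^ p.1
      have hsub : tI p ⊆ dy J.1 ⌊c * 2 ^ (-J.1)⌋ := dy_subset hk hc (mem_dy_floor _ c)
      obtain ⟨h1, h2⟩ := mem_dy.1 (mem_dy_floor J.1 c)
      obtain ⟨h3, h4⟩ := mem_dy.1 hx
      have h0 := two_zpow_pos J.1
      rw [abs_lt] at hcon
      refine hsub.trans ?_
      have e1 : (J.2 : ℝ) - 1 ≤ ⌊c * 2 ^ (-J.1)⌋ := by
        have : J.2 - 2 < ⌊c * 2 ^ (-J.1)⌋ := by
          have : ((J.2 - 2 : ℤ) : ℝ) < ⌊c * 2 ^ (-J.1)⌋ := by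
            push_cast
            by_contra! hh
            nlinarith
          exact_mod_cast this
        have : J.2 - 1 ≤ ⌊c * 2 ^ (-J.1)⌋ := by omega
        exact_mod_cast this
      have e2 : (⌊c * 2 ^ (-J.1)⌋ : ℝ) + 1 ≤ J.2 + 2 := by
        have : ⌊c * 2 ^ (-J.1)⌋ < J.2 + 2 := by
          have : (⌊c * 2 ^ (-J.1)⌋ : ℝ) < ((J.2 + 2 : ℤ) : ℝ) := by
            push_cast
            by_contra! hh
            nlinarith
          exact_mod_cast this
        have : ⌊c * 2 ^ (-J.1)⌋ + 1 ≤ J.2 + 2 := by omega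
        exact_mod_cast this
      apply Ico_subset_Ico
      · gcongr
      · gcongr
    have hs' : s = 2 ^ (-p.1) * (x - p.2.1 * 2 ^ p.1) := by
      rw [hs, mul_sub, mul_left_comm, two_zpow_neg_mul, mul_one]
    have h1 : |s - t| ≤ |s| := by
      rw [hst, hs', abs_mul, abs_of_pos hk0]
      exact mul_le_mul_of_nonneg_left (hxy.trans hfar) hk0.le
    have h2 : |t| ≤ 2 * |s| := by
      have := abs_sub_abs_le_abs_sub t s
      rw [abs_sub_comm t s] at this
      linarith
    unfold W
    rw [← div_eq_mul_inv, inv_eq_one_div, div_le_div_iff₀ (by positivity) (by positivity)]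
    have h3 : t ^ 2 ≤ (2 * |s|) ^ 2 := by
      rw [← sq_abs t]; gcongr
    rw [mul_pow, sq_abs] at h3
    nlinarith
  · have h1 : |s - t| ≤ 1 / 2 := by
      rw [hst]
      have h3 := two_zpow_mono (show J.1 ≤ p.1 - 1 by omega)
      rw [two_zpow_pred] at h3
      calc _ ≤ (2 : ℝ) ^ (-p.1) * (2 ^ p.1 / 2) := by gcongr; linarith
        _ = 1 / 2 := by rw [← mul_div_assoc, two_zpow_neg_mul]
    have := W_shift h1
    have := W_nonneg t
    norm_num at *
    linarith

section
variable {C : ℝ} {ψ : Tile → ℝ → ℂ}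

/-- The linearized model operator. -/
def trF (ψ : Tile → ℝ → ℂ) (N : ℝ → ℝ) (a : Tile → ℂ) (T : Finset Tile) (x : ℝ) : ℂ :=
  ∑ p ∈ T, a p * (N ⁻¹' Om2 p).indicator (ψ p) x

/-- The weight adapted to the time interval of a top. -/
def wtT (θ : Top) (x : ℝ) : ℝ := wt (θ.1, θ.2.1, 0) x

lemma wtT_nonneg (θ : Top) (x : ℝ) : 0 ≤ wtT θ x := wt_nonneg _ _

lemma wt_le_wtT {p : Tile} {θ : Top} (h : tI p ⊆ topI θ) (x : ℝ) : wt p x ≤ 16 * wtT θ x :=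
  wt_le_of_subset h x

lemma small_tile_le (hψ : IsPacket C ψ) {N : ℝ → ℝ} (hN : Measurable N) {E : Set ℝ}
    (hE : MeasurableSet E) {T : Finset Tile} {a : Tile → ℂ} {ε μ : ℝ} (hε : 0 ≤ ε)
    (ha : ∀ p ∈ T, ‖a p‖ ≤ ε) (hm : HasMass N E T μ) {J : ℤ × ℤ} (hJ : IsSmall T J) {y : ℝ}
    (hy : y ∈ dI J) {p : Tile} (hp : p ∈ T) :
    ∫⁻ x in E ∩ dI J, ‖a p * (N ⁻¹' Om2 p).indicator (ψ p) x‖ₑ ≤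
      ofReal (ε * C * 4 ^ 6 * wt p y ^ 6 * (μ * 2 ^ p.1)) := by
  have hC := hψ.pos
  have hw := wt_nonneg p y
  set D := ε * C * 4 ^ 6 * wt p y ^ 6
  have hD : 0 ≤ D := by positivity
  have hms : MeasurableSet (N ⁻¹' Om p) := hN (measurableSet_Om p)
  calc ∫⁻ x in E ∩ dI J, ‖a p * (N ⁻¹' Om2 p).indicator (ψ p) x‖ₑ
      ≤ ∫⁻ x in E ∩ dI J, (N ⁻¹' Om p).indicator (fun x => ofReal (D * wt p x ^ 2)) x := by
        apply setLIntegral_mono' (hE.inter (measurableSet_dI J))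
        intro x hx
        by_cases hx2 : x ∈ N ⁻¹' Om2 p
        · rw [indicator_of_mem hx2, indicator_of_mem (show x ∈ N ⁻¹' Om p from Om2_subset p hx2),
            ← ofReal_norm, norm_mul]
          apply ENNReal.ofReal_le_ofReal
          have h1 := hJ.wt_le hp hx.2 hy
          have h2 := wt_nonneg p x
          calc ‖a p‖ * ‖ψ p x‖ ≤ ε * (C * wt p x ^ 8) := by
                gcongr
                · exact ha p hp
                · exact hψ.decay p x
            _ = ε * C * (wt p x ^ 6 * wt p x ^ 2) := by ring
            _ ≤ ε * C * ((4 * wt p y) ^ 6 * wt p x ^ 2) := by gcongr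
            _ = D * wt p x ^ 2 := by simp only [D]; ring
        · rw [indicator_of_notMem hx2]
          simp
    _ ≤ ∫⁻ x in E ∩ N ⁻¹' Om p, ofReal (D * wt p x ^ 2) := by
        rw [lintegral_indicator hms, Measure.restrict_restrict hms]
        apply lintegral_mono_set
        intro x hx
        exact ⟨hx.2.1, hx.1⟩
    _ = ofReal (D * ∫ x in E ∩ N ⁻¹' Om p, wt p x ^ 2) := by
        rw [← integral_const_mul, ofReal_integral_eq_lintegral_ofReal]
        · exact ((integrable_wt_pow p two_ne_zero).const_mul _).integrableOn
        · exact Eventually.of_forall fun x => by have := wt_nonneg p x; positivity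
    _ ≤ _ := by
        apply ENNReal.ofReal_le_ofReal
        exact mul_le_mul_of_nonneg_left (hm p hp p (tle_refl p)) hD

/-- The contribution of tiles of small scale on a small interval. -/
lemma small_part_le (hψ : IsPacket C ψ) {N : ℝ → ℝ} (hN : Measurable N) {E : Set ℝ}
    (hE : MeasurableSet E) {T : Finset Tile} {θ : Top} (hT : IsTree T θ) {a : Tile → ℂ} {ε μ : ℝ}
    (hε : 0 ≤ ε) (hμ : 0 ≤ μ)
    (ha : ∀ p ∈ T, ‖a p‖ ≤ ε) (hm : HasMass N E T μ) {J : ℤ × ℤ} (hJ : IsSmall T J) {y : ℝ}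
    (hy : y ∈ dI J) :
    ∫⁻ x in E ∩ dI J, ‖trF ψ N a (T.filter fun p => p.1 ≤ J.1 + 1) x‖ₑ ≤
      ofReal (2 ^ 24 * π * C * ε * μ * wtT θ y ^ 2) * volume (dI J) := by
  have hC := hψ.pos
  have hpi := Real.pi_pos
  set T' := T.filter fun p => p.1 ≤ J.1 + 1
  have hT' : ∀ p ∈ T', p ∈ T ∧ p.1 ≤ J.1 + 1 := fun p hp => Finset.mem_filter.1 hp
  have hnn : ∀ p ∈ T', 0 ≤ ε * C * 4 ^ 6 * wt p y ^ 6 * (μ * 2 ^ p.1) := fun p _ => by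
    have := wt_nonneg p y
    have := two_zpow_pos p.1
    positivity
  have hk : ∀ k : ℤ, ∑ p ∈ T'.filter (fun p => p.1 = k),
      ε * C * 4 ^ 6 * wt p y ^ 6 * (μ * 2 ^ p.1) ≤
        2 ^ 22 * π * C * ε * μ * wtT θ y ^ 2 * 2 ^ k := by
    intro k
    have hs := tree_slice (T := T') (ξ := θ.2.2) (fun p hp => (hT p (hT' p hp).1).2) k
    have h0 := two_zpow_pos k
    calc _ ≤ ∑ p ∈ T'.filter (fun p => p.1 = k),
          (ε * C * 4 ^ 6 * (16 * wtT θ y) ^ 2 * (μ * 2 ^ k)) * wt p y := by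
          apply Finset.sum_le_sum
          intro p hp
          have hp1 := (hs p hp).1
          have hp2 := hT' p (Finset.mem_filter.1 hp).1
          have h1 := wt_le_wtT (hT p hp2.1).1 y
          have h2 := wt_nonneg p y
          have h3 : wt p y ^ 6 ≤ (16 * wtT θ y) ^ 2 * wt p y := by
            calc wt p y ^ 6 ≤ wt p y ^ 3 := wt_pow_anti p y (by norm_num)
              _ = wt p y ^ 2 * wt p y := by ring
              _ ≤ _ := by gcongr
          rw [hp1]
          calc _ ≤ ε * C * 4 ^ 6 * ((16 * wtT θ y) ^ 2 * wt p y) * (μ * 2 ^ k) := by gcongr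
            _ = _ := by ring
      _ ≤ (ε * C * 4 ^ 6 * (16 * wtT θ y) ^ 2 * (μ * 2 ^ k)) * (4 * π) := by
          rw [← Finset.mul_sum]
          exact mul_le_mul_of_nonneg_left (sum_slice_wt_le _ _ _ hs y) (by positivity)
      _ = _ := by ring
  have hvol : volume (dI J) = ofReal (2 ^ J.1) := volume_dy _ _
  have hM : 0 ≤ 2 ^ 22 * π * C * ε * μ * wtT θ y ^ 2 := by positivity
  calc ∫⁻ x in E ∩ dI J, ‖trF ψ N a T' x‖ₑ
      ≤ ∫⁻ x in E ∩ dI J, ∑ p ∈ T', ‖a p * (N ⁻¹' Om2 p).indicator (ψ p) x‖ₑ :=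
        lintegral_mono fun x => enorm_sum_le _ _
    _ = ∑ p ∈ T', ∫⁻ x in E ∩ dI J, ‖a p * (N ⁻¹' Om2 p).indicator (ψ p) x‖ₑ := by
        apply lintegral_finsetSum
        intro p _
        exact (((hψ.cont p).measurable.indicator (hN (measurableSet_Om2 p))).const_mul _).enorm
    _ ≤ ∑ p ∈ T', ofReal (ε * C * 4 ^ 6 * wt p y ^ 6 * (μ * 2 ^ p.1)) :=
        Finset.sum_le_sum fun p hp => small_tile_le hψ hN hE hε ha hm hJ hy (hT' p hp).1
    _ = ofReal (∑ p ∈ T', ε * C * 4 ^ 6 * wt p y ^ 6 * (μ * 2 ^ p.1)) :=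
        (ENNReal.ofReal_sum_of_nonneg hnn).symm
    _ ≤ ofReal (2 ^ 24 * π * C * ε * μ * wtT θ y ^ 2 * 2 ^ J.1) := by
        apply ENNReal.ofReal_le_ofReal
        refine (sum_by_scale T' _ hk).trans ?_
        rw [← Finset.mul_sum]
        have h1 : ∑ k ∈ T'.image (fun p => p.1), (2 : ℝ) ^ k ≤ 2 * 2 ^ (J.1 + 1) := by
          apply sum_two_zpow_le
          intro k hk
          obtain ⟨p, hp, rfl⟩ := Finset.mem_image.1 hk
          exact (hT' p hp).2
        rw [two_zpow_succ] at h1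
        refine (mul_le_mul_of_nonneg_left h1 hM).trans (le_of_eq ?_)
        ring
    _ = _ := by rw [hvol, ← ENNReal.ofReal_mul (by positivity)]

/-- The tiles of large scale active somewhere on a maximal small interval live on a small set. -/
lemma exists_large_support {N : ℝ → ℝ} (hN : Measurable N) {E : Set ℝ}
    (hE : MeasurableSet E) {T : Finset Tile} {θ : Top} (hT : IsTree T θ) {μ : ℝ} (hμ : 0 ≤ μ)
    (hm : HasMass N E T μ) {J : ℤ × ℤ} (hJ : ¬ IsSmall T (par J)) :
    ∃ G : Set ℝ, MeasurableSet G ∧ (∀ x ∈ E ∩ dI J, ∀ p ∈ T, J.1 + 2 ≤ p.1 → N x ∈ Om p → x ∈ G) ∧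
      volume G ≤ ofReal (100 * μ) * volume (dI J) := by
  obtain ⟨q, hq, hqJ⟩ : ∃ q ∈ T, tI q ⊆ tri (par J) := by
    simpa [IsSmall] using hJ
  obtain ⟨hq1, hq2⟩ := hT q hq
  set k := J.1 + 2 with hk
  have h0 := two_zpow_pos J.1
  have hkk : (2 : ℝ) ^ k = 4 * 2 ^ J.1 := by rw [hk, two_zpow_add]; norm_num; ring
  have hqk : q.1 ≤ k := by
    by_contra! hcon
    have h1 := measure_mono (μ := volume) hqJ
    rw [tI, volume_dy, tri, Real.volume_Ico, ENNReal.ofReal_le_ofReal_iff (by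
      have := two_zpow_pos (par J).1; nlinarith)] at h1
    have h2 := two_zpow_mono (show J.1 + 3 ≤ q.1 by omega)
    rw [two_zpow_add] at h2
    simp only [par, two_zpow_succ] at h1
    norm_num at h2
    linarith
  obtain ⟨z, hz⟩ := dy_nonempty q.1 q.2.1
  set p' : Tile := (k, ⌊z * 2 ^ (-k)⌋, ⌊θ.2.2 * 2 ^ k⌋) with hp'
  have hzp : z ∈ tI p' := mem_dy_floor k z
  have hξp : θ.2.2 ∈ Om p' := by
    have := mem_dy_floor (-k) θ.2.2
    rwa [neg_neg] at this
  have hle : tle q p' := tle_of_mem hqk hz hzp hq2 hξp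
  refine ⟨(E ∩ N ⁻¹' Om p') ∩ dI J, (hE.inter (hN (measurableSet_Om p'))).inter
    (measurableSet_dI J), fun x hx p hp hpk hNx => ⟨⟨hx.1, ?_⟩, hx.2⟩, ?_⟩
  · exact Om_subset_Om (q := p') (p := p) hpk (hT p hp).2 hξp hNx
  · have hw : ∀ x ∈ dI J, 1 / 25 ≤ wt p' x ^ 2 := by
      intro x hx
      have hx' := mem_dy.1 (dI_subset_par J hx)
      have hz' := hqJ hz
      have hz2 := mem_dy.1 hzp
      simp only [tri, mem_Ico] at hz'
      simp only [par] at hx' hz'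
      rw [two_zpow_succ] at hx' hz'
      simp only [hp'] at hz2
      rw [hkk] at hz2
      have h3 : |(2 : ℝ) ^ (-p'.1) * x - p'.2.1| ≤ 2 := by
        have e : (2 : ℝ) ^ (-p'.1) * x - p'.2.1 = (x - ⌊z * 2 ^ (-k)⌋ * (4 * 2 ^ J.1)) / 2 ^ k := by
          rw [eq_div_iff (two_zpow_pos k).ne', ← hkk, sub_mul, mul_comm _ x, mul_assoc,
            two_zpow_neg_mul, mul_one]
        rw [e, hkk, abs_div, abs_of_pos (show (0:ℝ) < 4 * 2 ^ J.1 by linarith),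
          div_le_iff₀ (by linarith), abs_le]
        constructor <;> nlinarith
      have h4 : (1 : ℝ) / 5 ≤ wt p' x := by
        unfold wt W
        rw [← one_div]
        apply one_div_le_one_div_of_le (by positivity)
        nlinarith [abs_le.1 h3]
      calc (1 : ℝ) / 25 = (1 / 5) ^ 2 := by norm_num
        _ ≤ _ := by gcongr
    have h1 := hm q hq p' hle
    have hsc : sc p' = 4 * 2 ^ J.1 := hkk
    have hI := (integrable_wt_pow p' two_ne_zero).integrableOn (s := E ∩ N ⁻¹' Om p')
    have h2 : volume ((E ∩ N ⁻¹' Om p') ∩ dI J) ≤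
        ofReal 25 * ofReal (∫ x in E ∩ N ⁻¹' Om p', wt p' x ^ 2) := by
      rw [ofReal_integral_eq_lintegral_ofReal hI
        (Eventually.of_forall fun x => by positivity),
        ← lintegral_const_mul _ (show Measurable fun x => ofReal (wt p' x ^ 2) from
          ((continuous_wt p').measurable.pow_const 2).ennreal_ofReal)]
      calc _ = ∫⁻ x in (E ∩ N ⁻¹' Om p') ∩ dI J, 1 := by simp
        _ ≤ ∫⁻ x in (E ∩ N ⁻¹' Om p') ∩ dI J, ofReal 25 * ofReal (wt p' x ^ 2) := by
            apply setLIntegral_mono' ((hE.inter (hN (measurableSet_Om p'))).inter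
              (measurableSet_dI J))
            intro x hx
            rw [← ENNReal.ofReal_mul (by norm_num), ENNReal.one_le_ofReal]
            linarith [hw x hx.2]
        _ ≤ _ := lintegral_mono_set inter_subset_left
    refine h2.trans ?_
    rw [show volume (dI J) = ofReal (2 ^ J.1) from volume_dy _ _,
      ← ENNReal.ofReal_mul (by norm_num), ← ENNReal.ofReal_mul (by positivity)]
    apply ENNReal.ofReal_le_ofReal
    rw [hsc] at h1
    linarith

/-- Truncations of an upper tree are controlled by averages. -/
lemma trunc_le (hψ : IsPacket C ψ) {T : Finset Tile} {ξ : ℝ} (hT : ∀ p ∈ T, ξ ∈ Om2 p)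
    (a : Tile → ℂ) (k₀ : ℤ) (x : ℝ) :
    ‖∑ p ∈ T.filter (fun p => k₀ ≤ p.1), a p * ψ p x‖ₑ ≤
      ofReal C * Av k₀ (fun y => ‖∑ p ∈ T, a p * ψ p y‖ₑ) x := by
  obtain ⟨κ, hκc, hκ, hκψ⟩ := hψ.trunc ξ k₀
  have hC := hψ.pos
  have h0 := two_zpow_pos (-k₀)
  have hκb : ∀ y, ‖κ y‖ ≤ C * 2 ^ (-k₀) := fun y => (hκ y).trans (by
    have := W_le_one ((2 : ℝ) ^ (-k₀) * y)
    have h3 : 0 ≤ C * (2 : ℝ) ^ (-k₀) := by positivity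
    nlinarith)
  have h1 : ∑ p ∈ T.filter (fun p => k₀ ≤ p.1), a p * ψ p x =
      ∫ y, (∑ p ∈ T, a p * ψ p (x - y)) * κ y := by
    have e : ∀ y, (∑ p ∈ T, a p * ψ p (x - y)) * κ y = ∑ p ∈ T, a p * (ψ p (x - y) * κ y) := by
      intro y
      rw [Finset.sum_mul]
      exact Finset.sum_congr rfl fun p _ => mul_assoc _ _ _
    simp_rw [e]
    rw [integral_finsetSum _ fun p _ => ?_, Finset.sum_filter]
    · refine Finset.sum_congr rfl fun p hp => ?_
      rw [integral_const_mul, hκψ p (hT p hp) x]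
      split_ifs <;> simp
    · apply Integrable.const_mul
      exact ((hψ.integrable p).comp_sub_left x).mul_bdd (c := C * 2 ^ (-k₀))
        hκc.aestronglyMeasurable (Eventually.of_forall hκb)
  rw [h1]
  refine (enorm_integral_le_lintegral_enorm _).trans ?_
  unfold Av
  rw [← lintegral_sub_left_eq_self (fun y => ‖∑ p ∈ T, a p * ψ p y‖ₑ * _) x,
    ← mul_assoc, ← lintegral_const_mul']
  · apply lintegral_mono
    intro y
    simp only [sub_sub_cancel]
    rw [enorm_mul, ← ofReal_norm (κ y), mul_left_comm, ← ENNReal.ofReal_mul (by positivity),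
      ← ENNReal.ofReal_mul (by positivity)]
    gcongr
    exact hκ y
  · exact ENNReal.mul_ne_top ENNReal.ofReal_ne_top ENNReal.ofReal_ne_top

/-- A finite set of tiles with `ξ` in the lower halves and `η` in the upper halves. -/
lemma lower_active_le (hψ : IsPacket C ψ) {U : Finset Tile} {ξ η : ℝ} (h1 : ∀ p ∈ U, ξ ∈ Om1 p)
    (h2 : ∀ p ∈ U, η ∈ Om2 p) {a : Tile → ℂ} {ε : ℝ} (hε : 0 ≤ ε) (ha : ∀ p ∈ U, ‖a p‖ ≤ ε)
    (x : ℝ) : ‖∑ p ∈ U, a p * ψ p x‖ ≤ 4 * π * C * ε := by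
  have hC := hψ.pos
  have hpi := Real.pi_pos
  rcases U.eq_empty_or_nonempty with rfl | ⟨q, hq⟩
  · simp; positivity
  have hs : ∀ p ∈ U, ∀ q ∈ U, q.1 ≤ p.1 := by
    intro p hp q hq
    by_contra! hcon
    have h3 := Om_subset_Om1 (ξ := ξ) hcon (Om1_subset q (h1 q hq)) (h1 p hp)
    exact Set.disjoint_left.1 (disjoint_Om1_Om2 p) (h3 (Om2_subset q (h2 q hq))) (h2 p hp)
  have hs' : ∀ p ∈ U, p.1 = q.1 ∧ p.2.2 = ⌊ξ * 2 ^ q.1⌋ := fun p hp => by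
    have : p.1 = q.1 := le_antisymm (hs q hq p hp) (hs p hp q hq)
    exact ⟨this, this ▸ freq_index (Om1_subset p (h1 p hp))⟩
  calc _ ≤ ∑ p ∈ U, ‖a p * ψ p x‖ := norm_sum_le _ _
    _ ≤ ∑ p ∈ U, ε * C * wt p x := by
        apply Finset.sum_le_sum
        intro p hp
        rw [norm_mul, mul_assoc]
        gcongr
        · exact ha p hp
        · simpa using hψ.decay' (show 1 ≤ 8 by norm_num) p x
    _ ≤ ε * C * (4 * π) := by
        rw [← Finset.mul_sum]
        exact mul_le_mul_of_nonneg_left (sum_slice_wt_le _ _ _ hs' x) (by positivity)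
    _ = _ := by ring

/-- The contribution of tiles of large scale, pointwise. -/
lemma upper_active_le (hψ : IsPacket C ψ) {T : Finset Tile} {ξ : ℝ} (hT : ∀ p ∈ T, ξ ∈ Om2 p)
    (a : Tile → ℂ) (k₀ : ℤ) (η : ℝ) {x y : ℝ} (hxy : |x - y| ≤ 2 ^ k₀)
    {U : Finset Tile} (hU : ∀ p, p ∈ U ↔ p ∈ T ∧ k₀ ≤ p.1 ∧ η ∈ Om2 p) :
    ‖∑ p ∈ U, a p * ψ p x‖ₑ ≤
      ofReal (8 * C) * MW (fun y => ‖∑ p ∈ T, a p * ψ p y‖ₑ) y := by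
  have hC := hψ.pos
  set g := fun y => ‖∑ p ∈ T, a p * ψ p y‖ₑ
  rcases U.eq_empty_or_nonempty with rfl | hne
  · simp
  obtain ⟨q, hq, hmax⟩ := U.exists_max_image (fun p => p.1) hne
  have hk : ∀ k, k₀ ≤ k → ‖∑ p ∈ T.filter (fun p => k ≤ p.1), a p * ψ p x‖ₑ ≤
      ofReal (4 * C) * MW g y := by
    intro k hk
    refine (trunc_le hψ hT a k x).trans ?_
    have h1 : |x - y| ≤ 1 * 2 ^ k := by
      rw [one_mul]; exact hxy.trans (two_zpow_mono hk)
    calc _ ≤ ofReal C * (ofReal (2 * (1 + 1 ^ 2)) * Av k g y) := by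
          gcongr; exact Av_shift g h1
      _ = ofReal (4 * C) * Av k g y := by
          rw [← mul_assoc, ← ENNReal.ofReal_mul hC.le]; congr 2; ring
      _ ≤ _ := by gcongr; exact le_MW k g y
  have hUe : U = (T.filter (fun p => k₀ ≤ p.1)).filter (fun p => ¬ q.1 + 1 ≤ p.1) := by
    ext p
    rw [hU, Finset.mem_filter, Finset.mem_filter]
    obtain ⟨hqT, -, hqη⟩ := (hU q).1 hq
    constructor
    · rintro ⟨h1, h2, h3⟩
      have := hmax p ((hU p).2 ⟨h1, h2, h3⟩)
      exact ⟨⟨h1, h2⟩, by omega⟩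
    · rintro ⟨⟨h1, h2⟩, h3⟩
      refine ⟨h1, h2, ?_⟩
      rcases (show p.1 ≤ q.1 by omega).lt_or_eq with h4 | h4
      · exact Om_subset_Om2 h4 (Om2_subset q (hT q hqT)) (hT p h1) (Om2_subset q hqη)
      · have e : p.2.2 = q.2.2 := by
          rw [freq_index (Om2_subset p (hT p h1)), freq_index (Om2_subset q (hT q hqT)), h4]
        have : Om2 p = Om2 q := by unfold Om2; rw [h4, e]
        rwa [this]
  have hdec : ∑ p ∈ U, a p * ψ p x = ∑ p ∈ T.filter (fun p => k₀ ≤ p.1), a p * ψ p x -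
      ∑ p ∈ T.filter (fun p => q.1 + 1 ≤ p.1), a p * ψ p x := by
    have h1 := Finset.sum_filter_add_sum_filter_not (T.filter (fun p => k₀ ≤ p.1))
      (fun p => q.1 + 1 ≤ p.1) (fun p => a p * ψ p x)
    rw [← hUe, Finset.filter_filter] at h1
    rw [← h1, add_comm, eq_comm, add_sub_assoc, add_eq_left, sub_eq_zero]
    congr 1
    ext p
    have := ((hU q).1 hq).2.1
    simp only [Finset.mem_filter]
    constructor
    · rintro ⟨h2, h3, h4⟩; exact ⟨h2, h4⟩
    · rintro ⟨h2, h3⟩; exact ⟨h2, by omega, h3⟩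
  rw [hdec]
  calc _ ≤ _ + _ := enorm_sub_le
    _ ≤ ofReal (4 * C) * MW g y + ofReal (4 * C) * MW g y :=
        add_le_add (hk k₀ le_rfl) (hk _ (by have := ((hU q).1 hq).2.1; omega))
    _ = _ := by
        rw [← add_mul, ← ENNReal.ofReal_add (by positivity) (by positivity)]; congr 2; ring

lemma le_setLIntegral_of_forall {α : Type*} [MeasurableSpace α] {m : Measure α} {s : Set α}
    (hs : MeasurableSet s) (h0 : m s ≠ 0)
    (h1 : m s ≠ ∞) {A : ℝ≥0∞} {f : α → ℝ≥0∞} (h : ∀ y ∈ s, A ≤ f y * m s) :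
    A ≤ ∫⁻ y in s, f y ∂m := by
  calc A = ∫⁻ _ in s, A / m s ∂m := by
        rw [setLIntegral_const, ENNReal.div_mul_cancel h0 h1]
    _ ≤ _ := setLIntegral_mono' hs fun y hy => ENNReal.div_le_of_le_mul (h y hy)

lemma one_le_wtT {T : Finset Tile} {θ : Top} (hT : IsTree T θ) {J : ℤ × ℤ}
    (hJ : ¬ IsSmall T (par J)) {p : Tile} (hp : p ∈ T) (hpk : J.1 + 2 ≤ p.1) {y : ℝ}
    (hy : y ∈ dI J) : 1 ≤ 25 * wtT θ y ^ 2 := by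
  obtain ⟨q, hq, hqJ⟩ : ∃ q ∈ T, tI q ⊆ tri (par J) := by
    simpa [IsSmall] using hJ
  obtain ⟨z, hz⟩ := dy_nonempty q.1 q.2.1
  have hzθ := mem_dy.1 ((hT q hq).1 hz)
  have hz' := hqJ hz
  have hK := le_of_dy_subset (hT p hp).1
  have hy' := mem_dy.1 (dI_subset_par J hy)
  have h0 := two_zpow_mono (hpk.trans hK)
  rw [two_zpow_add] at h0
  simp only [tri, mem_Ico] at hz'
  simp only [par] at hz' hy'
  rw [two_zpow_succ] at hz' hy'
  have hK0 := two_zpow_pos θ.1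
  have h3 : |(2 : ℝ) ^ (-θ.1) * y - θ.2.1| ≤ 2 := by
    have e : (2 : ℝ) ^ (-θ.1) * y - θ.2.1 = (y - θ.2.1 * 2 ^ θ.1) / 2 ^ θ.1 := by
      rw [eq_div_iff hK0.ne', sub_mul, mul_comm _ y, mul_assoc, two_zpow_neg_mul, mul_one]
    rw [e, abs_div, abs_of_pos hK0, div_le_iff₀ hK0, abs_le]
    norm_num at h0
    constructor <;> nlinarith
  have h4 : (1 : ℝ) / 5 ≤ wtT θ y := by
    unfold wtT wt W
    rw [← one_div]
    apply one_div_le_one_div_of_le (by positivity)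
    simp only
    nlinarith [abs_le.1 h3]
  nlinarith

lemma le_add_inv_mul_sq {ε : ℝ} (hε : 0 < ε) (M : ℝ≥0∞) :
    M ≤ ofReal ε + ofReal ε⁻¹ * M ^ 2 := by
  rcases le_total M (ofReal ε) with h | h
  · exact h.trans le_self_add
  · calc M = ofReal ε⁻¹ * ofReal ε * M := by
          rw [← ENNReal.ofReal_mul (by positivity), inv_mul_cancel₀ hε.ne']; simp
      _ ≤ ofReal ε⁻¹ * M * M := by gcongr
      _ = ofReal ε⁻¹ * M ^ 2 := by ring
      _ ≤ _ := le_add_self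

/-- The contribution of tiles of large scale on a maximal small interval. -/
lemma large_part_le (hψ : IsPacket C ψ) {N : ℝ → ℝ} (hN : Measurable N) {E : Set ℝ}
    (hE : MeasurableSet E) {T : Finset Tile} {θ : Top} (hT : IsTree T θ) {a : Tile → ℂ} {ε μ : ℝ}
    (hε : 0 < ε) (hμ : 0 ≤ μ)
    (ha : ∀ p ∈ T, ‖a p‖ ≤ ε) (hm : HasMass N E T μ) {J : ℤ × ℤ} (hJ : J ∈ stp (IsSmall T)) {y : ℝ}
    (hy : y ∈ dI J) :
    ∫⁻ x in E ∩ dI J, ‖trF ψ N a (T.filter fun p => ¬ p.1 ≤ J.1 + 1) x‖ₑ ≤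
      ofReal (100 * μ) * (ofReal (4 * π * C * ε * (25 * wtT θ y ^ 2)) +
        ofReal (8 * C) * (ofReal (ε * (25 * wtT θ y ^ 2)) +
          ofReal ε⁻¹ *
            MW (fun y => ‖∑ p ∈ tree2 T θ, a p * ψ p y‖ₑ) y ^ 2)) * volume (dI J) := by
  classical
  have hC := hψ.pos
  have hpi := Real.pi_pos
  set T' := T.filter fun p => ¬ p.1 ≤ J.1 + 1
  set g := fun y => ‖∑ p ∈ tree2 T θ, a p * ψ p y‖ₑ
  rcases T'.eq_empty_or_nonempty with h0 | ⟨p, hp⟩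
  · simp [h0, trF]
  obtain ⟨hp1, hp2⟩ := Finset.mem_filter.1 hp
  have hw := one_le_wtT hT hJ.2 hp1 (by omega) hy
  obtain ⟨G, hGm, hG, hGv⟩ := exists_large_support hN hE hT hμ hm hJ.2
  set c : ℝ≥0∞ := ofReal (4 * π * C * ε) + ofReal (8 * C) * MW g y
  have hpt : ∀ x ∈ E ∩ dI J, ‖trF ψ N a T' x‖ₑ ≤ G.indicator (fun _ => c) x := by
    intro x hx
    set U := T'.filter fun p => N x ∈ Om2 p with hU
    have e1 : trF ψ N a T' x = ∑ p ∈ U, a p * ψ p x := by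
      rw [hU, Finset.sum_filter]
      refine Finset.sum_congr rfl fun p _ => ?_
      by_cases h : N x ∈ Om2 p
      · rw [if_pos h, indicator_of_mem (by exact h)]
      · rw [if_neg h, indicator_of_notMem (by exact h), mul_zero]
    have hUm : ∀ p, p ∈ U ↔ (p ∈ T ∧ J.1 + 2 ≤ p.1) ∧ N x ∈ Om2 p := by
      intro p
      rw [hU, Finset.mem_filter, Finset.mem_filter, not_le]
      exact ⟨fun h => ⟨⟨h.1.1, by omega⟩, h.2⟩, fun h => ⟨⟨h.1.1, by omega⟩, h.2⟩⟩
    rcases U.eq_empty_or_nonempty with h0 | ⟨q, hq⟩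
    · simp [e1, h0]
    have hxG : x ∈ G := hG x hx q ((hUm q).1 hq).1.1 ((hUm q).1 hq).1.2
      (Om2_subset q ((hUm q).1 hq).2)
    rw [indicator_of_mem hxG, e1]
    have h4 := Finset.sum_filter_add_sum_filter_not U (fun p => θ.2.2 ∈ Om1 p)
      (fun p => a p * ψ p x)
    rw [← h4]
    refine (enorm_add_le _ _).trans (add_le_add ?_ ?_)
    · rw [← ofReal_norm]
      apply ENNReal.ofReal_le_ofReal
      exact lower_active_le hψ (fun p hp => (Finset.mem_filter.1 hp).2)
        (fun p hp => ((hUm p).1 (Finset.mem_filter.1 hp).1).2) hε.le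
        (fun p hp => ha p ((hUm p).1 (Finset.mem_filter.1 hp).1).1.1) x
    · refine upper_active_le hψ (T := tree2 T θ) (ξ := θ.2.2) (fun p hp => (mem_tree2.1 hp).2.2)
        a (J.1 + 2) (N x) ?_ ?_
      · have h1 := mem_dy.1 hx.2
        have h2 := mem_dy.1 hy
        have h3 := two_zpow_pos J.1
        have h4 := two_zpow_mono (show J.1 ≤ J.1 + 2 by omega)
        refine le_trans ?_ h4
        rw [abs_le]; constructor <;> nlinarith
      · intro p
        rw [Finset.mem_filter, hUm, mem_tree2]
        constructor
        · rintro ⟨⟨⟨h1, h2⟩, h3⟩, h4⟩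
          exact ⟨⟨h1, (hT p h1).1, ((mem_Om1_or_Om2 (hT p h1).2).resolve_left h4)⟩, h2, h3⟩
        · rintro ⟨⟨h1, h2, h3⟩, h4, h5⟩
          exact ⟨⟨⟨h1, h4⟩, h5⟩, fun h => Set.disjoint_left.1 (disjoint_Om1_Om2 p) h h3⟩
  calc ∫⁻ x in E ∩ dI J, ‖trF ψ N a T' x‖ₑ ≤ ∫⁻ x in E ∩ dI J, G.indicator (fun _ => c) x :=
        setLIntegral_mono' (hE.inter (measurableSet_dI J)) hpt
    _ ≤ ∫⁻ x, G.indicator (fun _ => c) x := setLIntegral_le_lintegral _ _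
    _ = c * volume G := by rw [lintegral_indicator hGm, setLIntegral_const]
    _ ≤ c * (ofReal (100 * μ) * volume (dI J)) := by gcongr
    _ = ofReal (100 * μ) * c * volume (dI J) := by ring
    _ ≤ _ := by
        gcongr
        apply add_le_add
        · apply ENNReal.ofReal_le_ofReal
          exact le_mul_of_one_le_right (by positivity) hw
        · gcongr
          refine (le_add_inv_mul_sq hε _).trans ?_
          gcongr
          exact le_mul_of_one_le_right hε.le hw

/-- The tree estimate. -/
lemma tree_le (hψ : IsPacket C ψ) {N : ℝ → ℝ} (hN : Measurable N) {E : Set ℝ}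
    (hE : MeasurableSet E) {T : Finset Tile} {θ : Top} (hT : IsTree T θ) {a : Tile → ℂ} {ε μ : ℝ}
    (hε : 0 < ε) (hμ : 0 ≤ μ)
    (ha : HasEnergy a T ε) (hm : HasMass N E T μ) :
    ∫⁻ x in E, ‖trF ψ N a T x‖ₑ ≤
      ofReal (2 ^ 27 * π ^ 2 * C ^ 3 * ε * μ * 2 ^ θ.1) := by
  classical
  have hC := hψ.pos
  have hC1 := hψ.one_le
  have hpi := Real.pi_pos
  rcases T.eq_empty_or_nonempty with rfl | hne
  · simp [trF]
  set g : ℝ → ℝ := fun y => ‖∑ p ∈ tree2 T θ, a p * ψ p y‖ with hg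
  have hgm : Measurable g := by
    apply Measurable.norm
    exact Finset.measurable_sum _ fun p _ => (hψ.cont p).measurable.const_mul _
  have hge : (fun y => ‖∑ p ∈ tree2 T θ, a p * ψ p y‖ₑ) = fun y => ofReal (g y) := by
    ext y; rw [hg, ofReal_norm]
  set M := MW fun y => ofReal (g y) with hM
  have hMm : Measurable M := measurable_MW hgm.ennreal_ofReal
  have hgB : ∀ y, g y ≤ ∑ p ∈ tree2 T θ, ‖a p‖ * C := fun y => (norm_sum_le _ _).trans
    (Finset.sum_le_sum fun p _ => by rw [norm_mul]; gcongr; exact hψ.norm_le p y)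
  have ha' : ∀ p ∈ T, ‖a p‖ ≤ ε := fun p hp => ha.norm_le hε.le hp
  have hMsq : ∫⁻ y, M y ^ 2 ≤
      ofReal (20480 * π ^ 2 * C ^ 2 * ε ^ 2 * 2 ^ θ.1) := by
    refine (lintegral_MW_sq_le hgm hgB).trans ?_
    have h1 := hψ.bessel (tree2 T θ) a (X := 0) (le_of_eq (by
      apply Finset.sum_eq_zero; intro p hp
      apply Finset.sum_eq_zero; intro q hq
      rw [if_neg]
      intro hsub
      exact Set.disjoint_left.1 (disjoint_Om1_Om2 q)
        (hsub (Om2_subset p (mem_tree2.1 hp).2.2)) (mem_tree2.1 hq).2.2))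
    have h2 : ∫⁻ y, ofReal (g y) ^ 2 = ofReal (∫ y, g y ^ 2) := by
      rw [ofReal_integral_eq_lintegral_ofReal (hψ.integrable_sq_sum _ _)
        (Eventually.of_forall fun x => sq_nonneg _)]
      exact lintegral_congr fun y => (ENNReal.ofReal_pow (norm_nonneg _) 2).symm
    rw [h2, ← ENNReal.ofReal_mul (by norm_num)]
    apply ENNReal.ofReal_le_ofReal
    have h3 := ha θ
    have h4 : 0 ≤ 8 * π ^ 2 * C ^ 2 := by positivity
    nlinarith [mul_le_mul_of_nonneg_left h3 h4]
  set Φ : ℝ → ℝ≥0∞ := fun y =>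
    ofReal (2 ^ 24 * π * C * ε * μ * wtT θ y ^ 2) +
    ofReal (100 * μ) * (ofReal (4 * π * C * ε * (25 * wtT θ y ^ 2)) +
        ofReal (8 * C) * (ofReal (ε * (25 * wtT θ y ^ 2)) +
          ofReal ε⁻¹ * M y ^ 2)) with hΦ
  have hJ : ∀ J ∈ stp (IsSmall T), ∫⁻ x in E ∩ dI J, ‖trF ψ N a T x‖ₑ ≤ ∫⁻ y in dI J, Φ y := by
    intro J hJ
    have hv : volume (dI J) = ofReal (2 ^ J.1) := volume_dy _ _
    refine le_setLIntegral_of_forall (measurableSet_dI J)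
      (by rw [hv]; simpa using two_zpow_pos J.1) (by rw [hv]; simp) fun y hy => ?_
    have h1 := small_part_le hψ hN hE hT hε.le hμ ha' hm hJ.1 hy
    have h2 := large_part_le hψ hN hE hT hε hμ ha' hm hJ hy
    rw [hge, ← hM] at h2
    calc _ ≤ ∫⁻ x in E ∩ dI J, (‖trF ψ N a (T.filter fun p => p.1 ≤ J.1 + 1) x‖ₑ +
          ‖trF ψ N a (T.filter fun p => ¬ p.1 ≤ J.1 + 1) x‖ₑ) := by
          apply lintegral_mono
          intro x
          simp only [trF]
          rw [← Finset.sum_filter_add_sum_filter_not T (fun p => p.1 ≤ J.1 + 1)]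
          exact enorm_add_le _ _
      _ = _ := by
          apply lintegral_add_left
          apply Measurable.enorm
          exact Finset.measurable_sum _ fun p _ =>
            ((hψ.cont p).measurable.indicator (hN (measurableSet_Om2 p))).const_mul _
      _ ≤ _ := add_le_add h1 h2
      _ = _ := by rw [hΦ, add_mul]
  have hsum : ∫⁻ x in E, ‖trF ψ N a T x‖ₑ ≤ ∫⁻ y, Φ y := by
    have h1 := lintegral_eq_tsum_stp (good := IsSmall T) IsSmall.mono Φ
    have h2 := lintegral_eq_tsum_stp (good := IsSmall T) IsSmall.mono
      (E.indicator fun x => ‖trF ψ N a T x‖ₑ)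
    rw [iUnion_stp_isSmall hne, Measure.restrict_univ] at h1 h2
    rw [lintegral_indicator hE] at h2
    rw [← h1, ← h2]
    apply ENNReal.tsum_le_tsum
    intro J
    rw [lintegral_indicator hE, Measure.restrict_restrict hE]
    exact hJ J J.2
  refine hsum.trans ?_
  have hwm : Measurable fun y => wtT θ y ^ 2 :=
    (continuous_wt (θ.1, θ.2.1, 0)).measurable.pow_const 2
  have hwi : ∀ c : ℝ, 0 ≤ c → ∫⁻ y, ofReal (c * wtT θ y ^ 2) ≤
      ofReal (c * (π * 2 ^ θ.1)) := by
    intro c hc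
    rw [← ofReal_integral_eq_lintegral_ofReal (f := fun y => c * wtT θ y ^ 2)
      ((integrable_wt_pow (θ.1, θ.2.1, 0) two_ne_zero).const_mul c)
      (Eventually.of_forall fun x => by have := wtT_nonneg θ x; positivity)]
    apply ENNReal.ofReal_le_ofReal
    rw [integral_const_mul]
    exact mul_le_mul_of_nonneg_left (integral_wt_pow_le (θ.1, θ.2.1, 0) two_ne_zero) hc
  have h0 := two_zpow_pos θ.1
  calc ∫⁻ y, Φ y = (∫⁻ y, ofReal (2 ^ 24 * π * C * ε * μ * wtT θ y ^ 2)) +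
      ofReal (100 * μ) *
        ((∫⁻ y, ofReal ((4 * π * C * ε * 25) * wtT θ y ^ 2)) +
        ofReal (8 * C) * ((∫⁻ y, ofReal ((ε * 25) * wtT θ y ^ 2)) +
          ofReal ε⁻¹ * ∫⁻ y, M y ^ 2)) := by
        rw [hΦ, lintegral_add_left (by fun_prop), lintegral_const_mul _ (by fun_prop),
          lintegral_add_left (by fun_prop), lintegral_const_mul _ (by fun_prop),
          lintegral_add_left (by fun_prop), lintegral_const_mul _ (by fun_prop)]
        simp only [mul_assoc]
    _ ≤ ofReal (2 ^ 24 * π * C * ε * μ * (π * 2 ^ θ.1)) +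
      ofReal (100 * μ) *
        (ofReal ((4 * π * C * ε * 25) * (π * 2 ^ θ.1)) +
        ofReal (8 * C) * (ofReal ((ε * 25) * (π * 2 ^ θ.1)) +
          ofReal ε⁻¹ *
            ofReal (20480 * π ^ 2 * C ^ 2 * ε ^ 2 * 2 ^ θ.1))) := by
        gcongr
        · exact hwi _ (by positivity)
        · exact hwi _ (by positivity)
        · exact hwi _ (by positivity)
    _ = ofReal (2 ^ 24 * π * C * ε * μ * (π * 2 ^ θ.1) +
      (100 * μ) * ((4 * π * C * ε * 25) * (π * 2 ^ θ.1) +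
        (8 * C) * ((ε * 25) * (π * 2 ^ θ.1) +
          ε⁻¹ * (20480 * π ^ 2 * C ^ 2 * ε ^ 2 * 2 ^ θ.1)))) := by
        rw [← ENNReal.ofReal_mul (by positivity), ← ENNReal.ofReal_add (by positivity)
          (by positivity), ← ENNReal.ofReal_mul (by positivity), ← ENNReal.ofReal_add
          (by positivity) (by positivity), ← ENNReal.ofReal_mul (by positivity),
          ← ENNReal.ofReal_add (by positivity) (by positivity)]
    _ ≤ _ := by
        apply ENNReal.ofReal_le_ofReal
        have e : 2 ^ 24 * π * C * ε * μ * (π * 2 ^ θ.1) +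
          (100 * μ) * ((4 * π * C * ε * 25) * (π * 2 ^ θ.1) +
            (8 * C) * ((ε * 25) * (π * 2 ^ θ.1) +
            ε⁻¹ * (20480 * π ^ 2 * C ^ 2 * ε ^ 2 * 2 ^ θ.1))) =
          (16787216 * π ^ 2 * C + 20000 * π * C + 16384000 * π ^ 2 * C ^ 3) *
            (ε * μ * 2 ^ θ.1) := by
          field_simp
          ring
        rw [e, show 2 ^ 27 * π ^ 2 * C ^ 3 * ε * μ * 2 ^ θ.1 =
          (2 ^ 27 * π ^ 2 * C ^ 3) * (ε * μ * 2 ^ θ.1) by ring]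
        apply mul_le_mul_of_nonneg_right _ (by positivity)
        have h1 : C ≤ C ^ 3 := by nlinarith [mul_pos hC hC]
        have h2 : π ≤ π ^ 2 := by nlinarith [Real.two_le_pi]
        have h3 : π * C ≤ π ^ 2 * C ^ 3 := by gcongr
        have h4 : π ^ 2 * C ≤ π ^ 2 * C ^ 3 := by gcongr
        nlinarith

lemma IsPacket.measurable_trF (hψ : IsPacket C ψ) {N : ℝ → ℝ} (hN : Measurable N) (a : Tile → ℂ)
    (T : Finset Tile) : Measurable (trF ψ N a T) :=
  Finset.measurable_sum _ fun p _ =>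
    ((hψ.cont p).measurable.indicator (hN (measurableSet_Om2 p))).const_mul _

lemma IsPacket.lintegral_trF_biUnion_le (hψ : IsPacket C ψ) {N : ℝ → ℝ} (hN : Measurable N)
    {a : Tile → ℂ} (E : Set ℝ) {ι : Type*} [DecidableEq ι] (Q : Finset Tile) (Θ : Finset ι)
    (top : Tile → ι) (h : ∀ p ∈ Q, top p ∈ Θ) :
    ∫⁻ x in E, ‖trF ψ N a Q x‖ₑ ≤
      ∑ θ ∈ Θ, ∫⁻ x in E, ‖trF ψ N a (Q.filter fun p => top p = θ) x‖ₑ := by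
  rw [← lintegral_finsetSum _ fun θ _ => (hψ.measurable_trF hN a _).enorm]
  apply lintegral_mono
  intro x
  simp only [trF]
  rw [← Finset.sum_fiberwise_of_maps_to h]
  exact enorm_sum_le _ _

lemma IsPacket.lintegral_trF_sdiff (hψ : IsPacket C ψ) {N : ℝ → ℝ} (hN : Measurable N)
    {a : Tile → ℂ} (E : Set ℝ) {P Q : Finset Tile} (h : Q ⊆ P) :
    ∫⁻ x in E, ‖trF ψ N a P x‖ₑ ≤
      (∫⁻ x in E, ‖trF ψ N a Q x‖ₑ) + ∫⁻ x in E, ‖trF ψ N a (P \ Q) x‖ₑ := by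
  rw [← lintegral_add_left (hψ.measurable_trF hN a _).enorm]
  apply lintegral_mono
  intro x
  simp only [trF]
  rw [← Finset.sum_sdiff h, add_comm]
  exact enorm_add_le _ _

lemma HasMass.mono {N : ℝ → ℝ} {E : Set ℝ} {P Q : Finset Tile} {μ : ℝ} (h : HasMass N E P μ)
    (hQ : Q ⊆ P) : HasMass N E Q μ := fun p hp => h p (hQ hp)

lemma forest_le (hψ : IsPacket C ψ) {N : ℝ → ℝ} (hN : Measurable N) {E : Set ℝ}
    (hE : MeasurableSet E) {Q : Finset Tile} {Θ : Finset Top} {top : Tile → Top}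
    (hQ : ∀ p ∈ Q, top p ∈ Θ ∧ tI p ⊆ topI (top p) ∧ (top p).2.2 ∈ Om p)
    {a : Tile → ℂ} {ε μ : ℝ} (hε : 0 < ε) (hμ : 0 ≤ μ)
    (ha : HasEnergy a Q ε) (hm : HasMass N E Q μ) :
    ∫⁻ x in E, ‖trF ψ N a Q x‖ₑ ≤
      ofReal (2 ^ 27 * π ^ 2 * C ^ 3 * ε * μ * ∑ θ ∈ Θ, (2 : ℝ) ^ θ.1) := by
  classical
  have hC := hψ.pos
  refine (hψ.lintegral_trF_biUnion_le hN E Q Θ top fun p hp => (hQ p hp).1).trans ?_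
  rw [Finset.mul_sum, ENNReal.ofReal_sum_of_nonneg fun θ _ => by
    have := two_zpow_pos θ.1; positivity]
  refine Finset.sum_le_sum fun θ _ => ?_
  refine tree_le hψ hN hE (fun p hp => ?_) hε hμ (ha.mono (Finset.filter_subset _ _) hε.le le_rfl)
    (hm.mono (Finset.filter_subset _ _))
  obtain ⟨h1, rfl⟩ := Finset.mem_filter.1 hp
  exact (hQ p h1).2

/-- One step of the simultaneous mass and energy decomposition. -/
lemma decomposition_step (hψ : IsPacket C ψ) {N : ℝ → ℝ} (hN : Measurable N) {E : Set ℝ}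
    (hE : MeasurableSet E) (hE' : volume E ≠ ∞) {f : ℝ → ℂ} (hf : Integrable f)
    (hf2 : Integrable (fun x => ‖f x‖ ^ 2)) {P : Finset Tile} {ε μ ε' μ' : ℝ} (hε : 0 < ε)
    (hμ : 0 < μ) (hε' : 0 < ε') (hμ' : 0 ≤ μ') (hP : HasEnergy (cf ψ f) P (2 * ε))
    (hP' : HasEnergy (cf ψ f) P ε') (hm : HasMass N E P μ') :
    ∃ P' ⊆ P, HasEnergy (cf ψ f) P' ε ∧ HasMass N E P' μ ∧
      ∫⁻ x in E, ‖trF ψ N (cf ψ f) P x‖ₑ ≤ (∫⁻ x in E, ‖trF ψ N (cf ψ f) P' x‖ₑ) +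
        ofReal (2 ^ 27 * π ^ 2 * C ^ 3 * ε' * μ' *
          (100000 * π ^ 3 * C ^ 2 * (∫ x, ‖f x‖ ^ 2) / ε ^ 2 + 512 * volume.real E / μ)) := by
  have hC := hψ.pos
  obtain ⟨P₁, Θ₁, top₁, h1, h2, h3, h4⟩ := energy_lemma hψ hf hf2 (by positivity) hP
  obtain ⟨P₂, Θ₂, top₂, h5, h6, h7, h8⟩ := mass_lemma hN hE hE' P₁ hμ
  rw [mul_div_cancel_left₀ _ two_ne_zero] at h2
  refine ⟨P₂, h5.trans h1, h2.mono h5 hε.le le_rfl, h6, ?_⟩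
  have a1 := hψ.lintegral_trF_sdiff hN (a := cf ψ f) E h1
  have a2 := hψ.lintegral_trF_sdiff hN (a := cf ψ f) E h5
  have a3 := forest_le hψ hN hE h3 hε' hμ' (hP'.mono Finset.sdiff_subset hε'.le le_rfl)
    (hm.mono Finset.sdiff_subset)
  have a4 := forest_le hψ hN hE h7 hε' hμ'
    (hP'.mono (Finset.sdiff_subset.trans h1) hε'.le le_rfl)
    (hm.mono (Finset.sdiff_subset.trans h1))
  have i0 : 0 ≤ ∫ x, ‖f x‖ ^ 2 := integral_nonneg fun x => by positivity
  refine a1.trans ((add_le_add (a2.trans (add_le_add le_rfl a4)) a3).trans ?_)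
  have s0 : ∀ Θ : Finset Top, 0 ≤ ∑ θ ∈ Θ, (2 : ℝ) ^ θ.1 := fun Θ =>
    Finset.sum_nonneg fun θ _ => (two_zpow_pos _).le
  have := s0 Θ₁
  have := s0 Θ₂
  rw [add_assoc, ← ENNReal.ofReal_add (by positivity) (by positivity), ← mul_add]
  rw [add_comm (∑ θ ∈ Θ₂, _)]
  gcongr
  · rw [le_div_iff₀ (by positivity)]
    nlinarith [mul_nonneg (sq_nonneg ε) (s0 Θ₁)]
  · rw [le_div_iff₀ hμ]
    linarith

/-- The weights occurring in the summation over all levels. -/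
def lvl (s : ℝ) (n : ℤ) : ℝ :=
  ((2 : ℝ) ^ (n + 1)) ^ s * min (4 * ((2 : ℝ) ^ n) ^ 2) 1 / ((2 : ℝ) ^ n) ^ 2

lemma lvl_nonneg (s : ℝ) (n : ℤ) : 0 ≤ lvl s n := by
  have := two_zpow_pos n
  unfold lvl
  have := two_zpow_pos (n + 1)
  positivity

lemma summable_lvl {s : ℝ} (h0 : 0 < s) (h1 : s ≤ 1) : Summable (lvl s) := by
  apply Summable.of_nat_of_neg_add_one
  · refine Summable.of_nonneg_of_le (fun n => lvl_nonneg s n) (fun n => ?_)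
      (summable_geometric_two.mul_left 2)
    have h2 : (1 : ℝ) ≤ 2 ^ ((n : ℤ) + 1) := by
      have := one_le_pow₀ (n := n + 1) (one_le_two (α := ℝ)); exact_mod_cast this
    calc lvl s n ≤ (2 : ℝ) ^ ((n : ℤ) + 1) * 1 / ((2 : ℝ) ^ (n : ℤ)) ^ 2 := by
          unfold lvl
          gcongr
          · conv_rhs => rw [← Real.rpow_one ((2 : ℝ) ^ ((n : ℤ) + 1))]
            exact Real.rpow_le_rpow_of_exponent_le h2 h1
          · exact min_le_right _ _
      _ = _ := by
          rw [two_zpow_succ, one_div, inv_pow, zpow_natCast]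
          field_simp
  · have hr : (2 : ℝ) ^ (-s) < 1 := Real.rpow_lt_one_of_one_lt_of_neg one_lt_two (by linarith)
    refine Summable.of_nonneg_of_le (fun n => lvl_nonneg s _) (fun n => ?_)
      ((summable_geometric_of_lt_one (by positivity) hr).mul_left 4)
    have h2 := two_zpow_pos (-((n : ℤ) + 1))
    calc lvl s (-((n : ℤ) + 1)) ≤ ((2 : ℝ) ^ (-((n : ℤ) + 1) + 1)) ^ s *
          (4 * ((2 : ℝ) ^ (-((n : ℤ) + 1))) ^ 2) / ((2 : ℝ) ^ (-((n : ℤ) + 1))) ^ 2 := by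
          unfold lvl
          gcongr
          exact min_le_left _ _
      _ = _ := by
          rw [show -((n : ℤ) + 1) + 1 = -n by ring]
          have : ((2 : ℝ) ^ (-(n : ℤ))) ^ s = ((2 : ℝ) ^ (-s)) ^ n := by
            rw [← Real.rpow_intCast, ← Real.rpow_mul (by norm_num), ← Real.rpow_natCast,
              ← Real.rpow_mul (by norm_num)]
            congr 1; push_cast; ring
          rw [this]
          field_simp

lemma HasEnergy.min {a : Tile → ℂ} {P : Finset Tile} {ε δ : ℝ} (h : HasEnergy a P ε)
    (h' : HasEnergy a P δ) : HasEnergy a P (min ε δ) := by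
  rcases min_choice ε δ with e | e <;> rwa [e]

lemma HasMass.min {N : ℝ → ℝ} {E : Set ℝ} {P : Finset Tile} {μ δ : ℝ} (h : HasMass N E P μ)
    (h' : HasMass N E P δ) : HasMass N E P (min μ δ) := by
  rcases min_choice μ δ with e | e <;> rwa [e]

lemma hasMass_pi (N : ℝ → ℝ) (E : Set ℝ) (P : Finset Tile) :
    HasMass N E P π := by
  intro p _ p' _
  refine le_trans ?_ (integral_wt_pow_le p' two_ne_zero)
  exact setIntegral_le_integral (integrable_wt_pow p' two_ne_zero)
    (Eventually.of_forall fun x => sq_nonneg _)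

lemma min_le_rpow_mul {x A s : ℝ} (hx : 0 < x) (hA : 0 < A) (h0 : 0 ≤ s) (h1 : s ≤ 1) :
    min x A ≤ x ^ s * A ^ (1 - s) := by
  have h := lt_min hx hA
  calc min x A = (min x A) ^ s * (min x A) ^ (1 - s) := by
        rw [← Real.rpow_add h, add_sub_cancel, Real.rpow_one]
    _ ≤ _ := by
        gcongr
        · exact min_le_left _ _
        · exact min_le_right _ _

lemma trivial_le (hψ : IsPacket C ψ) (N : ℝ → ℝ) (E : Set ℝ) {P Q : Finset Tile} (hQ : Q ⊆ P)
    {a : Tile → ℂ} {ε : ℝ} (hε : 0 ≤ ε) (ha : HasEnergy a Q ε) :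
    ∫⁻ x in E, ‖trF ψ N a Q x‖ₑ ≤ ofReal (ε * (π * C * ∑ p ∈ P, sc p)) := by
  have hC := hψ.pos
  calc ∫⁻ x in E, ‖trF ψ N a Q x‖ₑ ≤ ∫⁻ x, ofReal (∑ p ∈ P, ε * C * wt p x) := by
        refine (setLIntegral_le_lintegral _ _).trans (lintegral_mono fun x => ?_)
        rw [← ofReal_norm]
        apply ENNReal.ofReal_le_ofReal
        refine (norm_sum_le _ _).trans (le_trans (Finset.sum_le_sum (g := fun p => ε * C * wt p x)
          fun p hp => ?_) (Finset.sum_le_sum_of_subset_of_nonneg hQ fun p _ _ => by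
            have := wt_nonneg p x; positivity))
        rw [norm_mul, mul_assoc]
        gcongr
        · exact ha.norm_le hε hp
        · refine (norm_indicator_le_norm_self _ _).trans ?_
          simpa using hψ.decay' (show 1 ≤ 8 by norm_num) p x
    _ = ofReal (∫ x, ∑ p ∈ P, ε * C * wt p x) := by
        rw [ofReal_integral_eq_lintegral_ofReal]
        · exact integrable_finsetSum _ fun p _ => (integrable_wt p).const_mul _
        · exact Eventually.of_forall fun x => Finset.sum_nonneg fun p _ => by
            have := wt_nonneg p x; positivity
    _ = _ := by
        rw [integral_finsetSum _ fun p _ => (integrable_wt p).const_mul _]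
        congr 1
        rw [Finset.mul_sum, Finset.mul_sum]
        refine Finset.sum_congr rfl fun p _ => ?_
        rw [integral_const_mul, integral_wt]
        ring

/-- The constant in the model estimate. -/
def szC (C s : ℝ) : ℝ :=
  2 ^ 27 * π ^ 2 * C ^ 3 * (100000 * π ^ 3 * C ^ 2 + 512) * π ^ (s / 2) *
    ∑' n, lvl s n

/-- The single-energy estimate for the model operator. -/
theorem model_estimate (hψ : IsPacket C ψ) {N : ℝ → ℝ} (hN : Measurable N) {E : Set ℝ}
    (hE : MeasurableSet E) (hE' : volume E ≠ ∞) {f : ℝ → ℂ} (hf : Integrable f)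
    (hf2 : Integrable (fun x => ‖f x‖ ^ 2)) {P : Finset Tile} {s A φ e : ℝ} (hs0 : 0 < s)
    (hs1 : s ≤ 1) (hA : 0 < A) (hφ : 0 < φ) (he : 0 < e) (hfφ : ∫ x, ‖f x‖ ^ 2 ≤ φ ^ 2)
    (hEe : volume.real E ≤ e) (hP : HasEnergy (cf ψ f) P A) :
    ∫⁻ x in E, ‖trF ψ N (cf ψ f) P x‖ₑ ≤
      ofReal (szC C s * (φ ^ s * A ^ (1 - s) * e ^ (1 - s / 2))) := by
  have hC := hψ.pos
  have hpi := Real.pi_pos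
  set t := √(π / e) with ht
  have ht0 : 0 < t := Real.sqrt_pos.2 (by positivity)
  have ht2 : t ^ 2 = π / e := Real.sq_sqrt (by positivity)
  set K := 2 ^ 27 * π ^ 2 * C ^ 3 * (100000 * π ^ 3 * C ^ 2 + 512) * e *
    ((t * φ) ^ s * A ^ (1 - s)) with hK
  have hK0 : 0 ≤ K := by positivity
  obtain ⟨m, hm⟩ : ∃ m : ℕ, max (A / (t * φ)) 1 < 2 ^ m :=
    pow_unbounded_of_one_lt _ one_lt_two
  have step : ∀ j : ℕ, ∃ P' ⊆ P, HasEnergy (cf ψ f) P' (2 ^ ((m : ℤ) - j) * (t * φ)) ∧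
      HasMass N E P' (((2 : ℝ) ^ ((m : ℤ) - j)) ^ 2 * π) ∧
      ∫⁻ x in E, ‖trF ψ N (cf ψ f) P x‖ₑ ≤ (∫⁻ x in E, ‖trF ψ N (cf ψ f) P' x‖ₑ) +
        ofReal (K * ∑ i ∈ Finset.range j, lvl s ((m : ℤ) - (i + 1))) := by
    intro j
    induction j with
    | zero =>
      refine ⟨P, subset_rfl, ?_, ?_, by simp⟩
      · apply hP.mono subset_rfl hA.le
        have := ((le_max_left _ _).trans_lt hm).le
        rw [div_le_iff₀ (by positivity)] at this
        simpa using this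
      · intro p hp p' hle
        refine (hasMass_pi N E P p hp p' hle).trans ?_
        have h1 := ((le_max_right _ _).trans_lt hm).le
        have h2 : (1 : ℝ) ≤ ((2 : ℝ) ^ ((m : ℤ) - ((0 : ℕ) : ℤ))) ^ 2 := by
          simpa using one_le_pow₀ (n := 2) h1
        have := sc_pos p'
        gcongr
        exact le_mul_of_one_le_left hpi.le h2
    | succ j ih =>
      obtain ⟨P', h1, h2, h3, h4⟩ := ih
      set n : ℤ := (m : ℤ) - (j + 1) with hn
      have hn1 : (m : ℤ) - j = n + 1 := by rw [hn]; ring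
      have hn0 := two_zpow_pos n
      rw [hn1] at h2 h3
      have h2' : HasEnergy (cf ψ f) P' (2 * (2 ^ n * (t * φ))) := by
        rw [two_zpow_succ] at h2; convert h2 using 1; ring
      have h3' : HasMass N E P' (4 * ((2 : ℝ) ^ n) ^ 2 * π) := by
        rw [two_zpow_succ] at h3; convert h3 using 1; ring
      obtain ⟨P'', h5, h6, h7, h8⟩ := decomposition_step hψ hN hE hE' hf hf2
        (ε := 2 ^ n * (t * φ)) (μ := ((2 : ℝ) ^ n) ^ 2 * π)
        (ε' := min (2 * (2 ^ n * (t * φ))) A) (μ' := min (4 * ((2 : ℝ) ^ n) ^ 2 * π) π)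
        (by positivity) (by positivity) (lt_min (by positivity) hA) (by positivity)
        h2' (h2'.min (hP.mono h1 hA.le le_rfl)) (h3'.min (hasMass_pi N E P'))
      refine ⟨P'', h5.trans h1, by push_cast; exact h6, by push_cast; exact h7, ?_⟩
      refine h4.trans ((add_le_add_left h8 _).trans ?_)
      rw [Finset.sum_range_succ, add_comm (∑ i ∈ Finset.range j, _), mul_add K, add_assoc, ← hn,
        ENNReal.ofReal_add (mul_nonneg hK0 (lvl_nonneg _ _))
          (mul_nonneg hK0 (Finset.sum_nonneg fun i _ => lvl_nonneg _ _))]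
      refine add_le_add le_rfl (add_le_add (ENNReal.ofReal_le_ofReal ?_) le_rfl)
      have b1 : min (2 * (2 ^ n * (t * φ))) A ≤
          ((2 : ℝ) ^ (n + 1)) ^ s * ((t * φ) ^ s * A ^ (1 - s)) := by
        rw [← mul_assoc 2, ← two_zpow_succ, ← mul_assoc (((2 : ℝ) ^ (n + 1)) ^ s), ← Real.mul_rpow (by positivity) (by positivity)]
        exact min_le_rpow_mul (by positivity) hA hs0.le hs1
      have b2 : min (4 * ((2 : ℝ) ^ n) ^ 2 * π) π =
          min (4 * ((2 : ℝ) ^ n) ^ 2) 1 * π := by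
        rw [min_mul_of_nonneg _ _ hpi.le, one_mul]
      have b3 : 100000 * π ^ 3 * C ^ 2 * (∫ x, ‖f x‖ ^ 2) / (2 ^ n * (t * φ)) ^ 2 +
          512 * volume.real E / (((2 : ℝ) ^ n) ^ 2 * π) ≤
          (100000 * π ^ 3 * C ^ 2 + 512) * e / (((2 : ℝ) ^ n) ^ 2 * π) := by
        rw [add_mul, add_div]
        apply add_le_add
        · rw [mul_pow, mul_pow, ht2]
          calc _ ≤ 100000 * π ^ 3 * C ^ 2 * φ ^ 2 /
                (((2 : ℝ) ^ n) ^ 2 * (π / e * φ ^ 2)) := by gcongr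
            _ = _ := by field_simp
        · gcongr
      rw [b2]
      calc _ ≤ 2 ^ 27 * π ^ 2 * C ^ 3 *
            (((2 : ℝ) ^ (n + 1)) ^ s * ((t * φ) ^ s * A ^ (1 - s))) *
            (min (4 * ((2 : ℝ) ^ n) ^ 2) 1 * π) *
            ((100000 * π ^ 3 * C ^ 2 + 512) * e / (((2 : ℝ) ^ n) ^ 2 * π)) := by
            refine mul_le_mul (mul_le_mul_of_nonneg_right (mul_le_mul_of_nonneg_left b1
              (by positivity)) (by positivity)) b3 ?_ (by positivity)
            have : 0 ≤ ∫ x, ‖f x‖ ^ 2 := integral_nonneg fun x => by positivity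
            positivity
        _ = _ := by
            rw [hK, lvl]
            field_simp
  have hsum : ∀ j : ℕ, ∑ i ∈ Finset.range j, lvl s ((m : ℤ) - (i + 1)) ≤ ∑' n, lvl s n := by
    intro j
    rw [← Finset.sum_image (f := lvl s) (g := fun i : ℕ => (m : ℤ) - (i + 1))
      (fun a _ b _ hab => by simp only at hab; omega)]
    exact (summable_lvl hs0 hs1).sum_le_tsum _ fun n _ => lvl_nonneg s n
  set D := π * C * ∑ p ∈ P, sc p
  have hfin : ∀ j : ℕ, ∫⁻ x in E, ‖trF ψ N (cf ψ f) P x‖ₑ ≤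
      ofReal ((2 : ℝ) ^ m * (t * φ) * D * (1 / 2) ^ j) +
        ofReal (K * ∑' n, lvl s n) := by
    intro j
    obtain ⟨P', h1, h2, h3, h4⟩ := step j
    refine h4.trans (add_le_add ?_ ?_)
    · refine (trivial_le hψ N E h1 (by positivity) h2).trans (le_of_eq ?_)
      congr 1
      rw [sub_eq_add_neg, two_zpow_add, zpow_neg, zpow_natCast, zpow_natCast, one_div, inv_pow]
      ring
    · have := hsum j
      gcongr
  have hlim : Tendsto (fun j : ℕ =>
      ofReal ((2 : ℝ) ^ m * (t * φ) * D * (1 / 2) ^ j) +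
        ofReal (K * ∑' n, lvl s n)) atTop
      (nhds (0 + ofReal (K * ∑' n, lvl s n))) := by
    apply Tendsto.add _ tendsto_const_nhds
    rw [← ENNReal.ofReal_zero, ← mul_zero ((2 : ℝ) ^ m * (t * φ) * D)]
    exact ENNReal.tendsto_ofReal ((tendsto_pow_atTop_nhds_zero_of_lt_one
      (by norm_num) (by norm_num)).const_mul _)
  refine (ge_of_tendsto' hlim hfin).trans (le_of_eq ?_)
  rw [zero_add, hK, szC, Real.mul_rpow ht0.le hφ.le, ht, Real.sqrt_eq_rpow,
    ← Real.rpow_mul (by positivity), Real.div_rpow hpi.le he.le,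
    Real.rpow_sub he, Real.rpow_one, show 1 / 2 * s = s / 2 by ring]
  congr 1
  ring

lemma IsPacket.cf_add (hψ : IsPacket C ψ) {f g : ℝ → ℂ} (hf : Integrable f) (hg : Integrable g)
    (p : Tile) : cf ψ (fun x => f x + g x) p = cf ψ f p + cf ψ g p := by
  unfold cf
  rw [← mul_add, ← integral_add (hψ.integrable_mul hf p) (hψ.integrable_mul hg p)]
  simp only [add_mul]

lemma IsPacket.norm_cf_le (hψ : IsPacket C ψ) {f : ℝ → ℂ} (hf : Integrable f) (p : Tile)
    {j : ℕ} (hj : j ≤ 8) :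
    ‖cf ψ f p‖ ≤ (sc p)⁻¹ * (C * ∫ x, ‖f x‖ * wt p x ^ j) := by
  have hs := sc_pos p
  have hC := hψ.pos
  unfold cf
  rw [norm_mul, ← integral_const_mul]
  rw [show ‖(((sc p)⁻¹ : ℝ) : ℂ)‖ = (sc p)⁻¹ by
    rw [Complex.norm_real, Real.norm_of_nonneg (by positivity)]]
  gcongr
  refine norm_integral_le_of_norm_le ?_ (Eventually.of_forall fun x => ?_)
  · refine (hf.norm.mul_bdd (c := 1) ((continuous_wt p).pow j).aestronglyMeasurable
      (Eventually.of_forall fun x => ?_)).const_mul C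
    change ‖wt p x ^ j‖ ≤ 1
    rw [Real.norm_of_nonneg (pow_nonneg (wt_nonneg p x) j)]
    exact pow_le_one₀ (wt_nonneg p x) (wt_le_one p x)
  · rw [norm_mul, RCLike.norm_conj]
    have := hψ.decay' hj p x
    calc ‖f x‖ * ‖ψ p x‖ ≤ ‖f x‖ * (C * wt p x ^ j) := by gcongr
      _ = _ := by ring

/-- The coefficients of an upper tree are square summable. -/
lemma IsPacket.tree2_coef_le (hψ : IsPacket C ψ) {f : ℝ → ℂ} (hf : Integrable f)
    (hf2 : Integrable (fun x => ‖f x‖ ^ 2)) (P : Finset Tile) (θ : Top) :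
    ∑ p ∈ tree2 P θ, sc p * ‖cf ψ f p‖ ^ 2 ≤ 8 * π ^ 2 * C ^ 2 * ∫ x, ‖f x‖ ^ 2 := by
  classical
  have hC := hψ.pos
  refine hψ.coef_sum_le hf hf2 _ (by positivity) ?_
  have := hψ.bessel (tree2 P θ) (cf ψ f) (X := 0) (le_of_eq ?_)
  · simpa using this
  · refine Finset.sum_eq_zero fun p hp => Finset.sum_eq_zero fun q hq => if_neg fun h => ?_
    rw [mem_tree2] at hp hq
    exact Set.disjoint_left.1 (disjoint_Om1_Om2 q) (h (Om2_subset p hp.2.2)) hq.2.2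

/-- A bounded function has bounded energy. -/
lemma IsPacket.hasEnergy_of_le (hψ : IsPacket C ψ) {f : ℝ → ℂ} (hf : Integrable f)
    (hf2 : Integrable (fun x => ‖f x‖ ^ 2)) {A : ℝ} (hfA : ∀ x, ‖f x‖ ≤ A)
    (P : Finset Tile) : HasEnergy (cf ψ f) P (40 * C * A) := by
  intro θ
  have hC := hψ.pos
  have hpi := Real.pi_pos
  have hpi4 := Real.pi_lt_four
  have h2 := two_zpow_pos θ.1
  set I := topI θ with hI
  have hIm : MeasurableSet I := measurableSet_dy _ _
  have hsq : ∀ s : Set ℝ, (fun x => ‖s.indicator f x‖ ^ 2) = s.indicator fun x => ‖f x‖ ^ 2 := by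
    intro s; ext x; by_cases hx : x ∈ s <;> simp [hx]
  have e1 := hψ.tree2_coef_le (hf.indicator hIm) (by rw [hsq]; exact hf2.indicator hIm) P θ
  have e2 : ∫ x, ‖I.indicator f x‖ ^ 2 ≤ A ^ 2 * 2 ^ θ.1 := by
    rw [hsq, integral_indicator hIm]
    refine (setIntegral_mono_on (g := fun _ => A ^ 2) hf2.integrableOn ?_ hIm
      fun x _ => by have := hfA x; gcongr).trans (le_of_eq ?_)
    · exact integrableOn_const (by rw [hI, topI, volume_dy]; simp) (by simp)
    · rw [setIntegral_const, measureReal_def, hI, topI, volume_dy, ENNReal.toReal_ofReal h2.le,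
        smul_eq_mul, mul_comm]
  have e3 : ∀ p ∈ tree2 P θ, sc p * ‖cf ψ (Iᶜ.indicator f) p‖ ^ 2 ≤
      (C ^ 2 * A ^ 2 * π) * ∫ x in Iᶜ, wt p x ^ 2 := by
    intro p _
    have hs := sc_pos p
    set J := ∫ x in Iᶜ, wt p x ^ 2 with hJ
    have hJ0 : 0 ≤ J := integral_nonneg fun x => sq_nonneg _
    have h1 : ‖cf ψ (Iᶜ.indicator f) p‖ ≤ (sc p)⁻¹ * (C * (A * J)) := by
      refine (hψ.norm_cf_le (hf.indicator hIm.compl) p (j := 2) (by norm_num)).trans ?_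
      gcongr
      rw [hJ, ← integral_indicator hIm.compl, ← integral_const_mul]
      refine integral_mono_of_nonneg (Eventually.of_forall fun x => by positivity)
        (((integrable_wt_pow p two_ne_zero).indicator hIm.compl).const_mul A)
        (Eventually.of_forall fun x => ?_)
      by_cases hx : x ∈ Iᶜ
      · simp only [indicator_of_mem hx]
        have := hfA x
        gcongr
      · simp only [indicator_of_notMem hx]; simp
    have h3 : J ≤ π * sc p :=
      (setIntegral_le_integral (integrable_wt_pow p two_ne_zero)
        (Eventually.of_forall fun x => sq_nonneg _)).trans
        (integral_wt_pow_le p two_ne_zero)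
    calc sc p * ‖cf ψ (Iᶜ.indicator f) p‖ ^ 2 ≤ sc p * ((sc p)⁻¹ * (C * (A * J))) ^ 2 := by gcongr
      _ = C ^ 2 * A ^ 2 * (sc p)⁻¹ * J * J := by field_simp
      _ ≤ C ^ 2 * A ^ 2 * (sc p)⁻¹ * (π * sc p) * J := by gcongr
      _ = _ := by field_simp
  have e4 := Finset.sum_le_sum e3
  rw [← Finset.mul_sum] at e4
  have e5 := tree_off_sum (T := tree2 P θ) (K := θ.1) (n := θ.2.1) (ξ := θ.2.2)
    (fun p hp => (mem_tree2.1 hp).2.1) (fun p hp => Om2_subset p (mem_tree2.1 hp).2.2)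
  have hcf : ∀ p, cf ψ f p = cf ψ (I.indicator f) p + cf ψ (Iᶜ.indicator f) p := by
    intro p
    rw [← hψ.cf_add (hf.indicator hIm) (hf.indicator hIm.compl)]
    congr 1; ext x
    exact (congr_fun (indicator_self_add_compl I f) x).symm
  calc ∑ p ∈ tree2 P θ, sc p * ‖cf ψ f p‖ ^ 2
      ≤ ∑ p ∈ tree2 P θ, (2 * (sc p * ‖cf ψ (I.indicator f) p‖ ^ 2) +
        2 * (sc p * ‖cf ψ (Iᶜ.indicator f) p‖ ^ 2)) := by
        refine Finset.sum_le_sum fun p _ => ?_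
        have hs := sc_pos p
        rw [hcf]
        have h := norm_add_le (cf ψ (I.indicator f) p) (cf ψ (Iᶜ.indicator f) p)
        have h' : ‖cf ψ (I.indicator f) p + cf ψ (Iᶜ.indicator f) p‖ ^ 2 ≤
            2 * ‖cf ψ (I.indicator f) p‖ ^ 2 + 2 * ‖cf ψ (Iᶜ.indicator f) p‖ ^ 2 := by
          refine (pow_le_pow_left₀ (norm_nonneg _) h 2).trans ?_
          nlinarith [sq_nonneg (‖cf ψ (I.indicator f) p‖ - ‖cf ψ (Iᶜ.indicator f) p‖)]
        nlinarith
    _ ≤ 2 * (8 * π ^ 2 * C ^ 2 * (A ^ 2 * 2 ^ θ.1)) +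
        2 * (C ^ 2 * A ^ 2 * π * (16 * π ^ 2 * 2 ^ θ.1)) := by
        rw [Finset.sum_add_distrib, ← Finset.mul_sum, ← Finset.mul_sum]
        gcongr
        · exact e1.trans (by gcongr)
        · exact e4.trans (by gcongr; exact e5)
    _ = (16 * π ^ 2 + 32 * π ^ 3) * (C ^ 2 * A ^ 2 * 2 ^ θ.1) := by ring
    _ ≤ 1600 * (C ^ 2 * A ^ 2 * 2 ^ θ.1) := by
        gcongr
        have := Real.pi_lt_d2
        have h1 : π ^ 2 ≤ 3.15 ^ 2 := by gcongr
        have h3 : π ^ 3 ≤ 3.15 ^ 3 := by gcongr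
        linarith
    _ = _ := by ring

/-- An open set outside of which all averages of the indicator of `F` are small. -/
structure Exc (F Ω : Set ℝ) (δ : ℝ) : Prop where
  pos : 0 < δ
  isOpen : IsOpen Ω
  subset : F ⊆ Ω
  fin : volume Ω < ∞
  small : ∀ y ∉ Ω, ∀ r : ℝ, 0 < r → volume (F ∩ Metric.closedBall y r) ≤ ofReal (δ * r)

lemma exists_exc {F : Set ℝ} (hF : MeasurableSet F) {w δ : ℝ} (hw : 0 < w) (hδ : 0 < δ)
    (hFw : volume F ≤ ofReal w) :
    ∃ Ω, Exc F Ω δ ∧ volume Ω ≤ ofReal (10 / δ * w + 2 * w) := by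
  obtain ⟨O, hFO, hO, hOw⟩ := F.exists_isOpen_lt_of_lt (ofReal (2 * w)) (μ := volume)
    (hFw.trans_lt ((ENNReal.ofReal_lt_ofReal_iff (by positivity)).2 (by linarith)))
  let S : Set (ℝ × ℝ) := {a | 0 < a.2 ∧
    ofReal (δ * a.2) ≤ ∫⁻ y in Metric.closedBall a.1 a.2, F.indicator 1 y}
  have h := measure_iUnion_closedBall_le hδ S fun a ha => ha
  rw [lintegral_indicator_one hF] at h
  have hb : volume ((⋃ a ∈ S, Metric.ball a.1 a.2) ∪ O) ≤
      ofReal (10 / δ * w + 2 * w) := by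
    rw [ENNReal.ofReal_add (by positivity) (by positivity)]
    refine (measure_union_le _ _).trans (add_le_add ?_ hOw.le)
    refine (measure_mono (iUnion₂_mono fun a _ => Metric.ball_subset_closedBall)).trans
      (h.trans ?_)
    rw [ENNReal.ofReal_mul (by positivity)]
    gcongr
  refine ⟨_, ⟨hδ, ?_, hFO.trans subset_union_right, hb.trans_lt ENNReal.ofReal_lt_top, ?_⟩, hb⟩
  · exact (isOpen_biUnion fun a _ => Metric.isOpen_ball).union hO
  · intro y hy r hr
    by_contra! hcon
    apply hy
    left
    refine mem_iUnion₂.2 ⟨(y, r), ⟨hr, ?_⟩, Metric.mem_ball_self hr⟩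
    change _ ≤ ∫⁻ z in Metric.closedBall y r, F.indicator 1 z
    rw [lintegral_indicator_one hF, Measure.restrict_apply hF]
    exact hcon.le

/-- A dyadic interval well inside `Ω`. -/
def Inside (Ω : Set ℝ) (J : ℤ × ℤ) : Prop := tri J ⊆ Ω

lemma Inside.mono {Ω : Set ℝ} (J J' : ℤ × ℤ) (h : dI J ⊆ dI J') (h' : Inside Ω J') :
    Inside Ω J := (tri_mono h).trans h'

lemma Exc.iUnion_stp {F Ω : Set ℝ} {δ : ℝ} (h : Exc F Ω δ) :
    ⋃ J ∈ stp (Inside Ω), dI J = Ω := by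
  apply Subset.antisymm
  · exact iUnion₂_subset fun J hJ => (dI_subset_tri J).trans hJ.1
  intro x hx
  obtain ⟨r, hr, hrx⟩ := Metric.isOpen_iff.1 h.isOpen x hx
  have htri : ∀ k : ℤ, ∀ y ∈ tri (k, ⌊x * 2 ^ (-k)⌋), |y - x| ≤ 2 * 2 ^ k := by
    intro k y hy
    have h1 := mem_dy.1 (mem_dy_floor k x)
    have h2 : (_ : ℝ) ≤ _ ∧ _ < _ := hy
    simp only at h2
    rw [abs_le]
    constructor <;> nlinarith [h1.1, h1.2, h2.1, h2.2]
  obtain ⟨J, hJ, hxJ⟩ := exists_mem_stp (x := x) (good := Inside Ω) Inside.mono (by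
    obtain ⟨n, hn⟩ := exists_pow_lt_of_lt_one (show 0 < r / 2 by positivity)
      (show (1 / 2 : ℝ) < 1 by norm_num)
    refine ⟨(-n, ⌊x * 2 ^ (-(-n : ℤ))⌋), fun y hy => hrx ?_, mem_dy_floor _ x⟩
    have := htri _ y hy
    rw [zpow_neg, zpow_natCast] at this
    rw [one_div, inv_pow] at hn
    rw [Metric.mem_ball, Real.dist_eq]
    linarith) (by
    obtain ⟨n, hn⟩ := pow_unbounded_of_one_lt (volume Ω).toReal (one_lt_two (α := ℝ))
    refine ⟨(n, ⌊x * 2 ^ (-(n : ℤ))⌋), fun hin => ?_, mem_dy_floor _ x⟩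
    have h1 := ENNReal.toReal_mono h.fin.ne (measure_mono ((dI_subset_tri _).trans hin))
    rw [dI, volume_dy, ENNReal.toReal_ofReal (two_zpow_pos _).le, zpow_natCast] at h1
    linarith)
  exact mem_iUnion₂.2 ⟨J, hJ, hxJ⟩

lemma Exc.volume_inter_le {F Ω : Set ℝ} {δ : ℝ} (h : Exc F Ω δ) {J : ℤ × ℤ}
    (hJ : J ∈ stp (Inside Ω)) : volume (F ∩ dI J) ≤ ofReal (δ * (4 * 2 ^ J.1)) := by
  obtain ⟨y, hy, hyΩ⟩ := not_subset.1 hJ.2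
  have h2 := two_zpow_pos J.1
  refine (measure_mono (inter_subset_inter_right F fun x hx => ?_)).trans
    (h.small y hyΩ (4 * 2 ^ J.1) (by positivity))
  have h3 := mem_dy.1 (dI_subset_par J hx)
  have h4 : (_ : ℝ) ≤ _ ∧ _ < _ := hy
  rw [show (par J).1 = J.1 + 1 from rfl, two_zpow_succ] at h3 h4
  rw [Metric.mem_closedBall, Real.dist_eq, abs_le]
  constructor <;> nlinarith [h3.1, h3.2, h4.1, h4.2]

/-- The gain obtained from the separation of scales. -/
def gain (j k : ℤ) : ℝ := 2 ^ (-|j - k|)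

lemma gain_pos (j k : ℤ) : 0 < gain j k := two_zpow_pos _

lemma gain_le_one (j k : ℤ) : gain j k ≤ 1 := by
  have := two_zpow_mono (show -|j - k| ≤ 0 by have := abs_nonneg (j - k); omega)
  simpa [gain] using this

lemma sum_gain_le (S : Finset ℤ) (j : ℤ) : ∑ k ∈ S, gain j k ≤ 4 := by
  rw [← Finset.sum_filter_add_sum_filter_not S (fun k => k ≤ j)]
  have h1 : ∑ k ∈ S with k ≤ j, gain j k ≤ 2 := by
    have := sum_two_zpow_le (S.filter (fun k => k ≤ j)) (K := j)
      (fun k hk => (Finset.mem_filter.1 hk).2)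
    have h2 : ∑ k ∈ S with k ≤ j, gain j k = 2 ^ (-j) * ∑ k ∈ S with k ≤ j, (2 : ℝ) ^ k := by
      rw [Finset.mul_sum]
      refine Finset.sum_congr rfl fun k hk => ?_
      have := (Finset.mem_filter.1 hk).2
      rw [gain, abs_of_nonneg (by omega), ← two_zpow_add]
      congr 1; ring
    rw [h2]
    have h3 := two_zpow_pos (-j)
    calc _ ≤ (2 : ℝ) ^ (-j) * (2 * 2 ^ j) := by gcongr
      _ = 2 * ((2 : ℝ) ^ (-j) * 2 ^ j) := by ring
      _ = 2 := by rw [two_zpow_neg_mul, mul_one]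
  have h2 : ∑ k ∈ S with ¬ k ≤ j, gain j k ≤ 2 := by
    have := sum_two_zpow_le ((S.filter (fun k => ¬ k ≤ j)).image fun k => -k) (K := -j)
      (fun k hk => by
        obtain ⟨l, hl, rfl⟩ := Finset.mem_image.1 hk
        have := (Finset.mem_filter.1 hl).2
        omega)
    rw [Finset.sum_image (fun a _ b _ h => by simpa using h)] at this
    have h2 : ∑ k ∈ S with ¬ k ≤ j, gain j k =
        2 ^ j * ∑ k ∈ S with ¬ k ≤ j, (2 : ℝ) ^ (-k) := by
      rw [Finset.mul_sum]
      refine Finset.sum_congr rfl fun k hk => ?_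
      have := (Finset.mem_filter.1 hk).2
      rw [gain, abs_of_nonpos (by omega), ← two_zpow_add]
      congr 1; ring
    rw [h2]
    have h3 := two_zpow_pos j
    calc _ ≤ (2 : ℝ) ^ j * (2 * 2 ^ (-j)) := by gcongr
      _ = 2 * ((2 : ℝ) ^ (-j) * 2 ^ j) := by ring
      _ = 2 := by rw [two_zpow_neg_mul, mul_one]
  linarith

/-- Separation of a stopping interval from the tiles which are not well inside `Ω`. -/
lemma separation {Ω : Set ℝ} {J : ℤ × ℤ} (hJ : Inside Ω J) {p : Tile}
    (hp : ¬ Inside Ω (p.1, p.2.1)) {x : ℝ} (hx : x ∈ dI J) :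
    (2 : ℝ) ^ (J.1 - p.1) - 2 ≤ |(2 : ℝ) ^ (-p.1) * x - p.2.1| := by
  obtain ⟨z, hz, hzΩ⟩ := not_subset.1 hp
  have hzJ : z ∉ tri J := fun h => hzΩ (hJ h)
  have h1 := mem_dy.1 hx
  have h2 : (_ : ℝ) ≤ _ ∧ _ < _ := hz
  simp only at h2
  have h3 := two_zpow_pos (-p.1)
  have h4 : (2 : ℝ) ^ (-p.1) * 2 ^ p.1 = 1 := two_zpow_neg_mul _
  have h5 : (2 : ℝ) ^ (J.1 - p.1) = 2 ^ (-p.1) * 2 ^ J.1 := by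
    rw [← two_zpow_add]; congr 1; ring
  have h6 : ∀ c : ℝ, c = 2 ^ (-p.1) * (c * 2 ^ p.1) := fun c => by
    rw [mul_left_comm, h4, mul_one]
  have ha : (p.2.1 : ℝ) - 1 ≤ 2 ^ (-p.1) * z := by
    rw [h6 (p.2.1 - 1)]; gcongr; exact h2.1
  have hb : 2 ^ (-p.1) * z ≤ (p.2.1 : ℝ) + 2 := by
    rw [h6 (p.2.1 + 2)]; gcongr; exact h2.2.le
  have h7 : z < (J.2 - 1) * 2 ^ J.1 ∨ (J.2 + 2) * 2 ^ J.1 ≤ z := by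
    by_contra! hcon
    exact hzJ ⟨hcon.1, hcon.2⟩
  rw [h5]
  rcases h7 with h7 | h7
  · have : (2 : ℝ) ^ (-p.1) * 2 ^ J.1 ≤ 2 ^ (-p.1) * (x - z) := by
      gcongr; linarith [h1.1]
    refine le_trans ?_ (le_abs_self _)
    linarith
  · have : (2 : ℝ) ^ (-p.1) * 2 ^ J.1 ≤ 2 ^ (-p.1) * (z - x) := by
      gcongr; linarith [h1.2]
    refine le_trans ?_ (neg_le_abs _)
    linarith

lemma wt_le_of_stp {Ω : Set ℝ} {J : ℤ × ℤ} (hJ : Inside Ω J) {p : Tile}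
    (hp : ¬ Inside Ω (p.1, p.2.1)) {x y : ℝ} (hx : x ∈ dI J) (hy : y ∈ dI J) :
    wt p x ≤ 9 * wt p y := by
  have h1 := mem_dy.1 hx
  have h2 := mem_dy.1 hy
  have h3 := two_zpow_pos (-p.1)
  have h0 := separation hJ hp hx
  set R := (2 : ℝ) ^ (J.1 - p.1)
  have h5 : R = 2 ^ (-p.1) * 2 ^ J.1 := by
    rw [← two_zpow_add, neg_add_eq_sub]
  have hd : |x - y| ≤ 2 ^ J.1 := by
    rw [abs_le]; constructor <;> linarith [h1.1, h1.2, h2.1, h2.2]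
  set a := (2 : ℝ) ^ (-p.1) * x - p.2.1
  set b := (2 : ℝ) ^ (-p.1) * y - p.2.1
  have hab : |a - b| ≤ R := by
    rw [show a - b = 2 ^ (-p.1) * (x - y) by ring, abs_mul, abs_of_pos h3, h5]
    gcongr
  have hb : |b| ≤ 2 * |a| + 2 := by
    have := abs_sub_abs_le_abs_sub b a
    rw [abs_sub_comm b a] at this
    linarith
  change W a ≤ 9 * W b
  unfold W
  rw [← div_eq_mul_inv, inv_eq_one_div, div_le_div_iff₀ (by positivity) (by positivity)]
  rw [← sq_abs a, ← sq_abs b]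
  nlinarith [abs_nonneg a, abs_nonneg b, sq_nonneg (|a| - 1)]

lemma wt_le_gain {Ω : Set ℝ} {J : ℤ × ℤ} (hJ : Inside Ω J) {p : Tile}
    (hp : ¬ Inside Ω (p.1, p.2.1)) (hk : p.1 < J.1) {x : ℝ} (hx : x ∈ dI J) :
    wt p x ≤ 4 * gain J.1 p.1 := by
  have h0 := separation hJ hp hx
  have hg : gain J.1 p.1 = (2 ^ (J.1 - p.1))⁻¹ := by
    rw [gain, abs_of_nonneg (by omega), zpow_neg]
  have h1 : (2 : ℝ) ≤ 2 ^ (J.1 - p.1) := by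
    simpa using two_zpow_mono (show 1 ≤ J.1 - p.1 by omega)
  rw [hg]
  set R := (2 : ℝ) ^ (J.1 - p.1)
  unfold wt W
  set a := (2 : ℝ) ^ (-p.1) * x - p.2.1
  rw [← div_eq_mul_inv, inv_eq_one_div, div_le_div_iff₀ (by positivity) (by positivity)]
  rw [← sq_abs a]
  nlinarith [abs_nonneg a, sq_nonneg (|a| - 2)]

lemma eChar_eq (t x : ℝ) : eChar t x = Complex.exp (((2 * π * t * x : ℝ) : ℂ) * Complex.I) := by
  unfold eChar; congr 1; push_cast; ring

lemma norm_eChar (t x : ℝ) : ‖eChar t x‖ = 1 := by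
  rw [eChar_eq, Complex.norm_exp_ofReal_mul_I]

lemma continuous_eChar (t : ℝ) : Continuous (eChar t) := by
  unfold eChar; fun_prop

lemma eChar_mul_neg (t x : ℝ) : eChar t x * eChar (-t) x = 1 := by
  unfold eChar
  rw [← Complex.exp_add]
  push_cast
  rw [show 2 * π * Complex.I * t * x + 2 * π * Complex.I * (-t) * x = (0 : ℂ) by ring,
    Complex.exp_zero]

lemma conj_eChar (t x : ℝ) : conj (eChar t x) = eChar (-t) x := by
  unfold eChar
  rw [← Complex.exp_conj]
  congr 1
  simp only [map_mul, Complex.conj_ofReal, Complex.conj_I, map_ofNat]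
  push_cast; ring

/-- The modulated mean of a function over a dyadic interval. -/
def mn (f : ℝ → ℂ) (ξ : ℝ) (J : ℤ × ℤ) : ℂ :=
  ((2 ^ J.1 : ℝ) : ℂ)⁻¹ * ∫ x in dI J, f x * eChar (-ξ) x

lemma volume_real_dI (J : ℤ × ℤ) : volume.real (dI J) = 2 ^ J.1 := by
  rw [measureReal_def, dI, volume_dy, ENNReal.toReal_ofReal (two_zpow_pos _).le]

lemma integrableOn_mul_eChar {f : ℝ → ℂ} {s : Set ℝ} (hf : IntegrableOn f s) (ξ : ℝ) :
    IntegrableOn (fun x => f x * eChar ξ x) s :=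
  Integrable.mul_bdd (c := 1) hf (continuous_eChar ξ).aestronglyMeasurable
    (Eventually.of_forall fun x => (norm_eChar ξ x).le)

lemma setIntegral_sub_mn {f : ℝ → ℂ} (hf : Integrable f) (ξ : ℝ) (J : ℤ × ℤ) :
    ∫ x in dI J, (f x * eChar (-ξ) x - mn f ξ J) = 0 := by
  have h0 : ((2 ^ J.1 : ℝ) : ℂ) ≠ 0 := by exact_mod_cast (two_zpow_pos J.1).ne'
  rw [integral_sub (integrableOn_mul_eChar hf.integrableOn _)
    (integrableOn_const (by rw [dI, volume_dy]; simp) (by simp)), setIntegral_const,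
    volume_real_dI, mn, Complex.real_smul, ← mul_assoc, mul_inv_cancel₀ h0, one_mul, sub_self]

lemma setIntegral_norm_le {F Ω : Set ℝ} {δ : ℝ} (h : Exc F Ω δ) {J : ℤ × ℤ}
    (hJ : J ∈ stp (Inside Ω)) (hF : MeasurableSet F) {f : ℝ → ℂ} (hf : Integrable f)
    (hfF : ∀ x, ‖f x‖ ≤ F.indicator 1 x) : ∫ x in dI J, ‖f x‖ ≤ δ * (4 * 2 ^ J.1) := by
  have h2 := two_zpow_pos J.1
  have hδ := h.pos
  have hfin : volume F ≠ ∞ := ((measure_mono h.subset).trans_lt h.fin).ne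
  calc ∫ x in dI J, ‖f x‖ ≤ ∫ x in dI J, F.indicator 1 x := by
        refine integral_mono hf.norm.integrableOn ?_ hfF
        exact ((integrableOn_const hfin (by simp)).integrable_indicator hF).integrableOn
    _ = (volume (F ∩ dI J)).toReal := by
        rw [integral_indicator_one hF, measureReal_def, Measure.restrict_apply hF]
    _ ≤ _ := ENNReal.toReal_le_of_le_ofReal (by positivity) (h.volume_inter_le hJ)

lemma norm_mn_le {F Ω : Set ℝ} {δ : ℝ} (h : Exc F Ω δ) {J : ℤ × ℤ}
    (hJ : J ∈ stp (Inside Ω)) (hF : MeasurableSet F) {f : ℝ → ℂ} (hf : Integrable f)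
    (hfF : ∀ x, ‖f x‖ ≤ F.indicator 1 x) (ξ : ℝ) : ‖mn f ξ J‖ ≤ 4 * δ := by
  have h2 := two_zpow_pos J.1
  unfold mn
  rw [norm_mul, norm_inv, Complex.norm_real, Real.norm_of_nonneg h2.le, inv_mul_le_iff₀ h2]
  refine (norm_integral_le_integral_norm _).trans ?_
  simp only [norm_mul, norm_eChar, mul_one]
  exact (setIntegral_norm_le h hJ hF hf hfF).trans (le_of_eq (by ring))

/-- The interaction of a packet with the mean-zero part on a stopping interval. -/
lemma bad_part_le (hψ : IsPacket C ψ) {F Ω : Set ℝ} {δ : ℝ} (h : Exc F Ω δ) {J : ℤ × ℤ}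
    (hJ : J ∈ stp (Inside Ω)) (hF : MeasurableSet F) {f : ℝ → ℂ} (hf : Integrable f)
    (hfF : ∀ x, ‖f x‖ ≤ F.indicator 1 x) {ξ : ℝ} {p : Tile} (hξ : ξ ∈ Om p)
    (hp : ¬ Inside Ω (p.1, p.2.1)) :
    ‖∫ x in dI J, (f x - eChar ξ x * mn f ξ J) * conj (ψ p x)‖ ≤
      2 ^ 15 * C * δ * gain J.1 p.1 * ∫ x in dI J, wt p x ^ 3 := by
  have hC := hψ.pos
  have h2 := two_zpow_pos J.1
  have hs := sc_pos p
  have hδ := h.pos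
  have hg := gain_pos J.1 p.1
  set u : ℝ → ℂ := fun x => f x * eChar (-ξ) x - mn f ξ J with hu
  set φ : ℝ → ℂ := fun x => conj (ψ p x * eChar (-ξ) x) with hφ
  have hui : IntegrableOn u (dI J) := (integrableOn_mul_eChar hf.integrableOn _).sub
    (integrableOn_const (by rw [dI, volume_dy]; simp) (by simp))
  have hu0 : ∫ x in dI J, u x = 0 := setIntegral_sub_mn hf ξ J
  have hφc : Continuous φ :=
    Complex.continuous_conj.comp ((hψ.cont p).mul (continuous_eChar _))
  have hφb : ∀ x, ‖φ x‖ ≤ C := fun x => by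
    rw [hφ]; simp only [RCLike.norm_conj, norm_mul, norm_eChar, mul_one]; exact hψ.norm_le p x
  set c : ℝ := J.2 * 2 ^ J.1 with hc
  have hcJ : c ∈ dI J := dy_left_mem _ _
  set z : ℂ := if J.1 ≤ p.1 then φ c else 0 with hz
  have e1 : ∫ x in dI J, (f x - eChar ξ x * mn f ξ J) * conj (ψ p x) =
      ∫ x in dI J, u x * (φ x - z) := by
    have : ∀ x, (f x - eChar ξ x * mn f ξ J) * conj (ψ p x) = u x * φ x := by
      intro x
      have := eChar_mul_neg ξ x
      simp only [hu, hφ, map_mul, conj_eChar, neg_neg]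
      linear_combination (-f x * conj (ψ p x)) * this
    simp only [this, mul_sub]
    rw [integral_sub (Integrable.mul_bdd (c := C) hui hφc.aestronglyMeasurable
        (Eventually.of_forall hφb)) (hui.mul_const z),
      integral_mul_const, hu0, zero_mul, sub_zero]
  set M := ((2 : ℝ) ^ J.1)⁻¹ * ∫ x in dI J, wt p x ^ 3 with hM
  have hwt : ∀ x ∈ dI J, wt p x ^ 3 ≤ 729 * M := by
    intro x hx
    have h1 : ∫ y in dI J, wt p x ^ 3 ≤ ∫ y in dI J, 729 * wt p y ^ 3 := by
      refine setIntegral_mono_on (integrableOn_const (by rw [dI, volume_dy]; simp) (by simp))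
        (((integrable_wt_pow p three_ne_zero).const_mul _).integrableOn) (measurableSet_dI J)
        fun y hy => ?_
      have := wt_le_of_stp hJ.1 hp hx hy
      calc wt p x ^ 3 ≤ (9 * wt p y) ^ 3 := by
            have := wt_nonneg p x
            gcongr
        _ = _ := by ring
    rw [setIntegral_const, volume_real_dI, integral_const_mul, smul_eq_mul] at h1
    rw [hM, mul_left_comm, le_inv_mul_iff₀ h2]
    exact h1
  have hI : 0 ≤ ∫ x in dI J, wt p x ^ 3 :=
    integral_nonneg fun x => pow_nonneg (wt_nonneg p x) 3
  have hM0 : 0 ≤ M := by positivity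
  have hker : ∀ x ∈ dI J, ‖φ x - z‖ ≤ C * (4 * gain J.1 p.1) * (729 * M) := by
    intro x hx
    have hw := hwt x hx
    have hw0 := wt_nonneg p x
    have hw1 := wt_le_one p x
    rcases le_or_gt J.1 p.1 with hk | hk
    · have hgk : gain J.1 p.1 = 2 ^ J.1 / sc p := by
        rw [gain, abs_of_nonpos (by omega), sc, div_eq_mul_inv, ← zpow_neg, ← two_zpow_add]
        congr 1; ring
      have hxc : |x - c| ≤ 2 ^ J.1 := by
        have h3 := mem_dy.1 hx
        rw [abs_le, hc]; constructor <;> linarith [h3.1, h3.2]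
      have hL : (2 : ℝ) ^ J.1 ≤ sc p := two_zpow_mono hk
      rw [hz, if_pos hk, hφ, ← map_sub, RCLike.norm_conj]
      refine (hψ.lip p ξ hξ x c (hxc.trans hL)).trans ?_
      rw [hgk]
      have h4 : wt p x ^ 4 ≤ 729 * M := (by
        rw [pow_succ]; exact mul_le_of_le_one_right (by positivity) hw1 :
          wt p x ^ 4 ≤ wt p x ^ 3).trans hw
      have h5 : (2 : ℝ) ^ J.1 / sc p ≤ 4 * (2 ^ J.1 / sc p) := by
        have : 0 < (2 : ℝ) ^ J.1 / sc p := by positivity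
        linarith
      calc C * (|x - c| / sc p) * wt p x ^ 4 ≤ C * (2 ^ J.1 / sc p) * (729 * M) := by gcongr
        _ ≤ _ := by gcongr
    · rw [hz, if_neg (by omega), sub_zero, hφ]
      simp only [RCLike.norm_conj, norm_mul, norm_eChar, mul_one]
      refine (hψ.decay' (show 4 ≤ 8 by norm_num) p x).trans ?_
      have := wt_le_gain hJ.1 hp hk hx
      calc C * wt p x ^ 4 = C * wt p x * wt p x ^ 3 := by ring
        _ ≤ _ := by gcongr
  have hun : ∫ x in dI J, ‖u x‖ ≤ 8 * δ * 2 ^ J.1 := by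
    calc ∫ x in dI J, ‖u x‖ ≤ ∫ x in dI J, (‖f x‖ + 4 * δ) := by
          refine integral_mono hui.norm (hf.norm.integrableOn.add
            (integrableOn_const (by rw [dI, volume_dy]; simp) enorm_ne_top)) fun x => ?_
          refine (norm_sub_le _ _).trans ?_
          rw [norm_mul, norm_eChar, mul_one]
          have := norm_mn_le h hJ hF hf hfF ξ
          linarith
      _ ≤ _ := by
          rw [integral_add hf.norm.integrableOn
            (integrableOn_const (by rw [dI, volume_dy]; simp) enorm_ne_top), setIntegral_const,
            volume_real_dI, smul_eq_mul]
          have := setIntegral_norm_le h hJ hF hf hfF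
          linarith
  rw [e1]
  calc ‖∫ x in dI J, u x * (φ x - z)‖
      ≤ ∫ x in dI J, ‖u x‖ * (C * (4 * gain J.1 p.1) * (729 * M)) := by
        refine norm_integral_le_of_norm_le (hui.norm.mul_const _) ?_
        refine (ae_restrict_iff' (measurableSet_dI J)).2 (Eventually.of_forall fun x hx => ?_)
        rw [norm_mul]
        exact mul_le_mul_of_nonneg_left (hker x hx) (norm_nonneg _)
    _ ≤ 8 * δ * 2 ^ J.1 * (C * (4 * gain J.1 p.1) * (729 * M)) := by
        rw [integral_mul_const]
        gcongr
    _ = 23328 * C * δ * gain J.1 p.1 * ∫ x in dI J, wt p x ^ 3 := by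
        rw [hM]; field_simp; ring
    _ ≤ _ := by
        have h9 : (23328 : ℝ) ≤ 2 ^ 15 := by norm_num
        gcongr

open Classical in
/-- The index of the stopping interval containing a point. -/
def jx (Ω : Set ℝ) (x : ℝ) : ℤ × ℤ :=
  if h : ∃ J ∈ stp (Inside Ω), x ∈ dI J then h.choose else (0, 0)

lemma jx_eq {Ω : Set ℝ} {J : ℤ × ℤ} (hJ : J ∈ stp (Inside Ω)) {x : ℝ} (hx : x ∈ dI J) :
    jx Ω x = J := by
  have h : ∃ J ∈ stp (Inside Ω), x ∈ dI J := ⟨J, hJ, hx⟩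
  rw [jx, dif_pos h]
  by_contra hne
  exact Set.disjoint_left.1
    (stp_pairwiseDisjoint Inside.mono h.choose_spec.1 hJ hne) h.choose_spec.2 hx

lemma Exc.jx_mem {F Ω : Set ℝ} {δ : ℝ} (h : Exc F Ω δ) {x : ℝ} (hx : x ∈ Ω) :
    jx Ω x ∈ stp (Inside Ω) ∧ x ∈ dI (jx Ω x) := by
  rw [← h.iUnion_stp] at hx
  obtain ⟨J, hJ, hxJ⟩ := mem_iUnion₂.1 hx
  rw [jx_eq hJ hxJ]
  exact ⟨hJ, hxJ⟩

lemma Exc.measurable_jx {F Ω : Set ℝ} {δ : ℝ} (h : Exc F Ω δ) : Measurable (jx Ω) := by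
  classical
  refine measurable_to_countable' fun J => ?_
  have : jx Ω ⁻¹' {J} = (if J ∈ stp (Inside Ω) then dI J else ∅) ∪
      (if J = (0, 0) then Ωᶜ else ∅) := by
    ext x
    simp only [mem_preimage, mem_singleton_iff, mem_union]
    constructor
    · rintro rfl
      by_cases hx : x ∈ Ω
      · left
        rw [if_pos (h.jx_mem hx).1]
        exact (h.jx_mem hx).2
      · right
        have : ¬ ∃ J ∈ stp (Inside Ω), x ∈ dI J := fun ⟨J, hJ, hxJ⟩ =>
          hx (dI_subset_tri J |>.trans hJ.1 <| hxJ)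
        rw [if_pos (by rw [jx, dif_neg this])]
        exact hx
    · rintro (hx | hx)
      · split_ifs at hx with hJ
        · exact jx_eq hJ hx
        · exact hx.elim
      · split_ifs at hx with hJ
        · have : ¬ ∃ J ∈ stp (Inside Ω), x ∈ dI J := fun ⟨J, hJ, hxJ⟩ =>
            hx (dI_subset_tri J |>.trans hJ.1 <| hxJ)
          rw [jx, dif_neg this, hJ]
        · exact hx.elim
  rw [this]
  refine MeasurableSet.union ?_ ?_
  · split_ifs
    exacts [measurableSet_dI J, MeasurableSet.empty]
  · split_ifs
    exacts [h.isOpen.measurableSet.compl, MeasurableSet.empty]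

/-- The good part of a function at frequency `ξ`. -/
def gd (Ω : Set ℝ) (f : ℝ → ℂ) (ξ : ℝ) : ℝ → ℂ :=
  Ω.indicator fun x => eChar ξ x * mn f ξ (jx Ω x)

lemma measurable_gain_jx {F Ω : Set ℝ} {δ : ℝ} (h : Exc F Ω δ) (k : ℤ) :
    Measurable fun x => gain (jx Ω x).1 k :=
  (measurable_of_countable fun J : ℤ × ℤ => gain J.1 k).comp h.measurable_jx

lemma integrable_gain_wt {F Ω : Set ℝ} {δ : ℝ} (h : Exc F Ω δ) (p : Tile) :
    Integrable fun x => gain (jx Ω x).1 p.1 * wt p x ^ 3 :=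
  (integrable_wt_pow p three_ne_zero).bdd_mul (c := 1)
    (measurable_gain_jx h _).aestronglyMeasurable (Eventually.of_forall fun x => by
      rw [Real.norm_of_nonneg (gain_pos _ _).le]; exact gain_le_one _ _)

section
variable {F Ω : Set ℝ} {δ : ℝ} {f : ℝ → ℂ}

lemma measurable_gd (h : Exc F Ω δ) (ξ : ℝ) : Measurable (gd Ω f ξ) :=
  ((continuous_eChar ξ).measurable.mul
    ((measurable_of_countable (mn f ξ)).comp h.measurable_jx)).indicator h.isOpen.measurableSet

lemma norm_gd_le (h : Exc F Ω δ) (hF : MeasurableSet F) (hf : Integrable f)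
    (hfF : ∀ x, ‖f x‖ ≤ F.indicator 1 x) (ξ x : ℝ) :
    ‖gd Ω f ξ x‖ ≤ Ω.indicator (fun _ => 4 * δ) x := by
  unfold gd
  by_cases hx : x ∈ Ω
  · rw [indicator_of_mem hx, indicator_of_mem hx, norm_mul, norm_eChar, one_mul]
    exact norm_mn_le h (h.jx_mem hx).1 hF hf hfF ξ
  · rw [indicator_of_notMem hx, indicator_of_notMem hx, norm_zero]

lemma integrable_gd (h : Exc F Ω δ) (hF : MeasurableSet F) (hf : Integrable f)
    (hfF : ∀ x, ‖f x‖ ≤ F.indicator 1 x) (ξ : ℝ) : Integrable (gd Ω f ξ) :=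
  ((integrableOn_const h.fin.ne enorm_ne_top).integrable_indicator h.isOpen.measurableSet).mono'
    (measurable_gd h ξ).aestronglyMeasurable
    (Eventually.of_forall (norm_gd_le h hF hf hfF ξ))

lemma integral_bad_le (hψ : IsPacket C ψ) (h : Exc F Ω δ) (hF : MeasurableSet F)
    (hf : Integrable f) (hfF : ∀ x, ‖f x‖ ≤ F.indicator 1 x) {ξ : ℝ} {p : Tile}
    (hξ : ξ ∈ Om p) (hp : ¬ Inside Ω (p.1, p.2.1)) :
    ‖∫ x, (f x - gd Ω f ξ x) * conj (ψ p x)‖ ≤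
      2 ^ 15 * C * δ * ∫ x in Ω, gain (jx Ω x).1 p.1 * wt p x ^ 3 := by
  have hoff : ∀ x ∉ Ω, (f x - gd Ω f ξ x) * conj (ψ p x) = 0 := by
    intro x hx
    have h1 := hfF x
    rw [indicator_of_notMem (fun hx' => hx (h.subset hx'))] at h1
    rw [norm_le_zero_iff.1 h1, gd, indicator_of_notMem hx, sub_zero, zero_mul]
  have hU : ⋃ J : stp (Inside Ω), dI J = Ω := by 
    rw [← biUnion_eq_iUnion (stp (Inside Ω)) fun J _ => dI J, h.iUnion_stp]
  have hd : Pairwise (Function.onFun Disjoint fun J : stp (Inside Ω) => dI J) := by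
    intro J J' hne
    exact stp_pairwiseDisjoint Inside.mono J.2 J'.2 (fun h => hne (Subtype.ext h))
  have hm : ∀ J : stp (Inside Ω), MeasurableSet (dI J) := fun J => measurableSet_dI _
  have hi : Integrable (fun x => (f x - gd Ω f ξ x) * conj (ψ p x)) :=
    hψ.integrable_mul (hf.sub (integrable_gd h hF hf hfF ξ)) p
  have e1 := hasSum_integral_iUnion hm hd (μ := volume)
    (f := fun x => (f x - gd Ω f ξ x) * conj (ψ p x)) hi.integrableOn
  have e2 := hasSum_integral_iUnion hm hd (μ := volume)
    (f := fun x => gain (jx Ω x).1 p.1 * wt p x ^ 3) (integrable_gain_wt h p).integrableOn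
  rw [hU] at e1 e2
  rw [← setIntegral_eq_integral_of_forall_compl_eq_zero hoff, ← e1.tsum_eq]
  refine tsum_of_norm_bounded (e2.mul_left _) fun J => ?_
  have h1 : ∫ x in dI J, gain (jx Ω x).1 p.1 * wt p x ^ 3 =
      gain J.1.1 p.1 * ∫ x in dI J, wt p x ^ 3 := by
    rw [← integral_const_mul]
    refine setIntegral_congr_fun (hm J) fun x hx => ?_
    simp only [jx_eq J.2 hx]
  have h2 : ∫ x in dI J, (f x - gd Ω f ξ x) * conj (ψ p x) =
      ∫ x in dI J, (f x - eChar ξ x * mn f ξ J) * conj (ψ p x) := by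
    refine setIntegral_congr_fun (hm J) fun x hx => ?_
    have hxΩ : x ∈ Ω := J.2.1 (dI_subset_tri _ hx)
    simp only [gd, indicator_of_mem hxΩ, jx_eq J.2 hx]
  rw [h1, h2, ← mul_assoc]
  exact bad_part_le hψ h J.2 hF hf hfF hξ hp

lemma sum_gain_wt_le {T : Finset Tile} {θ : Top} (hT : IsTree T θ) (j : ℤ) (x : ℝ) :
    ∑ p ∈ T, gain j p.1 * wt p x ^ 3 ≤ 4096 * π * wtT θ x ^ 2 := by
  have h0 := wtT_nonneg θ x
  have hpi := Real.pi_pos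
  refine (sum_by_scale T _ (c := fun k => 1024 * π * wtT θ x ^ 2 * gain j k) ?_).trans ?_
  · intro k
    have hs := tree_slice (T := T) (ξ := θ.2.2) (fun p hp => (hT p hp).2) k
    have hg := gain_pos j k
    calc _ ≤ ∑ p ∈ T.filter (fun p => p.1 = k), (gain j k * (16 * wtT θ x) ^ 2) * wt p x := by
          refine Finset.sum_le_sum fun p hp => ?_
          have h1 := wt_le_wtT (hT p (Finset.mem_filter.1 hp).1).1 x
          have h2 := wt_nonneg p x
          rw [(hs p hp).1, pow_succ, ← mul_assoc]
          gcongr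
      _ ≤ (gain j k * (16 * wtT θ x) ^ 2) * (4 * π) := by
          rw [← Finset.mul_sum]
          exact mul_le_mul_of_nonneg_left (sum_slice_wt_le _ _ _ hs x) (by positivity)
      _ = _ := by ring
  · rw [← Finset.mul_sum]
    have := sum_gain_le (T.image fun p => p.1) j
    calc _ ≤ 1024 * π * wtT θ x ^ 2 * 4 := by gcongr
      _ = _ := by ring

/-- Tiles which are not inside the exceptional set have small energy. -/
lemma IsPacket.hasEnergy_exc (hψ : IsPacket C ψ) (h : Exc F Ω δ) (hF : MeasurableSet F)
    (hf : Integrable f) (hfF : ∀ x, ‖f x‖ ≤ F.indicator 1 x) {P : Finset Tile}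
    (hP : ∀ p ∈ P, ¬ Inside Ω (p.1, p.2.1)) : HasEnergy (cf ψ f) P (2 ^ 26 * C * δ) := by
  intro θ
  have hC := hψ.pos
  have hδ := h.pos
  have hpi := Real.pi_pos
  have h2 := two_zpow_pos θ.1
  set ξ := θ.2.2 with hξ
  set g := gd Ω f ξ with hg
  set T := tree2 P θ with hT
  set b : ℝ → ℂ := fun x => f x - g x with hb
  have hgi : Integrable g := integrable_gd h hF hf hfF ξ
  have hg4 : ∀ x, ‖g x‖ ≤ 4 * δ := fun x =>
    (norm_gd_le h hF hf hfF ξ x).trans (indicator_le_self' (fun _ _ => by positivity) x)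
  have hg2 : Integrable (fun x => ‖g x‖ ^ 2) := by
    simp only [pow_two]
    exact hgi.norm.mul_bdd (c := 4 * δ) hgi.norm.aestronglyMeasurable
      (Eventually.of_forall fun x => by rw [norm_norm]; exact hg4 x)
  have e1 := hψ.hasEnergy_of_le hgi hg2 hg4 P θ
  rw [← hT] at e1
  have hTT : IsTree T θ := fun p hp =>
    ⟨(mem_tree2.1 hp).2.1, Om2_subset p (mem_tree2.1 hp).2.2⟩
  set A := 2 ^ 15 * C * δ with hA
  have hA0 : 0 < A := by positivity
  set L : Tile → ℝ := fun p => ∫ x in Ω, gain (jx Ω x).1 p.1 * wt p x ^ 3 with hL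
  have hL0 : ∀ p, 0 ≤ L p := fun p => integral_nonneg fun x =>
    mul_nonneg (gain_pos _ _).le (pow_nonneg (wt_nonneg p x) 3)
  have hLpi : ∀ p, L p ≤ π * sc p := fun p => by
    refine (setIntegral_le_integral (integrable_gain_wt h p) (Eventually.of_forall fun x =>
      mul_nonneg (gain_pos _ _).le (pow_nonneg (wt_nonneg p x) 3))).trans ?_
    refine (integral_mono (integrable_gain_wt h p) (integrable_wt_pow p three_ne_zero)
      fun x => ?_).trans (integral_wt_pow_le p three_ne_zero)
    exact mul_le_of_le_one_left (pow_nonneg (wt_nonneg p x) 3) (gain_le_one _ _)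
  have hsum : ∑ p ∈ T, L p ≤ 4096 * π ^ 2 * 2 ^ θ.1 := by
    rw [hL, ← integral_finsetSum _ fun p _ => (integrable_gain_wt h p).integrableOn]
    have hi2 : Integrable fun x => 4096 * π * wtT θ x ^ 2 :=
      (integrable_wt_pow (θ.1, θ.2.1, 0) two_ne_zero).const_mul _
    calc _ ≤ ∫ x in Ω, 4096 * π * wtT θ x ^ 2 := by
          refine integral_mono ?_ hi2.integrableOn fun x => sum_gain_wt_le hTT _ x
          exact integrable_finsetSum _ fun p _ => (integrable_gain_wt h p).integrableOn
      _ ≤ ∫ x, 4096 * π * wtT θ x ^ 2 :=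
          setIntegral_le_integral hi2 (Eventually.of_forall fun x => by positivity)
      _ ≤ 4096 * π * (π * 2 ^ θ.1) := by
          rw [integral_const_mul]
          gcongr
          exact integral_wt_pow_le (θ.1, θ.2.1, 0) two_ne_zero
      _ = _ := by ring
  have e2 : ∑ p ∈ T, sc p * ‖cf ψ b p‖ ^ 2 ≤ A ^ 2 * (4096 * π ^ 3 * 2 ^ θ.1) := by
    calc _ ≤ ∑ p ∈ T, A ^ 2 * π * L p := by
          refine Finset.sum_le_sum fun p hp => ?_
          have hs := sc_pos p
          have h1 := integral_bad_le hψ h hF hf hfF (hTT p hp).2 (hP p (mem_tree2.1 hp).1)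
          have h3 : ‖cf ψ b p‖ ≤ (sc p)⁻¹ * (A * L p) := by
            unfold cf
            rw [norm_mul, Complex.norm_real, Real.norm_of_nonneg (by positivity)]
            gcongr
          have hl := hL0 p
          calc sc p * ‖cf ψ b p‖ ^ 2 ≤ sc p * ((sc p)⁻¹ * (A * L p)) ^ 2 := by gcongr
            _ = A ^ 2 * (sc p)⁻¹ * L p * L p := by field_simp
            _ ≤ A ^ 2 * (sc p)⁻¹ * (π * sc p) * L p := by
                gcongr; exact hLpi p
            _ = _ := by field_simp
      _ ≤ A ^ 2 * π * (4096 * π ^ 2 * 2 ^ θ.1) := by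
          rw [← Finset.mul_sum]; gcongr
      _ = _ := by ring
  have hcf : ∀ p, cf ψ f p = cf ψ g p + cf ψ b p := by
    intro p
    rw [← hψ.cf_add hgi (show Integrable b from hf.sub hgi)]
    congr 1; ext x
    simp [hb]
  calc ∑ p ∈ T, sc p * ‖cf ψ f p‖ ^ 2
      ≤ ∑ p ∈ T, (2 * (sc p * ‖cf ψ g p‖ ^ 2) + 2 * (sc p * ‖cf ψ b p‖ ^ 2)) := by
        refine Finset.sum_le_sum fun p _ => ?_
        have hs := sc_pos p
        rw [hcf]
        have h := norm_add_le (cf ψ g p) (cf ψ b p)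
        have h' : ‖cf ψ g p + cf ψ b p‖ ^ 2 ≤ 2 * ‖cf ψ g p‖ ^ 2 + 2 * ‖cf ψ b p‖ ^ 2 := by
          refine (pow_le_pow_left₀ (norm_nonneg _) h 2).trans ?_
          nlinarith [sq_nonneg (‖cf ψ g p‖ - ‖cf ψ b p‖)]
        nlinarith
    _ ≤ 2 * ((40 * C * (4 * δ)) ^ 2 * 2 ^ θ.1) + 2 * (A ^ 2 * (4096 * π ^ 3 * 2 ^ θ.1)) := by
        rw [Finset.sum_add_distrib, ← Finset.mul_sum, ← Finset.mul_sum]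
        gcongr
    _ = (51200 + 2 ^ 43 * π ^ 3) * (C ^ 2 * δ ^ 2 * 2 ^ θ.1) := by rw [hA]; ring
    _ ≤ 2 ^ 52 * (C ^ 2 * δ ^ 2 * 2 ^ θ.1) := by
        gcongr
        have := Real.pi_lt_d2
        have h3 : π ^ 3 ≤ 3.15 ^ 3 := by gcongr
        linarith
    _ = _ := by ring

lemma avg_mul_wt_le (h : Exc F Ω δ) (hF : MeasurableSet F) (hf : Integrable f)
    (hfF : ∀ x, ‖f x‖ ≤ F.indicator 1 x) (p : Tile) {x : ℝ} (hx : x ∉ Ω) :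
    (sc p)⁻¹ * (∫ y, ‖f y‖ * wt p y) * wt p x ≤ 16 * δ := by
  have hδ := h.pos
  have hs := sc_pos p
  have h0 := two_zpow_pos (-p.1)
  have hsc : (sc p)⁻¹ = 2 ^ (-p.1) := by rw [zpow_neg]; rfl
  have hA := Av_le_of_closedBall (u := F.indicator 1) (measurable_one.indicator hF)
    (x := x) (l := 8 * δ) (by positivity) p.1 (fun r hr => by
      rw [lintegral_indicator_one hF, Measure.restrict_apply hF, mul_div_cancel_left₀ _ (by simp)]
      exact h.small x hx r ((two_zpow_pos _).trans_le hr))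
  rw [← ENNReal.ofReal_le_ofReal_iff (by positivity)]
  have hi : Integrable fun y => ‖f y‖ * wt p y * wt p x :=
    (hf.norm.mul_bdd (c := 1) (continuous_wt p).aestronglyMeasurable
      (Eventually.of_forall fun y => by
        rw [Real.norm_of_nonneg (wt_nonneg p y)]; exact wt_le_one p y)).mul_const _
  have hnn : ∀ y, 0 ≤ ‖f y‖ * wt p y * wt p x := fun y => by
    have := wt_nonneg p y
    have := wt_nonneg p x
    positivity
  rw [mul_assoc, ← integral_mul_const, hsc, ENNReal.ofReal_mul h0.le,
    ofReal_integral_eq_lintegral_ofReal hi (Eventually.of_forall hnn)]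
  calc _ ≤ ofReal (2 ^ (-p.1)) * ∫⁻ y, 2 *
        (F.indicator 1 y * ofReal (W (2 ^ (-p.1) * (x - y)))) := by
        gcongr with y
        have h1 := hfF y
        by_cases hy : y ∈ F
        · rw [indicator_of_mem hy] at h1 ⊢
          simp only [Pi.one_apply] at h1 ⊢
          rw [one_mul, show (2 : ℝ≥0∞) = ofReal 2 by simp,
            ← ENNReal.ofReal_mul (by norm_num)]
          apply ENNReal.ofReal_le_ofReal
          have h2 := W_mul_le' ((2 : ℝ) ^ (-p.1) * x - p.2.1) ((2 : ℝ) ^ (-p.1) * y - p.2.1)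
          rw [show (2 : ℝ) ^ (-p.1) * x - p.2.1 - ((2 : ℝ) ^ (-p.1) * y - p.2.1) =
            2 ^ (-p.1) * (x - y) by ring] at h2
          have h3 := wt_nonneg p y
          have h4 := wt_nonneg p x
          change wt p x * wt p y ≤ _ at h2
          calc ‖f y‖ * wt p y * wt p x ≤ 1 * wt p y * wt p x := by gcongr
            _ ≤ _ := by linarith
        · rw [indicator_of_notMem hy] at h1
          rw [norm_le_zero_iff.1 h1]; simp
    _ = 2 * Av p.1 (F.indicator 1) x := by
        rw [lintegral_const_mul' _ _ (by simp), Av]; ring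
    _ ≤ 2 * ofReal (8 * δ) := by gcongr
    _ = _ := by
        rw [show (2 : ℝ≥0∞) = ofReal 2 by simp, ← ENNReal.ofReal_mul (by norm_num)]
        congr 1; ring

lemma IsPacket.cf_mul_le_of_notMem (hψ : IsPacket C ψ) (h : Exc F Ω δ) (hF : MeasurableSet F)
    (hf : Integrable f) (hfF : ∀ x, ‖f x‖ ≤ F.indicator 1 x) (p : Tile) {x : ℝ} (hx : x ∉ Ω) :
    ‖cf ψ f p‖ * ‖ψ p x‖ ≤ 16 * C ^ 2 * δ * wt p x ^ 2 := by
  have hC := hψ.pos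
  have h1 := hψ.norm_cf_le hf p (j := 1) (by norm_num)
  simp only [pow_one] at h1
  have h2 := hψ.decay' (show 3 ≤ 8 by norm_num) p x
  have h3 := avg_mul_wt_le h hF hf hfF p hx
  have h4 := wt_nonneg p x
  calc ‖cf ψ f p‖ * ‖ψ p x‖ ≤ ((sc p)⁻¹ * (C * ∫ y, ‖f y‖ * wt p y)) * (C * wt p x ^ 3) :=
        mul_le_mul h1 h2 (norm_nonneg _) ((norm_nonneg _).trans h1)
    _ = C ^ 2 * wt p x ^ 2 * ((sc p)⁻¹ * (∫ y, ‖f y‖ * wt p y) * wt p x) := by ring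
    _ ≤ C ^ 2 * wt p x ^ 2 * (16 * δ) := by gcongr
    _ = _ := by ring

/-- The spatial index of a tile. -/
def ix (p : Tile) : ℤ × ℤ := (p.1, p.2.1)

lemma sum_trF_le {N : ℝ → ℝ} {a : Tile → ℂ} (P : Finset Tile) (x : ℝ) {c : ℤ × ℤ → ℝ}
    (hc : ∀ p ∈ P, ‖a p‖ * ‖ψ p x‖ ≤ c (ix p)) (hc0 : ∀ J, 0 ≤ c J) :
    ‖trF ψ N a P x‖ ≤ ∑ J ∈ P.image ix, c J := by
  classical
  unfold trF
  refine (norm_sum_le _ _).trans ?_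
  rw [← Finset.sum_fiberwise_of_maps_to (g := ix) (t := P.image ix)
    (fun p hp => Finset.mem_image_of_mem _ hp)]
  refine Finset.sum_le_sum fun J _ => ?_
  set Q := P.filter fun p => ix p = J with hQ
  by_cases hx : ∃ p ∈ Q, N x ∈ Om2 p
  · obtain ⟨p, hp, hpx⟩ := hx
    rw [Finset.sum_eq_single_of_mem p hp]
    · have hp' := Finset.mem_filter.1 hp
      rw [indicator_of_mem (show x ∈ N ⁻¹' Om2 p from hpx), norm_mul, ← hp'.2]
      exact hc p hp'.1
    · intro q hq hqp
      rw [indicator_of_notMem, mul_zero, norm_zero]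
      intro hqx
      apply hqp
      have e : ix q = ix p := (Finset.mem_filter.1 hq).2.trans (Finset.mem_filter.1 hp).2.symm
      have e1 : q.1 = p.1 := (Prod.ext_iff.1 e).1
      have e2 : q.2.1 = p.2.1 := (Prod.ext_iff.1 e).2
      have h1 := Om2_subset q hqx
      have h2 := Om2_subset p hpx
      unfold Om at h1 h2
      rw [e1] at h1
      exact Prod.ext e1 (Prod.ext e2 (dy_inj h1 h2))
  · refine le_of_eq_of_le (Finset.sum_eq_zero fun p hp => ?_) (hc0 J)
    rw [indicator_of_notMem (show x ∉ N ⁻¹' Om2 p from fun h => hx ⟨p, hp, h⟩), mul_zero, norm_zero]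

lemma sum_len_le (S : Finset (ℤ × ℤ)) {z D : ℝ} (hD : 0 ≤ D) (hS : ∀ J ∈ S, z ∈ dI J)
    (hSD : ∀ J ∈ S, (2 : ℝ) ^ J.1 ≤ D) : ∑ J ∈ S, (2 : ℝ) ^ J.1 ≤ 2 * D := by
  classical
  rcases S.eq_empty_or_nonempty with rfl | hne
  · simp only [Finset.sum_empty]; positivity
  obtain ⟨J₀, hJ₀, hmax⟩ := S.exists_max_image (fun J => J.1) hne
  have hinj : Set.InjOn (fun J : ℤ × ℤ => J.1) S := by
    intro J hJ J' hJ' e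
    have h1 := hS J hJ
    have h2 := hS J' hJ'
    unfold dI at h1 h2
    rw [show J.1 = J'.1 from e] at h1
    exact Prod.ext e (dy_inj h1 h2)
  have := sum_two_zpow_le (S.image fun J => J.1) (K := J₀.1) (fun k hk => by
    obtain ⟨J, hJ, rfl⟩ := Finset.mem_image.1 hk
    exact hmax J hJ)
  rw [Finset.sum_image hinj] at this
  linarith [hSD J₀ hJ₀]

lemma Exc.lintegral_compl_le (h : Exc F Ω δ) (S : Finset (ℤ × ℤ)) (hS : ∀ J ∈ S, Inside Ω J) :
    ∑ J ∈ S, ∫⁻ x in Ωᶜ, ofReal (wt (J.1, J.2, 0) x ^ 2) ≤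
      ofReal (32 * π) * volume Ω := by
  classical
  have hpi := Real.pi_pos
  set D : ℝ → ℝ := fun z => Metric.infDist z Ωᶜ with hD
  have hne : Ωᶜ.Nonempty := by
    rw [nonempty_compl]
    rintro rfl
    simpa using h.fin
  have hDJ : ∀ J ∈ S, ∀ z ∈ dI J, (2 : ℝ) ^ J.1 ≤ D z := by
    intro J hJ z hz
    refine (Metric.le_infDist hne).2 fun x hx => ?_
    by_contra! hcon
    apply hx
    apply hS J hJ
    have h1 := mem_dy.1 hz
    rw [Real.dist_eq, abs_lt] at hcon
    constructor
    · nlinarith [h1.1, h1.2, hcon.1, hcon.2]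
    · nlinarith [h1.1, h1.2, hcon.1, hcon.2]
  have hDm : Measurable D := (Metric.continuous_infDist_pt _).measurable
  have hpt : ∀ J ∈ S, ∀ z ∈ dI J, ∫⁻ x in Ωᶜ, ofReal (wt (J.1, J.2, 0) x ^ 2) ≤
      ofReal (16 * π * (2 ^ J.1 / D z)) * ofReal (2 ^ J.1) := by
    intro J hJ z hz
    have h2 := two_zpow_pos J.1
    have h2' := two_zpow_pos (-J.1)
    have hDz := hDJ J hJ z hz
    have hDp : 0 < D z := h2.trans_le hDz
    have hd1 : 2 ^ J.1 / D z ≤ 1 := (div_le_one hDp).2 hDz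
    have hd0 : 0 < 2 ^ J.1 / D z := by positivity
    have hi : Integrable fun x => 16 * (2 ^ J.1 / D z) * W (2 ^ (-J.1) * x - 2 ^ (-J.1) * z) :=
      (integrable_W_affine h2'.ne' _).const_mul _
    calc _ ≤ ∫⁻ x in Ωᶜ, ofReal
          (16 * (2 ^ J.1 / D z) * W (2 ^ (-J.1) * x - 2 ^ (-J.1) * z)) := by
          refine setLIntegral_mono' h.isOpen.measurableSet.compl fun x hx => ?_
          apply ENNReal.ofReal_le_ofReal
          have h3 := wt_le_of_mem (q := (J.1, J.2, 0)) (x := x) (y := z) hz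
          rw [mul_sub] at h3
          set b := (2 : ℝ) ^ (-J.1) * x - 2 ^ (-J.1) * z with hb
          have h4 : D z ≤ |x - z| := by
            rw [abs_sub_comm]; exact Metric.infDist_le_dist_of_mem hx
          have h5 : (2 ^ J.1 / D z)⁻¹ ≤ |b| := by
            rw [hb, ← mul_sub, abs_mul, abs_of_pos h2', inv_div, zpow_neg, div_eq_inv_mul]
            gcongr
          have h6 : W b ≤ 2 ^ J.1 / D z := by
            have h7 : 1 ≤ |b| := (one_le_inv₀ hd0 |>.2 hd1).trans h5
            calc W b ≤ |b|⁻¹ := by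
                  unfold W
                  rw [← sq_abs b]
                  gcongr
                  nlinarith
              _ ≤ _ := inv_le_of_inv_le₀ hd0 h5
          have h8 := wt_nonneg (J.1, J.2, 0) x
          have h9 := W_nonneg b
          calc wt (J.1, J.2, 0) x ^ 2 ≤ (4 * W b) ^ 2 := by gcongr
            _ = 16 * W b * W b := by ring
            _ ≤ _ := by gcongr
      _ ≤ ∫⁻ x, ofReal
          (16 * (2 ^ J.1 / D z) * W (2 ^ (-J.1) * x - 2 ^ (-J.1) * z)) :=
          setLIntegral_le_lintegral _ _
      _ = _ := by
          rw [← ofReal_integral_eq_lintegral_ofReal hi (Eventually.of_forall fun x => by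
            have := W_nonneg (2 ^ (-J.1) * x - 2 ^ (-J.1) * z)
            positivity), integral_const_mul, integral_W_affine h2', ← ENNReal.ofReal_mul
            (by positivity), zpow_neg, div_inv_eq_mul]
          congr 1; ring
  have hJ : ∀ J ∈ S, ∫⁻ x in Ωᶜ, ofReal (wt (J.1, J.2, 0) x ^ 2) ≤
      ∫⁻ z, (dI J).indicator (fun z => ofReal (16 * π * (2 ^ J.1 / D z))) z := by
    intro J hJS
    have h2 := two_zpow_pos J.1
    rw [lintegral_indicator (measurableSet_dI J)]
    have h3 : ofReal (2 ^ J.1) ≠ 0 := by simpa using h2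
    rw [← ENNReal.mul_le_mul_iff_left h3 ENNReal.ofReal_ne_top]
    calc _ = ∫⁻ z in dI J, ∫⁻ x in Ωᶜ, ofReal (wt (J.1, J.2, 0) x ^ 2) := by
          rw [setLIntegral_const, dI, volume_dy]
      _ ≤ _ := setLIntegral_mono' (measurableSet_dI J) fun z hz => hpt J hJS z hz
      _ = _ := lintegral_mul_const' _ _ ENNReal.ofReal_ne_top
  calc _ ≤ ∑ J ∈ S, ∫⁻ z, (dI J).indicator
        (fun z => ofReal (16 * π * (2 ^ J.1 / D z))) z := Finset.sum_le_sum hJ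
    _ = ∫⁻ z, ∑ J ∈ S, (dI J).indicator
        (fun z => ofReal (16 * π * (2 ^ J.1 / D z))) z := by
        rw [lintegral_finsetSum _ fun J _ => ?_]
        refine Measurable.indicator ?_ (measurableSet_dI J)
        fun_prop
    _ ≤ ∫⁻ z, Ω.indicator (fun _ => ofReal (32 * π)) z := by
        refine lintegral_mono fun z => ?_
        by_cases hz : z ∈ Ω
        · rw [indicator_of_mem hz]
          set S' := S.filter fun J => z ∈ dI J
          have h1 : ∑ J ∈ S, (dI J).indicator
              (fun z => ofReal (16 * π * (2 ^ J.1 / D z))) z =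
              ∑ J ∈ S', ofReal (16 * π * (2 ^ J.1 / D z)) := by
            rw [Finset.sum_filter]
            refine Finset.sum_congr rfl fun J _ => ?_
            rw [indicator_apply]
          have hD0 : 0 ≤ D z := Metric.infDist_nonneg
          change ∑ J ∈ S, (dI J).indicator
              (fun z => ofReal (16 * π * (2 ^ J.1 / D z))) z ≤ _
          rw [h1, ← ENNReal.ofReal_sum_of_nonneg fun J _ => by
            have := two_zpow_pos J.1
            positivity]
          apply ENNReal.ofReal_le_ofReal
          rw [← Finset.mul_sum, ← Finset.sum_div]
          have h3 := sum_len_le S' hD0 (fun J hJ => (Finset.mem_filter.1 hJ).2)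
            (fun J hJ => hDJ J (Finset.mem_filter.1 hJ).1 z (Finset.mem_filter.1 hJ).2)
          have h4 : (∑ J ∈ S', (2 : ℝ) ^ J.1) / D z ≤ 2 := div_le_of_le_mul₀ hD0 (by norm_num) h3
          nlinarith
        · rw [indicator_of_notMem hz]
          refine le_of_eq (Finset.sum_eq_zero fun J hJ => ?_)
          exact indicator_of_notMem (fun hzJ => hz (hS J hJ (dI_subset_tri J hzJ))) _
    _ = _ := by rw [lintegral_indicator h.isOpen.measurableSet, setLIntegral_const]

/-- Tiles well inside the exceptional set contribute little outside of it. -/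
lemma IsPacket.lintegral_compl_le (hψ : IsPacket C ψ) {N : ℝ → ℝ} (h : Exc F Ω δ)
    (hF : MeasurableSet F) (hf : Integrable f) (hfF : ∀ x, ‖f x‖ ≤ F.indicator 1 x)
    {P : Finset Tile} (hP : ∀ p ∈ P, Inside Ω (ix p)) :
    ∫⁻ x in Ωᶜ, ‖trF ψ N (cf ψ f) P x‖ₑ ≤
      ofReal (2 ^ 11 * C ^ 2 * δ) * volume Ω := by
  classical
  have hC := hψ.pos
  have hδ := h.pos
  have hpi := Real.pi_pos
  set M := 16 * C ^ 2 * δ with hM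
  have hM0 : 0 < M := by positivity
  calc ∫⁻ x in Ωᶜ, ‖trF ψ N (cf ψ f) P x‖ₑ
      ≤ ∫⁻ x in Ωᶜ, ∑ J ∈ P.image ix, ofReal M *
          ofReal (wt (J.1, J.2, 0) x ^ 2) := by
        refine setLIntegral_mono' h.isOpen.measurableSet.compl fun x hx => ?_
        have h1 := sum_trF_le (N := N) (a := cf ψ f) (ψ := ψ) P x
          (c := fun J => M * wt (J.1, J.2, 0) x ^ 2)
          (fun p _ => hψ.cf_mul_le_of_notMem h hF hf hfF p hx)
          (fun J => by have := wt_nonneg (J.1, J.2, 0) x; positivity)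
        rw [← ofReal_norm]
        refine (ENNReal.ofReal_le_ofReal h1).trans (le_of_eq ?_)
        rw [ENNReal.ofReal_sum_of_nonneg fun J _ => by
          have := wt_nonneg (J.1, J.2, 0) x; positivity]
        exact Finset.sum_congr rfl fun J _ => ENNReal.ofReal_mul hM0.le
    _ = ofReal M * ∑ J ∈ P.image ix,
          ∫⁻ x in Ωᶜ, ofReal (wt (J.1, J.2, 0) x ^ 2) := by
        rw [lintegral_finsetSum _ fun J _ => ?_, Finset.mul_sum]
        · exact Finset.sum_congr rfl fun J _ => lintegral_const_mul' _ _ ENNReal.ofReal_ne_top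
        · have := (continuous_wt (J.1, J.2, 0)).measurable
          fun_prop
    _ ≤ ofReal M * (ofReal (32 * π) * volume Ω) := by
        gcongr
        refine h.lintegral_compl_le _ fun J hJ => ?_
        obtain ⟨p, hp, rfl⟩ := Finset.mem_image.1 hJ
        exact hP p hp
    _ ≤ _ := by
        rw [← mul_assoc, ← ENNReal.ofReal_mul hM0.le]
        refine mul_le_mul_left (ENNReal.ofReal_le_ofReal ?_) _
        rw [hM]
        have := Real.pi_lt_four
        have h1 : 0 < C ^ 2 * δ := by positivity
        nlinarith

end

lemma integrable_sq_of_le {F : Set ℝ} {f : ℝ → ℂ} (hf : Integrable f)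
    (hfF : ∀ x, ‖f x‖ ≤ F.indicator 1 x) : Integrable (fun x => ‖f x‖ ^ 2) := by
  simp only [pow_two]
  refine hf.norm.mul_bdd (c := 1) hf.norm.aestronglyMeasurable
    (Eventually.of_forall fun x => ?_)
  rw [norm_norm]
  exact (hfF x).trans (indicator_le_self' (fun _ _ => zero_le_one) x)

lemma integral_sq_le {F : Set ℝ} (hF : MeasurableSet F) {f : ℝ → ℂ} (hf : Integrable f)
    (hfF : ∀ x, ‖f x‖ ≤ F.indicator 1 x) {w : ℝ} (hw : 0 ≤ w)
    (hFw : volume F ≤ ofReal w) : ∫ x, ‖f x‖ ^ 2 ≤ w := by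
  have hfin : volume F ≠ ∞ := (hFw.trans_lt ENNReal.ofReal_lt_top).ne
  calc ∫ x, ‖f x‖ ^ 2 ≤ ∫ x, F.indicator 1 x := by
        refine integral_mono (integrable_sq_of_le hf hfF)
          ((integrableOn_const hfin (by simp)).integrable_indicator hF) fun x => ?_
        refine le_trans ?_ (hfF x)
        have h1 := (hfF x).trans (indicator_le_self' (fun _ _ => zero_le_one) x)
        exact pow_le_of_le_one (norm_nonneg _) h1 two_ne_zero
    _ = (volume F).toReal := by rw [integral_indicator_one hF, measureReal_def]
    _ ≤ w := ENNReal.toReal_le_of_le_ofReal hw hFw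

lemma szC_nonneg (hC : 0 < C) (s : ℝ) : 0 ≤ szC C s := by
  have hpi := Real.pi_pos
  unfold szC
  have : 0 ≤ ∑' n, lvl s n := tsum_nonneg fun n => by unfold lvl; positivity
  positivity

/-- The model estimate for a function supported in a set, for given energy. -/
lemma IsPacket.restricted_energy (hψ : IsPacket C ψ) {N : ℝ → ℝ} (hN : Measurable N) {F E : Set ℝ}
    (hF : MeasurableSet F) (hE : MeasurableSet E) {f : ℝ → ℂ} (hf : Integrable f)
    (hfF : ∀ x, ‖f x‖ ≤ F.indicator 1 x) {w e : ℝ} (hw : 0 < w) (he : 0 < e)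
    (hFw : volume F ≤ ofReal w) (hEe : volume E ≤ ofReal e) {P : Finset Tile}
    {A s : ℝ} (hA : 0 < A) (hs : 0 < s) (hs' : s ≤ 1) (hP : HasEnergy (cf ψ f) P A) :
    ∫⁻ x in E, ‖trF ψ N (cf ψ f) P x‖ₑ ≤
      ofReal (szC C s * (w ^ (s / 2) * A ^ (1 - s) * e ^ (1 - s / 2))) := by
  have h := model_estimate hψ hN hE (hEe.trans_lt ENNReal.ofReal_lt_top).ne hf
    (integrable_sq_of_le hf hfF) hs hs' hA (Real.sqrt_pos.2 hw) he
    (by rw [Real.sq_sqrt hw.le]; exact integral_sq_le hF hf hfF hw.le hFw)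
    (ENNReal.toReal_le_of_le_ofReal he.le hEe) hP
  rwa [Real.sqrt_eq_rpow, ← Real.rpow_mul hw.le, show 1 / 2 * s = s / 2 by ring] at h

/-- The restricted estimate of exponent `t` with constant `K`. -/
def Restricted (C t K : ℝ) : Prop :=
  ∀ ψ : Tile → ℝ → ℂ, IsPacket C ψ → ∀ N : ℝ → ℝ, Measurable N → ∀ F E : Set ℝ,
    MeasurableSet F → MeasurableSet E → ∀ f : ℝ → ℂ, Integrable f →
    (∀ x, ‖f x‖ ≤ F.indicator 1 x) → ∀ w e : ℝ, 0 < w → 0 < e →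
    volume F ≤ ofReal w → volume E ≤ ofReal e → ∀ P : Finset Tile,
    ∫⁻ x in E, ‖trF ψ N (cf ψ f) P x‖ₑ ≤ ofReal (K * (w ^ t * e ^ (1 - t)))

lemma restricted_low (hC : 0 < C) {t : ℝ} (ht : 0 < t) (ht' : t ≤ 1 / 2) :
    ∃ K, 0 ≤ K ∧ Restricted C t K := by
  refine ⟨szC C (2 * t) * (40 * C) ^ (1 - 2 * t), ?_, ?_⟩
  · have := szC_nonneg hC (2 * t)
    positivity
  intro ψ hψ N hN F E hF hE f hf hfF w e hw he hFw hEe P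
  have hP := hψ.hasEnergy_of_le hf (integrable_sq_of_le hf hfF)
    (fun x => (hfF x).trans (indicator_le_self' (fun _ _ => zero_le_one) x)) P
  rw [mul_one] at hP
  refine (hψ.restricted_energy hN hF hE hf hfF hw he hFw hEe (by positivity) (s := 2 * t)
    (by linarith) (by linarith) hP).trans (le_of_eq ?_)
  congr 1
  rw [show 2 * t / 2 = t by ring]
  ring

lemma restricted_high (hC : 0 < C) {t : ℝ} (ht : 1 / 2 < t) (ht' : t < 1) :
    ∃ K, 0 ≤ K ∧ Restricted C t K := by
  classical
  obtain ⟨K₁, hK₁, h₁⟩ := restricted_low hC (t := 1 / 2) (by norm_num) le_rfl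
  set s := 2 * (1 - t) with hs
  have hs0 : 0 < s := by rw [hs]; linarith
  have hs1 : s ≤ 1 := by rw [hs]; linarith
  set K₂ := szC C s * (2 ^ 26 * C * 40) ^ (1 - s) with hK₂
  have hK₂0 : 0 ≤ K₂ := by
    have := szC_nonneg hC s
    positivity
  set K₃ := 2 ^ 11 * C ^ 2 * 20 with hK₃
  have hK₃0 : 0 ≤ K₃ := by positivity
  set ρ := (1 / 2 : ℝ) ^ (1 - t) with hρ
  have hρ1 : ρ < 1 := Real.rpow_lt_one (by norm_num) (by norm_num) (by linarith)
  set M := 8 * K₁ + (K₂ + K₃) / (1 - ρ) with hM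
  have hdiv : 0 ≤ (K₂ + K₃) / (1 - ρ) := div_nonneg (by linarith) (by linarith)
  have hM0 : 0 ≤ M := by positivity
  refine ⟨M, hM0, ?_⟩
  intro ψ hψ N hN F E₀ hF hE₀ f hf hfF w e₀ hw he₀ hFw hEe₀ P
  have key : ∀ n : ℕ, ∀ E : Set ℝ, ∀ e : ℝ, MeasurableSet E → 0 < e →
      volume E ≤ ofReal e → e ≤ 2 ^ n * (8 * w) →
      ∫⁻ x in E, ‖trF ψ N (cf ψ f) P x‖ₑ ≤ ofReal (M * (w ^ t * e ^ (1 - t))) := by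
    have small : ∀ E : Set ℝ, ∀ e : ℝ, MeasurableSet E → 0 < e →
        volume E ≤ ofReal e → e ≤ 8 * w →
        ∫⁻ x in E, ‖trF ψ N (cf ψ f) P x‖ₑ ≤ ofReal (M * (w ^ t * e ^ (1 - t))) := by
      intro E e hE he hEe hew
      refine (h₁ ψ hψ N hN F E hF hE f hf hfF w e hw he hFw hEe P).trans
        (ENNReal.ofReal_le_ofReal ?_)
      have e1 : e ^ (1 - 1 / 2 : ℝ) = e ^ (t - 1 / 2) * e ^ (1 - t) := by
        rw [← Real.rpow_add he]; congr 1; ring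
      have e2 : e ^ (t - 1 / 2) ≤ 8 * w ^ (t - 1 / 2) := by
        calc e ^ (t - 1 / 2) ≤ (8 * w) ^ (t - 1 / 2) :=
              Real.rpow_le_rpow he.le hew (by linarith)
          _ = 8 ^ (t - 1 / 2) * w ^ (t - 1 / 2) := Real.mul_rpow (by norm_num) hw.le
          _ ≤ 8 * w ^ (t - 1 / 2) := by
              gcongr
              calc (8 : ℝ) ^ (t - 1 / 2) ≤ 8 ^ (1 : ℝ) :=
                    Real.rpow_le_rpow_of_exponent_le (by norm_num) (by linarith)
                _ = 8 := Real.rpow_one 8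
      have e3 : w ^ t = w ^ (1 / 2 : ℝ) * w ^ (t - 1 / 2) := by
        rw [← Real.rpow_add hw]; congr 1; ring
      calc K₁ * (w ^ (1 / 2 : ℝ) * e ^ (1 - 1 / 2 : ℝ))
          = K₁ * (w ^ (1 / 2 : ℝ) * (e ^ (t - 1 / 2) * e ^ (1 - t))) := by rw [e1]
        _ ≤ K₁ * (w ^ (1 / 2 : ℝ) * (8 * w ^ (t - 1 / 2) * e ^ (1 - t))) := by gcongr
        _ = 8 * K₁ * (w ^ t * e ^ (1 - t)) := by rw [e3]; ring
        _ ≤ _ := by gcongr; linarith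
    intro n
    induction n with
    | zero =>
      intro E e hE he hEe hew
      exact small E e hE he hEe (by simpa using hew)
    | succ n ih =>
      intro E e hE he hEe hew
      rcases le_or_gt e (8 * w) with h8 | h8
      · exact small E e hE he hEe h8
      set δ := 40 * w / e with hδ
      have hδ0 : 0 < δ := by positivity
      obtain ⟨Ω, hΩ, hΩv⟩ := exists_exc hF hw hδ0 hFw
      have hΩe : volume Ω ≤ ofReal (e / 2) := by
        refine hΩv.trans (ENNReal.ofReal_le_ofReal ?_)
        have : 10 / δ * w = e / 4 := by rw [hδ]; field_simp; norm_num
        rw [this]; linarith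
      have hΩm := hΩ.isOpen.measurableSet
      have hI := ih (E ∩ Ω) (e / 2) (hE.inter hΩm) (by positivity)
        ((measure_mono inter_subset_right).trans hΩe) (by rw [pow_succ] at hew; linarith)
      set Q := P.filter fun p => Inside Ω (ix p) with hQ
      have hsplit := hψ.lintegral_trF_sdiff hN (a := cf ψ f) (E \ Ω) (Finset.filter_subset
        (fun p => Inside Ω (ix p)) P)
      have hQ1 : ∫⁻ x in E \ Ω, ‖trF ψ N (cf ψ f) Q x‖ₑ ≤
          ofReal (K₃ * (w ^ t * e ^ (1 - t))) := by
        calc _ ≤ ∫⁻ x in Ωᶜ, ‖trF ψ N (cf ψ f) Q x‖ₑ :=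
              lintegral_mono_set fun x hx => hx.2
          _ ≤ ofReal (2 ^ 11 * C ^ 2 * δ) * volume Ω :=
              hψ.lintegral_compl_le hΩ hF hf hfF fun p hp => (Finset.mem_filter.1 hp).2
          _ ≤ ofReal (2 ^ 11 * C ^ 2 * δ) * ofReal (e / 2) := by gcongr
          _ = ofReal (K₃ * w) := by
              rw [← ENNReal.ofReal_mul (by positivity), hK₃, hδ]
              congr 1; field_simp; norm_num
          _ ≤ _ := by
              apply ENNReal.ofReal_le_ofReal
              have : w = w ^ t * w ^ (1 - t) := by
                rw [← Real.rpow_add hw, add_sub_cancel, Real.rpow_one]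
              have hwe : w ^ (1 - t) ≤ e ^ (1 - t) :=
                Real.rpow_le_rpow hw.le (by linarith) (by linarith)
              calc K₃ * w = K₃ * (w ^ t * w ^ (1 - t)) := by rw [← this]
                _ ≤ _ := by gcongr
      have hQ2 : ∫⁻ x in E \ Ω, ‖trF ψ N (cf ψ f) (P \ Q) x‖ₑ ≤
          ofReal (K₂ * (w ^ t * e ^ (1 - t))) := by
        have hen := hψ.hasEnergy_exc hΩ hF hf hfF (P := P \ Q) (fun p hp hin => by
          have := Finset.mem_sdiff.1 hp
          exact this.2 (Finset.mem_filter.2 ⟨this.1, hin⟩))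
        refine (hψ.restricted_energy hN hF (hE.diff hΩm) hf hfF hw he hFw
          ((measure_mono sdiff_subset).trans hEe) (by positivity) hs0 hs1 hen).trans
          (ENNReal.ofReal_le_ofReal (le_of_eq ?_))
        have e1 : (2 ^ 26 * C * δ) ^ (1 - s) = (2 ^ 26 * C * 40) ^ (1 - s) *
            (w ^ (1 - s) * e ^ (-(1 - s))) := by
          rw [show 2 ^ 26 * C * δ = 2 ^ 26 * C * 40 * (w * e⁻¹) by rw [hδ]; field_simp,
            Real.mul_rpow (by positivity) (by positivity), Real.mul_rpow hw.le (by positivity),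
            Real.inv_rpow he.le, Real.rpow_neg he.le]
        have e2 : w ^ t = w ^ (s / 2) * w ^ (1 - s) := by
          rw [← Real.rpow_add hw]; congr 1; rw [hs]; ring
        have e3 : e ^ (1 - t) = e ^ (-(1 - s)) * e ^ (1 - s / 2) := by
          rw [← Real.rpow_add he]; congr 1; rw [hs]; ring
        rw [e1, e2, e3, hK₂]; ring
      rw [← lintegral_inter_add_sdiff _ E hΩm]
      refine (add_le_add hI (hsplit.trans (add_le_add hQ1 hQ2))).trans ?_
      have hwt : 0 ≤ w ^ t * e ^ (1 - t) := by positivity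
      have hρ0 : 0 ≤ ρ := by positivity
      have e4 : (e / 2) ^ (1 - t) = ρ * e ^ (1 - t) := by
        rw [hρ, ← Real.mul_rpow (by norm_num) he.le]; congr 1; ring
      rw [e4, ← ENNReal.ofReal_add (by positivity) (by positivity), ← ENNReal.ofReal_add
        (by positivity) (by positivity)]
      apply ENNReal.ofReal_le_ofReal
      have h9 : K₂ + K₃ ≤ M * (1 - ρ) := by
        rw [hM, add_mul, div_mul_cancel₀ _ (by linarith)]
        nlinarith
      nlinarith
  obtain ⟨n, hn⟩ := pow_unbounded_of_one_lt (e₀ / (8 * w)) (one_lt_two (α := ℝ))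
  exact key n E₀ e₀ hE₀ he₀ hEe₀ (by rw [div_lt_iff₀ (by positivity)] at hn; exact hn.le)

/-- The restricted estimate holds in the full range of exponents. -/
theorem restricted (hC : 0 < C) {t : ℝ} (ht : 0 < t) (ht' : t < 1) :
    ∃ K, 0 ≤ K ∧ Restricted C t K := by
  rcases le_or_gt t (1 / 2) with h | h
  · exact restricted_low hC ht h
  · exact restricted_high hC h ht'

/-- The dyadic level sets of a nonnegative function. -/
def lev (u : ℝ → ℝ) (i : ℤ) : Set ℝ := u ⁻¹' Ico ((2 : ℝ) ^ i) (2 ^ (i + 1))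

section
variable {u : ℝ → ℝ}

lemma measurableSet_lev (hu : Measurable u) (i : ℤ) : MeasurableSet (lev u i) :=
  hu measurableSet_Ico

lemma lev_disjoint (u : ℝ → ℝ) : Pairwise (Function.onFun Disjoint (lev u)) := by
  have key : ∀ i j : ℤ, i < j → Disjoint (lev u i) (lev u j) := by
    intro i j hij
    rw [Set.disjoint_left]
    intro x hx hx'
    have h1 : u x < 2 ^ (i + 1) := hx.2
    have h2 : (2 : ℝ) ^ j ≤ u x := hx'.1
    have h3 := two_zpow_mono (show i + 1 ≤ j by omega)
    linarith
  intro i j hij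
  rcases lt_or_gt_of_ne hij with h | h
  · exact key i j h
  · exact (key j i h).symm

lemma iUnion_lev (u : ℝ → ℝ) : ⋃ i, lev u i = {x | 0 < u x} := by
  ext x
  rw [mem_iUnion]
  constructor
  · rintro ⟨i, hi⟩
    exact (two_zpow_pos i).trans_le hi.1
  · intro hx
    obtain ⟨i, hi⟩ := exists_mem_Ico_zpow hx (one_lt_two (α := ℝ))
    exact ⟨i, hi⟩

lemma tsum_lev_le (hu : Measurable u) {r : ℝ} (hr : 0 < r) :
    ∑' i, ofReal ((2 ^ i : ℝ) ^ r) * volume (lev u i) ≤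
      ∫⁻ x, ofReal (u x) ^ r := by
  calc _ ≤ ∑' i, ∫⁻ x in lev u i, ofReal (u x) ^ r := by
        refine ENNReal.tsum_le_tsum fun i => ?_
        rw [← setLIntegral_const]
        refine setLIntegral_mono' (measurableSet_lev hu i) fun x hx => ?_
        rw [← ENNReal.ofReal_rpow_of_pos (two_zpow_pos i)]
        gcongr
        exact hx.1
    _ = ∫⁻ x in ⋃ i, lev u i, ofReal (u x) ^ r :=
        (lintegral_iUnion (measurableSet_lev hu) (lev_disjoint u) _).symm
    _ ≤ _ := setLIntegral_le_lintegral _ _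

lemma lintegral_mul_le_tsum_lev (hu : Measurable u) (g : ℝ → ℝ≥0∞) :
    ∫⁻ x, g x * ofReal (u x) ≤
      ∑' i : ℤ, ofReal (2 ^ (i + 1)) * ∫⁻ x in lev u i, g x := by
  have hU : ∫⁻ x, g x * ofReal (u x) =
      ∫⁻ x in ⋃ i, lev u i, g x * ofReal (u x) := by
    rw [setLIntegral_eq_of_support_subset]
    rw [iUnion_lev]
    intro x hx
    by_contra hcon
    apply hx
    simp only
    rw [ENNReal.ofReal_of_nonpos (not_lt.1 hcon), mul_zero]
  rw [hU, lintegral_iUnion (measurableSet_lev hu) (lev_disjoint u)]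
  refine ENNReal.tsum_le_tsum fun i => ?_
  rw [← lintegral_const_mul' _ _ ENNReal.ofReal_ne_top]
  refine setLIntegral_mono' (measurableSet_lev hu i) fun x hx => ?_
  rw [mul_comm]
  gcongr
  exact hx.2.le

lemma volume_lev_ne_top (hu : Measurable u) {r : ℝ} (hr : 0 < r)
    (h : ∫⁻ x, ofReal (u x) ^ r ≠ ∞) (i : ℤ) : volume (lev u i) ≠ ∞ := by
  intro htop
  apply h
  have h1 := (ENNReal.le_tsum i).trans (tsum_lev_le hu hr)
  rw [htop, ENNReal.mul_top (by simpa using Real.rpow_pos_of_pos (two_zpow_pos i) r)] at h1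
  exact top_le_iff.1 h1

end

lemma sum_exp_le {c : ℝ} (hc : 0 < c) (s : Finset ℤ) (a : ℝ) :
    ∑ n ∈ s, Real.exp (-(c * |n - a|)) ≤ (1 + 2 / c ^ 2) * (4 * π) := by
  calc _ ≤ ∑ n ∈ s, (1 + 2 / c ^ 2) * W (n - a) := by
        refine Finset.sum_le_sum fun n _ => ?_
        set t : ℝ := n - a
        have h1 := Real.quadratic_le_exp_of_nonneg (x := c * |t|) (by positivity)
        have h2 : 1 + c ^ 2 * t ^ 2 / 2 ≤ Real.exp (c * |t|) := by
          rw [mul_pow, sq_abs] at h1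
          have : 0 ≤ c * |t| := by positivity
          linarith
        have h3 : 1 + t ^ 2 ≤ (1 + 2 / c ^ 2) * (1 + c ^ 2 * t ^ 2 / 2) := by
          have : (1 + 2 / c ^ 2) * (1 + c ^ 2 * t ^ 2 / 2) =
            1 + t ^ 2 + (2 / c ^ 2 + c ^ 2 * t ^ 2 / 2) := by field_simp; ring
          rw [this]
          have : 0 ≤ 2 / c ^ 2 + c ^ 2 * t ^ 2 / 2 := by positivity
          linarith
        unfold W
        rw [Real.exp_neg, ← div_eq_mul_inv, inv_eq_one_div, div_le_div_iff₀ (Real.exp_pos _)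
          (by positivity), one_mul]
        refine h3.trans ?_
        gcongr
    _ ≤ _ := by
        rw [← Finset.mul_sum]
        gcongr
        exact sum_W_le s a

lemma tsum_exp_le {c : ℝ} (hc : 0 < c) (a : ℝ) :
    ∑' n : ℤ, ofReal (Real.exp (-(c * |n - a|))) ≤
      ofReal ((1 + 2 / c ^ 2) * (4 * π)) := by
  rw [ENNReal.tsum_eq_iSup_sum]
  refine iSup_le fun s => ?_
  rw [← ENNReal.ofReal_sum_of_nonneg fun n _ => (Real.exp_pos _).le]
  exact ENNReal.ofReal_le_ofReal (sum_exp_le hc s a)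

lemma rpow_mul_rpow_le_add {a b t : ℝ} (ha : 0 ≤ a) (hb : 0 ≤ b) (ht : 0 < t) (ht' : t < 1) :
    a ^ t * b ^ (1 - t) ≤ a + b := by
  have := Real.geom_mean_le_arith_mean2_weighted ht.le (by linarith : 0 ≤ 1 - t) ha hb (by ring)
  nlinarith

lemma interp_identity {x y a b p q t : ℝ} (hx : 0 < x) (hy : 0 < y) (ha : 0 ≤ a) (hb : 0 ≤ b) :
    x * y * (a ^ t * b ^ (1 - t)) = Real.exp ((1 - p * t) * Real.log x +
      (1 - q * (1 - t)) * Real.log y) * ((x ^ p * a) ^ t * (y ^ q * b) ^ (1 - t)) := by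
  have h1 : Real.exp ((1 - p * t) * Real.log x + (1 - q * (1 - t)) * Real.log y) =
      x ^ (1 - p * t) * y ^ (1 - q * (1 - t)) := by
    rw [Real.exp_add, mul_comm (1 - p * t), mul_comm (1 - q * (1 - t)),
      ← Real.rpow_def_of_pos hx, ← Real.rpow_def_of_pos hy]
  rw [h1, Real.mul_rpow (by positivity) ha, Real.mul_rpow (by positivity) hb,
    ← Real.rpow_mul hx.le, ← Real.rpow_mul hy.le]
  have h2 : x ^ (1 - p * t) * x ^ (p * t) = x := by
    rw [← Real.rpow_add hx, sub_add_cancel, Real.rpow_one]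
  have h3 : y ^ (1 - q * (1 - t)) * y ^ (q * (1 - t)) = y := by
    rw [← Real.rpow_add hy, sub_add_cancel, Real.rpow_one]
  calc x * y * (a ^ t * b ^ (1 - t)) = (x ^ (1 - p * t) * x ^ (p * t)) *
        (y ^ (1 - q * (1 - t)) * y ^ (q * (1 - t))) * (a ^ t * b ^ (1 - t)) := by rw [h2, h3]
    _ = _ := by ring

lemma interp_term {x y a b p q η X K : ℝ} (hx : 0 < x) (hy : 0 < y) (ha : 0 ≤ a) (hb : 0 ≤ b)
    (hpq : p.HolderConjugate q) (hη : 0 < η) (hη1 : η < p⁻¹) (hη2 : η < q⁻¹) (hK : 0 ≤ K)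
    (h1 : X ≤ K * (a ^ (p⁻¹ + η) * b ^ (1 - (p⁻¹ + η))))
    (h2 : X ≤ K * (a ^ (p⁻¹ - η) * b ^ (1 - (p⁻¹ - η)))) :
    x * y * X ≤ K * (Real.exp (-(η * |p * Real.log x - q * Real.log y|)) *
      (x ^ p * a + y ^ q * b)) := by
  have hp := hpq.pos
  have hq := hpq.symm.pos
  have hs : p⁻¹ + q⁻¹ = 1 := hpq.inv_add_inv_eq_one
  have hqi : q⁻¹ = 1 - p⁻¹ := by linarith
  have hpp : p * p⁻¹ = 1 := mul_inv_cancel₀ hp.ne'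
  have hqq : q * (1 - p⁻¹) = 1 := by rw [← hqi]; exact mul_inv_cancel₀ hq.ne'
  have key : ∀ t : ℝ, 0 < t → t < 1 → X ≤ K * (a ^ t * b ^ (1 - t)) →
      (1 - p * t) * Real.log x + (1 - q * (1 - t)) * Real.log y ≤
        -(η * |p * Real.log x - q * Real.log y|) →
      x * y * X ≤ K * (Real.exp (-(η * |p * Real.log x - q * Real.log y|)) *
      (x ^ p * a + y ^ q * b)) := by
    intro t ht0 ht1 hX hle
    calc x * y * X ≤ x * y * (K * (a ^ t * b ^ (1 - t))) := by gcongr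
      _ = K * (x * y * (a ^ t * b ^ (1 - t))) := by ring
      _ ≤ _ := by
          rw [interp_identity (p := p) (q := q) hx hy ha hb]
          gcongr
          exact rpow_mul_rpow_le_add (by positivity) (by positivity) ht0 ht1
  rcases le_total 0 (p * Real.log x - q * Real.log y) with h | h
  · refine key _ (by have := inv_pos.2 hp; linarith) (by linarith) h1 (le_of_eq ?_)
    rw [abs_of_nonneg h]
    linear_combination (-Real.log x) * hpp - Real.log y * hqq
  · refine key _ (by linarith) (by have := inv_pos.2 hq; linarith) h2 (le_of_eq ?_)
    rw [abs_of_nonpos h]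
    linear_combination (-Real.log x) * hpp - Real.log y * hqq

lemma cf_const_mul (ψ : Tile → ℝ → ℂ) (c : ℂ) (f : ℝ → ℂ) (p : Tile) :
    cf ψ (fun x => c * f x) p = c * cf ψ f p := by
  unfold cf
  simp only [mul_assoc]
  rw [integral_const_mul]
  ring

lemma trF_cf_const_mul (ψ : Tile → ℝ → ℂ) (N : ℝ → ℝ) (c : ℂ) (f : ℝ → ℂ) (P : Finset Tile) (x : ℝ) :
    trF ψ N (cf ψ fun x => c * f x) P x = c * trF ψ N (cf ψ f) P x := by
  unfold trF
  rw [Finset.mul_sum]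
  exact Finset.sum_congr rfl fun p _ => by rw [cf_const_mul, mul_assoc]

lemma trF_cf_eq_zero (ψ : Tile → ℝ → ℂ) (N : ℝ → ℝ) {f : ℝ → ℂ} (hf : f =ᵐ[volume] 0)
    (P : Finset Tile) (x : ℝ) : trF ψ N (cf ψ f) P x = 0 := by
  unfold trF
  refine Finset.sum_eq_zero fun p _ => ?_
  have : cf ψ f p = 0 := by
    unfold cf
    rw [integral_eq_zero_of_ae, mul_zero]
    filter_upwards [hf] with x hx
    simp [hx]
  rw [this, zero_mul]

lemma Restricted.real_bound {t K : ℝ} (hK : Restricted C t K) (hψ : IsPacket C ψ) {N : ℝ → ℝ}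
    (hN : Measurable N) {F E : Set ℝ} (hF : MeasurableSet F) (hE : MeasurableSet E)
    (hF' : volume F ≠ ∞) (hE' : volume E ≠ ∞) {f : ℝ → ℂ} (hf : Integrable f)
    {c : ℝ} (hc : 0 < c) (hfF : ∀ x, ‖f x‖ ≤ c * F.indicator 1 x) (P : Finset Tile) :
    ∫⁻ x in E, ‖trF ψ N (cf ψ f) P x‖ₑ ≤
      ofReal (c * (K * (volume.real F ^ t * volume.real E ^ (1 - t)))) := by
  rcases eq_or_ne (volume E) 0 with hE0 | hE0
  · rw [setLIntegral_measure_zero _ _ hE0]; exact zero_le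
  rcases eq_or_ne (volume F) 0 with hF0 | hF0
  · have : f =ᵐ[volume] 0 := by
      filter_upwards [measure_eq_zero_iff_ae_notMem.1 hF0] with x hx
      have := hfF x
      rw [indicator_of_notMem hx, mul_zero] at this
      exact norm_le_zero_iff.1 this
    simp [trF_cf_eq_zero ψ N this]
  have hfe : f = fun x => (c : ℂ) * (((c⁻¹ : ℝ) : ℂ) * f x) := by
    ext x
    rw [← mul_assoc, ← Complex.ofReal_mul, mul_inv_cancel₀ hc.ne']; simp
  have h1 := hK ψ hψ N hN F E hF hE (fun x => ((c⁻¹ : ℝ) : ℂ) * f x) (hf.const_mul _)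
    (fun x => by
      rw [norm_mul, Complex.norm_real, Real.norm_of_nonneg (inv_pos.2 hc).le,
        inv_mul_le_iff₀ hc]
      exact hfF x) (volume.real F) (volume.real E)
    (ENNReal.toReal_pos hF0 hF') (ENNReal.toReal_pos hE0 hE')
    (by rw [Measure.real, ENNReal.ofReal_toReal hF'])
    (by rw [Measure.real, ENNReal.ofReal_toReal hE']) P
  rw [hfe]
  simp only [trF_cf_const_mul ψ N (c : ℂ), enorm_mul]
  rw [lintegral_const_mul' _ _ enorm_ne_top, ENNReal.ofReal_mul hc.le]
  have : ‖(c : ℂ)‖ₑ = ofReal c := by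
    rw [← ofReal_norm, Complex.norm_real, Real.norm_of_nonneg hc.le]
  rw [this]
  exact mul_le_mul_right h1 _

lemma IsPacket.hasSum_cf_lev (hψ : IsPacket C ψ) {f : ℝ → ℂ} (hf : Integrable f)
    (hm : Measurable f) (p : Tile) :
    HasSum (fun i : ℤ => cf ψ ((lev (fun x => ‖f x‖) i).indicator f) p) (cf ψ f p) := by
  unfold cf
  have h := hasSum_integral_iUnion (f := fun x => f x * conj (ψ p x))
    (measurableSet_lev hm.norm) (lev_disjoint _) (hψ.integrable_mul hf p).integrableOn (μ := volume)
  rw [iUnion_lev, setIntegral_eq_integral_of_forall_compl_eq_zero (fun x hx => by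
    have : f x = 0 := by
      by_contra h0
      exact hx (norm_pos_iff.2 h0)
    simp [this])] at h
  refine (h.mul_left (((sc p)⁻¹ : ℝ) : ℂ)).congr_fun ?_
  intro i
  congr 1
  rw [← integral_indicator (measurableSet_lev hm.norm i)]
  refine integral_congr_ae (Eventually.of_forall fun x => ?_)
  simp only [indicator]
  split_ifs <;> simp

lemma IsPacket.enorm_trF_le_tsum (hψ : IsPacket C ψ) (N : ℝ → ℝ) {f : ℝ → ℂ} (hf : Integrable f)
    (hm : Measurable f) (P : Finset Tile) (x : ℝ) :
    ‖trF ψ N (cf ψ f) P x‖ₑ ≤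
      ∑' i : ℤ, ‖trF ψ N (cf ψ ((lev (fun x => ‖f x‖) i).indicator f)) P x‖ₑ := by
  have h : HasSum (fun i : ℤ => trF ψ N (cf ψ ((lev (fun x => ‖f x‖) i).indicator f)) P x)
      (trF ψ N (cf ψ f) P x) := by
    unfold trF
    exact hasSum_sum fun p _ => (hψ.hasSum_cf_lev hf hm p).mul_right _
  rw [← h.tsum_eq]
  exact enorm_tsum_le_tsum_enorm

lemma tsum_tsum_exp_le {p q η : ℝ} (hp : 0 < p) (hq : 0 < q) (hη : 0 < η) :
    ∃ D : ℝ, 0 ≤ D ∧ ∀ A B : ℤ → ℝ≥0∞,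
      ∑' j : ℤ, ∑' i : ℤ, ofReal (Real.exp (-(η * |p * Real.log ((2 : ℝ) ^ i) -
        q * Real.log ((2 : ℝ) ^ j)|))) * (A i + B j) ≤
      ofReal D * ((∑' i, A i) + ∑' j, B j) := by
  have hl := Real.log_pos one_lt_two
  set D1 := (1 + 2 / (η * q * Real.log 2) ^ 2) * (4 * π) with hD1
  set D2 := (1 + 2 / (η * p * Real.log 2) ^ 2) * (4 * π) with hD2
  have h1 : 0 ≤ D1 := by have := Real.pi_pos; positivity
  have h2 : 0 ≤ D2 := by have := Real.pi_pos; positivity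
  refine ⟨D1 + D2, by positivity, fun A B => ?_⟩
  have e1 : ∀ i : ℤ, ∑' j : ℤ, ofReal (Real.exp (-(η * |p * Real.log ((2 : ℝ) ^ i) -
        q * Real.log ((2 : ℝ) ^ j)|))) ≤ ofReal D1 := by
    intro i
    refine le_of_eq_of_le ?_ (tsum_exp_le (c := η * q * Real.log 2) (by positivity) (p * i / q))
    congr 1; ext j
    congr 3
    have : p * Real.log ((2 : ℝ) ^ i) - q * Real.log ((2 : ℝ) ^ j) =
      (q * Real.log 2) * -(j - p * i / q) := by
      rw [Real.log_zpow, Real.log_zpow]; field_simp; ring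
    rw [this, abs_mul, abs_neg, abs_of_pos (by positivity)]; ring
  have e2 : ∀ j : ℤ, ∑' i : ℤ, ofReal (Real.exp (-(η * |p * Real.log ((2 : ℝ) ^ i) -
        q * Real.log ((2 : ℝ) ^ j)|))) ≤ ofReal D2 := by
    intro j
    refine le_of_eq_of_le ?_ (tsum_exp_le (c := η * p * Real.log 2) (by positivity) (q * j / p))
    congr 1; ext i
    congr 3
    have : p * Real.log ((2 : ℝ) ^ i) - q * Real.log ((2 : ℝ) ^ j) =
      (p * Real.log 2) * (i - q * j / p) := by
      rw [Real.log_zpow, Real.log_zpow]; field_simp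
    rw [this, abs_mul, abs_of_pos (by positivity)]; ring
  simp only [mul_add]
  rw [ENNReal.ofReal_add h1 h2]
  simp only [ENNReal.tsum_add]
  rw [ENNReal.tsum_comm]
  simp only [ENNReal.tsum_mul_right]
  calc _ ≤ (∑' i, ofReal D1 * A i) + ∑' j, ofReal D2 * B j :=
        add_le_add (ENNReal.tsum_le_tsum fun i => mul_le_mul_left (e1 i) _)
          (ENNReal.tsum_le_tsum fun j => mul_le_mul_left (e2 j) _)
    _ ≤ _ := by
        rw [ENNReal.tsum_mul_left, ENNReal.tsum_mul_left]
        exact add_le_add (mul_le_mul' le_self_add le_rfl) (mul_le_mul' le_add_self le_rfl)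

lemma strong_sum (hC : 0 < C) {p q : ℝ} (hpq : p.HolderConjugate q) :
    ∃ D : ℝ, 0 ≤ D ∧ ∀ ψ : Tile → ℝ → ℂ, IsPacket C ψ → ∀ N : ℝ → ℝ, Measurable N →
      ∀ f : ℝ → ℂ, Integrable f → Measurable f → ∀ h : ℝ → ℝ, Measurable h →
      ∫⁻ x, ofReal ‖f x‖ ^ p ≠ ∞ → ∫⁻ x, ofReal (h x) ^ q ≠ ∞ →
      ∀ P : Finset Tile, ∫⁻ x, ‖trF ψ N (cf ψ f) P x‖ₑ * ofReal (h x) ≤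
        ofReal D *
          ((∫⁻ x, ofReal ‖f x‖ ^ p) + ∫⁻ x, ofReal (h x) ^ q) := by
  have hp := hpq.pos
  have hq := hpq.symm.pos
  have hs : p⁻¹ + q⁻¹ = 1 := hpq.inv_add_inv_eq_one
  have hpi : 0 < p⁻¹ := by positivity
  have hqi : 0 < q⁻¹ := by positivity
  obtain ⟨η, hη, hη'⟩ := exists_between (lt_min hpi hqi)
  have hη1 := hη'.trans_le (min_le_left _ _)
  have hη2 := hη'.trans_le (min_le_right _ _)
  obtain ⟨K1, hK1, h1⟩ := restricted hC (t := p⁻¹ + η) (by linarith) (by linarith)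
  obtain ⟨K2, hK2, h2⟩ := restricted hC (t := p⁻¹ - η) (by linarith) (by linarith)
  obtain ⟨D, hD, hsum⟩ := tsum_tsum_exp_le hp hq hη
  set K := max K1 K2
  have hK : 0 ≤ K := hK1.trans (le_max_left _ _)
  refine ⟨4 * K * D, by positivity, fun ψ hψ N hN f hf hfm h hh hfp hhq P => ?_⟩
  set u : ℝ → ℝ := fun x => ‖f x‖ with hu
  have hum : Measurable u := hfm.norm
  have hterm : ∀ i j : ℤ, ofReal (2 ^ (j + 1)) *
      ∫⁻ x in lev h j, ‖trF ψ N (cf ψ ((lev u i).indicator f)) P x‖ₑ ≤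
      ofReal (4 * K) * (ofReal (Real.exp (-(η * |p * Real.log ((2 : ℝ) ^ i) -
        q * Real.log ((2 : ℝ) ^ j)|))) * (ofReal (((2 : ℝ) ^ i) ^ p) * volume (lev u i) +
        ofReal (((2 : ℝ) ^ j) ^ q) * volume (lev h j))) := by
    intro i j
    have hFi : volume (lev u i) ≠ ∞ := volume_lev_ne_top hum hp hfp i
    have hEj : volume (lev h j) ≠ ∞ := volume_lev_ne_top hh hq hhq j
    have hi := two_zpow_pos i
    have hj := two_zpow_pos j
    have hle : ∀ x, ‖(lev u i).indicator f x‖ ≤ 2 ^ (i + 1) * (lev u i).indicator 1 x := by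
      intro x
      by_cases hx : x ∈ lev u i
      · rw [indicator_of_mem hx, indicator_of_mem hx, Pi.one_apply, mul_one]
        exact hx.2.le
      · rw [indicator_of_notMem hx, indicator_of_notMem hx]; simp
    have hInt : Integrable ((lev u i).indicator f) := hf.indicator (measurableSet_lev hum i)
    have b1 := h1.real_bound hψ hN (measurableSet_lev hum i) (measurableSet_lev hh j) hFi hEj hInt
      (two_zpow_pos (i + 1)) hle P
    have b2 := h2.real_bound hψ hN (measurableSet_lev hum i) (measurableSet_lev hh j) hFi hEj hInt
      (two_zpow_pos (i + 1)) hle P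
    set a := volume.real (lev u i) with ha
    set b := volume.real (lev h j) with hb
    have ha0 : 0 ≤ a := measureReal_nonneg
    have hb0 : 0 ≤ b := measureReal_nonneg
    set X := min (K * (a ^ (p⁻¹ + η) * b ^ (1 - (p⁻¹ + η))))
      (K * (a ^ (p⁻¹ - η) * b ^ (1 - (p⁻¹ - η)))) with hX
    have hI : ∫⁻ x in lev h j, ‖trF ψ N (cf ψ ((lev u i).indicator f)) P x‖ₑ ≤
        ofReal (2 ^ (i + 1) * X) := by
      rw [hX, mul_min_of_nonneg _ _ (two_zpow_pos (i + 1)).le, ENNReal.ofReal_min]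
      refine le_min (b1.trans (ENNReal.ofReal_le_ofReal ?_))
        (b2.trans (ENNReal.ofReal_le_ofReal ?_))
      · gcongr; exact le_max_left _ _
      · gcongr; exact le_max_right _ _
    have hfin := interp_term hi hj ha0 hb0 hpq hη hη1 hη2 hK (min_le_left _ _) (min_le_right _ _)
      (X := X)
    calc _ ≤ ofReal (2 ^ (j + 1)) * ofReal (2 ^ (i + 1) * X) := by gcongr
      _ = ofReal (4 * (2 ^ i * 2 ^ j * X)) := by
          rw [← ENNReal.ofReal_mul (by positivity), two_zpow_succ, two_zpow_succ]
          congr 1; ring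
      _ ≤ ofReal (4 * (K * (Real.exp (-(η * |p * Real.log (2 ^ i) - q * Real.log (2 ^ j)|)) *
          ((2 ^ i) ^ p * a + (2 ^ j) ^ q * b)))) := by
          apply ENNReal.ofReal_le_ofReal; linarith
      _ = _ := by
          rw [← mul_assoc, ENNReal.ofReal_mul (by positivity : 0 ≤ 4 * K),
            ENNReal.ofReal_mul (Real.exp_pos _).le,
            ENNReal.ofReal_add (by positivity) (by positivity),
            ENNReal.ofReal_mul (by positivity : (0 : ℝ) ≤ (2 ^ i) ^ p),
            ENNReal.ofReal_mul (by positivity : (0 : ℝ) ≤ (2 ^ j) ^ q), ha, hb, Measure.real, Measure.real,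
            ENNReal.ofReal_toReal hFi, ENNReal.ofReal_toReal hEj]
  calc ∫⁻ x, ‖trF ψ N (cf ψ f) P x‖ₑ * ofReal (h x)
      ≤ ∑' j : ℤ, ofReal (2 ^ (j + 1)) * ∫⁻ x in lev h j, ‖trF ψ N (cf ψ f) P x‖ₑ :=
        lintegral_mul_le_tsum_lev hh _
    _ ≤ ∑' j : ℤ, ∑' i : ℤ, ofReal (2 ^ (j + 1)) *
          ∫⁻ x in lev h j, ‖trF ψ N (cf ψ ((lev u i).indicator f)) P x‖ₑ := by
        refine ENNReal.tsum_le_tsum fun j => ?_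
        rw [ENNReal.tsum_mul_left, ← lintegral_tsum fun i =>
          (hψ.measurable_trF hN _ _).enorm.aemeasurable]
        exact mul_le_mul_right (lintegral_mono fun x => hψ.enorm_trF_le_tsum N hf hfm P x) _
    _ ≤ ∑' j : ℤ, ∑' i : ℤ, ofReal (4 * K) * (ofReal (Real.exp
          (-(η * |p * Real.log ((2 : ℝ) ^ i) - q * Real.log ((2 : ℝ) ^ j)|))) *
          (ofReal (((2 : ℝ) ^ i) ^ p) * volume (lev u i) +
          ofReal (((2 : ℝ) ^ j) ^ q) * volume (lev h j))) :=
        ENNReal.tsum_le_tsum fun j => ENNReal.tsum_le_tsum fun i => hterm i j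
    _ ≤ ofReal (4 * K) * (ofReal D *
          ((∑' i, ofReal (((2 : ℝ) ^ i) ^ p) * volume (lev u i)) +
          ∑' j, ofReal (((2 : ℝ) ^ j) ^ q) * volume (lev h j))) := by
        simp only [ENNReal.tsum_mul_left]
        exact mul_le_mul_right (hsum _ _) _
    _ ≤ _ := by
        rw [ENNReal.ofReal_mul (by positivity : 0 ≤ 4 * K), mul_assoc]
        gcongr
        · exact tsum_lev_le hum hp
        · exact tsum_lev_le hh hq

/-- Strong type estimate for the linearized model operator. -/
theorem strong_type (hC : 0 < C) {p q : ℝ} (hpq : p.HolderConjugate q) :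
    ∃ D : ℝ, 0 ≤ D ∧ ∀ ψ : Tile → ℝ → ℂ, IsPacket C ψ → ∀ N : ℝ → ℝ, Measurable N →
      ∀ f : ℝ → ℂ, Integrable f → Measurable f → ∀ h : ℝ → ℝ, Measurable h →
      ∫⁻ x, ofReal ‖f x‖ ^ p ≠ ∞ → ∫⁻ x, ofReal (h x) ^ q ≠ ∞ →
      ∀ P : Finset Tile, ∫⁻ x, ‖trF ψ N (cf ψ f) P x‖ₑ * ofReal (h x) ≤
        ofReal D * ((∫⁻ x, ofReal ‖f x‖ ^ p) ^ p⁻¹ *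
          (∫⁻ x, ofReal (h x) ^ q) ^ q⁻¹) := by
  obtain ⟨D, hD, H⟩ := strong_sum hC hpq
  have hp := hpq.pos
  have hq := hpq.symm.pos
  refine ⟨2 * D, by positivity, fun ψ hψ N hN f hf hfm h hh hfp hhq P => ?_⟩
  set A := ∫⁻ x, ofReal ‖f x‖ ^ p with hA
  set B := ∫⁻ x, ofReal (h x) ^ q with hB
  rcases eq_or_ne A 0 with hA0 | hA0
  · have : f =ᵐ[volume] 0 := by
      rw [hA, lintegral_eq_zero_iff (by fun_prop)] at hA0
      filter_upwards [hA0] with x hx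
      simpa [hp.ne', hp, hp.not_gt] using hx
    simp [trF_cf_eq_zero ψ N this]
  rcases eq_or_ne B 0 with hB0 | hB0
  · have : (fun x => ofReal (h x)) =ᵐ[volume] 0 := by
      rw [hB, lintegral_eq_zero_iff (by fun_prop)] at hB0
      filter_upwards [hB0] with x hx
      simpa [hq.ne', hq, hq.not_gt] using hx
    rw [lintegral_eq_zero_of_ae_eq_zero (by filter_upwards [this] with x hx; simp [hx])]
    exact zero_le
  set α := A.toReal ^ p⁻¹ with hα
  set β := B.toReal ^ q⁻¹ with hβ
  have hα0 : 0 < α := Real.rpow_pos_of_pos (ENNReal.toReal_pos hA0 hfp) _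
  have hβ0 : 0 < β := Real.rpow_pos_of_pos (ENNReal.toReal_pos hB0 hhq) _
  have hαA : A ^ p⁻¹ = ofReal α := by
    rw [hα, ← ENNReal.ofReal_rpow_of_nonneg ENNReal.toReal_nonneg (by positivity),
      ENNReal.ofReal_toReal hfp]
  have hβB : B ^ q⁻¹ = ofReal β := by
    rw [hβ, ← ENNReal.ofReal_rpow_of_nonneg ENNReal.toReal_nonneg (by positivity),
      ENNReal.ofReal_toReal hhq]
  have key : ∀ {r c : ℝ} {Z : ℝ≥0∞} {g : ℝ → ℝ}, 0 < r → 0 < c →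
      Z = ∫⁻ x, ofReal (g x) ^ r → Z ≠ 0 → Z ≠ ∞ → Z ^ r⁻¹ = ofReal c →
      ∫⁻ x, ofReal (c⁻¹ * g x) ^ r = 1 := by
    intro r c Z g hr hc hZ h0 ht hZc
    simp only [ENNReal.ofReal_mul (inv_pos.2 hc).le, ENNReal.mul_rpow_of_nonneg _ _ hr.le]
    rw [lintegral_const_mul' _ _ (by finiteness), ← hZ, ENNReal.ofReal_inv_of_pos hc, ← hZc,
      ENNReal.inv_rpow, ← ENNReal.rpow_mul, inv_mul_cancel₀ hr.ne', ENNReal.rpow_one,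
      ENNReal.inv_mul_cancel h0 ht]
  have k1 := key hp hα0 hA hA0 hfp hαA
  have k2 := key hq hβ0 hB hB0 hhq hβB
  have hnf : ∀ x, ‖((α⁻¹ : ℝ) : ℂ) * f x‖ = α⁻¹ * ‖f x‖ := fun x => by
    rw [norm_mul, Complex.norm_real, Real.norm_of_nonneg (inv_pos.2 hα0).le]
  have fin := H ψ hψ N hN (fun x => ((α⁻¹ : ℝ) : ℂ) * f x) (hf.const_mul _) (hfm.const_mul _)
    (fun x => β⁻¹ * h x) (hh.const_mul _) (by simp only [hnf]; rw [k1]; exact ENNReal.one_ne_top)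
    (by rw [k2]; exact ENNReal.one_ne_top) P
  simp only [hnf] at fin
  rw [k1, k2] at fin
  have hα' : ‖((α⁻¹ : ℝ) : ℂ)‖ₑ = ofReal α⁻¹ := by
    rw [← ofReal_norm, Complex.norm_real, Real.norm_of_nonneg (inv_pos.2 hα0).le]
  simp only [trF_cf_const_mul, enorm_mul, hα', ENNReal.ofReal_mul (inv_pos.2 hβ0).le] at fin
  have e : ∀ x, ofReal α⁻¹ * ‖trF ψ N (cf ψ f) P x‖ₑ *
      (ofReal β⁻¹ * ofReal (h x)) = ofReal (α⁻¹ * β⁻¹) *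
      (‖trF ψ N (cf ψ f) P x‖ₑ * ofReal (h x)) := fun x => by
    rw [ENNReal.ofReal_mul (inv_pos.2 hα0).le]; ring
  simp only [e] at fin
  rw [lintegral_const_mul' _ _ ENNReal.ofReal_ne_top] at fin
  rw [hαA, hβB]
  calc _ = ofReal (α * β) * (ofReal (α⁻¹ * β⁻¹) *
        ∫⁻ x, ‖trF ψ N (cf ψ f) P x‖ₑ * ofReal (h x)) := by
        rw [← mul_assoc, ← ENNReal.ofReal_mul (by positivity)]
        have : α * β * (α⁻¹ * β⁻¹) = 1 := by field_simp
        rw [this, ENNReal.ofReal_one, one_mul]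
    _ ≤ ofReal (α * β) * (ofReal D * (1 + 1)) := by gcongr
    _ = _ := by
        rw [one_add_one_eq_two, ENNReal.ofReal_mul (by norm_num : (0 : ℝ) ≤ 2), ENNReal.ofReal_mul hα0.le,
          ENNReal.ofReal_ofNat]
        ring

end

open scoped FourierTransform SchwartzMap

lemma continuous_eChar₂ : Continuous fun z : ℝ × ℝ => eChar z.1 z.2 := by
  unfold eChar; fun_prop

lemma eChar_add_left (a b x : ℝ) : eChar (a + b) x = eChar a x * eChar b x := by
  unfold eChar
  rw [← Complex.exp_add]; congr 1; push_cast; ring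

lemma eChar_add_right (a x y : ℝ) : eChar a (x + y) = eChar a x * eChar a y := by
  unfold eChar
  rw [← Complex.exp_add]; congr 1; push_cast; ring

lemma eChar_comm (a x : ℝ) : eChar a x = eChar x a := by
  unfold eChar; congr 1; ring

lemma eChar_congr {a x b y : ℝ} (h : a * x = b * y) : eChar a x = eChar b y := by
  rw [eChar_eq, eChar_eq]
  congr 3
  linear_combination 2 * π * h

lemma eChar_zero_right (a : ℝ) : eChar a 0 = 1 := by simp [eChar]

lemma fourierT_eq (f : ℝ → ℂ) (ξ : ℝ) : fourierT f ξ = 𝓕 f ξ := by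
  rw [Real.fourier_eq', fourierT]
  refine integral_congr_ae (Eventually.of_forall fun x => ?_)
  simp only [smul_eq_mul]
  rw [eChar_eq, mul_comm]
  congr 3
  simp; ring

lemma fourierInv_eq (f : ℝ → ℂ) (x : ℝ) : 𝓕⁻ f x = ∫ ξ, f ξ * eChar ξ x := by
  rw [Real.fourierInv_eq']
  refine integral_congr_ae (Eventually.of_forall fun ξ => ?_)
  simp only [smul_eq_mul]
  rw [eChar_eq, mul_comm]
  congr 3
  simp; ring

lemma continuous_fourierT {f : ℝ → ℂ} (hf : Integrable f) : Continuous (fourierT f) := by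
  unfold fourierT
  refine continuous_of_dominated (bound := fun x => ‖f x‖) (fun ξ => ?_) (fun ξ => ?_) hf.norm ?_
  · exact hf.aestronglyMeasurable.mul (continuous_eChar _).aestronglyMeasurable
  · exact Eventually.of_forall fun x => by rw [norm_mul, norm_eChar, mul_one]
  · exact Eventually.of_forall fun x => continuous_const.mul
      (continuous_eChar₂.comp (by fun_prop : Continuous fun ξ : ℝ => (-ξ, x)))

lemma integral_mul_synth {f G : ℝ → ℂ} (hf : Integrable f) (hG : Integrable G) (a : ℝ) :
    ∫ x, f x * (∫ ζ, G ζ * eChar ζ (a - x)) = ∫ ζ, G ζ * fourierT f ζ * eChar ζ a := by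
  simp only [← integral_const_mul, fourierT]
  rw [integral_integral_swap]
  · refine integral_congr_ae (Eventually.of_forall fun ζ => ?_)
    simp only
    rw [← integral_mul_const]
    refine integral_congr_ae (Eventually.of_forall fun x => ?_)
    simp only
    rw [sub_eq_add_neg, eChar_add_right, eChar_congr (show ζ * -x = -ζ * x by ring)]
    ring
  · have := (hf.mul_prod hG)
    refine (this.mul_bdd (c := 1) (g := fun z : ℝ × ℝ => eChar z.2 (a - z.1))
      (continuous_eChar₂.comp (by fun_prop : Continuous fun z : ℝ × ℝ =>
        (z.2, a - z.1))).aestronglyMeasurable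
      (Eventually.of_forall fun z => (norm_eChar _ _).le)).congr
      (Eventually.of_forall fun z => ?_)
    simp only [Function.uncurry]
    ring

lemma integral_mul_conj_synth {f G : ℝ → ℂ} (hf : Integrable f) (hG : Integrable G) :
    ∫ x, f x * conj (∫ ζ, G ζ * eChar ζ x) =
      ∫ ζ, conj (G ζ) * fourierT f ζ := by
  have h := integral_mul_synth hf (G := fun ζ => conj (G ζ))
    (by simpa using (Complex.conjLIE.toContinuousLinearEquiv.toContinuousLinearMap.integrable_comp hG)) 0
  simp only [eChar_zero_right, mul_one] at h
  rw [← h]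
  refine integral_congr_ae (Eventually.of_forall fun x => ?_)
  simp only
  rw [← integral_conj]
  congr 1
  refine integral_congr_ae (Eventually.of_forall fun ζ => ?_)
  simp only [map_mul, conj_eChar]
  rw [eChar_congr (show -ζ * x = ζ * (0 - x) by ring)]

lemma integral_affine (g : ℝ → ℂ) {r : ℝ} (hr : 0 < r) (m : ℝ) :
    ∫ ζ, (r : ℂ) * g (r * ζ - m) = ∫ s, g s := by
  rw [integral_const_mul, Measure.integral_comp_mul_left (fun s => g (s - m)) r,
    integral_sub_right_eq_self g m, abs_of_pos (inv_pos.2 hr), Complex.real_smul, ← mul_assoc,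
    ← Complex.ofReal_mul, mul_inv_cancel₀ hr.ne', Complex.ofReal_one, one_mul]

/-- The Fourier side of a wave packet. -/
def spec (χ : ℝ → ℂ) (r m σ : ℝ) (ζ : ℝ) : ℂ :=
  (r : ℂ) * (χ (r * ζ - m) * eChar (-σ) (r * ζ - m))

lemma integrable_spec {χ : ℝ → ℂ} (hχ : Integrable χ) {r : ℝ} (hr : 0 < r) (m σ : ℝ) :
    Integrable (spec χ r m σ) := by
  unfold spec
  refine Integrable.const_mul ?_ _
  have h : Integrable (fun s => χ s * eChar (-σ) s) := hχ.mul_bdd (c := 1)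
    (continuous_eChar _).aestronglyMeasurable
    (Eventually.of_forall fun z => (norm_eChar _ _).le)
  exact (h.comp_sub_right m).comp_mul_left' hr.ne'

lemma synth_spec (χ : ℝ → ℂ) {r : ℝ} (hr : 0 < r) (m σ x : ℝ) :
    ∫ ζ, spec χ r m σ ζ * eChar ζ x =
      (∫ s, χ s * eChar s (r⁻¹ * x - σ)) * eChar (m * r⁻¹) x := by
  rw [← integral_mul_const,
    ← integral_affine (fun s => χ s * eChar s (r⁻¹ * x - σ) * eChar (m * r⁻¹) x) hr m]
  refine integral_congr_ae (Eventually.of_forall fun ζ => ?_)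
  simp only [spec]
  have h1 : eChar ζ x = eChar (r * ζ - m) (r⁻¹ * x) * eChar (m * r⁻¹) x := by
    rw [eChar_congr (show (r * ζ - m) * (r⁻¹ * x) = (ζ - m * r⁻¹) * x by field_simp),
      ← eChar_add_left, sub_add_cancel]
  rw [h1, sub_eq_add_neg (r⁻¹ * x), eChar_add_right, eChar_comm (-σ)]
  ring

lemma fourierT_dil (β : ℝ → ℂ) {r : ℝ} (hr : 0 < r) (m ζ : ℝ) :
    fourierT (fun y => ((r⁻¹ : ℝ) : ℂ) * (β (r⁻¹ * y) * eChar (m * r⁻¹) y)) ζ =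
      fourierT β (r * ζ - m) := by
  unfold fourierT
  have hri : 0 < r⁻¹ := inv_pos.2 hr
  rw [← integral_affine (fun y => β y * eChar (-(r * ζ - m)) y) hri 0]
  refine integral_congr_ae (Eventually.of_forall fun y => ?_)
  simp only [sub_zero]
  rw [mul_assoc, mul_assoc, ← eChar_add_left]
  congr 2
  apply eChar_congr
  field_simp
  ring

lemma schwartz_le_W (φ : 𝓢(ℝ, ℂ)) : ∃ A : ℝ, 0 ≤ A ∧ ∀ x, ‖φ x‖ ≤ A * W x ^ 8 := by
  set A := 2 ^ 16 * ((Finset.Iic (16, 0)).sup (fun m : ℕ × ℕ => SchwartzMap.seminorm ℝ m.1 m.2)) φ with hA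
  refine ⟨A, by positivity, fun x => ?_⟩
  have h := SchwartzMap.one_add_le_sup_seminorm_apply (𝕜 := ℝ) (m := (16, 0)) (k := 16) (n := 0)
    le_rfl le_rfl φ x
  rw [norm_iteratedFDeriv_zero, ← hA] at h
  have h2 : 1 + x ^ 2 ≤ (1 + ‖x‖) ^ 2 := by
    rw [Real.norm_eq_abs]; nlinarith [abs_nonneg x, sq_abs x]
  have h3 : (1 + x ^ 2) ^ 8 ≤ (1 + ‖x‖) ^ 16 := by
    calc _ ≤ ((1 + ‖x‖) ^ 2) ^ 8 := by gcongr
      _ = _ := by ring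
  unfold W
  rw [inv_pow, ← div_eq_mul_inv, le_div_iff₀ (by positivity), mul_comm]
  exact (mul_le_mul_of_nonneg_right h3 (norm_nonneg _)).trans h

lemma W_pow_shift {a b c : ℝ} (h : |a - b| ≤ c) (n : ℕ) :
    W a ^ n ≤ (2 * (1 + c ^ 2)) ^ n * W b ^ n := by
  rw [← mul_pow]
  exact pow_le_pow_left₀ (W_nonneg _) (W_shift h) n

lemma hasDerivAt_eChar (s y : ℝ) :
    HasDerivAt (eChar s) (2 * π * Complex.I * s * eChar s y) y := by
  unfold eChar
  have h : HasDerivAt (fun x : ℝ => 2 * π * Complex.I * s * x)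
      (2 * π * Complex.I * s) y := by
    simpa using (Complex.ofRealCLM.hasDerivAt (x := y)).const_mul (2 * π * Complex.I * s)
  convert h.cexp using 1
  ring

lemma schwartz_lip (φ : 𝓢(ℝ, ℂ)) : ∃ A : ℝ, 0 ≤ A ∧ ∀ s τ : ℝ, |s| ≤ 1 → |τ| ≤ 1 → ∀ x y,
    |x - y| ≤ 1 → ‖φ (x - τ) * eChar s x - φ (y - τ) * eChar s y‖ ≤ A * |x - y| * W x ^ 8 := by
  obtain ⟨A1, h1, H1⟩ := schwartz_le_W φ
  obtain ⟨A2, h2, H2⟩ := schwartz_le_W (SchwartzMap.derivCLM ℝ ℂ φ)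
  have hpi := Real.pi_pos
  refine ⟨(A2 + 2 * π * A1) * (2 * (1 + 2 ^ 2)) ^ 8, by positivity,
    fun s τ hs hτ x y hxy => ?_⟩
  have hd : ∀ z, HasDerivAt (fun z => φ (z - τ) * eChar s z)
      (deriv φ (z - τ) * eChar s z + φ (z - τ) * (2 * π * Complex.I * s * eChar s z)) z := by
    intro z
    have := (φ.differentiableAt (x := z - τ)).hasDerivAt.comp_sub_const z τ
    exact this.mul (hasDerivAt_eChar s z)
  have hb : ∀ z ∈ uIcc y x, ‖deriv φ (z - τ) * eChar s z +
      φ (z - τ) * (2 * π * Complex.I * s * eChar s z)‖ ≤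
      (A2 + 2 * π * A1) * ((2 * (1 + 2 ^ 2)) ^ 8 * W x ^ 8) := by
    intro z hz
    have hzx : |z - x| ≤ 1 := by
      rw [abs_sub_comm] at hxy
      have := abs_sub_right_of_mem_uIcc hz
      rw [abs_sub_comm] at this
      rw [abs_sub_comm] at hxy
      linarith
    have hW : W (z - τ) ^ 8 ≤ (2 * (1 + 2 ^ 2)) ^ 8 * W x ^ 8 := by
      refine W_pow_shift ?_ 8
      calc |z - τ - x| = |(z - x) - τ| := by ring_nf
        _ ≤ |z - x| + |τ| := abs_sub _ _
        _ ≤ 2 := by linarith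
    calc _ ≤ ‖deriv φ (z - τ)‖ + ‖φ (z - τ)‖ * (2 * π * |s|) := by
          refine (norm_add_le _ _).trans (le_of_eq ?_)
          simp [norm_eChar, abs_of_pos hpi]
      _ ≤ A2 * W (z - τ) ^ 8 + A1 * W (z - τ) ^ 8 * (2 * π * 1) := by
          have := W_nonneg (z - τ)
          gcongr
          · exact H2 (z - τ)
          · exact H1 (z - τ)
      _ = (A2 + 2 * π * A1) * W (z - τ) ^ 8 := by ring
      _ ≤ _ := by gcongr
  have := Convex.norm_image_sub_le_of_norm_hasDerivWithin_le
    (fun z hz => (hd z).hasDerivWithinAt) hb (convex_uIcc y x) left_mem_uIcc right_mem_uIcc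
  refine this.trans (le_of_eq ?_)
  rw [Real.norm_eq_abs]; ring

lemma two_zpow_neg_eq (k : ℤ) : (2 : ℝ) ^ (-k) = (2 ^ k)⁻¹ := zpow_neg 2 k

lemma mem_Om_iff {p : Tile} {ξ : ℝ} : ξ ∈ Om p ↔ (p.2.2 : ℝ) ≤ sc p * ξ ∧ sc p * ξ < p.2.2 + 1 := by
  unfold Om
  have := sc_pos p
  rw [mem_dy, two_zpow_neg_eq, ← div_eq_mul_inv, ← div_eq_mul_inv]
  change _ / sc p ≤ _ ∧ _ < _ / sc p ↔ _
  rw [div_le_iff₀ this, lt_div_iff₀ this, mul_comm ξ]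

lemma mem_Om1_iff {p : Tile} {ξ : ℝ} :
    ξ ∈ Om1 p ↔ (p.2.2 : ℝ) ≤ sc p * ξ ∧ sc p * ξ < p.2.2 + 1 / 2 := by
  unfold Om1
  have := sc_pos p
  rw [mem_dy, two_zpow_pred, two_zpow_neg_eq]
  change _ * ((sc p)⁻¹ / 2) ≤ _ ∧ _ < _ * ((sc p)⁻¹ / 2) ↔ _
  rw [← mul_div_assoc, ← mul_div_assoc, div_le_iff₀ two_pos, lt_div_iff₀ two_pos,
    ← div_eq_mul_inv, ← div_eq_mul_inv, div_le_iff₀ this, lt_div_iff₀ this]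
  push_cast
  constructor <;> rintro ⟨h1, h2⟩ <;> constructor <;> linarith

lemma mem_Om2_iff {p : Tile} {ξ : ℝ} :
    ξ ∈ Om2 p ↔ (p.2.2 : ℝ) + 1 / 2 ≤ sc p * ξ ∧ sc p * ξ < p.2.2 + 1 := by
  unfold Om2
  have := sc_pos p
  rw [mem_dy, two_zpow_pred, two_zpow_neg_eq]
  change _ * ((sc p)⁻¹ / 2) ≤ _ ∧ _ < _ * ((sc p)⁻¹ / 2) ↔ _
  rw [← mul_div_assoc, ← mul_div_assoc, div_le_iff₀ two_pos, lt_div_iff₀ two_pos,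
    ← div_eq_mul_inv, ← div_eq_mul_inv, div_le_iff₀ this, lt_div_iff₀ this]
  push_cast
  constructor <;> rintro ⟨h1, h2⟩ <;> constructor <;> linarith

/-- A smooth bump as a Schwartz function. -/
def bumpS {c : ℝ} (b : ContDiffBump c) : 𝓢(ℝ, ℂ) :=
  HasCompactSupport.toSchwartzMap (f := fun x => ((b x : ℝ) : ℂ))
    (b.hasCompactSupport.comp_left (g := fun x : ℝ => (x : ℂ)) (by simp))
    (Complex.ofRealCLM.contDiff.comp b.contDiff)

lemma bumpS_apply {c : ℝ} (b : ContDiffBump c) (x : ℝ) : bumpS b x = ((b x : ℝ) : ℂ) := rfl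

/-- The frequency profile of the wave packets, on the real side. -/
def bumpA : ContDiffBump (1 / 4 : ℝ) := ⟨1 / 16, 1 / 8, by norm_num, by norm_num⟩

/-- A bump equal to one on the unit interval. -/
def bumpB : ContDiffBump (1 / 2 : ℝ) := ⟨1 / 2, 3 / 4, by norm_num, by norm_num⟩

lemma bumpA_eq_zero {s : ℝ} (h : ¬ (1 / 8 < s ∧ s < 3 / 8)) : bumpA s = 0 := by
  apply bumpA.zero_of_le_dist
  change (1 / 8 : ℝ) ≤ _
  rw [Real.dist_eq]
  by_contra h1
  rw [not_le, abs_lt] at h1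
  exact h ⟨by linarith [h1.1], by linarith [h1.2]⟩

lemma bumpB_eq_one {s : ℝ} (h0 : 0 ≤ s) (h1 : s ≤ 1) : bumpB s = 1 := by
  apply bumpB.one_of_mem_closedBall
  rw [Metric.mem_closedBall, Real.dist_eq]
  change _ ≤ (1 / 2 : ℝ)
  rw [abs_le]; constructor <;> linarith

lemma bumpB_eq_zero {s : ℝ} (h : s ≤ -(1 / 4)) : bumpB s = 0 := by
  apply bumpB.zero_of_le_dist
  change (3 / 4 : ℝ) ≤ _
  rw [Real.dist_eq]
  exact le_abs.2 (Or.inr (by linarith))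

/-- The frequency profile of the wave packets. -/
def chi : 𝓢(ℝ, ℂ) := bumpS bumpA

/-- The time profile of the wave packets. -/
def phi : 𝓢(ℝ, ℂ) := 𝓕⁻ chi

lemma phi_eq (x : ℝ) : phi x = ∫ s, chi s * eChar s x := by
  rw [← fourierInv_eq, phi, ← SchwartzMap.fourierInv_coe]

lemma fourierT_fourierInv (b : 𝓢(ℝ, ℂ)) (ζ : ℝ) : fourierT (𝓕⁻ b : 𝓢(ℝ, ℂ)) ζ = b ζ := by
  rw [fourierT_eq, ← SchwartzMap.fourier_coe, FourierTransform.fourier_fourierInv_eq]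

/-- The wave packets. -/
def pkt (τ : ℝ) (p : Tile) (x : ℝ) : ℂ :=
  phi ((sc p)⁻¹ * x - p.2.1 - τ) * eChar (p.2.2 * (sc p)⁻¹) x

lemma pkt_eq (τ : ℝ) (p : Tile) (x : ℝ) :
    pkt τ p x = ∫ ζ, spec chi (sc p) p.2.2 (p.2.1 + τ) ζ * eChar ζ x := by
  rw [synth_spec _ (sc_pos p), ← phi_eq, pkt, sub_sub]

lemma spec_chi_eq_zero {r m σ ζ : ℝ} (h : ¬ (1 / 8 < r * ζ - m ∧ r * ζ - m < 3 / 8)) :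
    spec chi r m σ ζ = 0 := by
  unfold spec chi
  rw [bumpS_apply, bumpA_eq_zero h]; simp

lemma fourierT_shift (f : ℝ → ℂ) (a ζ : ℝ) :
    fourierT (fun x => f (x - a)) ζ = eChar (-ζ) a * fourierT f ζ := by
  unfold fourierT
  rw [← integral_const_mul, ← integral_sub_right_eq_self (fun x => eChar (-ζ) a * _) a]
  refine integral_congr_ae (Eventually.of_forall fun x => ?_)
  simp only
  have : eChar (-ζ) x = eChar (-ζ) (x - a) * eChar (-ζ) a := by rw [← eChar_add_right, sub_add_cancel]
  rw [this]; ring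

lemma fourierT_pkt (τ : ℝ) (p : Tile) (ζ : ℝ) :
    fourierT (pkt τ p) ζ = spec chi (sc p) p.2.2 (p.2.1 + τ) ζ := by
  have h := fourierT_dil (fun u => phi (u - (p.2.1 + τ))) (sc_pos p) p.2.2 ζ
  have h2 : fourierT (pkt τ p) ζ = (sc p : ℂ) * fourierT (fun y => (((sc p)⁻¹ : ℝ) : ℂ) *
      (phi ((sc p)⁻¹ * y - (p.2.1 + τ)) * eChar (p.2.2 * (sc p)⁻¹) y)) ζ := by
    unfold fourierT
    rw [← integral_const_mul]
    refine integral_congr_ae (Eventually.of_forall fun x => ?_)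
    simp only [pkt, sub_sub]
    have : (sc p : ℂ) * (((sc p)⁻¹ : ℝ) : ℂ) = 1 := by
      rw [← Complex.ofReal_mul, mul_inv_cancel₀ (sc_pos p).ne', Complex.ofReal_one]
    linear_combination (-(phi ((sc p)⁻¹ * x - (↑p.2.1 + τ)) * eChar (↑p.2.2 * (sc p)⁻¹) x *
      eChar (-ζ) x)) * this
  rw [h2, h, fourierT_shift, phi, fourierT_fourierInv, spec]
  rw [eChar_congr (show -(sc p * ζ - p.2.2) * (p.2.1 + τ) = -(p.2.1 + τ) * (sc p * ζ - p.2.2) by ring)]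
  ring

lemma continuous_pkt (τ : ℝ) (p : Tile) : Continuous (pkt τ p) := by
  unfold pkt
  exact (phi.continuous.comp (by fun_prop)).mul (continuous_eChar _)

lemma pkt_decay : ∃ A : ℝ, 0 ≤ A ∧ ∀ τ : ℝ, |τ| ≤ 1 → ∀ p x, ‖pkt τ p x‖ ≤ A * wt p x ^ 8 := by
  obtain ⟨A, hA, H⟩ := schwartz_le_W phi
  refine ⟨A * (2 * (1 + 1 ^ 2)) ^ 8, by positivity, fun τ hτ p x => ?_⟩
  unfold pkt
  rw [norm_mul, norm_eChar, mul_one, mul_assoc]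
  refine (H _).trans (mul_le_mul_of_nonneg_left ?_ hA)
  unfold wt
  rw [two_zpow_neg_eq]
  refine W_pow_shift ?_ 8
  change |(sc p)⁻¹ * x - p.2.1 - τ - ((sc p)⁻¹ * x - p.2.1)| ≤ 1
  rwa [sub_sub_cancel_left, abs_neg]

lemma pkt_lip : ∃ A : ℝ, 0 ≤ A ∧ ∀ τ : ℝ, |τ| ≤ 1 → ∀ p ξ, ξ ∈ Om p → ∀ x y, |x - y| ≤ sc p →
    ‖pkt τ p x * eChar (-ξ) x - pkt τ p y * eChar (-ξ) y‖ ≤ A * (|x - y| / sc p) * wt p x ^ 4 := by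
  obtain ⟨A, hA, H⟩ := schwartz_lip phi
  refine ⟨A, hA, fun τ hτ p ξ hξ x y hxy => ?_⟩
  have hs := sc_pos p
  rw [mem_Om_iff] at hξ
  set s : ℝ := p.2.2 - sc p * ξ with hsd
  have hs1 : |s| ≤ 1 := by rw [abs_le]; constructor <;> linarith [hξ.1, hξ.2]
  have e : ∀ x, pkt τ p x * eChar (-ξ) x =
      phi ((sc p)⁻¹ * x - p.2.1 - τ) * eChar s ((sc p)⁻¹ * x - p.2.1) * eChar s p.2.1 := by
    intro x
    rw [mul_assoc, ← eChar_add_right, sub_add_cancel, pkt, mul_assoc, ← eChar_add_left]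
    congr 1
    apply eChar_congr
    rw [hsd]; field_simp; ring
  have hd : (sc p)⁻¹ * x - p.2.1 - ((sc p)⁻¹ * y - p.2.1) = (sc p)⁻¹ * (x - y) := by ring
  have hd' : |(sc p)⁻¹ * x - p.2.1 - ((sc p)⁻¹ * y - p.2.1)| = |x - y| / sc p := by
    rw [hd, abs_mul, abs_of_pos (inv_pos.2 hs)]; ring
  rw [e, e, ← sub_mul, norm_mul, norm_eChar, mul_one]
  refine (H s τ hs1 hτ _ _ (by rw [hd']; exact (div_le_one hs).2 hxy)).trans ?_
  rw [hd']
  have : W ((sc p)⁻¹ * x - p.2.1) = wt p x := by unfold wt; rw [two_zpow_neg_eq]; rfl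
  rw [this]
  exact mul_le_mul_of_nonneg_left (wt_pow_anti p x (by norm_num)) (by positivity)

/-- The wave packets satisfy the axioms uniformly in the shift. -/
theorem isPacket_pkt : ∃ C : ℝ, ∀ τ : ℝ, |τ| ≤ 1 → IsPacket C (pkt τ) := by
  obtain ⟨A1, hA1, H1⟩ := pkt_decay
  obtain ⟨A2, hA2, H2⟩ := pkt_lip
  obtain ⟨A3, hA3, H3⟩ := schwartz_le_W (𝓕⁻ (bumpS bumpB) : 𝓢(ℝ, ℂ))
  have hInt : ∀ (τ : ℝ) (p : Tile), Integrable (spec chi (sc p) p.2.2 (p.2.1 + τ)) := fun τ p =>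
    integrable_spec chi.integrable (sc_pos p) _ _
  refine ⟨1 + A1 + A2 + A3, fun τ hτ => ⟨by linarith, continuous_pkt τ, fun p x => ?_, ?_, ?_, ?_⟩⟩
  · exact (H1 τ hτ p x).trans (mul_le_mul_of_nonneg_right (by linarith) (pow_nonneg (wt_nonneg p x) 8))
  · intro p q hpq
    have hi : Integrable (pkt τ p) :=
      ((integrable_wt_pow p (by norm_num : (8 : ℕ) ≠ 0)).const_mul A1).mono'
        (continuous_pkt τ p).aestronglyMeasurable (Eventually.of_forall (H1 τ hτ p))
    simp only [pkt_eq τ q]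
    rw [integral_mul_conj_synth hi (hInt τ q)]
    refine integral_eq_zero_of_ae (Eventually.of_forall fun ζ => ?_)
    simp only [Pi.zero_apply]
    rw [fourierT_pkt]
    by_cases h1 : (1 / 8 < sc p * ζ - p.2.2 ∧ sc p * ζ - p.2.2 < 3 / 8)
    · by_cases h2 : (1 / 8 < sc q * ζ - q.2.2 ∧ sc q * ζ - q.2.2 < 3 / 8)
      · have hq : ζ ∈ Om1 q := mem_Om1_iff.2 ⟨by linarith [h2.1], by linarith [h2.2]⟩
        have hp : ζ ∈ Om1 p := mem_Om1_iff.2 ⟨by linarith [h1.1], by linarith [h1.2]⟩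
        exact absurd hq (Set.disjoint_left.1 hpq hp)
      · rw [spec_chi_eq_zero h2]; simp
    · rw [spec_chi_eq_zero h1]; simp
  · intro p ξ hξ x y hxy
    refine (H2 τ hτ p ξ hξ x y hxy).trans ?_
    have := wt_nonneg p x
    have := sc_pos p
    gcongr
    linarith
  · intro ξ k₀
    set r : ℝ := 2 ^ k₀ with hr
    have hr0 : 0 < r := two_zpow_pos k₀
    set m : ℤ := ⌊ξ * 2 ^ k₀⌋ with hm
    set β : 𝓢(ℝ, ℂ) := 𝓕⁻ (bumpS bumpB) with hβ
    set κ : ℝ → ℂ := fun y => ((r⁻¹ : ℝ) : ℂ) * (β (r⁻¹ * y) * eChar (m * r⁻¹) y) with hκ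
    have hκc : Continuous κ := continuous_const.mul
      ((β.continuous.comp (by fun_prop)).mul (continuous_eChar _))
    have hκb : ∀ y, ‖κ y‖ ≤ (1 + A1 + A2 + A3) * 2 ^ (-k₀) * W (2 ^ (-k₀) * y) := by
      intro y
      rw [hκ, two_zpow_neg_eq, ← hr]
      simp only [norm_mul, norm_eChar, mul_one, Complex.norm_real]
      rw [Real.norm_of_nonneg (inv_pos.2 hr0).le, mul_comm _ r⁻¹, mul_assoc]
      refine mul_le_mul_of_nonneg_left ((H3 _).trans ?_) (inv_pos.2 hr0).le
      have hW := W_nonneg (r⁻¹ * y)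
      have : W (r⁻¹ * y) ^ 8 ≤ W (r⁻¹ * y) := pow_le_of_le_one hW (W_le_one _) (by norm_num)
      exact mul_le_mul (by linarith) this (by positivity) (by linarith)
    have hκi : Integrable κ := by
      refine Integrable.const_mul ?_ _
      exact (β.integrable.comp_mul_left' (inv_pos.2 hr0).ne').mul_bdd (c := 1)
        (continuous_eChar _).aestronglyMeasurable
        (Eventually.of_forall fun z => (norm_eChar _ _).le)
    refine ⟨κ, hκc, hκb, fun p hp x => ?_⟩
    have hκF : ∀ ζ, fourierT κ ζ = ((bumpB (r * ζ - m) : ℝ) : ℂ) := fun ζ => by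
      rw [hκ, fourierT_dil β hr0, hβ, fourierT_fourierInv, bumpS_apply]
    have hξ : ξ ∈ dy (-k₀) m := by rw [mem_dy_iff, neg_neg]
    have e1 : ∫ y, pkt τ p (x - y) * κ y =
        ∫ ζ, spec chi (sc p) p.2.2 (p.2.1 + τ) ζ * ((bumpB (r * ζ - m) : ℝ) : ℂ) * eChar ζ x := by
      simp only [← hκF]
      rw [← integral_mul_synth hκi (hInt τ p)]
      refine integral_congr_ae (Eventually.of_forall fun y => ?_)
      simp only
      rw [pkt_eq, mul_comm]
    rw [e1]
    have hOm := Om2_subset p hp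
    split_ifs with hk
    · rw [pkt_eq]
      refine integral_congr_ae (Eventually.of_forall fun ζ => ?_)
      simp only
      by_cases h1 : (1 / 8 < sc p * ζ - p.2.2 ∧ sc p * ζ - p.2.2 < 3 / 8)
      · have hζ : ζ ∈ Om p := mem_Om_iff.2 ⟨by linarith [h1.1], by linarith [h1.2]⟩
        have h2 : ζ ∈ Om (k₀, 0, m) := dy_subset (neg_le_neg hk) hOm hξ hζ
        rw [mem_Om_iff] at h2
        change (m : ℝ) ≤ r * ζ ∧ r * ζ < m + 1 at h2
        rw [bumpB_eq_one (by linarith [h2.1]) (by linarith [h2.2])]; simp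
      · rw [spec_chi_eq_zero h1]; simp
    · refine integral_eq_zero_of_ae (Eventually.of_forall fun ζ => ?_)
      simp only [Pi.zero_apply]
      by_cases h1 : (1 / 8 < sc p * ζ - p.2.2 ∧ sc p * ζ - p.2.2 < 3 / 8)
      · have hsub : dy (-k₀) m ⊆ Om2 p := dy_subset (by omega) hξ hp
        have hl := mem_Om2_iff.1 (hsub (dy_left_mem _ _))
        have h2r : 2 * sc p ≤ r := by
          rw [hr, sc, ← two_zpow_succ]; exact two_zpow_mono (by omega)
        rw [two_zpow_neg_eq, ← hr] at hl
        have hs := sc_pos p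
        have : bumpB (r * ζ - m) = 0 := by
          apply bumpB_eq_zero
          have e2 : sc p * ζ - sc p * (m * r⁻¹) < - (1 / 8) := by linarith [h1.2, hl.1]
          have e3 : r * ζ - m = r / sc p * (sc p * ζ - sc p * (m * r⁻¹)) := by
            field_simp
          have e4 : 2 ≤ r / sc p := by rwa [le_div_iff₀ hs]
          rw [e3]; nlinarith
        rw [this]; simp
      · rw [spec_chi_eq_zero h1]; simp

/-- The linearised maximal multiplier with real symbol `m`. -/
def opT (m : ℝ → ℝ → ℝ) (f : ℝ → ℂ) (N : ℝ → ℝ) (x : ℝ) : ℂ :=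
  ∫ ξ, fourierT f ξ * (m ξ (N x) : ℂ) * eChar ξ x

/-- The dual form of the `L^p` bound for the linearised maximal multiplier `opT m`. -/
def Carl (p q D : ℝ) (m : ℝ → ℝ → ℝ) : Prop :=
  ∀ f : ℝ → ℂ, Measurable f → Integrable f → Integrable (fourierT f) →
    ∀ N : ℝ → ℝ, Measurable N → ∀ h : ℝ → ℝ, Measurable h →
    ∫⁻ x, ofReal ‖f x‖ ^ p ≠ ∞ → ∫⁻ x, ofReal (h x) ^ q ≠ ∞ →
    ∫⁻ x, ‖opT m f N x‖ₑ * ofReal (h x) ≤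
      ofReal D * ((∫⁻ x, ofReal ‖f x‖ ^ p) ^ p⁻¹ *
        (∫⁻ x, ofReal (h x) ^ q) ^ q⁻¹)

/-- A measurable symbol bounded by `B`. -/
structure Sym (B : ℝ) (m : ℝ → ℝ → ℝ) : Prop where
  meas : Measurable (Function.uncurry m)
  bdd : ∀ ξ n, |m ξ n| ≤ B

variable {p q D B : ℝ} {m : ℝ → ℝ → ℝ}

lemma measurable_eChar₂ : Measurable fun z : ℝ × ℝ => eChar z.1 z.2 := continuous_eChar₂.measurable

lemma lintegral_comp_mul_left' (F : ℝ → ℝ≥0∞) {r : ℝ} (hr : 0 < r) :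
    ∫⁻ x, F (r * x) = ofReal r⁻¹ * ∫⁻ x, F x := by
  have h := (Homeomorph.mulLeft₀ r hr.ne').measurableEmbedding.lintegral_map (μ := volume) F
  rw [show ⇑(Homeomorph.mulLeft₀ r hr.ne') = (r * ·) from rfl, Real.map_volume_mul_left hr.ne',
    lintegral_smul_measure, abs_of_pos (inv_pos.2 hr)] at h
  rw [← h]; rfl

lemma Carl.translate (H : Carl p q D m) (θ : ℝ) : Carl p q D (fun ξ n => m (ξ + θ) (n + θ)) := by
  intro f hfm hf hf' N hN h hh hA hB
  have e : fourierT (fun x => f x * eChar θ x) = fun ξ => fourierT f (ξ - θ) := by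
    funext ξ
    unfold fourierT
    refine integral_congr_ae (Eventually.of_forall fun x => ?_)
    simp only
    rw [mul_assoc, ← eChar_add_left]; congr 2; ring
  have hn : ∀ x, ‖f x * eChar θ x‖ = ‖f x‖ := fun x => by rw [norm_mul, norm_eChar, mul_one]
  have H1 := H (fun x => f x * eChar θ x) (hfm.mul (continuous_eChar θ).measurable)
    (hf.mul_bdd (c := 1) (continuous_eChar _).aestronglyMeasurable
      (Eventually.of_forall fun z => (norm_eChar _ _).le))
    (by rw [e]; exact hf'.comp_sub_right θ) (fun x => N x + θ) (hN.add_const θ) h hh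
    (by simpa only [hn] using hA) hB
  simp only [hn] at H1
  refine le_trans (lintegral_mono fun x => ?_) H1
  refine mul_le_mul_left (le_of_eq ?_) _
  have : opT m (fun x => f x * eChar θ x) (fun x => N x + θ) x =
      opT (fun ξ n => m (ξ + θ) (n + θ)) f N x * eChar θ x := by
    unfold opT
    rw [e, ← integral_mul_const,
      ← integral_add_right_eq_self (fun ξ => fourierT f (ξ - θ) * _ * _) θ]
    refine integral_congr_ae (Eventually.of_forall fun ξ => ?_)
    simp only [add_sub_cancel_right, eChar_add_left]
    ring
  rw [this, enorm_mul]
  have : ‖eChar θ x‖ₑ = 1 := by rw [← ofReal_norm, norm_eChar, ENNReal.ofReal_one]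
  rw [this, mul_one]

lemma fourierT_comp_mul (f : ℝ → ℂ) {r : ℝ} (hr : 0 < r) (ξ : ℝ) :
    fourierT (fun x => f (r * x)) ξ = ((r⁻¹ : ℝ) : ℂ) * fourierT f (r⁻¹ * ξ) := by
  unfold fourierT
  have h := Measure.integral_comp_mul_left (fun y => f y * eChar (-(r⁻¹ * ξ)) y) r
  rw [abs_of_pos (inv_pos.2 hr), Complex.real_smul] at h
  rw [← h]
  refine integral_congr_ae (Eventually.of_forall fun x => ?_)
  simp only
  congr 1
  apply eChar_congr
  field_simp

lemma Carl.dilate (hpq : p.HolderConjugate q) (H : Carl p q D m) {r : ℝ} (hr : 0 < r) :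
    Carl p q D (fun ξ n => m (r * ξ) (r * n)) := by
  intro f hfm hf hf' N hN h hh hA hB
  have hr' := inv_pos.2 hr
  have e : fourierT (fun x => f (r * x)) = fun ξ => ((r⁻¹ : ℝ) : ℂ) * fourierT f (r⁻¹ * ξ) :=
    funext fun ξ => fourierT_comp_mul f hr ξ
  have hmr : Measurable fun x : ℝ => r * x := measurable_const_mul r
  have H1 := H (fun x => f (r * x)) (hfm.comp hmr) (hf.comp_mul_left' hr.ne')
    (by rw [e]; exact (hf'.comp_mul_left' hr'.ne').const_mul _) (fun x => r * N (r * x))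
    ((hN.comp hmr).const_mul r) (fun x => h (r * x)) (hh.comp hmr)
    (by rw [lintegral_comp_mul_left' (fun x => ofReal ‖f x‖ ^ p) hr]
        exact ENNReal.mul_ne_top ENNReal.ofReal_ne_top hA)
    (by rw [lintegral_comp_mul_left' (fun x => ofReal (h x) ^ q) hr]
        exact ENNReal.mul_ne_top ENNReal.ofReal_ne_top hB)
  rw [lintegral_comp_mul_left' (fun x => ofReal ‖f x‖ ^ p) hr,
    lintegral_comp_mul_left' (fun x => ofReal (h x) ^ q) hr] at H1
  have key : ∀ x, opT m (fun x => f (r * x)) (fun x => r * N (r * x)) x =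
      opT (fun ξ n => m (r * ξ) (r * n)) f N (r * x) := by
    intro x
    unfold opT
    rw [e]
    have h2 := Measure.integral_comp_mul_left (fun ξ => fourierT f ξ *
      (m (r * ξ) (r * N (r * x)) : ℂ) * eChar ξ (r * x)) r⁻¹
    rw [abs_of_pos (inv_pos.2 hr'), inv_inv, Complex.real_smul] at h2
    have h3 : (r : ℂ) ≠ 0 := by exact_mod_cast hr.ne'
    rw [← mul_right_inj' h3, ← h2, ← integral_const_mul]
    refine integral_congr_ae (Eventually.of_forall fun ξ => ?_)
    simp only
    rw [mul_inv_cancel_left₀ hr.ne', eChar_congr (show r⁻¹ * ξ * (r * x) = ξ * x by field_simp)]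
    push_cast
    field_simp
  simp only [key] at H1
  rw [lintegral_comp_mul_left' (fun x => ‖opT (fun ξ n => m (r * ξ) (r * n)) f N x‖ₑ *
    ofReal (h x)) hr, ENNReal.mul_rpow_of_nonneg _ _ (inv_nonneg.2 hpq.nonneg),
    ENNReal.mul_rpow_of_nonneg _ _ (inv_nonneg.2 hpq.symm.nonneg)] at H1
  have h0 : ofReal r⁻¹ ≠ 0 := by simpa using hr
  have h1 : ofReal r⁻¹ ^ p⁻¹ * ofReal r⁻¹ ^ q⁻¹ = ofReal r⁻¹ := by
    rw [← ENNReal.rpow_add _ _ h0 ENNReal.ofReal_ne_top, hpq.inv_add_inv_eq_one, ENNReal.rpow_one]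
  rw [← ENNReal.mul_le_mul_iff_right h0 ENNReal.ofReal_ne_top]
  refine H1.trans (le_of_eq ?_)
  conv_rhs => rw [← h1]
  ring

lemma lintegral_enorm_integral_le {Ω : Type*} [MeasurableSpace Ω] {μ : Measure Ω} [SFinite μ]
    {T : Ω → ℝ → ℂ} (hT : Measurable (Function.uncurry T)) {h : ℝ → ℝ} (hh : Measurable h)
    {A : ℝ≥0∞} (H : ∀ᵐ ω ∂μ, ∫⁻ x, ‖T ω x‖ₑ * ofReal (h x) ≤ A) :
    ∫⁻ x, ‖∫ ω, T ω x ∂μ‖ₑ * ofReal (h x) ≤ A * μ univ := by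
  calc ∫⁻ x, ‖∫ ω, T ω x ∂μ‖ₑ * ofReal (h x)
      ≤ ∫⁻ x, ∫⁻ ω, ‖T ω x‖ₑ * ofReal (h x) ∂μ := by
        refine lintegral_mono fun x => ?_
        rw [lintegral_mul_const' _ _ ENNReal.ofReal_ne_top]
        exact mul_le_mul_left (enorm_integral_le_lintegral_enorm _) _
    _ = ∫⁻ ω, (∫⁻ x, ‖T ω x‖ₑ * ofReal (h x)) ∂μ := by
        refine lintegral_lintegral_swap ?_
        refine Measurable.aemeasurable ?_
        refine Measurable.mul (f := fun z : ℝ × Ω => ‖T z.2 z.1‖ₑ) ?_ ?_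
        · exact (hT.comp measurable_swap).enorm
        · exact (ENNReal.measurable_ofReal.comp hh).comp measurable_fst
    _ ≤ ∫⁻ _, A ∂μ := lintegral_mono_ae H
    _ = A * μ univ := lintegral_const A

lemma Sym.integrable (hm : Sym B m) {f : ℝ → ℂ} (hf' : Integrable (fourierT f)) (n x : ℝ) :
    Integrable fun ξ => fourierT f ξ * (m ξ n : ℂ) * eChar ξ x := by
  refine (hf'.mul_bdd (c := B) ?_ ?_).mul_bdd (c := 1) ?_ ?_
  · exact (Complex.measurable_ofReal.comp
      (hm.meas.comp (measurable_id.prodMk measurable_const))).aestronglyMeasurable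
  · exact Eventually.of_forall fun ξ => by
      rw [Complex.norm_real]; exact hm.bdd ξ n
  · exact (continuous_eChar₂.comp (by fun_prop : Continuous fun ξ : ℝ => (ξ, x))).aestronglyMeasurable
  · exact Eventually.of_forall fun z => (norm_eChar _ _).le

lemma Carl.average {μ : Measure ℝ} [IsFiniteMeasure μ] {M : ℝ → ℝ → ℝ → ℝ}
    (hM : Measurable fun z : ℝ × ℝ × ℝ => M z.1 z.2.1 z.2.2) (hB : ∀ ω ξ n, |M ω ξ n| ≤ B)
    (H : ∀ ω, Carl p q D (M ω)) :
    Carl p q (D * (μ univ).toReal) (fun ξ n => ∫ ω, M ω ξ n ∂μ) := by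
  intro f hfm hf hf' N hN h hh hA hB'
  have e : ∀ x, opT (fun ξ n => ∫ ω, M ω ξ n ∂μ) f N x = ∫ ω, opT (M ω) f N x ∂μ := by
    intro x
    unfold opT
    rw [integral_integral_swap]
    · refine integral_congr_ae (Eventually.of_forall fun ξ => ?_)
      simp only
      rw [integral_mul_const, integral_const_mul, integral_complex_ofReal]
    · have h1 : Integrable (fun z : ℝ × ℝ => fourierT f z.2) (μ.prod volume) := hf'.comp_snd μ
      refine (h1.mul_bdd (c := B) ?_ ?_).mul_bdd (c := 1) ?_ ?_
      · exact (Complex.measurable_ofReal.comp (hM.comp (measurable_fst.prodMk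
          (measurable_snd.prodMk measurable_const)))).aestronglyMeasurable
      · exact Eventually.of_forall fun z => by
          rw [Complex.norm_real]; exact hB _ _ _
      · exact (continuous_eChar₂.comp
          (by fun_prop : Continuous fun z : ℝ × ℝ => (z.2, x))).aestronglyMeasurable
      · exact Eventually.of_forall fun z => (norm_eChar _ _).le
  simp only [e]
  refine (lintegral_enorm_integral_le (T := fun ω x => opT (M ω) f N x) ?_ hh
    (Eventually.of_forall fun ω => H ω f hfm hf hf' N hN h hh hA hB')).trans (le_of_eq ?_)
  · unfold opT
    have : Measurable fun z : (ℝ × ℝ) × ℝ =>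
        fourierT f z.2 * (M z.1.1 z.2 (N z.1.2) : ℂ) * eChar z.2 z.1.2 := by
      refine (((continuous_fourierT hf).measurable.comp measurable_snd).mul
        (Complex.measurable_ofReal.comp (hM.comp (f := fun z : (ℝ × ℝ) × ℝ =>
          (z.1.1, z.2, N z.1.2)) ?_))).mul
        (measurable_eChar₂.comp (f := fun z : (ℝ × ℝ) × ℝ => (z.2, z.1.2)) (by fun_prop))
      fun_prop
    exact (this.stronglyMeasurable.integral_prod_right').measurable
  · rw [mul_right_comm, ENNReal.ofReal_mul' ENNReal.toReal_nonneg,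
      ENNReal.ofReal_toReal (measure_ne_top μ univ)]

lemma Sym.measurable_opT (hm : Sym B m) {f : ℝ → ℂ} (hf : Integrable f) {N : ℝ → ℝ}
    (hN : Measurable N) : Measurable (opT m f N) := by
  unfold opT
  have : Measurable fun z : ℝ × ℝ =>
      fourierT f z.2 * (m z.2 (N z.1) : ℂ) * eChar z.2 z.1 := by
    refine (((continuous_fourierT hf).measurable.comp measurable_snd).mul
      (Complex.measurable_ofReal.comp (hm.meas.comp (f := fun z : ℝ × ℝ =>
        (z.2, N z.1)) (by fun_prop)))).mul
      (measurable_eChar₂.comp (f := fun z : ℝ × ℝ => (z.2, z.1)) (by fun_prop))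
  exact (this.stronglyMeasurable.integral_prod_right').measurable

lemma lintegral_enorm_limit_le {T : ℕ → ℝ → ℂ} {T' : ℝ → ℂ} (hT : ∀ n, Measurable (T n))
    (hl : ∀ x, Tendsto (fun n => T n x) atTop (nhds (T' x)))
    {h : ℝ → ℝ} (hh : Measurable h) {A : ℝ≥0∞}
    (H : ∀ n, ∫⁻ x, ‖T n x‖ₑ * ofReal (h x) ≤ A) :
    ∫⁻ x, ‖T' x‖ₑ * ofReal (h x) ≤ A := by
  have e : ∀ x, ‖T' x‖ₑ * ofReal (h x) =
      liminf (fun n => ‖T n x‖ₑ * ofReal (h x)) atTop := fun x =>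
    ((ENNReal.Tendsto.mul_const ((continuous_enorm.tendsto _).comp (hl x))
      (Or.inr ENNReal.ofReal_ne_top)).liminf_eq).symm
  simp only [e]
  refine (lintegral_liminf_le fun n => (hT n).enorm.mul (ENNReal.measurable_ofReal.comp hh)).trans ?_
  exact liminf_le_of_le (by isBoundedDefault) fun b hb => by
    obtain ⟨n, hn⟩ := hb.exists
    exact hn.trans (H n)

lemma Carl.limit {M : ℕ → ℝ → ℝ → ℝ} (hM : ∀ n, Sym B (M n))
    (hl : ∀ ξ n, Tendsto (fun k => M k ξ n) atTop (nhds (m ξ n)))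
    (H : ∀ n, Carl p q D (M n)) : Carl p q D m := by
  intro f hfm hf hf' N hN h hh hA hB'
  refine lintegral_enorm_limit_le (fun n => (hM n).measurable_opT hf hN) (fun x => ?_) hh
    (fun n => H n f hfm hf hf' N hN h hh hA hB')
  refine tendsto_integral_of_dominated_convergence (fun ξ => ‖fourierT f ξ‖ * B)
    (fun n => ((hM n).integrable hf' (N x) x).aestronglyMeasurable) (hf'.norm.mul_const B) ?_ ?_
  · intro n
    refine Eventually.of_forall fun ξ => ?_
    rw [norm_mul, norm_mul, norm_eChar, mul_one, Complex.norm_real]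
    exact mul_le_mul_of_nonneg_left ((hM n).bdd ξ _) (norm_nonneg _)
  · refine Eventually.of_forall fun ξ => ?_
    exact (((Complex.continuous_ofReal.tendsto _).comp (hl ξ (N x))).const_mul _).mul_const _

/-- A wave packet with continuous parameters. -/
def wp (r m σ x : ℝ) : ℂ := phi (r⁻¹ * x - σ) * eChar (m * r⁻¹) x

/-- The contribution of one continuous wave packet. -/
def gfun (f : ℝ → ℂ) (r m x σ : ℝ) : ℂ :=
  ((r⁻¹ : ℝ) : ℂ) * (∫ y, f y * conj (wp r m σ y)) * wp r m σ x

/-- The localised Fourier transform. -/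
def locF (f : ℝ → ℂ) (r m s : ℝ) : ℂ := chi s * fourierT f (r⁻¹ * (s + m))

lemma wp_eq {r : ℝ} (hr : 0 < r) (m σ x : ℝ) :
    wp r m σ x = ∫ ζ, spec chi r m σ ζ * eChar ζ x := by
  rw [synth_spec _ hr, ← phi_eq, wp]

lemma norm_fourierT_le (f : ℝ → ℂ) (ξ : ℝ) : ‖fourierT f ξ‖ ≤ ∫ x, ‖f x‖ := by
  refine (norm_integral_le_integral_norm _).trans (le_of_eq ?_)
  simp only [norm_mul, norm_eChar, mul_one]

lemma integrable_locF {f : ℝ → ℂ} (hf : Integrable f) (r m : ℝ) : Integrable (locF f r m) :=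
  chi.integrable.mul_bdd (c := ∫ x, ‖f x‖)
    ((continuous_fourierT hf).comp (by fun_prop)).aestronglyMeasurable
    (Eventually.of_forall fun _ => norm_fourierT_le _ _)

lemma coef_eq {f : ℝ → ℂ} (hf : Integrable f) {r : ℝ} (hr : 0 < r) (m σ : ℝ) :
    ∫ y, f y * conj (wp r m σ y) = ∫ s, locF f r m s * eChar s σ := by
  simp only [wp_eq hr]
  rw [integral_mul_conj_synth hf (integrable_spec chi.integrable hr m σ),
    ← integral_affine (fun s => locF f r m s * eChar s σ) hr m]
  refine integral_congr_ae (Eventually.of_forall fun ζ => ?_)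
  simp only [spec, locF, map_mul, conj_eChar, neg_neg, Complex.conj_ofReal, sub_add_cancel]
  rw [inv_mul_cancel_left₀ hr.ne', chi, bumpS_apply, Complex.conj_ofReal, eChar_comm σ]
  ring

lemma gfun_eq {f : ℝ → ℂ} (hf : Integrable f) {r : ℝ} (hr : 0 < r) (m x σ : ℝ) :
    gfun f r m x σ = ((r⁻¹ : ℝ) : ℂ) * eChar (m * r⁻¹) x *
      (phi (r⁻¹ * x - σ) * ∫ s, locF f r m s * eChar s σ) := by
  rw [gfun, coef_eq hf hr, wp]; ring

lemma integrable_gfun {f : ℝ → ℂ} (hf : Integrable f) {r : ℝ} (hr : 0 < r) (m x : ℝ) :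
    Integrable (gfun f r m x) := by
  have e : gfun f r m x = fun σ => ((r⁻¹ : ℝ) : ℂ) * eChar (m * r⁻¹) x *
      (phi (r⁻¹ * x - σ) * fourierT (locF f r m) (-σ)) := by
    funext σ
    rw [gfun_eq hf hr, fourierT]
    simp only [neg_neg, eChar_comm σ]
  rw [e]
  refine Integrable.const_mul ?_ _
  exact (phi.integrable.comp_sub_left _).mul_bdd (c := ∫ x, ‖locF f r m x‖)
    ((continuous_fourierT (integrable_locF hf r m)).comp (by fun_prop)).aestronglyMeasurable
    (Eventually.of_forall fun _ => norm_fourierT_le _ _)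

lemma integral_gfun {f : ℝ → ℂ} (hf : Integrable f) {r : ℝ} (hr : 0 < r) (m x : ℝ) :
    ∫ σ, gfun f r m x σ =
      ∫ ζ, fourierT f ζ * ((bumpA (r * ζ - m) ^ 2 : ℝ) : ℂ) * eChar ζ x := by
  simp only [gfun_eq hf hr]
  have h1 := integral_mul_synth phi.integrable (integrable_locF hf r m) (r⁻¹ * x)
  rw [← integral_sub_left_eq_self _ volume (r⁻¹ * x)] at h1
  simp only [sub_sub_cancel] at h1
  rw [integral_const_mul, h1, ← integral_const_mul, ← integral_affine (fun ζ => _ * _) hr m]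
  refine integral_congr_ae (Eventually.of_forall fun ζ => ?_)
  simp only [locF, sub_add_cancel]
  have h2 : eChar (r * ζ - m) (r⁻¹ * x) * eChar (m * r⁻¹) x = eChar ζ x := by
    rw [eChar_congr (show (r * ζ - m) * (r⁻¹ * x) = (ζ - m * r⁻¹) * x by field_simp),
      ← eChar_add_left, sub_add_cancel]
  have h3 : (r : ℂ) * ((r⁻¹ : ℝ) : ℂ) = 1 := by
    rw [← Complex.ofReal_mul, mul_inv_cancel₀ hr.ne', Complex.ofReal_one]
  rw [inv_mul_cancel_left₀ hr.ne', phi, fourierT_fourierInv, chi, bumpS_apply, ← h2]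
  push_cast at h3 ⊢
  linear_combination ((bumpA (r * ζ - m) : ℂ) ^ 2 * fourierT f ζ * eChar (r * ζ - m) (r⁻¹ * x) *
    eChar (m * r⁻¹) x) * h3

/-- The symbol produced by the wave packets of one scale. -/
def modelSym (k : ℤ) (ξ n : ℝ) : ℝ :=
  if 1 / 2 ≤ Int.fract ((2 : ℝ) ^ k * n) then bumpA ((2 : ℝ) ^ k * ξ - ⌊(2 : ℝ) ^ k * n⌋) ^ 2 else 0

lemma modelSym_nonneg (k : ℤ) (ξ n : ℝ) : 0 ≤ modelSym k ξ n := by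
  unfold modelSym; split_ifs <;> positivity

lemma modelSym_le_one (k : ℤ) (ξ n : ℝ) : modelSym k ξ n ≤ 1 := by
  unfold modelSym
  split_ifs
  · exact pow_le_one₀ bumpA.nonneg bumpA.le_one
  · exact zero_le_one

lemma measurable_modelSym (k : ℤ) : Measurable fun z : ℝ × ℝ => modelSym k z.1 z.2 := by
  unfold modelSym
  have h : Measurable fun z : ℝ × ℝ => (2 : ℝ) ^ k * z.2 := by fun_prop
  refine Measurable.ite (measurableSet_le measurable_const h.fract) ?_ measurable_const
  have h2 : Measurable fun z : ℝ × ℝ => ((⌊(2 : ℝ) ^ k * z.2⌋ : ℤ) : ℝ) :=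
    (measurable_of_countable (fun n : ℤ => (n : ℝ))).comp h.floor
  exact (bumpA.continuous.measurable.comp ((measurable_fst.const_mul _).sub h2)).pow_const 2

lemma sym_modelSym (k : ℤ) : Sym 1 (modelSym k) :=
  ⟨measurable_modelSym k, fun ξ n => by
    rw [abs_of_nonneg (modelSym_nonneg _ _ _)]; exact modelSym_le_one _ _ _⟩

/-- The tiles with bounded parameters. -/
def boxTiles (K L : ℕ) : Finset Tile :=
  Finset.Ico (-K : ℤ) K ×ˢ Finset.Ico (-L : ℤ) L ×ˢ Finset.Icc (-L : ℤ) L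

lemma mem_Om2_iff_floor {p : Tile} {ξ : ℝ} :
    ξ ∈ Om2 p ↔ p.2.2 = ⌊(2 : ℝ) ^ p.1 * ξ⌋ ∧ 1 / 2 ≤ Int.fract ((2 : ℝ) ^ p.1 * ξ) := by
  rw [mem_Om2_iff]
  change _ ≤ (2 : ℝ) ^ p.1 * ξ ∧ (2 : ℝ) ^ p.1 * ξ < _ ↔ _
  constructor
  · rintro ⟨h1, h2⟩
    have : ⌊(2 : ℝ) ^ p.1 * ξ⌋ = p.2.2 := Int.floor_eq_iff.2 ⟨by linarith, h2⟩
    refine ⟨this.symm, ?_⟩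
    rw [Int.fract, this]; linarith
  · rintro ⟨h1, h2⟩
    rw [Int.fract, ← h1] at h2
    have := Int.lt_floor_add_one ((2 : ℝ) ^ p.1 * ξ)
    rw [← h1] at this
    exact ⟨by linarith, this⟩

lemma trF_pkt_eq (f : ℝ → ℂ) (N : ℝ → ℝ) (τ x : ℝ) {K L : ℕ}
    (hL : ∀ k ∈ Finset.Ico (-K : ℤ) K, ⌊(2 : ℝ) ^ k * N x⌋ ∈ Finset.Icc (-L : ℤ) L) :
    trF (pkt τ) N (cf (pkt τ) f) (boxTiles K L) x =
      ∑ k ∈ Finset.Ico (-K : ℤ) K, if 1 / 2 ≤ Int.fract ((2 : ℝ) ^ k * N x) then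
        ∑ n ∈ Finset.Ico (-L : ℤ) L, gfun f (2 ^ k) ⌊(2 : ℝ) ^ k * N x⌋ x (τ + n) else 0 := by
  classical
  rw [trF, boxTiles, Finset.sum_product]
  refine Finset.sum_congr rfl fun k hk => ?_
  rw [Finset.sum_product]
  have e : ∀ n m : ℤ, cf (pkt τ) f (k, n, m) * (N ⁻¹' Om2 (k, n, m)).indicator (pkt τ (k, n, m)) x =
      if m = ⌊(2 : ℝ) ^ k * N x⌋ then if 1 / 2 ≤ Int.fract ((2 : ℝ) ^ k * N x) then
        gfun f (2 ^ k) ⌊(2 : ℝ) ^ k * N x⌋ x (τ + n) else 0 else 0 := by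
    intro n m
    have hm : x ∈ N ⁻¹' Om2 (k, n, m) ↔ _ := mem_Om2_iff_floor (p := (k, n, m)) (ξ := N x)
    have hp : ∀ y, pkt τ (k, n, m) y = wp (2 ^ k) m (τ + n) y := fun y => by
      unfold pkt wp sc
      simp only
      rw [sub_sub, add_comm]
    rw [Set.indicator_apply]
    simp only [hm]
    by_cases h1 : m = ⌊(2 : ℝ) ^ k * N x⌋
    · by_cases h2 : 1 / 2 ≤ Int.fract ((2 : ℝ) ^ k * N x)
      · rw [if_pos ⟨h1, h2⟩, if_pos h1, if_pos h2, cf, gfun]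
        simp only [hp]
        rw [h1]; rfl
      · rw [if_neg (fun h => h2 h.2), if_pos h1, if_neg h2, mul_zero]
    · rw [if_neg (fun h => h1 h.1), if_neg h1, mul_zero]
  simp only [e]
  simp only [Finset.sum_ite_eq', hL k hk, if_true]
  split_ifs <;> simp

lemma tendsto_Ico_neg : Tendsto (fun L : ℕ => Finset.Ico (-L : ℤ) L) atTop atTop := by
  refine tendsto_atTop_finset_of_monotone (fun a b h => ?_) fun z => ⟨z.natAbs + 1, ?_⟩
  · exact Finset.Ico_subset_Ico (by simpa using h) (by simpa using h)
  · rw [Finset.mem_Ico]; constructor <;> push_cast <;> rcases abs_cases z with h | h <;> omega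

lemma opT_sum {ι : Type*} (s : Finset ι) {m : ι → ℝ → ℝ → ℝ} {B : ℝ} (hm : ∀ i ∈ s, Sym B (m i))
    {f : ℝ → ℂ} (hf' : Integrable (fourierT f)) (N : ℝ → ℝ) (x : ℝ) :
    opT (fun ξ n => ∑ i ∈ s, m i ξ n) f N x = ∑ i ∈ s, opT (m i) f N x := by
  unfold opT
  rw [← integral_finsetSum s fun i hi => (hm i hi).integrable hf' (N x) x]
  refine integral_congr_ae (Eventually.of_forall fun ξ => ?_)
  simp only
  rw [Complex.ofReal_sum, Finset.mul_sum, Finset.sum_mul]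

lemma tendsto_average {f : ℝ → ℂ} (hf : Integrable f) (hf' : Integrable (fourierT f)) (N : ℝ → ℝ)
    (K : ℕ) (x : ℝ) :
    Tendsto (fun L : ℕ => ∫ τ in Ioc (0 : ℝ) 1,
      trF (pkt τ) N (cf (pkt τ) f) (boxTiles K L) x) atTop
      (nhds (opT (fun ξ n => ∑ k ∈ Finset.Ico (-K : ℤ) K, modelSym k ξ n) f N x)) := by
  rw [opT_sum _ (fun k _ => sym_modelSym k) hf']
  have hr : ∀ k : ℤ, (0 : ℝ) < 2 ^ k := two_zpow_pos
  obtain ⟨L0, hL0⟩ : ∃ L0 : ℕ, ∀ k ∈ Finset.Ico (-K : ℤ) K, |⌊(2 : ℝ) ^ k * N x⌋| ≤ L0 := by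
    refine ⟨∑ k ∈ Finset.Ico (-K : ℤ) K, (⌊(2 : ℝ) ^ k * N x⌋).natAbs, fun k hk => ?_⟩
    have := Finset.single_le_sum (f := fun k : ℤ => (⌊(2 : ℝ) ^ k * N x⌋).natAbs)
      (fun _ _ => Nat.zero_le _) hk
    rw [Int.abs_eq_natAbs]
    exact_mod_cast this
  have h1 : Tendsto (fun L : ℕ => ∑ k ∈ Finset.Ico (-K : ℤ) K,
      if 1 / 2 ≤ Int.fract ((2 : ℝ) ^ k * N x) then ∑ n ∈ Finset.Ico (-L : ℤ) L,
        ∫ τ in (0 : ℝ)..1, gfun f (2 ^ k) ⌊(2 : ℝ) ^ k * N x⌋ x (τ + n) else 0) atTop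
      (nhds (∑ k ∈ Finset.Ico (-K : ℤ) K, opT (modelSym k) f N x)) := by
    refine tendsto_finsetSum _ fun k _ => ?_
    by_cases h2 : 1 / 2 ≤ Int.fract ((2 : ℝ) ^ k * N x)
    · simp only [h2, if_true, opT, modelSym]
      rw [← integral_gfun hf (hr k)]
      exact (integrable_gfun hf (hr k) _ x).hasSum_intervalIntegral_comp_add_int.comp tendsto_Ico_neg
    · simp only [h2, if_false, opT, modelSym]
      simp
  refine h1.congr' ?_
  filter_upwards [eventually_ge_atTop L0] with L hL
  have h3 : ∀ k ∈ Finset.Ico (-K : ℤ) K, ⌊(2 : ℝ) ^ k * N x⌋ ∈ Finset.Icc (-L : ℤ) L := by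
    intro k hk
    rw [Finset.mem_Icc, ← abs_le]
    exact (hL0 k hk).trans (by exact_mod_cast hL)
  have hi : ∀ (k : ℤ) (m : ℝ) (n : ℤ), Integrable (fun τ => gfun f (2 ^ k) m x (τ + n))
      (volume.restrict (Ioc 0 1)) := fun k m n =>
    ((integrable_gfun hf (hr k) m x).comp_add_right (n : ℝ)).restrict
  simp only [trF_pkt_eq f N _ x h3]
  rw [integral_finsetSum]
  · refine Finset.sum_congr rfl fun k _ => ?_
    split_ifs
    · rw [integral_finsetSum _ fun n _ => hi _ _ _]
      simp only [intervalIntegral.integral_of_le zero_le_one]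
    · simp
  · intro k _
    split_ifs
    · exact integrable_finsetSum _ fun n _ => hi _ _ _
    · exact integrable_zero _ _ _

lemma continuous_pkt₂' {X : Type*} [TopologicalSpace X] (p : Tile) {a b : X → ℝ}
    (ha : Continuous a) (hb : Continuous b) : Continuous fun z => pkt (a z) p (b z) := by
  unfold pkt
  refine (phi.continuous.comp (by fun_prop)).mul ?_
  have h : Continuous (eChar (p.2.2 * (sc p)⁻¹)) := continuous_eChar _
  exact h.comp hb

lemma measurable_trF_pkt {f : ℝ → ℂ} (hf : Measurable f) {N : ℝ → ℝ} (hN : Measurable N)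
    (P : Finset Tile) :
    Measurable (Function.uncurry fun τ x => trF (pkt τ) N (cf (pkt τ) f) P x) := by
  have h1 : ∀ p : Tile, Measurable fun z : ℝ × ℝ => cf (pkt z.1) f p := by
    intro p
    unfold cf
    refine Measurable.const_mul ?_ _
    have h3 : Continuous fun z : (ℝ × ℝ) × ℝ => pkt z.1.1 p z.2 :=
      continuous_pkt₂' p (by fun_prop) (by fun_prop)
    have h4 : Measurable fun z : (ℝ × ℝ) × ℝ => conj (pkt z.1.1 p z.2) :=
      (continuous_star.comp h3).measurable
    have h5 : StronglyMeasurable fun z : (ℝ × ℝ) × ℝ => f z.2 * conj (pkt z.1.1 p z.2) :=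
      ((hf.comp measurable_snd).mul h4).stronglyMeasurable
    exact (h5.integral_prod_right' (ν := volume)).measurable
  have h2 : ∀ p : Tile, Measurable fun z : ℝ × ℝ => (N ⁻¹' Om2 p).indicator (pkt z.1 p) z.2 := by
    intro p
    have hS : MeasurableSet ((fun z : ℝ × ℝ => N z.2) ⁻¹' Om2 p) :=
      (hN.comp measurable_snd) (measurableSet_Om2 p)
    have h3 : Continuous fun z : ℝ × ℝ => pkt z.1 p z.2 :=
      continuous_pkt₂' p continuous_fst continuous_snd
    exact h3.measurable.indicator hS
  exact Finset.measurable_sum P fun p _ => (h1 p).mul (h2 p)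

/-- Summing the model over all positions and frequencies. -/
lemma carl_modelSym {p q : ℝ} (hpq : p.HolderConjugate q) : ∃ D : ℝ, 0 ≤ D ∧ ∀ K : ℕ,
    Carl p q D (fun ξ n => ∑ k ∈ Finset.Ico (-K : ℤ) K, modelSym k ξ n) := by
  obtain ⟨C, hC⟩ := isPacket_pkt
  have hC0 : 0 < C := lt_of_lt_of_le one_pos (hC 0 (by simp)).one_le
  obtain ⟨D, hD, H⟩ := strong_type hC0 hpq
  refine ⟨D, hD, fun K f hfm hf hf' N hN h hh hA hB => ?_⟩
  have hT := fun L => measurable_trF_pkt hfm hN (boxTiles K L)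
  refine lintegral_enorm_limit_le (fun L => ?_) (tendsto_average hf hf' N K) hh fun L => ?_
  · exact ((hT L).comp measurable_swap).stronglyMeasurable.integral_prod_right'.measurable
  · refine (lintegral_enorm_integral_le (hT L) hh (A := ofReal D *
      ((∫⁻ x, ofReal ‖f x‖ ^ p) ^ p⁻¹ * (∫⁻ x, ofReal (h x) ^ q) ^ q⁻¹))
      ?_).trans (le_of_eq ?_)
    · refine (ae_restrict_iff' measurableSet_Ioc).2 (Eventually.of_forall fun τ hτ => ?_)
      exact H _ (hC τ (by rw [abs_le]; constructor <;> linarith [hτ.1, hτ.2])) N hN f hf hfm h hh hA hB _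
    · simp

lemma Carl.mono {p q D D' : ℝ} {m : ℝ → ℝ → ℝ} (H : Carl p q D m) (h : D ≤ D') :
    Carl p q D' m := fun f hfm hf hf' N hN g hg hA hB =>
  (H f hfm hf hf' N hN g hg hA hB).trans (mul_le_mul_left (ENNReal.ofReal_le_ofReal h) _)

lemma Carl.const_mul {p q D : ℝ} {m : ℝ → ℝ → ℝ} (H : Carl p q D m) {c : ℝ} (hc : 0 ≤ c) :
    Carl p q (c * D) (fun ξ n => c * m ξ n) := by
  intro f hfm hf hf' N hN g hg hA hB
  have e : ∀ x, opT (fun ξ n => c * m ξ n) f N x = c * opT m f N x := by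
    intro x
    unfold opT
    rw [← integral_const_mul]
    refine integral_congr_ae (Eventually.of_forall fun ξ => ?_)
    simp only
    push_cast; ring
  have h2 : ‖(c : ℂ)‖ₑ = ofReal c := by
    rw [← ofReal_norm, Complex.norm_real, Real.norm_of_nonneg hc]
  simp only [e, enorm_mul, h2, mul_assoc]
  rw [lintegral_const_mul' _ _ ENNReal.ofReal_ne_top, ENNReal.ofReal_mul hc, mul_assoc]
  exact mul_le_mul_right (H f hfm hf hf' N hN g hg hA hB) _

/-- The periodic kernel behind the translation average. -/
def kern (d s : ℝ) : ℝ := if 1 / 2 ≤ Int.fract s then bumpA (Int.fract s - d) ^ 2 else 0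

lemma kern_nonneg (d s : ℝ) : 0 ≤ kern d s := by
  unfold kern; split_ifs <;> positivity

lemma kern_le_one (d s : ℝ) : kern d s ≤ 1 := by
  unfold kern
  split_ifs
  · exact pow_le_one₀ bumpA.nonneg bumpA.le_one
  · exact zero_le_one

lemma measurable_kern : Measurable fun z : ℝ × ℝ => kern z.1 z.2 := by
  unfold kern
  refine Measurable.ite (measurableSet_le measurable_const measurable_snd.fract) ?_ measurable_const
  exact (bumpA.continuous.measurable.comp (measurable_snd.fract.sub measurable_fst)).pow_const 2

lemma measurable_kern_right (d : ℝ) : Measurable (kern d) :=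
  measurable_kern.comp (measurable_const.prodMk measurable_id)

lemma kern_periodic (d : ℝ) : Function.Periodic (kern d) 1 := fun s => by
  unfold kern; rw [Int.fract_add_one]

lemma kern_intervalIntegrable (d a b : ℝ) : IntervalIntegrable (kern d) volume a b := by
  refine (intervalIntegrable_const (c := (1 : ℝ))).mono_fun
    (measurable_kern_right d).aestronglyMeasurable (Eventually.of_forall fun s => ?_)
  beta_reduce
  rw [Real.norm_of_nonneg (kern_nonneg d s), norm_one]
  exact kern_le_one d s

lemma modelSym_shift (k : ℤ) (ξ n θ : ℝ) : modelSym k (ξ + θ) (n + θ) =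
    kern ((2 : ℝ) ^ k * (n - ξ)) ((2 : ℝ) ^ k * n + (2 : ℝ) ^ k * θ) := by
  unfold modelSym kern
  rw [mul_add, mul_add]
  congr 3
  rw [Int.fract]; ring

/-- The translation average of the model symbol of scale one. -/
def rho (d : ℝ) : ℝ := ∫ s in (0 : ℝ)..1, kern d s

lemma rho_nonneg (d : ℝ) : 0 ≤ rho d :=
  intervalIntegral.integral_nonneg zero_le_one fun s _ => kern_nonneg d s

lemma rho_le_one (d : ℝ) : rho d ≤ 1 := by
  have := intervalIntegral.norm_integral_le_of_norm_le_const (a := 0) (b := 1) (f := kern d) (C := 1)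
    fun x _ => by rw [Real.norm_of_nonneg (kern_nonneg d x)]; exact kern_le_one d x
  rw [sub_zero, abs_one, mul_one] at this
  exact (le_abs_self _).trans this

lemma measurable_rho : Measurable rho := by
  unfold rho
  simp only [intervalIntegral.integral_of_le zero_le_one]
  exact (measurable_kern.stronglyMeasurable.integral_prod_right'
    (ν := volume.restrict (Ioc (0 : ℝ) 1))).measurable

lemma rho_eq_zero {d : ℝ} (h : ¬ (1 / 8 < d ∧ d < 7 / 8)) : rho d = 0 := by
  unfold rho
  have : ∀ s, kern d s = 0 := fun s => by
    unfold kern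
    split_ifs with h1
    · rw [bumpA_eq_zero, zero_pow two_ne_zero]
      rintro ⟨h2, h3⟩
      have := Int.fract_lt_one s
      exact h ⟨by linarith, by linarith⟩
    · rfl
  simp [this]

lemma rho_pos {d : ℝ} (h1 : 5 / 16 ≤ d) (h2 : d ≤ 5 / 8) : 1 / 8 ≤ rho d := by
  have h3 : ∫ s in (d + 3 / 16)..(d + 5 / 16), kern d s = 1 / 8 := by
    have : ∫ s in (d + 3 / 16)..(d + 5 / 16), kern d s = ∫ s in (d + 3 / 16)..(d + 5 / 16), (1 : ℝ) := by
      refine intervalIntegral.integral_congr fun s hs => ?_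
      rw [uIcc_of_le (by linarith)] at hs
      have hf : Int.fract s = s := Int.fract_eq_self.2 ⟨by linarith [hs.1], by linarith [hs.2]⟩
      simp only [kern, hf]
      rw [if_pos (by linarith [hs.1]), bumpA.one_of_mem_closedBall, one_pow]
      rw [Metric.mem_closedBall, Real.dist_eq]
      change _ ≤ (1 / 16 : ℝ)
      rw [abs_le]; constructor <;> linarith [hs.1, hs.2]
    rw [this]; simp; ring
  rw [← h3]
  exact intervalIntegral.integral_mono_interval (by linarith) (by linarith) (by linarith)
    (Eventually.of_forall fun s => kern_nonneg d s) (kern_intervalIntegrable d _ _)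

lemma integral_modelSym_shift {K : ℕ} {k : ℤ} (hk : -(K : ℤ) ≤ k) (ξ n : ℝ) :
    ∫ θ in Ioc (0 : ℝ) (2 ^ K), modelSym k (ξ + θ) (n + θ) =
      2 ^ K * rho ((2 : ℝ) ^ k * (n - ξ)) := by
  have h2k := two_zpow_pos k
  simp only [modelSym_shift]
  rw [← intervalIntegral.integral_of_le (by positivity),
    intervalIntegral.integral_comp_add_mul (kern _) h2k.ne']
  obtain ⟨j, hj⟩ := Int.eq_ofNat_of_zero_le (by linarith : 0 ≤ k + K)
  have e : (2 : ℝ) ^ k * 2 ^ K = ((2 ^ j : ℤ)) • (1 : ℝ) := by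
    rw [← zpow_natCast, ← two_zpow_add, hj, zsmul_eq_mul, mul_one, zpow_natCast]; push_cast; rfl
  rw [mul_zero, add_zero, e, (kern_periodic _).intervalIntegral_add_zsmul_eq _ _
    (kern_intervalIntegrable _), (kern_periodic _).intervalIntegral_add_eq _ 0, zero_add]
  change (2 ^ k)⁻¹ • ((2 ^ j : ℤ) • rho _) = _
  rw [zsmul_eq_mul] at e ⊢
  rw [mul_one] at e
  rw [← e, smul_eq_mul]
  field_simp

lemma carl_rho {p q : ℝ} (hpq : p.HolderConjugate q) : ∃ D : ℝ, 0 ≤ D ∧ ∀ K : ℕ,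
    Carl p q D (fun ξ n => ∑ k ∈ Finset.Ico (-K : ℤ) K, rho ((2 : ℝ) ^ k * (n - ξ))) := by
  obtain ⟨D, hD, H⟩ := carl_modelSym hpq
  refine ⟨D, hD, fun K => ?_⟩
  have hK : (0 : ℝ) < 2 ^ K := by positivity
  have h1 := Carl.average (μ := volume.restrict (Ioc (0 : ℝ) (2 ^ K)))
    (M := fun θ ξ n => ∑ k ∈ Finset.Ico (-K : ℤ) K, modelSym k (ξ + θ) (n + θ))
    (B := ∑ k ∈ Finset.Ico (-K : ℤ) K, (1 : ℝ)) ?_ ?_ (fun θ => (H K).translate θ)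
  · have h2 := h1.const_mul (inv_nonneg.2 hK.le)
    have e : (2 ^ K : ℝ)⁻¹ * (D * ((volume.restrict (Ioc (0 : ℝ) (2 ^ K))) univ).toReal) = D := by
      rw [Measure.restrict_apply_univ, Real.volume_Ioc, sub_zero, ENNReal.toReal_ofReal hK.le]
      field_simp
    rw [e] at h2
    convert h2 using 3 with ξ n
    rw [integral_finsetSum, Finset.mul_sum]
    · refine Finset.sum_congr rfl fun k hk => ?_
      rw [integral_modelSym_shift (Finset.mem_Ico.1 hk).1, inv_mul_cancel_left₀ hK.ne']
    · intro k _
      refine Integrable.mono' (integrable_const (1 : ℝ)) ?_ (Eventually.of_forall fun θ => ?_)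
      · exact ((measurable_modelSym k).comp (by fun_prop :
          Measurable fun θ : ℝ => (ξ + θ, n + θ))).aestronglyMeasurable
      · rw [Real.norm_of_nonneg (modelSym_nonneg _ _ _)]; exact modelSym_le_one _ _ _
  · exact Finset.measurable_sum _ fun k _ => (measurable_modelSym k).comp (by fun_prop :
      Measurable fun z : ℝ × ℝ × ℝ => (z.2.1 + z.1, z.2.2 + z.1))
  · intro θ ξ n
    rw [abs_of_nonneg (Finset.sum_nonneg fun k _ => modelSym_nonneg _ _ _)]
    exact Finset.sum_le_sum fun k _ => modelSym_le_one _ _ _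

lemma measurable_rhoDiv : Measurable fun t => rho t / t := measurable_rho.div measurable_id

lemma rhoDiv_nonneg (t : ℝ) : 0 ≤ rho t / t := by
  by_cases h : 1 / 8 < t ∧ t < 7 / 8
  · exact div_nonneg (rho_nonneg t) (by linarith [h.1])
  · rw [rho_eq_zero h, zero_div]

lemma integrable_rhoDiv : Integrable fun t => rho t / t := by
  have : Integrable ((Icc (1 / 8 : ℝ) 1).indicator fun _ => (8 : ℝ)) :=
    (integrable_indicator_iff measurableSet_Icc).2 (integrableOn_const (by simp))
  refine this.mono' measurable_rhoDiv.aestronglyMeasurable (Eventually.of_forall fun t => ?_)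
  rw [Real.norm_of_nonneg (rhoDiv_nonneg t)]
  by_cases h : 1 / 8 < t ∧ t < 7 / 8
  · rw [indicator_of_mem (show t ∈ Icc (1 / 8 : ℝ) 1 from ⟨h.1.le, by linarith [h.2]⟩), div_le_iff₀ (by linarith [h.1])]
    linarith [rho_le_one t, h.1]
  · rw [rho_eq_zero h, zero_div]
    exact indicator_nonneg (fun _ _ => by norm_num) _

/-- The total mass of the dilation average. -/
def rhoMass : ℝ := ∫ t, rho t / t

lemma rhoMass_pos : 0 < rhoMass := by
  have h1 : ∫ t in (5 / 16 : ℝ)..(5 / 8), rho t / t ≤ rhoMass := by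
    rw [intervalIntegral.integral_of_le (by norm_num)]
    exact setIntegral_le_integral integrable_rhoDiv (Eventually.of_forall rhoDiv_nonneg)
  have h2 : ∫ t in (5 / 16 : ℝ)..(5 / 8), (1 / 8 : ℝ) ≤ ∫ t in (5 / 16 : ℝ)..(5 / 8), rho t / t := by
    refine intervalIntegral.integral_mono_on (by norm_num) intervalIntegrable_const
      integrable_rhoDiv.intervalIntegrable fun t ht => ?_
    rw [le_div_iff₀ (by linarith [ht.1])]
    linarith [rho_pos ht.1 ht.2, ht.2]
  rw [intervalIntegral.integral_const] at h2
  norm_num at h2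
  linarith

lemma sum_Ico_neg_sub (F : ℤ → ℝ) (K : ℕ) :
    ∑ k ∈ Finset.Ico (-K : ℤ) K, (F (k + 1) - F k) = F K - F (-K) := by
  have h := Finset.sum_range_sub (fun i : ℕ => F (i - K)) (2 * K)
  have e : ((2 * K : ℕ) : ℤ) - K = K := by push_cast; ring
  simp only [e, Nat.cast_zero, zero_sub] at h
  rw [← h]
  refine (Finset.sum_nbij' (fun i : ℕ => (i : ℤ) - K) (fun k : ℤ => (k + K).toNat) ?_ ?_ ?_ ?_ ?_).symm
  all_goals intro i hi
  · rw [Finset.mem_range] at hi; rw [Finset.mem_Ico]; omega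
  · rw [Finset.mem_Ico] at hi; rw [Finset.mem_range]; omega
  · omega
  · rw [Finset.mem_Ico] at hi; omega
  · push_cast; congr 2; ring

lemma integral_rho_dilate (s : ℝ) (hs : 0 < s) (K : ℕ) :
    ∫ l in Ioc (1 : ℝ) 2, (max l 1)⁻¹ * ∑ k ∈ Finset.Ico (-K : ℤ) K,
      rho ((2 : ℝ) ^ k * (max l 1 * s)) = ∫ t in ((2 : ℝ) ^ (-K : ℤ) * s)..((2 : ℝ) ^ (K : ℤ) * s), rho t / t := by
  have hi : ∀ a b : ℝ, IntervalIntegrable (fun t => rho t / t) volume a b := fun a b =>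
    integrable_rhoDiv.intervalIntegrable
  have hI : ∀ k : ℤ, IntervalIntegrable (fun l => ((2 : ℝ) ^ k * s) *
      (rho (l * ((2 : ℝ) ^ k * s)) / (l * ((2 : ℝ) ^ k * s)))) volume 1 2 := fun k => by
    have h2 : 0 < (2 : ℝ) ^ k * s := mul_pos (two_zpow_pos k) hs
    exact ((integrable_rhoDiv.comp_mul_right' h2.ne').const_mul _).intervalIntegrable
  calc _ = ∫ l in (1 : ℝ)..2, ∑ k ∈ Finset.Ico (-K : ℤ) K, ((2 : ℝ) ^ k * s) *
      (rho (l * ((2 : ℝ) ^ k * s)) / (l * ((2 : ℝ) ^ k * s))) := by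
        rw [intervalIntegral.integral_of_le one_le_two]
        refine setIntegral_congr_fun measurableSet_Ioc fun l hl => ?_
        rw [max_eq_left hl.1.le, Finset.mul_sum]
        refine Finset.sum_congr rfl fun k _ => ?_
        have h2 : 0 < (2 : ℝ) ^ k * s := mul_pos (two_zpow_pos k) hs
        have h3 : (2 : ℝ) ^ k * (l * s) = l * ((2 : ℝ) ^ k * s) := by ring
        have hl0 : 0 < l := by linarith [hl.1]
        have h4 := two_zpow_pos k
        rw [h3]
        field_simp
    _ = ∑ k ∈ Finset.Ico (-K : ℤ) K, ((∫ t in (0 : ℝ)..((2 : ℝ) ^ (k + 1) * s), rho t / t) -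
          ∫ t in (0 : ℝ)..((2 : ℝ) ^ k * s), rho t / t) := by
        rw [intervalIntegral.integral_finsetSum fun k _ => hI k]
        refine Finset.sum_congr rfl fun k _ => ?_
        have h2 : 0 < (2 : ℝ) ^ k * s := mul_pos (two_zpow_pos k) hs
        rw [intervalIntegral.integral_interval_sub_left (hi _ _) (hi _ _),
          intervalIntegral.integral_const_mul,
          intervalIntegral.integral_comp_mul_right (fun t => rho t / t) h2.ne', smul_eq_mul,
          mul_inv_cancel_left₀ h2.ne', one_mul, two_zpow_succ, mul_assoc]
    _ = _ := by
        rw [sum_Ico_neg_sub (fun k => ∫ t in (0 : ℝ)..((2 : ℝ) ^ k * s), rho t / t),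
          intervalIntegral.integral_interval_sub_left (hi _ _) (hi _ _)]

/-- The dilation average of the symbols. -/
def avgSym (K : ℕ) (ξ n : ℝ) : ℝ :=
  ∫ l in Ioc (1 : ℝ) 2, (max l 1)⁻¹ * ∑ k ∈ Finset.Ico (-K : ℤ) K,
    rho ((2 : ℝ) ^ k * (max l 1 * n - max l 1 * ξ))

lemma measurable_avg (K : ℕ) : Measurable fun z : ℝ × ℝ × ℝ =>
    (max z.1 1)⁻¹ * ∑ k ∈ Finset.Ico (-K : ℤ) K,
      rho ((2 : ℝ) ^ k * (max z.1 1 * z.2.2 - max z.1 1 * z.2.1)) := by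
  have h1 : Measurable fun z : ℝ × ℝ × ℝ => max z.1 1 := measurable_fst.max measurable_const
  refine h1.inv.mul (Finset.measurable_sum _ fun k _ => measurable_rho.comp ?_)
  exact ((h1.mul measurable_snd.snd).sub (h1.mul measurable_snd.fst)).const_mul _

lemma avgSym_of_pos {ξ n : ℝ} (h : ξ < n) (K : ℕ) : avgSym K ξ n =
    ∫ t in ((2 : ℝ) ^ (-K : ℤ) * (n - ξ))..((2 : ℝ) ^ (K : ℤ) * (n - ξ)), rho t / t := by
  rw [← integral_rho_dilate _ (sub_pos.2 h), avgSym]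
  simp only [mul_sub]

lemma avgSym_of_nonpos {ξ n : ℝ} (h : n ≤ ξ) (K : ℕ) : avgSym K ξ n = 0 := by
  have : ∀ (l : ℝ) (k : ℤ), rho ((2 : ℝ) ^ k * (max l 1 * n - max l 1 * ξ)) = 0 := by
    intro l k
    apply rho_eq_zero
    rintro ⟨h1, _⟩
    have h2 := two_zpow_pos k
    have h3 : 0 ≤ max l 1 * (ξ - n) := mul_nonneg (le_max_of_le_right zero_le_one) (by linarith)
    have h4 := mul_nonneg h2.le h3
    nlinarith
  simp [avgSym, this]

lemma sym_avgSym (K : ℕ) : Sym rhoMass (avgSym K) := by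
  refine ⟨?_, fun ξ n => ?_⟩
  · have h : Measurable fun z : (ℝ × ℝ) × ℝ => (max z.2 1)⁻¹ * ∑ k ∈ Finset.Ico (-K : ℤ) K,
      rho ((2 : ℝ) ^ k * (max z.2 1 * z.1.2 - max z.2 1 * z.1.1)) :=
      (measurable_avg K).comp (by fun_prop : Measurable fun z : (ℝ × ℝ) × ℝ => (z.2, z.1.1, z.1.2))
    exact (h.stronglyMeasurable.integral_prod_right' (ν := volume.restrict (Ioc (1 : ℝ) 2))).measurable
  · rcases lt_or_ge ξ n with h | h
    · have hk : (2 : ℝ) ^ (-K : ℤ) * (n - ξ) ≤ (2 : ℝ) ^ (K : ℤ) * (n - ξ) :=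
        mul_le_mul_of_nonneg_right (two_zpow_mono (by omega)) (by linarith)
      rw [avgSym_of_pos h, intervalIntegral.integral_of_le hk,
        abs_of_nonneg (integral_nonneg fun t => rhoDiv_nonneg t)]
      exact setIntegral_le_integral integrable_rhoDiv (Eventually.of_forall rhoDiv_nonneg)
    · rw [avgSym_of_nonpos h, abs_zero]; exact rhoMass_pos.le

lemma tendsto_avgSym (ξ n : ℝ) : Tendsto (fun K => avgSym K ξ n) atTop
    (nhds (if ξ < n then rhoMass else 0)) := by
  split_ifs with h
  · have hs := sub_pos.2 h
    have h1 : Tendsto (fun K : ℕ => (2 : ℝ) ^ K * (n - ξ)) atTop atTop :=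
      (tendsto_pow_atTop_atTop_of_one_lt one_lt_two).atTop_mul_const hs
    have h2 : Tendsto (fun K : ℕ => (1 / 2 : ℝ) ^ K * (n - ξ)) atTop (nhds 0) := by
      simpa using (tendsto_pow_atTop_nhds_zero_of_lt_one (by norm_num : (0 : ℝ) ≤ 1 / 2)
        (by norm_num)).mul_const (n - ξ)
    refine tendsto_const_nhds.congr' ?_
    filter_upwards [h1.eventually_ge_atTop 1, h2.eventually_le_const (by norm_num : (0 : ℝ) < 1 / 8)]
      with K hK1 hK2
    have e : (2 : ℝ) ^ (-K : ℤ) = (1 / 2) ^ K := by rw [zpow_neg, zpow_natCast]; simp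
    rw [avgSym_of_pos h, e, zpow_natCast, intervalIntegral.integral_of_le (by linarith),
      setIntegral_eq_integral_of_forall_compl_eq_zero, rhoMass]
    intro t ht
    rw [rho_eq_zero, zero_div]
    rintro ⟨h3, h4⟩
    exact ht ⟨by linarith, by linarith⟩
  · simp only [avgSym_of_nonpos (not_lt.1 h)]
    exact tendsto_const_nhds

/-- The Carleson–Hunt theorem for the linearised half-line multiplier. -/
theorem carleson_hunt {p q : ℝ} (hpq : p.HolderConjugate q) : ∃ D : ℝ, 0 ≤ D ∧
    Carl p q D (fun ξ n => if ξ < n then 1 else 0) := by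
  obtain ⟨D, hD, H⟩ := carl_rho hpq
  have hmax : ∀ l : ℝ, 0 < max l 1 := fun l => lt_max_of_lt_right one_pos
  have h1 : ∀ K : ℕ, Carl p q D (avgSym K) := by
    intro K
    have h2 := Carl.average (μ := volume.restrict (Ioc (1 : ℝ) 2))
      (M := fun l ξ n => (max l 1)⁻¹ * ∑ k ∈ Finset.Ico (-K : ℤ) K,
        rho ((2 : ℝ) ^ k * (max l 1 * n - max l 1 * ξ)))
      (B := ∑ k ∈ Finset.Ico (-K : ℤ) K, (1 : ℝ)) (p := p) (q := q) (D := D)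
      (measurable_avg K) ?_ ?_
    · refine h2.mono (le_of_eq ?_)
      rw [Measure.restrict_apply_univ, Real.volume_Ioc]
      norm_num
    · intro l ξ n
      have h3 : (max l 1)⁻¹ ≤ 1 := inv_le_one_of_one_le₀ (le_max_right _ _)
      have h4 : 0 ≤ (max l 1)⁻¹ := inv_nonneg.2 (hmax l).le
      have h5 : ∑ k ∈ Finset.Ico (-K : ℤ) K, rho ((2 : ℝ) ^ k * (max l 1 * n - max l 1 * ξ)) ≤
        ∑ k ∈ Finset.Ico (-K : ℤ) K, (1 : ℝ) := Finset.sum_le_sum fun k _ => rho_le_one _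
      have h6 : 0 ≤ ∑ k ∈ Finset.Ico (-K : ℤ) K, rho ((2 : ℝ) ^ k * (max l 1 * n - max l 1 * ξ)) :=
        Finset.sum_nonneg fun k _ => rho_nonneg _
      rw [abs_of_nonneg (mul_nonneg h4 h6)]
      exact (mul_le_of_le_one_left h6 h3).trans h5
    · intro l
      refine (((H K).dilate hpq (hmax l)).const_mul (inv_nonneg.2 (hmax l).le)).mono ?_
      exact mul_le_of_le_one_left hD (inv_le_one_of_one_le₀ (le_max_right _ _))
  have h2 := (Carl.limit sym_avgSym tendsto_avgSym h1).const_mul (inv_nonneg.2 rhoMass_pos.le)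
  refine ⟨_, mul_nonneg (inv_nonneg.2 rhoMass_pos.le) hD, ?_⟩
  convert h2 using 3 with ξ n
  split_ifs
  · rw [inv_mul_cancel₀ rhoMass_pos.ne']
  · rw [mul_zero]

lemma integrable_fourierT_schwartz (f : 𝓢(ℝ, ℂ)) : Integrable (fourierT f) := by
  have h : fourierT f = ((𝓕 f : 𝓢(ℝ, ℂ)) : ℝ → ℂ) := by
    funext ξ; rw [fourierT_eq, ← SchwartzMap.fourier_coe]
  rw [h]; exact SchwartzMap.integrable _

lemma continuous_fproj {f : ℝ → ℂ} (hf : Integrable (fourierT f)) (S : Set ℝ) :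
    Continuous (fproj S f) := by
  unfold fproj
  refine continuous_of_dominated (bound := fun ξ => ‖fourierT f ξ‖) (fun x => ?_) (fun x => ?_)
    hf.norm.integrableOn ?_
  · exact (hf.aestronglyMeasurable.mul (continuous_eChar₂.comp
      (by fun_prop : Continuous fun ξ : ℝ => (ξ, x))).aestronglyMeasurable).restrict
  · exact Eventually.of_forall fun ξ => by rw [norm_mul, norm_eChar, mul_one]
  · exact Eventually.of_forall fun ξ => continuous_const.mul (continuous_eChar ξ)

lemma norm_fproj_le {f : ℝ → ℂ} (hf : Integrable (fourierT f)) (S : Set ℝ) (x : ℝ) :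
    ‖fproj S f x‖ ≤ ∫ ξ, ‖fourierT f ξ‖ := by
  refine (norm_integral_le_integral_norm _).trans ?_
  simp only [norm_mul, norm_eChar, mul_one]
  exact setIntegral_le_integral hf.norm (Eventually.of_forall fun _ => norm_nonneg _)

lemma fproj_eq_indicator {S : Set ℝ} (hS : MeasurableSet S) (f : ℝ → ℂ) (x : ℝ) :
    fproj S f x = ∫ ξ, S.indicator (fourierT f) ξ * eChar ξ x := by
  rw [fproj, ← integral_indicator hS]
  congr 1; funext ξ
  by_cases h : ξ ∈ S <;> simp [h]

lemma fproj_congr {S T : Set ℝ} (h : S =ᵐ[volume] T) (f : ℝ → ℂ) : fproj S f = fproj T f := by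
  funext x; exact setIntegral_congr_set h

lemma integral_mul_synth' {f G : ℝ → ℂ} (hf : Integrable f) (hG : Integrable G) :
    ∫ x, f x * (∫ ζ, G ζ * eChar ζ x) = ∫ ζ, G ζ * fourierT f (-ζ) := by
  have h := integral_mul_synth hf hG.comp_neg 0
  simp only [eChar_zero_right, mul_one, zero_sub] at h
  rw [← integral_neg_eq_self (fun ζ => G ζ * fourierT f (-ζ))]
  simp only [neg_neg]
  rw [← h]
  congr 1; funext x; congr 1
  rw [← integral_neg_eq_self]
  congr 1; funext ζ
  congr 1
  exact eChar_congr (by ring)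

lemma integral_mul_fproj {w f : ℝ → ℂ} (hw : Integrable w) (hf : Integrable (fourierT f))
    {S : Set ℝ} (hS : MeasurableSet S) :
    ∫ x, w x * fproj S f x = ∫ ζ, S.indicator (fourierT f) ζ * fourierT w (-ζ) := by
  simp only [fproj_eq_indicator hS]
  exact integral_mul_synth' hw (hf.indicator hS)

lemma fproj_univ (h : 𝓢(ℝ, ℂ)) : fproj univ h = h := by
  funext x
  rw [fproj, Measure.restrict_univ]
  have e : ∀ ξ, fourierT h ξ = 𝓕 (h : ℝ → ℂ) ξ := fourierT_eq h
  simp only [e]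
  rw [← fourierInv_eq, ← SchwartzMap.fourier_coe, ← SchwartzMap.fourierInv_coe,
    FourierTransform.fourierInv_fourier_eq]

lemma fproj_add_compl {f : ℝ → ℂ} (hf : Integrable (fourierT f)) {S : Set ℝ}
    (hS : MeasurableSet S) (x : ℝ) : fproj S f x + fproj Sᶜ f x = fproj univ f x := by
  rw [fproj, fproj, fproj, Measure.restrict_univ]
  refine integral_add_compl hS (hf.mul_bdd (c := 1) (continuous_eChar₂.comp
      (by fun_prop : Continuous fun ξ : ℝ => (ξ, x))).aestronglyMeasurable ?_)
  exact Eventually.of_forall fun ξ => (norm_eChar _ _).le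

/-- Products of frequency localised functions have no frequencies outside the sum set. -/
lemma integral_fproj_mul_fourierT_eq_zero (g h ψ : 𝓢(ℝ, ℂ)) {B K : Set ℝ} (hB : MeasurableSet B)
    (hK : MeasurableSet K) (hψ : ∀ η ∈ B, ∀ ζ ∈ K, ψ (ζ + η) = 0) :
    ∫ x, fproj B g x * fproj K h x * fourierT ψ x = 0 := by
  have hθ := integrable_fourierT_schwartz ψ
  have hg := integrable_fourierT_schwartz g
  have hh := integrable_fourierT_schwartz h
  have hw : Integrable fun x => fourierT ψ x * fproj K h x :=
    hθ.mul_bdd (c := ∫ ξ, ‖fourierT h ξ‖) (continuous_fproj hh K).aestronglyMeasurable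
      (Eventually.of_forall fun x => norm_fproj_le hh K x)
  have e : ∫ x, fproj B g x * fproj K h x * fourierT ψ x =
      ∫ x, (fourierT ψ x * fproj K h x) * fproj B g x := by
    congr 1; funext x; ring
  rw [e, integral_mul_fproj hw hg hB]
  refine integral_eq_zero_of_ae (Eventually.of_forall fun η => ?_)
  by_cases hη : η ∈ B
  swap
  · simp [hη]
  have h2 : fourierT (fun x => fourierT ψ x * fproj K h x) (-η) = 0 := by
    have hwη : Integrable fun x => fourierT ψ x * eChar η x :=
      hθ.mul_bdd (c := 1) (continuous_eChar η).aestronglyMeasurable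
        (Eventually.of_forall fun x => (norm_eChar _ _).le)
    have e2 : fourierT (fun x => fourierT ψ x * fproj K h x) (-η) =
        ∫ x, (fourierT ψ x * eChar η x) * fproj K h x := by
      rw [fourierT]; congr 1; funext x; rw [neg_neg]; ring
    rw [e2, integral_mul_fproj hwη hh hK]
    refine integral_eq_zero_of_ae (Eventually.of_forall fun ζ => ?_)
    by_cases hζ : ζ ∈ K
    swap
    · simp [hζ]
    have e3 : fourierT (fun x => fourierT ψ x * eChar η x) (-ζ) = ψ (ζ + η) := by
      rw [← fproj_univ ψ, fproj, Measure.restrict_univ, fproj_univ, fourierT]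
      congr 1; funext x
      rw [neg_neg, mul_assoc, ← eChar_add_left, eChar_comm _ x, add_comm]
    simp [e3, hψ η hη ζ hζ]
  simp [h2]

/-- Frequency localisation of the third factor in a trilinear form. -/
lemma integral_fproj_mul_fproj_mul (f g h : 𝓢(ℝ, ℂ)) {a b : ℝ} {B C : Set ℝ}
    (hB : MeasurableSet B) (hC : MeasurableSet C)
    (hABC : ∀ x ∈ Ioc a b, ∀ y ∈ B, -x - y ∈ C)
    (hgL : MemLp (fproj B g) 2) (hhL : MemLp (fproj C h) 2) :
    ∫ x, fproj (Ioc a b) f x * fproj B g x * h x =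
      ∫ x, fproj (Ioc a b) f x * fproj B g x * fproj C h x := by
  have hf := integrable_fourierT_schwartz f
  have hh := integrable_fourierT_schwartz h
  have ek : ∀ x, h x = fproj C h x + fproj Cᶜ h x := fun x => by
    rw [fproj_add_compl hh hC, fproj_univ]
  have hkL : MemLp (fproj Cᶜ h) 2 := by
    have e : fproj Cᶜ h = (h : ℝ → ℂ) - fproj C h := by
      funext x; simp [ek x]
    rw [e]; exact (h.memLp 2).sub hhL
  have hW : Integrable fun x => fproj B g x * fproj Cᶜ h x := hgL.integrable_mul hkL
  have hW' : Integrable fun x => fproj B g x * fproj C h x := hgL.integrable_mul hhL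
  have hbd : ∀ w : ℝ → ℂ, Integrable w → Integrable fun x => w x * fproj (Ioc a b) f x :=
    fun w hw => hw.mul_bdd (c := ∫ ξ, ‖fourierT f ξ‖)
      (continuous_fproj hf _).aestronglyMeasurable
      (Eventually.of_forall fun x => norm_fproj_le hf _ x)
  have hzero : ∀ᵐ ζ, ζ ∈ Ioo (-b) (-a) →
      fourierT (fun x => fproj B g x * fproj Cᶜ h x) ζ = 0 := by
    refine isOpen_Ioo.ae_eq_zero_of_integral_contDiff_smul_eq_zero
      ((continuous_fourierT hW).locallyIntegrable.locallyIntegrableOn _) ?_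
    intro ψ hψ1 hψ2 hψ3
    have hs : HasCompactSupport fun x => (ψ x : ℂ) :=
      hψ2.comp_left (g := fun t : ℝ => (t : ℂ)) Complex.ofReal_zero
    have hc : ContDiff ℝ ((⊤ : ℕ∞) : WithTop ℕ∞) fun x => (ψ x : ℂ) := Complex.ofRealCLM.contDiff.comp hψ1
    set Ψ : 𝓢(ℝ, ℂ) := hs.toSchwartzMap hc with hΨ
    have eΨ : ∀ x, Ψ x = (ψ x : ℂ) := fun x => rfl
    have key := integral_mul_synth hW Ψ.integrable 0
    simp only [eChar_zero_right, mul_one, zero_sub] at key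
    have e1 : ∀ x, ∫ ζ, Ψ ζ * eChar ζ (-x) = fourierT Ψ x := fun x => by
      rw [fourierT]; congr 1; funext ζ; congr 1
      exact eChar_congr (by ring)
    simp only [e1] at key
    have e2 := integral_fproj_mul_fourierT_eq_zero g h Ψ hB hC.compl ?_
    · rw [e2] at key
      rw [key]
      rfl
    · intro η hη ζ hζ
      rw [eΨ]
      by_contra hne
      have hm : ζ + η ∈ Ioo (-b) (-a) := hψ3 (subset_tsupport _ (by
        intro h0; exact hne (by rw [h0]; simp)))
      apply hζ
      have := hABC (-(ζ + η)) ⟨by linarith [hm.2], by linarith [hm.1]⟩ η hη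
      convert this using 1; ring
  have hmain : ∫ x, (fproj B g x * fproj Cᶜ h x) * fproj (Ioc a b) f x = 0 := by
    rw [integral_mul_fproj hW hf measurableSet_Ioc]
    refine integral_eq_zero_of_ae ?_
    have h1 : ∀ᵐ ζ : ℝ, -ζ ∈ Ioo (-b) (-a) →
        fourierT (fun x => fproj B g x * fproj Cᶜ h x) (-ζ) = 0 :=
      (Measure.measurePreserving_neg (volume : Measure ℝ)).quasiMeasurePreserving.ae hzero
    have h2 : ∀ᵐ ζ : ℝ, ζ ≠ b := by simp [ae_iff, measure_singleton]
    filter_upwards [h1, h2] with ζ h1 h2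
    by_cases hζ : ζ ∈ Ioc a b
    · rw [h1 ⟨by have := lt_of_le_of_ne hζ.2 h2; linarith, by linarith [hζ.1]⟩]; simp
    · simp [hζ]
  have e4 : ∀ x, fproj (Ioc a b) f x * fproj B g x * h x =
      (fproj B g x * fproj C h x) * fproj (Ioc a b) f x +
        (fproj B g x * fproj Cᶜ h x) * fproj (Ioc a b) f x := fun x => by
    rw [ek x]; ring
  simp only [e4]
  rw [integral_add (hbd _ hW') (hbd _ hW), hmain, add_zero]
  congr 1; funext x; ring

lemma exists_measurable_argmax {F : ℕ → ℝ → ℝ} (hF : ∀ j, Measurable (F j)) (J : ℕ) :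
    ∃ k : ℝ → ℕ, Measurable k ∧ ∀ j ≤ J, ∀ x, F j x ≤ F (k x) x := by
  induction J with
  | zero => exact ⟨fun _ => 0, measurable_const, fun j hj x => by rw [Nat.le_zero.1 hj]⟩
  | succ J ih =>
    obtain ⟨k, hk, h⟩ := ih
    have hm : Measurable fun x => F (k x) x :=
      (measurable_from_prod_countable_right (f := fun z : ℕ × ℝ => F z.1 z.2) hF).comp
        (hk.prodMk measurable_id)
    refine ⟨fun x => if F (k x) x ≤ F (J + 1) x then J + 1 else k x,
      Measurable.ite (measurableSet_le hm (hF _)) measurable_const hk, fun j hj x => ?_⟩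
    simp only
    rcases Nat.le_succ_iff.1 hj with hj | rfl
    · split_ifs with h1
      · exact (h j hj x).trans h1
      · exact h j hj x
    · split_ifs with h1
      · exact le_rfl
      · exact (not_le.1 h1).le

/-- The sharp frequency cutoff to a half line. -/
def halfT (f : ℝ → ℂ) (t x : ℝ) : ℂ :=
  opT (fun ξ n => if ξ < n then 1 else 0) f (fun _ => t) x

lemma halfT_eq (f : ℝ → ℂ) (t x : ℝ) : halfT f t x = fproj (Iio t) f x := by
  rw [fproj_eq_indicator measurableSet_Iio, halfT, opT]
  congr 1; funext ξ
  by_cases h : ξ < t <;> simp [h]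

lemma fproj_Ioc {f : ℝ → ℂ} (hf : Integrable (fourierT f)) {a b : ℝ} (hab : a ≤ b) (x : ℝ) :
    fproj (Ioc a b) f x = halfT f b x - halfT f a x := by
  have hi : Integrable fun ξ => fourierT f ξ * eChar ξ x :=
    hf.mul_bdd (c := 1) (continuous_eChar₂.comp
      (by fun_prop : Continuous fun ξ : ℝ => (ξ, x))).aestronglyMeasurable
      (Eventually.of_forall fun ξ => (norm_eChar _ _).le)
  rw [halfT_eq, halfT_eq, fproj_congr Ioo_ae_eq_Ioc.symm, fproj_congr Ioo_ae_eq_Ico, eq_sub_iff_add_eq, fproj, fproj,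
    fproj, ← Iio_union_Ico_eq_Iio hab, setIntegral_union _ measurableSet_Ico hi.integrableOn
    hi.integrableOn, add_comm]
  exact disjoint_left.2 fun y h1 h2 => absurd h2.1 (not_le.2 h1)

/-- The maximal form of the Carleson–Hunt bound for finitely many truncations. -/
lemma lintegral_iSup_fproj_mul_le {p q D : ℝ} (hD : 0 ≤ D)
    (H : Carl p q D (fun ξ n => if ξ < n then 1 else 0)) (hp : 1 ≤ p) (f : 𝓢(ℝ, ℂ)) {a : ℝ}
    {c : ℕ → ℝ} (hac : ∀ j, a ≤ c j) (J : ℕ) {w : ℝ → ℝ≥0∞} (hw : Measurable w)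
    (hwt : ∀ x, w x ≠ ∞) (hwq : ∫⁻ x, w x ^ q ≠ ∞) {V : ℝ → ℝ≥0∞}
    (hV : ∀ x, ∃ j ≤ J, V x ≤ ‖fproj (Ioc a (c j)) f x‖ₑ * w x) :
    ∫⁻ x, V x ≤ ofReal (2 * D) *
      (eLpNorm f (ofReal p) volume * (∫⁻ x, w x ^ q) ^ q⁻¹) := by
  have hf := integrable_fourierT_schwartz f
  have hp0 : 0 < p := by linarith
  have hfc : ∀ j, Measurable fun x => ‖fproj (Ioc a (c j)) f x‖ := fun j =>
    (continuous_fproj hf _).norm.measurable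
  obtain ⟨k, hk, hmax⟩ := exists_measurable_argmax hfc J
  have ew : ∀ x, ofReal (w x).toReal = w x := fun x => ENNReal.ofReal_toReal (hwt x)
  have en : eLpNorm f (ofReal p) volume =
      (∫⁻ x, ofReal ‖f x‖ ^ p) ^ p⁻¹ := by
    rw [eLpNorm_eq_lintegral_rpow_enorm_toReal (by simpa using hp0) ENNReal.ofReal_ne_top,
      ENNReal.toReal_ofReal hp0.le, one_div]
    simp only [ofReal_norm]
  have hfp : ∫⁻ x, ofReal ‖f x‖ ^ p ≠ ∞ := by
    intro h
    have h1 := (f.memLp (ofReal p) (μ := volume)).2.ne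
    rw [en, h, ENNReal.top_rpow_of_pos (inv_pos.2 hp0)] at h1
    exact h1 rfl
  have hC : ∀ N : ℝ → ℝ, Measurable N → ∫⁻ x, ‖halfT f (N x) x‖ₑ * w x ≤ ofReal D *
      (eLpNorm f (ofReal p) volume * (∫⁻ x, w x ^ q) ^ q⁻¹) := by
    intro N hN
    have h1 := H f f.continuous.measurable f.integrable hf N hN (fun x => (w x).toReal)
      hw.ennreal_toReal hfp (by simpa only [ew] using hwq)
    simp only [ew] at h1
    rw [en]; exact h1
  calc ∫⁻ x, V x ≤ ∫⁻ x, (‖halfT f (c (k x)) x‖ₑ * w x + ‖halfT f a x‖ₑ * w x) := by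
        refine lintegral_mono fun x => ?_
        obtain ⟨j, hj, hVj⟩ := hV x
        refine hVj.trans ?_
        rw [← add_mul]
        refine mul_le_mul_left ?_ _
        have h2 : ‖fproj (Ioc a (c j)) f x‖ₑ ≤ ‖fproj (Ioc a (c (k x))) f x‖ₑ :=
          enorm_le_iff_norm_le.2 (hmax j hj x)
        refine h2.trans ?_
        rw [fproj_Ioc hf (hac _)]
        exact enorm_sub_le
    _ ≤ (∫⁻ x, ‖halfT f (c (k x)) x‖ₑ * w x) + ∫⁻ x, ‖halfT f a x‖ₑ * w x := by
        refine (lintegral_add_right' _ ?_).le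
        refine AEMeasurable.mul ?_ hw.aemeasurable
        simp only [halfT_eq]
        exact (continuous_fproj hf _).measurable.enorm.aemeasurable
    _ ≤ _ := by
        refine (add_le_add (hC (fun x => c (k x)) ((measurable_of_countable c).comp hk))
          (hC (fun _ => a) measurable_const)).trans (le_of_eq ?_)
        rw [two_mul, ENNReal.ofReal_add hD hD, add_mul]

/-- The `L^p` norm of a finite square function. -/
def sqF (s : Finset ℕ) (T : ℕ → Set ℝ) (f : ℝ → ℂ) (x : ℝ) : ℝ≥0∞ :=
  (∑ j ∈ s, ‖fproj (T j) f x‖ₑ ^ 2) ^ (2⁻¹ : ℝ)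

lemma measurable_sqF (s : Finset ℕ) (T : ℕ → Set ℝ) (f : 𝓢(ℝ, ℂ)) : Measurable (sqF s T f) :=
  (Finset.measurable_fun_sum _ fun j _ =>
    ((continuous_fproj (integrable_fourierT_schwartz f) (T j)).measurable.enorm.pow_const 2)).pow_const _

lemma sqF_ne_top (s : Finset ℕ) (T : ℕ → Set ℝ) (f : ℝ → ℂ) (x : ℝ) : sqF s T f x ≠ ∞ :=
  ENNReal.rpow_ne_top_of_nonneg (by norm_num)
    (ENNReal.sum_ne_top.2 fun _ _ => ENNReal.pow_ne_top enorm_ne_top)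

lemma lintegral_sqF_le {ι : Type*} {s : Finset ℕ} {T : ℕ → Set ℝ} {U : ι → Set ℝ} {φ : s → ι}
    (hφ : Function.Injective φ) {f : ℝ → ℂ} (h : ∀ j : s, fproj (T j) f = fproj (U (φ j)) f)
    {p : ℝ} (hp : 0 < p) : (∫⁻ x, sqF s T f x ^ p) ^ (1 / p) ≤ sqNormLp U f p := by
  refine ENNReal.rpow_le_rpow (lintegral_mono fun x => ?_) (by positivity)
  rw [sqF, ← ENNReal.rpow_mul, inv_mul_eq_div]
  refine ENNReal.rpow_le_rpow ?_ (by positivity)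
  rw [← Finset.sum_coe_sort]
  simp only [h]
  rw [← tsum_fintype (L := .unconditional _)]
  exact ENNReal.tsum_comp_le_tsum_of_injective hφ fun i => (‖fproj (U i) f x‖ₑ) ^ 2

lemma memLp_fproj {ι : Type*} {U : ι → Set ℝ} (f : 𝓢(ℝ, ℂ)) (h : sqNormLp U f 2 ≠ ∞) (i : ι) :
    MemLp (fproj (U i) f) 2 := by
  refine ⟨(continuous_fproj (integrable_fourierT_schwartz f) _).aestronglyMeasurable, ?_⟩
  have h1 := lintegral_sqF_le (s := {0}) (T := fun _ => U i) (U := U) (φ := fun _ => i)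
    (fun a b _ => Subtype.ext ((Finset.mem_singleton.1 a.2).trans (Finset.mem_singleton.1 b.2).symm)) (f := f) (fun _ => rfl) two_pos
  rw [eLpNorm_eq_lintegral_rpow_enorm_toReal two_ne_zero ENNReal.ofNat_ne_top]
  refine lt_of_le_of_lt (le_trans (le_of_eq ?_) h1) h.lt_top
  simp only [sqF, Finset.sum_singleton, ENNReal.toReal_ofNat]
  congr 2; funext x
  rw [← ENNReal.rpow_mul, inv_mul_cancel₀ two_ne_zero, ENNReal.rpow_one,
    ENNReal.rpow_two]

lemma sum_mul_le_sqF (s : Finset ℕ) (F G : ℕ → ℝ≥0∞) :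
    ∑ j ∈ s, F j * G j ≤
      (∑ j ∈ s, F j ^ 2) ^ (2⁻¹ : ℝ) * (∑ j ∈ s, G j ^ 2) ^ (2⁻¹ : ℝ) := by
  have := ENNReal.inner_le_Lp_mul_Lq s F G (p := 2) (q := 2) ⟨by norm_num, by norm_num, by norm_num⟩
  simpa [one_div] using this

/-- The trilinear bound for one class of frequency intervals. -/
lemma lintegral_trilinear_le {p1 p2 p3 q D : ℝ} (hp1 : 1 ≤ p1) (hp2 : 1 < p2)
    (hp3 : 1 < p3) (hq : 0 < q) (hqp : 1 / q = 1 / p2 + 1 / p3) (hD : 0 ≤ D)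
    (H : Carl p1 q D (fun ξ n => if ξ < n then 1 else 0)) (f g h : 𝓢(ℝ, ℂ)) {a : ℝ}
    {c : ℕ → ℝ} (hac : ∀ j, a ≤ c j) (s : Finset ℕ) (B C : ℕ → Set ℝ) {X Y : ℝ≥0∞}
    (hX : (∫⁻ x, sqF s B g x ^ p2) ^ (1 / p2) ≤ X) (hY : (∫⁻ x, sqF s C h x ^ p3) ^ (1 / p3) ≤ Y)
    (hXt : X ≠ ∞) (hYt : Y ≠ ∞) :
    ∫⁻ x, ∑ j ∈ s, ‖fproj (Ioc a (c j)) f x‖ₑ * (‖fproj (B j) g x‖ₑ * ‖fproj (C j) h x‖ₑ) ≤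
      ofReal (2 * D) * (eLpNorm f (ofReal p1) volume * (X * Y)) := by
  set w : ℝ → ℝ≥0∞ := fun x => sqF s B g x * sqF s C h x with hw
  have h1 : (∫⁻ x, w x ^ q) ^ q⁻¹ ≤ X * Y := by
    have h2 := ENNReal.lintegral_Lp_mul_le_Lq_mul_Lr hq (q := p2) (r := p3) ?_ hqp volume
      (measurable_sqF s B g).aemeasurable (measurable_sqF s C h).aemeasurable
    · rw [← one_div]
      exact h2.trans (mul_le_mul' hX hY)
    · have : 1 / p2 < 1 / q := by rw [hqp]; have : 0 < 1 / p3 := by positivity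
                                  linarith
      exact (one_div_lt_one_div (by linarith) hq).1 this
  have h3 : ∫⁻ x, w x ^ q ≠ ∞ := by
    intro h0
    rw [h0, ENNReal.top_rpow_of_pos (inv_pos.2 hq), top_le_iff] at h1
    exact ENNReal.mul_ne_top hXt hYt h1
  refine (lintegral_iSup_fproj_mul_le hD H hp1 f hac (s.sup id)
    ((measurable_sqF s B g).mul (measurable_sqF s C h))
    (fun x => ENNReal.mul_ne_top (sqF_ne_top _ _ _ _) (sqF_ne_top _ _ _ _)) h3 ?_).trans ?_
  · intro x
    rcases s.eq_empty_or_nonempty with rfl | hs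
    · exact ⟨0, by simp, by simp⟩
    obtain ⟨j, hj, hmax⟩ := s.exists_max_image (fun j => ‖fproj (Ioc a (c j)) f x‖ₑ) hs
    refine ⟨j, Finset.le_sup (f := id) hj, ?_⟩
    calc _ ≤ ∑ i ∈ s, ‖fproj (Ioc a (c j)) f x‖ₑ * (‖fproj (B i) g x‖ₑ * ‖fproj (C i) h x‖ₑ) :=
          Finset.sum_le_sum fun i hi => mul_le_mul_left (hmax i hi) _
      _ = ‖fproj (Ioc a (c j)) f x‖ₑ * ∑ i ∈ s, (‖fproj (B i) g x‖ₑ * ‖fproj (C i) h x‖ₑ) := by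
          rw [Finset.mul_sum]
      _ ≤ _ := mul_le_mul_right (sum_mul_le_sqF _ _ _) _
  · exact mul_le_mul_right (mul_le_mul_right h1 _) _

/-- The extremal function in the duality between `L^q` and its dual. -/
def dualPt (q : ℝ) (z : ℂ) : ℂ := conj z * ((‖z‖ ^ (q - 2) : ℝ) : ℂ)

lemma norm_dualPt {q : ℝ} (hq : 1 < q) (z : ℂ) : ‖dualPt q z‖ = ‖z‖ ^ (q - 1) := by
  rw [dualPt, norm_mul, RCLike.norm_conj, Complex.norm_real, Real.norm_eq_abs,
    abs_of_nonneg (Real.rpow_nonneg (norm_nonneg z) _)]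
  rcases eq_or_ne z 0 with rfl | hz
  · rw [norm_zero, zero_mul, Real.zero_rpow (by linarith)]
  · rw [mul_comm, ← Real.rpow_add_one (norm_ne_zero_iff.2 hz)]
    congr 1; ring

lemma mul_dualPt {q : ℝ} (hq : 1 < q) (z : ℂ) : z * dualPt q z = ((‖z‖ ^ q : ℝ) : ℂ) := by
  rw [dualPt, ← mul_assoc, Complex.mul_conj, Complex.normSq_eq_norm_sq, ← Complex.ofReal_mul]
  congr 1
  rcases eq_or_ne z 0 with rfl | hz
  · rw [norm_zero, Real.zero_rpow (by linarith : q ≠ 0)]; simp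
  · rw [← Real.rpow_natCast, ← Real.rpow_add (norm_pos_iff.2 hz)]
    congr 1; push_cast; ring

lemma continuous_dualPt {q : ℝ} (hq : 1 < q) : Continuous (dualPt q) := by
  rw [continuous_iff_continuousAt]
  intro z
  rcases eq_or_ne z 0 with rfl | hz
  · have h0 : dualPt q 0 = 0 := by simp [dualPt]
    rw [ContinuousAt, h0, tendsto_zero_iff_norm_tendsto_zero]
    simp only [norm_dualPt hq]
    have h : Continuous fun z : ℂ => ‖z‖ ^ (q - 1) :=
      continuous_norm.rpow_const fun _ => Or.inr (by linarith)
    have := h.tendsto 0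
    rwa [norm_zero, Real.zero_rpow (by linarith)] at this
  · refine ContinuousAt.mul (Complex.continuous_conj.continuousAt) ?_
    exact Complex.continuous_ofReal.continuousAt.comp
      (continuous_norm.continuousAt.rpow_const (Or.inl (norm_ne_zero_iff.2 hz)))

lemma enorm_integral_le_of_schwartz {b : ℝ → ℂ} (hb : Continuous b) {p : ℝ≥0∞} (hp : 1 ≤ p)
    (hpt : p ≠ ∞) {M : ℝ≥0∞} (hM : M ≠ ∞)
    (H : ∀ h : 𝓢(ℝ, ℂ), ‖∫ x, b x * h x‖ₑ ≤ M * eLpNorm h p volume)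
    {h : ℝ → ℂ} (hh : Continuous h) (hc : HasCompactSupport h) :
    ‖∫ x, b x * h x‖ₑ ≤ M * eLpNorm h p volume := by
  set K := tsupport h with hK
  have hKc : IsCompact K := hc
  have hKv : volume K ≠ ∞ := hKc.measure_ne_top
  have happ : ∀ n : ℕ, ∃ k : 𝓢(ℝ, ℂ), (∀ x, ‖k x - h x‖ ≤ 1 / ((n : ℝ) + 1)) ∧
      ∀ x, x ∉ K → k x - h x = 0 := by
    intro n
    obtain ⟨k, hk1, hk2, hk3⟩ := hh.exists_contDiff_approx (⊤ : ℕ∞)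
      (ε := fun _ => 1 / ((n : ℝ) + 1)) continuous_const (fun _ => by positivity)
    have hkc : HasCompactSupport k := hc.mono hk3
    refine ⟨hkc.toSchwartzMap hk1, fun x => ?_, fun x hx => ?_⟩
    · have := hk2 x
      rw [dist_eq_norm] at this
      exact this.le
    · have h1 : h x = 0 := image_eq_zero_of_notMem_tsupport hx
      have h2 : k x = 0 := by
        by_contra h0; exact hk3 h0 h1
      change k x - h x = 0
      rw [h1, h2, sub_zero]
  choose k hk1 hk2 using happ
  have hlim : Tendsto (fun n => ∫ x, b x * k n x) atTop (nhds (∫ x, b x * h x)) := by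
    refine tendsto_integral_of_dominated_convergence
      (fun x => K.indicator (fun x => ‖b x‖ * (‖h x‖ + 1)) x) (fun n => ?_) ?_ (fun n => ?_) ?_
    · exact (hb.mul (k n).continuous).aestronglyMeasurable
    · rw [integrable_indicator_iff hKc.isClosed.measurableSet]
      exact (by fun_prop : Continuous fun x => ‖b x‖ * (‖h x‖ + 1)).continuousOn.integrableOn_compact hKc
    · refine Eventually.of_forall fun x => ?_
      by_cases hx : x ∈ K
      · rw [indicator_of_mem hx, norm_mul]
        refine mul_le_mul_of_nonneg_left ?_ (norm_nonneg _)
        have h1 := norm_le_norm_add_norm_sub' (k n x) (h x)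
        have h2 : 1 / ((n : ℝ) + 1) ≤ 1 := by
          rw [div_le_one (by positivity)]; linarith [Nat.cast_nonneg (α := ℝ) n]
        linarith [hk1 n x]
      · have h1 := hk2 n x hx
        rw [image_eq_zero_of_notMem_tsupport hx, sub_zero] at h1
        rw [indicator_of_notMem hx, h1]; simp
    · refine Eventually.of_forall fun x => Tendsto.const_mul _ ?_
      rw [tendsto_iff_norm_sub_tendsto_zero]
      exact squeeze_zero (fun _ => norm_nonneg _) (fun n => hk1 n x)
        tendsto_one_div_add_atTop_nhds_zero_nat
  set d : ℕ → ℝ≥0∞ := fun n => ofReal (1 / ((n : ℝ) + 1)) with hd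
  have hd0 : Tendsto d atTop (nhds 0) := by
    have := ENNReal.tendsto_ofReal tendsto_one_div_add_atTop_nhds_zero_nat
    rwa [ENNReal.ofReal_zero] at this
  have hnorm : ∀ n, eLpNorm (k n) p volume ≤
      eLpNorm h p volume + d n * volume K ^ (1 / p.toReal) := by
    intro n
    have e : (k n : ℝ → ℂ) = h + fun x => k n x - h x := by funext x; simp
    have h1 : eLpNorm (fun x => k n x - h x) p volume ≤ d n * volume K ^ (1 / p.toReal) := by
      have h2 : eLpNorm (fun x => k n x - h x) p volume ≤
          eLpNorm (K.indicator fun _ => (1 / ((n : ℝ) + 1) : ℝ)) p volume := by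
        refine eLpNorm_mono fun x => ?_
        by_cases hx : x ∈ K
        · rw [indicator_of_mem hx]
          exact (hk1 n x).trans (le_abs_self _)
        · rw [hk2 n x hx, norm_zero]; exact norm_nonneg _
      refine h2.trans (le_of_eq ?_)
      rw [eLpNorm_indicator_const hKc.isClosed.measurableSet
        (zero_lt_one.trans_le hp).ne' hpt, Real.enorm_eq_ofReal (by positivity)]
    rw [e]
    exact (eLpNorm_add_le hh.aestronglyMeasurable
      ((k n).continuous.sub hh).aestronglyMeasurable hp).trans (add_le_add le_rfl h1)
  have hVt : volume K ^ (1 / p.toReal) ≠ ∞ := ENNReal.rpow_ne_top_of_nonneg (by positivity) hKv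
  have h3 : Tendsto (fun n => M * (eLpNorm h p volume + d n * volume K ^ (1 / p.toReal)))
      atTop (nhds (M * (eLpNorm h p volume + 0 * volume K ^ (1 / p.toReal)))) :=
    ENNReal.Tendsto.const_mul (tendsto_const_nhds.add
      (ENNReal.Tendsto.mul_const hd0 (Or.inr hVt))) (Or.inr hM)
  rw [zero_mul, add_zero] at h3
  exact le_of_tendsto_of_tendsto' hlim.enorm h3 fun n =>
    (H (k n)).trans (mul_le_mul_right (hnorm n) _)

/-- The `L^q` norm of a continuous function is controlled by testing on Schwartz functions. -/
lemma eLpNorm_le_of_schwartz {b : ℝ → ℂ} (hb : Continuous b) {p q : ℝ}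
    (hpq : p.HolderConjugate q) {M : ℝ≥0∞} (hM : M ≠ ∞)
    (H : ∀ h : 𝓢(ℝ, ℂ), ‖∫ x, b x * h x‖ₑ ≤ M * eLpNorm h (ofReal p) volume) :
    eLpNorm b (ofReal q) volume ≤ M := by
  have hp := hpq.lt
  have hq := hpq.symm.lt
  set φ : ℕ → ℝ → ℝ := fun R x => max 0 (min 1 (R + 1 - |x|)) with hφ
  have hφc : ∀ R, Continuous (φ R) := fun R => by simp only [hφ]; fun_prop
  have hφ0 : ∀ R x, 0 ≤ φ R x := fun R x => le_max_left _ _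
  have hφ1 : ∀ R x, φ R x ≤ 1 := fun R x => max_le zero_le_one (min_le_left _ _)
  have hφs : ∀ R, HasCompactSupport (φ R) := fun R => by
    refine HasCompactSupport.intro (isCompact_Icc (a := -((R : ℝ) + 1)) (b := R + 1)) fun x hx => ?_
    refine max_eq_left ((min_le_right _ _).trans ?_)
    by_contra h
    exact hx (abs_le.1 (by linarith))
  have key : ∀ R, ∫⁻ x, ofReal (φ R x) * ‖b x‖ₑ ^ q ≤ M ^ q := by
    intro R
    set h : ℝ → ℂ := fun x => (φ R x : ℂ) * dualPt q (b x) with hh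
    have hc : Continuous h :=
      (Complex.continuous_ofReal.comp (hφc R)).mul ((continuous_dualPt hq).comp hb)
    have hs : HasCompactSupport h :=
      ((hφs R).comp_left (g := fun t : ℝ => (t : ℂ)) Complex.ofReal_zero).mul_right
    have h1 := enorm_integral_le_of_schwartz hb (ENNReal.one_le_ofReal.2 hp.le)
      ENNReal.ofReal_ne_top hM H hc hs
    set I := ∫⁻ x, ofReal (φ R x) * ‖b x‖ₑ ^ q with hI
    have eb : ∀ x, ‖b x‖ₑ ^ q = ofReal (‖b x‖ ^ q) := fun x => by
      rw [← ofReal_norm, ENNReal.ofReal_rpow_of_nonneg (norm_nonneg _) (by linarith)]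
    have e2 : ∀ x, b x * h x = ((φ R x * ‖b x‖ ^ q : ℝ) : ℂ) := fun x => by
      rw [hh, mul_left_comm, mul_dualPt hq, Complex.ofReal_mul]
    have hInt : Integrable fun x => φ R x * ‖b x‖ ^ q :=
      ((hφc R).mul (hb.norm.rpow_const fun _ => Or.inr (by linarith))).integrable_of_hasCompactSupport
        ((hφs R).mul_right)
    have hnn : ∀ x, 0 ≤ φ R x * ‖b x‖ ^ q := fun x =>
      mul_nonneg (hφ0 R x) (Real.rpow_nonneg (norm_nonneg _) _)
    have eI : I = ofReal (∫ x, φ R x * ‖b x‖ ^ q) := by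
      rw [ofReal_integral_eq_lintegral_ofReal hInt (Eventually.of_forall hnn), hI]
      congr 1; funext x
      rw [ENNReal.ofReal_mul (hφ0 R x), eb]
    have hIt : I ≠ ∞ := by rw [eI]; exact ENNReal.ofReal_ne_top
    have h2 : I ≤ M * I ^ (1 / p) := by
      have e3 : ‖∫ x, b x * h x‖ₑ = I := by
        simp only [e2]
        rw [integral_complex_ofReal, eI, ← ofReal_norm, Complex.norm_real, Real.norm_eq_abs,
          abs_of_nonneg (integral_nonneg hnn)]
      rw [e3] at h1
      refine h1.trans (mul_le_mul_right ?_ _)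
      rw [eLpNorm_eq_lintegral_rpow_enorm_toReal (by simpa using hpq.pos) ENNReal.ofReal_ne_top,
        ENNReal.toReal_ofReal hpq.nonneg]
      refine ENNReal.rpow_le_rpow (lintegral_mono fun x => ?_) (by simpa using hpq.nonneg)
      rw [← ofReal_norm, ENNReal.ofReal_rpow_of_nonneg (norm_nonneg _) hpq.nonneg, eb,
        ← ENNReal.ofReal_mul (hφ0 R x)]
      refine ENNReal.ofReal_le_ofReal ?_
      rw [hh, norm_mul, norm_dualPt hq, Complex.norm_real, Real.norm_eq_abs,
        abs_of_nonneg (hφ0 R x), Real.mul_rpow (hφ0 R x) (Real.rpow_nonneg (norm_nonneg _) _),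
        ← Real.rpow_mul (norm_nonneg _), hpq.symm.sub_one_mul_conj]
      refine mul_le_mul_of_nonneg_right ?_ (Real.rpow_nonneg (norm_nonneg _) _)
      exact (Real.rpow_le_rpow_of_exponent_ge' (hφ0 R x) (hφ1 R x) zero_le_one hp.le).trans
        (Real.rpow_one _).le
    rcases eq_or_ne I 0 with h0 | h0
    · rw [h0]; exact zero_le
    have h4 : I ^ (1 / q) ≤ M := by
      have e5 : I = I ^ (1 / q) * I ^ (1 / p) := by
        rw [← ENNReal.rpow_add _ _ h0 hIt, one_div, one_div, add_comm, hpq.inv_add_inv_eq_one,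
          ENNReal.rpow_one]
      have hne : I ^ (1 / p) ≠ 0 := by simp [h0, hpq.pos, hIt]
      have hnt : I ^ (1 / p) ≠ ∞ :=
        ENNReal.rpow_ne_top_of_nonneg (by simpa using hpq.nonneg) hIt
      refine (ENNReal.mul_le_mul_iff_left hne hnt).1 ?_
      rw [← e5]; exact h2
    calc I = (I ^ (1 / q)) ^ q := by
          rw [← ENNReal.rpow_mul, one_div_mul_cancel (by linarith), ENNReal.rpow_one]
      _ ≤ M ^ q := ENNReal.rpow_le_rpow h4 (by linarith)
  have hfin : ∫⁻ x, ‖b x‖ₑ ^ q ≤ M ^ q := by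
    have e : ∀ x, ‖b x‖ₑ ^ q =
        liminf (fun R : ℕ => ofReal (φ R x) * ‖b x‖ₑ ^ q) atTop := by
      intro x
      refine (Tendsto.liminf_eq (tendsto_const_nhds.congr' ?_)).symm
      obtain ⟨n, hn⟩ := exists_nat_ge |x|
      filter_upwards [eventually_ge_atTop n] with R hR
      have h1 : φ R x = 1 := by
        have h2 : (n : ℝ) ≤ R := by exact_mod_cast hR
        simp only [hφ]
        rw [min_eq_left (by linarith), max_eq_right zero_le_one]
      rw [h1, ENNReal.ofReal_one, one_mul]
    rw [lintegral_congr e]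
    refine (lintegral_liminf_le fun R => ?_).trans ?_
    · exact (hφc R).measurable.ennreal_ofReal.mul (hb.measurable.enorm.pow_const q)
    · exact (liminf_le_liminf (Eventually.of_forall key)).trans
        (liminf_const _).le
  rw [eLpNorm_eq_lintegral_rpow_enorm_toReal (by simpa using hpq.symm.pos) ENNReal.ofReal_ne_top,
    ENNReal.toReal_ofReal hpq.symm.nonneg]
  refine (ENNReal.rpow_le_rpow hfin (by simpa using hpq.symm.nonneg)).trans (le_of_eq ?_)
  rw [← ENNReal.rpow_mul, mul_one_div_cancel (by linarith), ENNReal.rpow_one]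

/-- Partial sums of the paraproduct symbol. -/
def muvPart (u v : ℕ → ℝ) (J : ℕ) (ξ η : ℝ) : ℂ :=
  ∑ j ∈ Finset.range J, indC (Ioc (u 0) (u (j + 1))) ξ * indC (Ico (v (j + 1)) (v (j + 2))) η

lemma norm_indC_le (s : Set ℝ) (x : ℝ) : ‖indC s x‖ ≤ 1 := by
  by_cases h : x ∈ s <;> simp [indC, h]

lemma indC_Ico_eq_zero {v : ℕ → ℝ} (hv : StrictMono v) {η : ℝ} {i j : ℕ}
    (hi : η ∈ Ico (v i) (v (i + 1))) (hij : j ≠ i) : indC (Ico (v j) (v (j + 1))) η = 0 := by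
  refine indicator_of_notMem (fun h => ?_) _
  rcases lt_or_gt_of_ne hij with h1 | h1
  · exact absurd h.2 (not_lt.2 ((hv.monotone h1).trans hi.1))
  · exact absurd hi.2 (not_lt.2 ((hv.monotone h1).trans h.1))

lemma exists_symbol_support (u : ℕ → ℝ) {v : ℕ → ℝ} (hv : StrictMono v) (ξ η : ℝ) :
    ∃ i, ∀ j ≠ i,
      indC (Ioc (u 0) (u (j + 1))) ξ * indC (Ico (v (j + 1)) (v (j + 2))) η = 0 := by
  by_cases h : ∃ i, η ∈ Ico (v (i + 1)) (v (i + 2))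
  · obtain ⟨i, hi⟩ := h
    exact ⟨i, fun j hj => by rw [indC_Ico_eq_zero hv hi (by omega), mul_zero]⟩
  · push Not at h
    exact ⟨0, fun j _ => by
      rw [show indC (Ico (v (j + 1)) (v (j + 2))) η = 0 from indicator_of_notMem (h j) _, mul_zero]⟩

lemma norm_muvPart_le (u : ℕ → ℝ) {v : ℕ → ℝ} (hv : StrictMono v) (J : ℕ) (ξ η : ℝ) :
    ‖muvPart u v J ξ η‖ ≤ 1 := by
  obtain ⟨i, hi⟩ := exists_symbol_support u hv ξ η
  by_cases hJ : i ∈ Finset.range J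
  · rw [muvPart, Finset.sum_eq_single_of_mem i hJ fun j _ hj => hi j hj, norm_mul]
    exact mul_le_one₀ (norm_indC_le _ _) (norm_nonneg _) (norm_indC_le _ _)
  · rw [muvPart, Finset.sum_eq_zero fun j hj => hi j (by rintro rfl; exact hJ hj), norm_zero]
    exact zero_le_one

lemma tendsto_muvPart (u : ℕ → ℝ) {v : ℕ → ℝ} (hv : StrictMono v) (ξ η : ℝ) :
    Tendsto (fun J => muvPart u v J ξ η) atTop (nhds (muv u v ξ η)) := by
  obtain ⟨i, hi⟩ := exists_symbol_support u hv ξ η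
  have h := HasSum.tendsto_sum_nat (hasSum_single (L := .unconditional ℕ) (f := fun j =>
    indC (Ioc (u 0) (u (j + 1))) ξ * indC (Ico (v (j + 1)) (v (j + 2))) η) i hi)
  rw [← tsum_eq_single (L := .unconditional ℕ) (f := fun j =>
    indC (Ioc (u 0) (u (j + 1))) ξ * indC (Ico (v (j + 1)) (v (j + 2))) η) i hi] at h
  exact h

lemma integral_symbol (f g : ℝ → ℂ) {A B : Set ℝ} (hB : MeasurableSet B) (ξ x : ℝ) :
    ∫ η, indC A ξ * indC B η * fourierT f ξ * fourierT g η * eChar (ξ + η) x =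
      A.indicator (fourierT f) ξ * eChar ξ x * fproj B g x := by
  rw [fproj_eq_indicator hB, ← integral_const_mul]
  congr 1; funext η
  rw [eChar_add_left]
  by_cases h1 : ξ ∈ A <;> by_cases h2 : η ∈ B <;> simp [indC, h1, h2]
  ring

lemma integrable_symbol {m : ℝ → ℂ} (hm : Measurable m) (hm1 : ∀ η, ‖m η‖ ≤ 1) {g : ℝ → ℂ}
    (hg : Integrable (fourierT g)) (c : ℂ) (ξ x : ℝ) :
    Integrable fun η => m η * c * fourierT g η * eChar (ξ + η) x := by
  have h := (hg.bdd_mul (c := ‖c‖) (hm.mul_const c).aestronglyMeasurable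
    (Eventually.of_forall fun η => ?_)).mul_bdd (c := 1)
    (continuous_eChar₂.comp (by fun_prop : Continuous fun η : ℝ => (ξ + η, x))).aestronglyMeasurable
    (Eventually.of_forall fun η => (norm_eChar _ _).le)
  · exact h
  · rw [norm_mul]; exact mul_le_of_le_one_left (norm_nonneg _) (hm1 η)

lemma measurable_indC {s : Set ℝ} (hs : MeasurableSet s) : Measurable (indC s) :=
  measurable_one.indicator hs

lemma measurable_muvPart (u v : ℕ → ℝ) (J : ℕ) (ξ : ℝ) : Measurable (muvPart u v J ξ) :=
  Finset.measurable_fun_sum _ fun _ _ => (measurable_indC measurableSet_Ico).const_mul _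

lemma integral_muvPart (u v : ℕ → ℝ) {f g : ℝ → ℂ}
    (hg : Integrable (fourierT g)) (J : ℕ) (ξ x : ℝ) :
    ∫ η, muvPart u v J ξ η * fourierT f ξ * fourierT g η * eChar (ξ + η) x =
      ∑ j ∈ Finset.range J, (Ioc (u 0) (u (j + 1))).indicator (fourierT f) ξ * eChar ξ x *
        fproj (Ico (v (j + 1)) (v (j + 2))) g x := by
  simp only [muvPart, Finset.sum_mul]
  rw [integral_finsetSum]
  · exact Finset.sum_congr rfl fun j _ => integral_symbol f g measurableSet_Ico ξ x
  · intro j _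
    refine integrable_symbol ((measurable_indC measurableSet_Ico).const_mul _) (fun η => ?_) hg _ ξ x
    rw [norm_mul]
    exact mul_le_one₀ (norm_indC_le _ _) (norm_nonneg _) (norm_indC_le _ _)

lemma Bm_muvPart (u v : ℕ → ℝ) {f g : ℝ → ℂ} (hf : Integrable (fourierT f))
    (hg : Integrable (fourierT g)) (J : ℕ) (x : ℝ) :
    Bm (muvPart u v J) f g x = ∑ j ∈ Finset.range J,
      fproj (Ioc (u 0) (u (j + 1))) f x * fproj (Ico (v (j + 1)) (v (j + 2))) g x := by
  rw [Bm]
  simp only [integral_muvPart u v hg]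
  rw [integral_finsetSum]
  · exact Finset.sum_congr rfl fun j _ => by
      rw [integral_mul_const, fproj_eq_indicator measurableSet_Ioc]
  · intro j _
    refine Integrable.mul_const ?_ _
    exact (hf.indicator measurableSet_Ioc).mul_bdd (c := 1) (continuous_eChar₂.comp
      (by fun_prop : Continuous fun ξ : ℝ => (ξ, x))).aestronglyMeasurable
      (Eventually.of_forall fun ξ => (norm_eChar _ _).le)

lemma tendsto_Bm_muvPart (u : ℕ → ℝ) {v : ℕ → ℝ} (hv : StrictMono v) {f g : ℝ → ℂ}
    (hf : Integrable (fourierT f)) (hg : Integrable (fourierT g)) (x : ℝ) :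
    Tendsto (fun J => Bm (muvPart u v J) f g x) atTop
      (nhds (Bm (muv u v) f g x)) := by
  have hb : ∀ J ξ η, ‖muvPart u v J ξ η * fourierT f ξ * fourierT g η * eChar (ξ + η) x‖ ≤
      ‖fourierT f ξ‖ * ‖fourierT g η‖ := fun J ξ η => by
    rw [norm_mul, norm_eChar, mul_one, norm_mul, norm_mul]
    exact mul_le_mul_of_nonneg_right
      (mul_le_of_le_one_left (norm_nonneg _) (norm_muvPart_le u hv J ξ η)) (norm_nonneg _)
  refine tendsto_integral_of_dominated_convergence
    (fun ξ => ‖fourierT f ξ‖ * ∫ η, ‖fourierT g η‖) (fun J => ?_) (hf.norm.mul_const _)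
    (fun J => ?_) ?_
  · simp only [integral_muvPart u v hg]
    refine Finset.aestronglyMeasurable_fun_sum _ fun j _ => ?_
    exact ((hf.aestronglyMeasurable.indicator measurableSet_Ioc).mul (continuous_eChar₂.comp
      (by fun_prop : Continuous fun ξ : ℝ => (ξ, x))).aestronglyMeasurable).mul_const _
  · refine Eventually.of_forall fun ξ => ?_
    rw [← integral_const_mul]
    exact norm_integral_le_of_norm_le (hg.norm.const_mul _)
      (Eventually.of_forall fun η => hb J ξ η)
  · refine Eventually.of_forall fun ξ => ?_
    refine tendsto_integral_of_dominated_convergence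
      (fun η => ‖fourierT f ξ‖ * ‖fourierT g η‖) (fun J => ?_) (hg.norm.const_mul _)
      (fun J => Eventually.of_forall fun η => hb J ξ η)
      (Eventually.of_forall fun η =>
        (((tendsto_muvPart u hv ξ η).mul_const _).mul_const _).mul_const _)
    exact (integrable_symbol (measurable_muvPart u v J ξ) (norm_muvPart_le u hv J ξ) hg _ ξ
      x).aestronglyMeasurable

lemma ordConnected_mink2 {A B : Set ℝ} (hA : A.OrdConnected) (hB : B.OrdConnected) :
    (mink2 A B).OrdConnected := by
  have e : mink2 A B = (fun z : ℝ × ℝ => -z.1 - z.2) '' (A ×ˢ B) := by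
    exact (image_prod (fun x y : ℝ => -x - y)).symm
  rw [e]
  refine IsPreconnected.ordConnected ?_
  exact (hA.isPreconnected.prod hB.isPreconnected).image _ (by fun_prop)

lemma measurableSet_Iuv (u v : ℕ → ℝ) (j : ℕ) : MeasurableSet (Iuv u v j) :=
  (ordConnected_mink2 ordConnected_Ioc ordConnected_Ico).measurableSet

/-- The gaps of an increasing sequence are components of the complement of its closure. -/
lemma Ioo_mem_componentsOf {v : ℕ → ℝ} (hv : StrictMono v) (j : ℕ) :
    Ioo (v j) (v (j + 1)) ∈ componentsOf (closure (range v))ᶜ := by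
  have hlt : v j < v (j + 1) := hv (Nat.lt_succ_self j)
  have hsub : Ioo (v j) (v (j + 1)) ⊆ (closure (range v))ᶜ := by
    intro y hy hyc
    obtain ⟨z, hz1, i, rfl⟩ := mem_closure_iff.1 hyc _ isOpen_Ioo hy
    have h1 := hv.lt_iff_lt.1 hz1.1
    have h2 := hv.lt_iff_lt.1 hz1.2
    omega
  obtain ⟨x, hx⟩ := nonempty_Ioo.2 hlt
  refine ⟨x, hsub hx, Subset.antisymm
    (isPreconnected_Ioo.subset_connectedComponentIn hx hsub) fun y hy => ?_⟩
  have hoc : (connectedComponentIn (closure (range v))ᶜ x).OrdConnected :=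
    isPreconnected_connectedComponentIn.ordConnected
  have hxm : x ∈ connectedComponentIn (closure (range v))ᶜ x :=
    mem_connectedComponentIn (hsub hx)
  have hnot : ∀ i, v i ∉ connectedComponentIn (closure (range v))ᶜ x := fun i hi =>
    connectedComponentIn_subset _ _ hi (subset_closure (mem_range_self i))
  constructor
  · by_contra h
    exact hnot j (hoc.out hy hxm ⟨not_lt.1 h, hx.1.le⟩)
  · by_contra h
    exact hnot (j + 1) (hoc.out hxm hy ⟨hx.2.le, not_lt.1 h⟩)

lemma component_injective {v : ℕ → ℝ} (hv : StrictMono v) :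
    Function.Injective fun j : ℕ => (⟨Ioo (v j) (v (j + 1)), Ioo_mem_componentsOf hv j⟩ :
      componentsOf (closure (range v))ᶜ) := by
  intro j k h
  have h1 := congrArg sInf (Subtype.ext_iff.1 h)
  simp only at h1
  rw [csInf_Ioo (hv (Nat.lt_succ_self j)), csInf_Ioo (hv (Nat.lt_succ_self k))] at h1
  exact hv.injective h1

lemma eLpNorm_schwartz_ne_top (k : 𝓢(ℝ, ℂ)) (p : ℝ≥0∞) : eLpNorm k p volume ≠ ∞ :=
  (k.memLp p (μ := volume)).2.ne

/-- The uniform bound for the partial sums of the paraproduct. -/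
lemma eLpNorm_Bm_muvPart_le {u v : ℕ → ℝ} (hu : StrictMono u) (hv : StrictMono v) {n : ℕ}
    {σ : ℕ → Fin n} (hlp : IsLPSeq v)
    (hfam : ∀ i : Fin n, IsLPFamily (fun j : {j : ℕ // 1 ≤ j ∧ σ j = i} => Iuv u v j.1))
    {p1 p2 p3 D : ℝ} (hp1 : 1 < p1) (hp2 : 1 < p2) (hp3 : 1 < p3)
    (hsum : 1 / p1 + 1 / p2 + 1 / p3 = 1) (hD : 0 ≤ D)
    (H : Carl p1 (p1 / (p1 - 1)) D (fun ξ n => if ξ < n then 1 else 0))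
    {f g : 𝓢(ℝ, ℂ)} {Cg : ℝ} (hCg : 0 ≤ Cg)
    (hG : sqNormLp (fun ω : componentsOf (closure (range v))ᶜ => (ω : Set ℝ)) g p2 ≤
      ofReal Cg * eLpNorm g (ofReal p2) volume)
    {Ch : Fin n → ℝ} (hCh : ∀ i, 0 ≤ Ch i)
    (hH : ∀ i, ∀ h : 𝓢(ℝ, ℂ),
      sqNormLp (fun j : {j : ℕ // 1 ≤ j ∧ σ j = i} => Iuv u v j.1) h p3 ≤
        ofReal (Ch i) * eLpNorm h (ofReal p3) volume) (J : ℕ) :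
    eLpNorm (Bm (muvPart u v J) f g) (ofReal (p3 / (p3 - 1))) volume ≤
      ofReal (∑ i, 2 * D * (Cg * Ch i)) * eLpNorm f (ofReal p1) volume *
        eLpNorm g (ofReal p2) volume := by
  have hc3 : p3.HolderConjugate (p3 / (p3 - 1)) := Real.HolderConjugate.conjExponent hp3
  have hf' := integrable_fourierT_schwartz f
  have hg' := integrable_fourierT_schwartz g
  have hLt : ∀ (k : 𝓢(ℝ, ℂ)) (p : ℝ), eLpNorm k (ofReal p) volume ≠ ∞ := fun k p =>
    eLpNorm_schwartz_ne_top k _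
  let A : ℕ → Set ℝ := fun j => Ioc (u 0) (u (j + 1))
  let B : ℕ → Set ℝ := fun j => Ico (v (j + 1)) (v (j + 2))
  let K : ℕ → Set ℝ := fun j => Iuv u v (j + 1)
  have eB : ∀ j, fproj (B j) g = fproj (Ioo (v (j + 1)) (v (j + 1 + 1))) g := fun j =>
    fproj_congr Ioo_ae_eq_Ico.symm g
  have hBm : Bm (muvPart u v J) f g =
      fun x => ∑ j ∈ Finset.range J, fproj (A j) f x * fproj (B j) g x := by
    funext x; exact Bm_muvPart u v hf' hg' J x
  have hgL : ∀ j, MemLp (fproj (B j) g) 2 := fun j => by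
    obtain ⟨_, _, C2, _, h2⟩ := hlp.2.2 2 one_lt_two
    rw [eB]
    exact memLp_fproj g (ne_top_of_le_ne_top
      (ENNReal.mul_ne_top ENNReal.ofReal_ne_top (hLt g 2)) (h2 g).2)
      (⟨_, Ioo_mem_componentsOf hv (j + 1)⟩ : componentsOf (closure (range v))ᶜ)
  have hhL : ∀ (h : 𝓢(ℝ, ℂ)) j, MemLp (fproj (K j) h) 2 := fun h j => by
    obtain ⟨C2, -, h2⟩ := hfam (σ (j + 1)) 2 one_lt_two
    exact memLp_fproj h (ne_top_of_le_ne_top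
      (ENNReal.mul_ne_top ENNReal.ofReal_ne_top (hLt h 2)) (h2 h))
      (⟨j + 1, by omega, rfl⟩ : {k : ℕ // 1 ≤ k ∧ σ k = σ (j + 1)})
  rw [hBm]
  refine eLpNorm_le_of_schwartz (continuous_finsetSum _ fun j _ =>
    (continuous_fproj hf' _).mul (continuous_fproj hg' _)) hc3
    (ENNReal.mul_ne_top (ENNReal.mul_ne_top ENNReal.ofReal_ne_top (hLt f p1)) (hLt g p2)) fun h => ?_
  have hInt : ∀ j ∈ Finset.range J, Integrable fun x => fproj (A j) f x * fproj (B j) g x * h x :=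
    fun j _ => by
      refine h.integrable.bdd_mul (c := (∫ ξ, ‖fourierT f ξ‖) * ∫ ξ, ‖fourierT g ξ‖)
        ((continuous_fproj hf' _).mul (continuous_fproj hg' _)).aestronglyMeasurable
        (Eventually.of_forall fun x => ?_)
      rw [norm_mul]
      exact mul_le_mul (norm_fproj_le hf' _ x) (norm_fproj_le hg' _ x) (norm_nonneg _)
        (integral_nonneg fun _ => norm_nonneg _)
  let F : ℕ → ℝ → ℝ≥0∞ := fun j x =>
    ‖fproj (A j) f x‖ₑ * (‖fproj (B j) g x‖ₑ * ‖fproj (K j) h x‖ₑ)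
  have hFm : ∀ j, Measurable (F j) := fun j =>
    (continuous_fproj hf' _).measurable.enorm.mul ((continuous_fproj hg' _).measurable.enorm.mul
      (continuous_fproj (integrable_fourierT_schwartz h) _).measurable.enorm)
  have h1 : ‖∫ x, (∑ j ∈ Finset.range J, fproj (A j) f x * fproj (B j) g x) * h x‖ₑ ≤
      ∑ j ∈ Finset.range J, ∫⁻ x, F j x := by
    simp only [Finset.sum_mul]
    rw [integral_finsetSum _ hInt]
    refine (enorm_sum_le _ _).trans (Finset.sum_le_sum fun j _ => ?_)
    rw [integral_fproj_mul_fproj_mul f g h measurableSet_Ico (measurableSet_Iuv u v (j + 1))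
      (fun x hx y hy => ⟨x, hx, y, hy, rfl⟩) (hgL j) (hhL h j)]
    refine (enorm_integral_le_lintegral_enorm _).trans (le_of_eq ?_)
    congr 1; funext x
    rw [enorm_mul, enorm_mul, mul_assoc]
  refine h1.trans ?_
  rw [← Finset.sum_fiberwise (Finset.range J) (fun j => σ (j + 1)),
    ENNReal.ofReal_sum_of_nonneg fun i _ => mul_nonneg (by linarith) (mul_nonneg hCg (hCh i)),
    Finset.sum_mul, Finset.sum_mul, Finset.sum_mul]
  refine Finset.sum_le_sum fun i _ => ?_
  rw [← lintegral_finsetSum _ fun j _ => hFm j]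
  set s := (Finset.range J).filter fun j => σ (j + 1) = i with hs
  have hX : (∫⁻ x, sqF s B g x ^ p2) ^ (1 / p2) ≤
      ofReal Cg * eLpNorm g (ofReal p2) volume := by
    refine le_trans ?_ hG
    refine lintegral_sqF_le (φ := fun j : s => (⟨Ioo (v (j + 1)) (v (j + 1 + 1)),
      Ioo_mem_componentsOf hv (j + 1)⟩ : componentsOf (closure (range v))ᶜ))
      (fun j k hjk => ?_) (fun j => eB j) (by linarith)
    exact Subtype.ext (Nat.succ_injective (component_injective hv hjk))
  have hY : (∫⁻ x, sqF s K h x ^ p3) ^ (1 / p3) ≤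
      ofReal (Ch i) * eLpNorm h (ofReal p3) volume := by
    refine le_trans ?_ (hH i h)
    refine lintegral_sqF_le (φ := fun j : s => (⟨j + 1, by omega, (Finset.mem_filter.1 j.2).2⟩ :
      {k : ℕ // 1 ≤ k ∧ σ k = i})) (fun j k hjk => ?_) (fun j => rfl) (by linarith)
    exact Subtype.ext (Nat.succ_injective (Subtype.ext_iff.1 hjk))
  have hq : 0 < p1 / (p1 - 1) := div_pos (by linarith) (by linarith)
  have hqp : 1 / (p1 / (p1 - 1)) = 1 / p2 + 1 / p3 := by
    rw [one_div_div, sub_div, div_self (by linarith)]; linarith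
  refine (lintegral_trilinear_le hp1.le hp2 hp3 hq hqp hD H f g h (a := u 0)
    (c := fun j => u (j + 1)) (fun j => hu.monotone (Nat.zero_le _)) s B K hX hY
    (ENNReal.mul_ne_top ENNReal.ofReal_ne_top (hLt g p2))
    (ENNReal.mul_ne_top ENNReal.ofReal_ne_top (hLt h p3))).trans (le_of_eq ?_)
  rw [ENNReal.ofReal_mul (by linarith : 0 ≤ 2 * D), ENNReal.ofReal_mul hCg]
  ring

end

end CarlesonHunt

/-- Theorem 2.2 (`v` Littlewood--Paley and Littlewood--Paley subcollections): the
paraproduct bound for `B_{m̃_{u,v}}` holds for all `1 < p₁, p₂, p₃ < ∞` with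
`1/p₁ + 1/p₂ + 1/p₃ = 1`. -/
theorem paraproduct_increasing_LP_full_bound (u v : ℕ → ℝ)
    (hu : StrictMono u) (hv : StrictMono v)
    (hLP : IsLPSeq v)
    (hsplitLP : ∃ n : ℕ, ∃ σ : ℕ → Fin n,
      (∀ j k : ℕ, 1 ≤ j → 1 ≤ k → j ≠ k → σ j = σ k →
        Disjoint (Iuv u v j) (Iuv u v k)) ∧
      ∀ i : Fin n, IsLPFamily (fun j : {j : ℕ // 1 ≤ j ∧ σ j = i} => Iuv u v j.1))
    (p1 p2 p3 : ℝ) (hp1 : 1 < p1) (hp2 : 1 < p2) (hp3 : 1 < p3)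
    (hsum : 1 / p1 + 1 / p2 + 1 / p3 = 1) :
    ∃ C : ℝ, 0 < C ∧
      ∀ f g : SchwartzMap ℝ ℂ,
        eLpNorm (Bm (muv u v) (⇑f) (⇑g)) (ENNReal.ofReal (p3 / (p3 - 1))) volume ≤
          ENNReal.ofReal C * eLpNorm (⇑f) (ENNReal.ofReal p1) volume *
            eLpNorm (⇑g) (ENNReal.ofReal p2) volume := by
  obtain ⟨n, σ, -, hfam⟩ := hsplitLP
  have hc1 : p1.HolderConjugate (p1 / (p1 - 1)) := Real.HolderConjugate.conjExponent hp1
  have hc3 : p3.HolderConjugate (p3 / (p3 - 1)) := Real.HolderConjugate.conjExponent hp3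
  obtain ⟨D, hD, H⟩ := CarlesonHunt.carleson_hunt hc1
  obtain ⟨_, _, Cg, hCg, hG⟩ := hLP.2.2 p2 hp2
  choose Ch hCh hH using fun i => hfam i p3 hp3
  have hpos : ∀ i, 0 ≤ 2 * D * (Cg * Ch i) := fun i =>
    mul_nonneg (by linarith) (mul_nonneg hCg.le (hCh i).le)
  refine ⟨∑ i, 2 * D * (Cg * Ch i) + 1,
    add_pos_of_nonneg_of_pos (Finset.sum_nonneg fun i _ => hpos i) one_pos, fun f g => ?_⟩
  have hf' := CarlesonHunt.integrable_fourierT_schwartz f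
  have hg' := CarlesonHunt.integrable_fourierT_schwartz g
  have hmeas : ∀ J, AEStronglyMeasurable (Bm (CarlesonHunt.muvPart u v J) f g) volume := by
    intro J
    have e : Bm (CarlesonHunt.muvPart u v J) f g = fun x => ∑ j ∈ Finset.range J,
        fproj (Ioc (u 0) (u (j + 1))) f x * fproj (Ico (v (j + 1)) (v (j + 2))) g x := by
      funext x; exact CarlesonHunt.Bm_muvPart u v hf' hg' J x
    rw [e]
    exact (continuous_finsetSum _ fun j _ => (CarlesonHunt.continuous_fproj hf' _).mul
      (CarlesonHunt.continuous_fproj hg' _)).aestronglyMeasurable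
  refine (Lp.eLpNorm_lim_le_liminf_eLpNorm hmeas _ (Filter.Eventually.of_forall fun x =>
    CarlesonHunt.tendsto_Bm_muvPart u hv hf' hg' x)).trans ?_
  refine (Filter.liminf_le_liminf (Filter.Eventually.of_forall fun J =>
    CarlesonHunt.eLpNorm_Bm_muvPart_le hu hv hLP hfam hp1 hp2 hp3 hsum hD H hCg.le (hG g).2
      (fun i => (hCh i).le) hH J)).trans ((Filter.liminf_const _).le.trans ?_)
  gcongr
  linarith
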